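/- After passing to a subsequence, γ_ε (v_ε(ρ_ε x) − B_ε(ρ_ε)) → 2 ln(1/|x|) + 𝓗(x) in C¹_loc(D₀(1) ∖ {0}) as ε → 0, where 𝓗 is a harmonic function in the unit disk D₀(1) satisfying 𝓗(0) = 0 and ∇𝓗(0) = −(1/2) lim_{ε→0} ρ_ε ∇f_ε(0)/f_ε(0) (this limit existing along the subsequence). -/

import Mathlib

open Metric Set Filter Topology Real MeasureTheory
open scoped RealInnerProductSpace

noncomputable section

/-- Points of the plane. -/
abbrev Pt := EuclideanSpace ℝ (Fin 2)

/-- The geometer's Laplacian `Δu = -(∂²u/∂x² + ∂²u/∂y²)`. -/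
def lap (u : Pt → ℝ) (x : Pt) : ℝ :=
  - ∑ i : Fin 2, fderiv ℝ (fun y => fderiv ℝ u y (EuclideanSpace.single i 1)) x
      (EuclideanSpace.single i 1)

/-- Convergence in `C^k(s)`: uniform convergence on `s` of all derivatives of order `≤ k`. -/
def TendstoCkOn (F : ℕ → Pt → ℝ) (g : Pt → ℝ) (s : Set Pt) (k : ℕ) : Prop :=
  ∀ j : ℕ, j ≤ k → TendstoUniformlyOn (fun n x => iteratedFDeriv ℝ j (F n) x)
    (fun x => iteratedFDeriv ℝ j g x) atTop s

/-- Convergence in `C^k_loc(s)`: locally uniform convergence on `s` of all derivatives of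
order `≤ k`. -/
def TendstoCkLocOn (F : ℕ → Pt → ℝ) (g : Pt → ℝ) (s : Set Pt) (k : ℕ) : Prop :=
  ∀ j : ℕ, j ≤ k → TendstoLocallyUniformlyOn (fun n x => iteratedFDeriv ℝ j (F n) x)
    (fun x => iteratedFDeriv ℝ j g x) atTop s

/-- The standard bubble profile `U(x) = -ln(1 + |x|²/4)`. -/
def Ustd (x : Pt) : ℝ := - Real.log (1 + ‖x‖ ^ 2 / 4)

/-- The point of the plane with coordinates `(a, b)`. -/
def mkPt (a b : ℝ) : Pt := (WithLp.equiv 2 (Fin 2 → ℝ)).symm ![a, b]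

/-- Spherical mean `(1/(2πr)) ∫_{∂D(c,r)} v dσ`, written via the parametrization of the
circle of radius `r` around `c`. -/
def sphAvg (v : Pt → ℝ) (c : Pt) (r : ℝ) : ℝ :=
  (2 * π)⁻¹ * ∫ θ in (0 : ℝ)..(2 * π), v (c + r • mkPt (Real.cos θ) (Real.sin θ))

/-- Mean value of `g` over the circle of angles `[0, 2π]`. -/
def cavg {E : Type*} [NormedAddCommGroup E] [NormedSpace ℝ E] (g : ℝ → E) : E :=
  (2 * π)⁻¹ • ∫ θ in (0 : ℝ)..(2 * π), g θ

section cavg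

variable {E : Type*} [NormedAddCommGroup E] [NormedSpace ℝ E]

theorem cavg_add {g h : ℝ → E} (hg : Continuous g) (hh : Continuous h) :
    cavg (fun θ => g θ + h θ) = cavg g + cavg h := by
  unfold cavg
  rw [intervalIntegral.integral_add (hg.intervalIntegrable _ _) (hh.intervalIntegrable _ _),
    smul_add]

theorem cavg_sub {g h : ℝ → E} (hg : Continuous g) (hh : Continuous h) :
    cavg (fun θ => g θ - h θ) = cavg g - cavg h := by
  unfold cavg
  rw [intervalIntegral.integral_sub (hg.intervalIntegrable _ _) (hh.intervalIntegrable _ _),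
    smul_sub]

theorem cavg_smul {𝕜 : Type*} [NormedField 𝕜] [NormedSpace 𝕜 E] [SMulCommClass ℝ 𝕜 E]
    (c : 𝕜) (g : ℝ → E) :
    cavg (fun θ => c • g θ) = c • cavg g := by
  unfold cavg
  rw [intervalIntegral.integral_smul, smul_comm]

theorem cavg_const_mul (c : ℝ) (g : ℝ → ℝ) : cavg (fun θ => c * g θ) = c * cavg g :=
  cavg_smul c g

theorem cavg_neg (g : ℝ → E) : cavg (fun θ => - g θ) = - cavg g := by
  unfold cavg
  rw [intervalIntegral.integral_neg, smul_neg]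

theorem cavg_const [CompleteSpace E] (c : E) : cavg (fun _ => c) = c := by
  unfold cavg
  rw [intervalIntegral.integral_const, sub_zero, smul_smul, inv_mul_cancel₀ (by positivity),
    one_smul]

theorem norm_cavg_le {g : ℝ → E} {C : ℝ} (h : ∀ θ, ‖g θ‖ ≤ C) : ‖cavg g‖ ≤ C := by
  unfold cavg
  have h1 := intervalIntegral.norm_integral_le_of_norm_le_const (a := 0) (b := 2 * π)
    (f := g) (C := C) (fun θ _ => h θ)
  rw [sub_zero, abs_of_pos (by positivity)] at h1
  rw [norm_smul, norm_inv, Real.norm_of_nonneg (by positivity : (0 : ℝ) ≤ 2 * π)]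
  rw [inv_mul_le_iff₀ (by positivity)]
  linarith

theorem abs_cavg_le {g : ℝ → ℝ} {C : ℝ} (h : ∀ θ, |g θ| ≤ C) : |cavg g| ≤ C := by
  rw [← Real.norm_eq_abs]
  exact norm_cavg_le fun θ => (Real.norm_eq_abs _).le.trans (h θ)

theorem cavg_mono {g h : ℝ → ℝ} (hg : Continuous g) (hh : Continuous h) (hle : ∀ θ, g θ ≤ h θ) :
    cavg g ≤ cavg h := by
  unfold cavg
  rw [smul_eq_mul, smul_eq_mul]
  refine mul_le_mul_of_nonneg_left ?_ (by positivity)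
  exact intervalIntegral.integral_mono (by positivity) (hg.intervalIntegrable _ _)
    (hh.intervalIntegrable _ _) hle

theorem cavg_nonneg {g : ℝ → ℝ} (hle : ∀ θ, 0 ≤ g θ) : 0 ≤ cavg g := by
  unfold cavg
  rw [smul_eq_mul]
  refine mul_nonneg (by positivity) ?_
  exact intervalIntegral.integral_nonneg (by positivity) (fun θ _ => hle θ)

theorem abs_cavg_sub_le {g h : ℝ → ℝ} (hg : Continuous g) (hh : Continuous h) {C : ℝ}
    (hle : ∀ θ, |g θ - h θ| ≤ C) : |cavg g - cavg h| ≤ C := by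
  rw [← cavg_sub hg hh]; exact abs_cavg_le hle

theorem cavg_deriv_eq_zero [CompleteSpace E] {g g' : ℝ → E} (h : ∀ θ, HasDerivAt g (g' θ) θ)
    (hc : Continuous g') (hp : g (2 * π) = g 0) : cavg g' = 0 := by
  unfold cavg
  rw [intervalIntegral.integral_eq_sub_of_hasDerivAt (fun θ _ => h θ)
    (hc.intervalIntegrable _ _), hp, sub_self, smul_zero]

theorem continuous_slice {X : Type*} [TopologicalSpace X] {F : ℝ → ℝ → X} {b s : ℝ}
    (hF : ContinuousOn (Function.uncurry F) (Iio b ×ˢ univ)) (hs : s < b) :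
    Continuous (F s) := by
  have : F s = Function.uncurry F ∘ (fun θ => (s, θ)) := rfl
  rw [this, ← continuousOn_univ]
  exact hF.comp (by fun_prop) (fun θ _ => ⟨hs, mem_univ _⟩)

theorem exists_local_bound {E : Type*} [NormedAddCommGroup E] {F : ℝ → ℝ → E} {b s : ℝ}
    (hF : ContinuousOn (Function.uncurry F) (Iio b ×ˢ univ)) (hs : s < b) :
    ∃ δ > 0, s + δ < b ∧ ∃ C, ∀ t ∈ Icc (s - δ) (s + δ), ∀ θ ∈ Icc (0 : ℝ) (2 * π),
      ‖F t θ‖ ≤ C := by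
  refine ⟨(b - s) / 2, by linarith, by linarith, ?_⟩
  have hK : IsCompact (Icc (s - (b - s) / 2) (s + (b - s) / 2) ×ˢ Icc (0 : ℝ) (2 * π)) :=
    isCompact_Icc.prod isCompact_Icc
  obtain ⟨C, hC⟩ := hK.exists_bound_of_continuousOn (f := Function.uncurry F)
    (hF.mono (fun x hx => ⟨by have := hx.1.2; simp only [mem_Iio]; linarith, mem_univ _⟩))
  exact ⟨C, fun t ht θ hθ => hC (t, θ) ⟨ht, hθ⟩⟩

theorem hasDerivAt_cavg {F F' : ℝ → ℝ → E} {b : ℝ}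
    (hd : ∀ s < b, ∀ θ, HasDerivAt (fun t => F t θ) (F' s θ) s)
    (hF : ContinuousOn (Function.uncurry F) (Iio b ×ˢ univ))
    (hF' : ContinuousOn (Function.uncurry F') (Iio b ×ˢ univ)) {s : ℝ} (hs : s < b) :
    HasDerivAt (fun t => cavg (F t)) (cavg (F' s)) s := by
  obtain ⟨δ, hδ, hδb, C, hC⟩ := exists_local_bound hF' hs
  unfold cavg
  refine HasDerivAt.const_smul (R := ℝ) _ ?_
  refine (intervalIntegral.hasDerivAt_integral_of_dominated_loc_of_deriv_le (F := F) (F' := F')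
    (bound := fun _ => C) (s := Ioo (s - δ) (s + δ)) (Ioo_mem_nhds (by linarith) (by linarith))
    ?_ ?_ ?_ ?_ ?_ ?_).2
  · filter_upwards [Iio_mem_nhds hs] with t ht
    exact (continuous_slice hF ht).aestronglyMeasurable
  · exact (continuous_slice hF hs).intervalIntegrable _ _
  · exact (continuous_slice hF' hs).aestronglyMeasurable
  · refine Eventually.of_forall fun θ hθ t ht => hC t ⟨ht.1.le, ht.2.le⟩ θ ?_
    rw [uIoc_of_le (by positivity)] at hθ
    exact ⟨hθ.1.le, hθ.2⟩
  · exact intervalIntegrable_const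
  · exact Eventually.of_forall fun θ _ t ht => hd t (by have := ht.2; linarith) θ

/-- The mean of the square dominates the square of the mean. -/
theorem sq_cavg_le {g : ℝ → ℝ} (hg : Continuous g) : cavg g ^ 2 ≤ cavg (fun θ => g θ ^ 2) := by
  have h0 : 0 ≤ cavg (fun θ => (g θ - cavg g) ^ 2) := cavg_nonneg fun θ => sq_nonneg _
  have h1 : cavg (fun θ => (g θ - cavg g) ^ 2)
      = cavg (fun θ => g θ ^ 2) - cavg g ^ 2 := by
    have : (fun θ => (g θ - cavg g) ^ 2)
        = fun θ => g θ ^ 2 - ((2 * cavg g) * g θ - cavg g ^ 2) := by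
      ext θ; ring
    rw [this, cavg_sub (by fun_prop) (by fun_prop), cavg_sub (by fun_prop) (by fun_prop),
      cavg_const_mul, cavg_const]
    ring
  linarith

/-- A crude Poincaré inequality on the circle. -/
theorem cavg_sub_sq_le {g g' : ℝ → ℝ} (h : ∀ θ, HasDerivAt g (g' θ) θ) (hc : Continuous g') :
    cavg (fun θ => g θ ^ 2) - cavg g ^ 2 ≤ (2 * π) ^ 2 * cavg (fun θ => g' θ ^ 2) := by
  have hgc : Continuous g := continuous_iff_continuousAt.2 fun θ => (h θ).continuousAt
  set I := ∫ θ in (0 : ℝ)..(2 * π), g' θ ^ 2 with hI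
  have hπ : (0 : ℝ) < 2 * π := by positivity
  have hinc : ∀ x ∈ Icc (0 : ℝ) (2 * π), ∀ y ∈ Icc (0 : ℝ) (2 * π), x ≤ y →
      (g y - g x) ^ 2 ≤ 2 * π * I := by
    intro x hx y hy hxy
    have e1 : g y - g x = ∫ θ in x..y, g' θ :=
      (intervalIntegral.integral_eq_sub_of_hasDerivAt (fun θ _ => h θ)
        (hc.intervalIntegrable _ _)).symm
    have hmono : ∫ θ in x..y, g' θ ^ 2 ≤ I := by
      apply intervalIntegral.integral_mono_interval hx.1 hxy hy.2
      · exact Eventually.of_forall fun θ => sq_nonneg _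
      · exact (hc.pow 2).intervalIntegrable _ _
    have hI0 : 0 ≤ ∫ θ in x..y, g' θ ^ 2 :=
      intervalIntegral.integral_nonneg hxy fun θ _ => sq_nonneg _
    have key : ∀ c : ℝ, 0 ≤ (∫ θ in x..y, g' θ ^ 2) - 2 * c * (g y - g x) + c ^ 2 * (y - x) := by
      intro c
      have h2 : 0 ≤ ∫ θ in x..y, (g' θ - c) ^ 2 :=
        intervalIntegral.integral_nonneg hxy fun θ _ => sq_nonneg _
      have h3 : ∫ θ in x..y, (g' θ - c) ^ 2
          = (∫ θ in x..y, g' θ ^ 2) - 2 * c * (g y - g x) + c ^ 2 * (y - x) := by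
        have : (fun θ => (g' θ - c) ^ 2) = fun θ => g' θ ^ 2 - ((2 * c) * g' θ - c ^ 2) := by
          ext θ; ring
        rw [this, intervalIntegral.integral_sub
          ((by fun_prop : Continuous fun θ => g' θ ^ 2).intervalIntegrable _ _)
          ((by fun_prop : Continuous fun θ => (2 * c) * g' θ - c ^ 2).intervalIntegrable _ _),
          intervalIntegral.integral_sub
          ((by fun_prop : Continuous fun θ => (2 * c) * g' θ).intervalIntegrable _ _)
          intervalIntegrable_const, intervalIntegral.integral_const_mul,
          intervalIntegral.integral_const, ← e1, smul_eq_mul]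
        ring
      linarith
    rcases hxy.eq_or_lt with rfl | hlt
    · rw [sub_self, zero_pow two_ne_zero]
      exact mul_nonneg hπ.le (hI0.trans hmono)
    have hk := key ((g y - g x) / (y - x))
    have hne : (0:ℝ) < y - x := by linarith
    have e2 : (∫ θ in x..y, g' θ ^ 2) - 2 * ((g y - g x) / (y - x)) * (g y - g x)
        + ((g y - g x) / (y - x)) ^ 2 * (y - x)
        = (∫ θ in x..y, g' θ ^ 2) - (g y - g x) ^ 2 / (y - x) := by
      field_simp; ring
    rw [e2, sub_nonneg, div_le_iff₀ hne] at hk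
    calc (g y - g x) ^ 2 ≤ (∫ θ in x..y, g' θ ^ 2) * (y - x) := hk
      _ ≤ I * (2 * π) := by
        apply mul_le_mul hmono _ hne.le (hI0.trans hmono)
        linarith [hx.1, hy.2]
      _ = _ := by ring
  have hinc' : ∀ x ∈ Icc (0 : ℝ) (2 * π), ∀ y ∈ Icc (0 : ℝ) (2 * π),
      (g y - g x) ^ 2 ≤ 2 * π * I := by
    intro x hx y hy
    rcases le_total x y with hxy | hxy
    · exact hinc x hx y hy hxy
    · have := hinc y hy x hx hxy
      rw [← neg_sub, neg_sq]; exact this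
  have e3 : cavg (fun θ => (g θ - g 0) ^ 2)
      = cavg (fun θ => g θ ^ 2) - cavg g ^ 2 + (cavg g - g 0) ^ 2 := by
    have : (fun θ => (g θ - g 0) ^ 2)
        = fun θ => g θ ^ 2 - ((2 * g 0) * g θ - g 0 ^ 2) := by
      ext θ; ring
    rw [this, cavg_sub (by fun_prop) (by fun_prop), cavg_sub (by fun_prop) (by fun_prop),
      cavg_const_mul, cavg_const]
    ring
  have e4 : cavg (fun θ => (g θ - g 0) ^ 2) ≤ 2 * π * I := by
    unfold cavg
    rw [smul_eq_mul, inv_mul_le_iff₀ hπ]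
    have := intervalIntegral.integral_mono_on (μ := volume) hπ.le
      (f := fun θ => (g θ - g 0) ^ 2) (g := fun _ => 2 * π * I)
      ((by fun_prop : Continuous fun θ => (g θ - g 0) ^ 2).intervalIntegrable _ _)
      intervalIntegrable_const (fun θ hθ => hinc' 0 ⟨le_rfl, hπ.le⟩ θ hθ)
    rw [intervalIntegral.integral_const, smul_eq_mul, sub_zero] at this
    exact this
  have e5 : (2 * π) ^ 2 * cavg (fun θ => g' θ ^ 2) = 2 * π * I := by
    unfold cavg; rw [smul_eq_mul, ← hI]; field_simp
  rw [e5]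
  nlinarith [sq_nonneg (cavg g - g 0)]

end cavg

/-- A solution of `u_ss + u_θθ = - λ e^{2s} f u e^{u²}` on the cylinder `s < b`, together with its
derivatives. -/
structure Cyl (b lam : ℝ) where
  (u us ut uss ust utt f fs ft : ℝ → ℝ → ℝ)
  hus : ∀ s < b, ∀ θ, HasDerivAt (fun t => u t θ) (us s θ) s
  hut : ∀ s < b, ∀ θ, HasDerivAt (u s) (ut s θ) θ
  huss : ∀ s < b, ∀ θ, HasDerivAt (fun t => us t θ) (uss s θ) s
  hust : ∀ s < b, ∀ θ, HasDerivAt (fun t => ut t θ) (ust s θ) s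
  hust' : ∀ s < b, ∀ θ, HasDerivAt (us s) (ust s θ) θ
  hutt : ∀ s < b, ∀ θ, HasDerivAt (ut s) (utt s θ) θ
  hfs : ∀ s < b, ∀ θ, HasDerivAt (fun t => f t θ) (fs s θ) s
  hft : ∀ s < b, ∀ θ, HasDerivAt (f s) (ft s θ) θ
  cu : ContinuousOn (Function.uncurry u) (Iio b ×ˢ univ)
  cus : ContinuousOn (Function.uncurry us) (Iio b ×ˢ univ)
  cut : ContinuousOn (Function.uncurry ut) (Iio b ×ˢ univ)
  cuss : ContinuousOn (Function.uncurry uss) (Iio b ×ˢ univ)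
  cust : ContinuousOn (Function.uncurry ust) (Iio b ×ˢ univ)
  cutt : ContinuousOn (Function.uncurry utt) (Iio b ×ˢ univ)
  cf : ContinuousOn (Function.uncurry f) (Iio b ×ˢ univ)
  cfs : ContinuousOn (Function.uncurry fs) (Iio b ×ˢ univ)
  cft : ContinuousOn (Function.uncurry ft) (Iio b ×ˢ univ)
  pu : ∀ s < b, u s (2 * π) = u s 0
  pus : ∀ s < b, us s (2 * π) = us s 0
  put : ∀ s < b, ut s (2 * π) = ut s 0
  pf : ∀ s < b, f s (2 * π) = f s 0
  pde : ∀ s < b, ∀ θ, uss s θ + utt s θ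
    = - (lam * exp (2 * s) * (f s θ * u s θ * exp (u s θ ^ 2)))

namespace Cyl

variable {b lam : ℝ} (C : Cyl b lam) (γ : ℝ) (s : ℝ)

/-- the nonlinearity without the factor `λ e^{2s}` -/
def g (s θ : ℝ) : ℝ := C.f s θ * C.u s θ * exp (C.u s θ ^ 2)
/-- angular mean of the solution -/
def y : ℝ := cavg (C.u s)
/-- deviation of the mean from its central value -/
def phi : ℝ := γ ^ 2 - γ * C.y s
/-- flux -/
def p : ℝ := - γ * cavg (C.us s)
/-- mass density -/
def q : ℝ := γ * lam * exp (2 * s) * cavg (C.g s)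
/-- potential term in the Pohozaev identity -/
def Q : ℝ := γ ^ 2 * lam * exp (2 * s) * cavg (fun θ => C.f s θ * (exp (C.u s θ ^ 2) - 1))
/-- potential term without the weight -/
def Qhat : ℝ := γ ^ 2 * lam * exp (2 * s) * cavg (fun θ => exp (C.u s θ ^ 2) - 1)
/-- weight derivative term in the Pohozaev identity -/
def Fq : ℝ := γ ^ 2 * lam * exp (2 * s) * cavg (fun θ => C.fs s θ * (exp (C.u s θ ^ 2) - 1))
/-- Pohozaev quantity -/
def Z : ℝ := γ ^ 2 * cavg (fun θ => C.us s θ ^ 2 - C.ut s θ ^ 2) + C.Q γ s - 2 * C.p γ s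
/-- oscillation energy -/
def En : ℝ := γ ^ 2 * (cavg (fun θ => C.us s θ ^ 2) - cavg (C.us s) ^ 2
  + cavg (fun θ => C.ut s θ ^ 2))
/-- derivative of the angular variance -/
def nn : ℝ := 2 * γ ^ 2 * (cavg (fun θ => C.u s θ * C.us s θ) - C.y s * cavg (C.us s))
/-- source term for the angular variance -/
def err : ℝ := γ ^ 2 * lam * exp (2 * s) *
  (cavg (fun θ => C.u s θ * C.g s θ) - C.y s * cavg (C.g s))

theorem cg : ContinuousOn (Function.uncurry C.g) (Iio b ×ˢ univ) :=
  (C.cf.mul C.cu).mul (Real.continuous_exp.comp_continuousOn (C.cu.pow 2))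

theorem cg' {s : ℝ} (hs : s < b) : Continuous (C.g s) := continuous_slice C.cg hs

theorem hasDerivAt_y {s : ℝ} (hs : s < b) : HasDerivAt C.y (cavg (C.us s)) s :=
  hasDerivAt_cavg C.hus C.cu C.cus hs

theorem hasDerivAt_phi {s : ℝ} (hs : s < b) : HasDerivAt (C.phi γ) (C.p γ s) s := by
  have := ((C.hasDerivAt_y hs).const_mul γ).const_sub (γ ^ 2)
  refine this.congr_deriv ?_
  unfold p; ring

theorem cavg_utt {s : ℝ} (hs : s < b) : cavg (C.utt s) = 0 :=
  cavg_deriv_eq_zero (C.hutt s hs) (continuous_slice C.cutt hs) (C.put s hs)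

theorem cavg_uss {s : ℝ} (hs : s < b) : cavg (C.uss s) = - (lam * exp (2 * s) * cavg (C.g s)) := by
  have h1 : C.uss s = fun θ => - (lam * exp (2 * s) * C.g s θ) - C.utt s θ := by
    ext θ
    have := C.pde s hs θ
    unfold g
    linarith
  have c1 := C.cg' hs
  have c2 := continuous_slice C.cutt hs
  rw [h1, cavg_sub (by fun_prop) c2, cavg_neg, cavg_const_mul, C.cavg_utt hs, sub_zero]

theorem hasDerivAt_p {s : ℝ} (hs : s < b) : HasDerivAt (C.p γ) (C.q γ s) s := by
  have := (hasDerivAt_cavg C.huss C.cus C.cuss hs).const_mul (-γ)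
  refine this.congr_deriv ?_
  rw [C.cavg_uss hs]
  unfold q; ring

/-- integration by parts in the angular variable -/
theorem cavg_mul_deriv {g h g' h' : ℝ → ℝ} (hg : ∀ θ, HasDerivAt g (g' θ) θ)
    (hh : ∀ θ, HasDerivAt h (h' θ) θ) (cg : Continuous g') (ch : Continuous h')
    (pg : g (2 * π) = g 0) (ph : h (2 * π) = h 0) :
    cavg (fun θ => g θ * h' θ) = - cavg (fun θ => g' θ * h θ) := by
  have c1 : Continuous g := continuous_iff_continuousAt.2 fun θ => (hg θ).continuousAt
  have c2 : Continuous h := continuous_iff_continuousAt.2 fun θ => (hh θ).continuousAt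
  have := cavg_deriv_eq_zero (fun θ => (hg θ).mul (hh θ)) (by fun_prop)
    (by simp [pg, ph])
  rw [cavg_add (by fun_prop) (by fun_prop)] at this
  linarith

theorem cavg_u_uss {s : ℝ} (hs : s < b) : cavg (fun θ => C.u s θ * C.uss s θ)
    = cavg (fun θ => C.ut s θ ^ 2) - lam * exp (2 * s) * cavg (fun θ => C.u s θ * C.g s θ) := by
  have c1 := C.cg' hs
  have c2 := continuous_slice C.cutt hs
  have c3 := continuous_slice C.cu hs
  have c4 := continuous_slice C.cut hs
  have h1 : (fun θ => C.u s θ * C.uss s θ)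
      = fun θ => - (lam * exp (2 * s) * (C.u s θ * C.g s θ)) - C.u s θ * C.utt s θ := by
    ext θ
    have : C.uss s θ = - (lam * exp (2 * s) * C.g s θ) - C.utt s θ := by
      have := C.pde s hs θ
      unfold g; linarith
    rw [this]; ring
  rw [h1, cavg_sub (by fun_prop) (by fun_prop), cavg_neg, cavg_const_mul,
    cavg_mul_deriv (C.hut s hs) (C.hutt s hs) c4 c2 (C.pu s hs) (C.put s hs)]
  simp only [sq]
  ring

theorem hasDerivAt_nn {s : ℝ} (hs : s < b) :
    HasDerivAt (C.nn γ) (2 * C.En γ s - 2 * C.err γ s) s := by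
  have c1 := C.cu
  have c2 := C.cus
  have c3 := C.cuss
  have d1 : HasDerivAt (fun t => cavg (fun θ => C.u t θ * C.us t θ))
      (cavg (fun θ => C.us s θ * C.us s θ + C.u s θ * C.uss s θ)) s :=
    hasDerivAt_cavg (F := fun s θ => C.u s θ * C.us s θ)
      (F' := fun s θ => C.us s θ * C.us s θ + C.u s θ * C.uss s θ)
      (fun t ht θ => (C.hus t ht θ).mul (C.huss t ht θ)) (c1.mul c2)
      ((c2.mul c2).add (c1.mul c3)) hs
  have d2 := (C.hasDerivAt_y hs).mul (hasDerivAt_cavg C.huss C.cus C.cuss hs)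
  have := (d1.sub d2).const_mul (2 * γ ^ 2)
  refine this.congr_deriv ?_
  have k1 := continuous_slice C.cu hs
  have k2 := continuous_slice C.cus hs
  have k3 := continuous_slice C.cuss hs
  rw [cavg_add (by fun_prop) (by fun_prop), C.cavg_u_uss hs, C.cavg_uss hs]
  unfold En err
  simp only [← sq]
  ring

theorem cexp : ContinuousOn (Function.uncurry fun s θ => exp (C.u s θ ^ 2)) (Iio b ×ˢ univ) :=
  Real.continuous_exp.comp_continuousOn (C.cu.pow 2)

theorem hasDerivAt_Q {s : ℝ} (hs : s < b) :
    HasDerivAt (C.Q γ) (2 * C.Q γ s + C.Fq γ s +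
      2 * (γ ^ 2 * lam * exp (2 * s) * cavg (fun θ => C.us s θ * C.g s θ))) s := by
  have ce := C.cexp
  have c1 := C.cf
  have c2 := C.cfs
  have c3 := C.cus
  have c4 := C.cg
  have d1 : HasDerivAt (fun t => cavg (fun θ => C.f t θ * (exp (C.u t θ ^ 2) - 1)))
      (cavg (fun θ => C.fs s θ * (exp (C.u s θ ^ 2) - 1) + 2 * (C.us s θ * C.g s θ))) s := by
    refine hasDerivAt_cavg (F := fun s θ => C.f s θ * (exp (C.u s θ ^ 2) - 1))
      (F' := fun s θ => C.fs s θ * (exp (C.u s θ ^ 2) - 1) + 2 * (C.us s θ * C.g s θ))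
      (fun t ht θ => ?_) (by simp only [Function.uncurry_def] at *; fun_prop)
      (by simp only [Function.uncurry_def] at *; fun_prop) hs
    have := (C.hfs t ht θ).mul ((((C.hus t ht θ).pow 2).exp).sub_const 1)
    refine this.congr_deriv ?_
    unfold g
    simp only [Nat.cast_ofNat, Nat.add_one_sub_one, pow_one, Pi.pow_apply]
    ring
  have d2 : HasDerivAt (fun t => γ ^ 2 * lam * exp (2 * t))
      (2 * (γ ^ 2 * lam * exp (2 * s))) s := by
    have := (((hasDerivAt_id s).const_mul 2).exp).const_mul (γ ^ 2 * lam)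
    refine this.congr_deriv ?_
    simp only [id, mul_one]; ring
  have := d2.mul d1
  refine this.congr_deriv ?_
  have k1 := C.cg' hs
  have k2 := continuous_slice C.cus hs
  have k3 := continuous_slice C.cfs hs
  have k4 := continuous_slice C.cu hs
  rw [cavg_add (by fun_prop) (by fun_prop), cavg_const_mul]
  unfold Q Fq
  ring

theorem hasDerivAt_Z {s : ℝ} (hs : s < b) :
    HasDerivAt (C.Z γ) (2 * (C.Q γ s - C.q γ s) + C.Fq γ s) s := by
  have c1 := C.cus
  have c2 := C.cut
  have c3 := C.cuss
  have c4 := C.cust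
  have d1 : HasDerivAt (fun t => cavg (fun θ => C.us t θ ^ 2 - C.ut t θ ^ 2))
      (cavg (fun θ => 2 * (C.us s θ * C.uss s θ) - 2 * (C.ut s θ * C.ust s θ))) s := by
    refine hasDerivAt_cavg (F := fun s θ => C.us s θ ^ 2 - C.ut s θ ^ 2)
      (F' := fun s θ => 2 * (C.us s θ * C.uss s θ) - 2 * (C.ut s θ * C.ust s θ))
      (fun t ht θ => ?_) (by simp only [Function.uncurry_def] at *; fun_prop)
      (by simp only [Function.uncurry_def] at *; fun_prop) hs
    have := ((C.huss t ht θ).pow 2).sub ((C.hust t ht θ).pow 2)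
    refine this.congr_deriv ?_
    simp only [Nat.cast_ofNat, Nat.add_one_sub_one, pow_one]
    ring
  have := ((d1.const_mul (γ ^ 2)).add (C.hasDerivAt_Q γ hs)).sub ((C.hasDerivAt_p γ hs).const_mul 2)
  refine this.congr_deriv ?_
  have k1 := C.cg' hs
  have k2 := continuous_slice C.cus hs
  have k3 := continuous_slice C.cuss hs
  have k4 := continuous_slice C.cut hs
  have k5 := continuous_slice C.cust hs
  have k6 := continuous_slice C.cutt hs
  have e1 : cavg (fun θ => C.us s θ * C.uss s θ)
      = - (lam * exp (2 * s) * cavg (fun θ => C.us s θ * C.g s θ))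
        - cavg (fun θ => C.us s θ * C.utt s θ) := by
    have h1 : (fun θ => C.us s θ * C.uss s θ)
        = fun θ => - (lam * exp (2 * s) * (C.us s θ * C.g s θ)) - C.us s θ * C.utt s θ := by
      ext θ
      have : C.uss s θ = - (lam * exp (2 * s) * C.g s θ) - C.utt s θ := by
        have := C.pde s hs θ
        unfold g; linarith
      rw [this]; ring
    rw [h1, cavg_sub (by fun_prop) (by fun_prop), cavg_neg, cavg_const_mul]
  have e2 := cavg_mul_deriv (C.hust' s hs) (C.hutt s hs) k5 k6 (C.pus s hs) (C.put s hs)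
  have e3 : cavg (fun θ => C.ut s θ * C.ust s θ) = cavg (fun θ => C.ust s θ * C.ut s θ) := by
    simp only [mul_comm]
  rw [cavg_sub (by fun_prop) (by fun_prop), cavg_const_mul, cavg_const_mul, e1, e2, e3]
  ring

theorem En_nonneg {s : ℝ} (hs : s < b) : 0 ≤ C.En γ s := by
  have h1 := sq_cavg_le (continuous_slice C.cus hs)
  have h2 : 0 ≤ cavg (fun θ => C.ut s θ ^ 2) := cavg_nonneg fun θ => sq_nonneg _
  exact mul_nonneg (sq_nonneg _) (by linarith)

theorem abs_pohozaev_le {s : ℝ} (hs : s < b) :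
    |C.p γ s ^ 2 + C.Q γ s - 2 * C.p γ s - C.Z γ s| ≤ C.En γ s := by
  have h1 := sq_cavg_le (continuous_slice C.cus hs)
  have h2 : 0 ≤ cavg (fun θ => C.ut s θ ^ 2) := cavg_nonneg fun θ => sq_nonneg _
  have k2 := continuous_slice C.cus hs
  have k4 := continuous_slice C.cut hs
  have h3 : cavg (fun θ => C.us s θ ^ 2 - C.ut s θ ^ 2)
      = cavg (fun θ => C.us s θ ^ 2) - cavg (fun θ => C.ut s θ ^ 2) :=
    cavg_sub (by fun_prop) (by fun_prop)
  unfold Z En p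
  rw [h3]
  have hg := sq_nonneg γ
  have h4 := mul_nonneg hg (sub_nonneg.2 h1)
  have h5 := mul_nonneg hg h2
  rw [abs_le]
  constructor <;> nlinarith

/-- the mean-zero form of the correlation of `u` with another function -/
theorem cavg_sub_mul {g h : ℝ → ℝ} (cg : Continuous g) (ch : Continuous h) (c : ℝ) :
    cavg (fun θ => g θ * h θ) - cavg g * cavg h
      = cavg (fun θ => (g θ - cavg g) * (h θ - c)) := by
  have : (fun θ => (g θ - cavg g) * (h θ - c))
      = fun θ => g θ * h θ - (cavg g * h θ + (c * g θ - c * cavg g)) := by ext θ; ring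
  rw [this, cavg_sub (by fun_prop) (by fun_prop), cavg_add (by fun_prop) (by fun_prop),
    cavg_sub (by fun_prop) (by fun_prop), cavg_const_mul, cavg_const_mul, cavg_const]
  ring

theorem cavg_sub_sq {g : ℝ → ℝ} (cg : Continuous g) :
    cavg (fun θ => (g θ - cavg g) ^ 2) = cavg (fun θ => g θ ^ 2) - cavg g ^ 2 := by
  have := cavg_sub_mul cg cg (cavg g)
  simp only [← sq] at this
  exact this.symm

/-- angular variance is controlled by the energy -/
theorem var_le {s : ℝ} (hs : s < b) :
    γ ^ 2 * cavg (fun θ => (C.u s θ - C.y s) ^ 2) ≤ (2 * π) ^ 2 * C.En γ s := by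
  have k1 := continuous_slice C.cu hs
  have h1 := cavg_sub_sq_le (C.hut s hs) (continuous_slice C.cut hs)
  rw [← cavg_sub_sq k1] at h1
  have h2 := sq_cavg_le (continuous_slice C.cus hs)
  have h3 := mul_le_mul_of_nonneg_left h1 (sq_nonneg γ)
  have h4 := mul_nonneg (mul_nonneg (sq_nonneg (2 * π)) (sq_nonneg γ)) (sub_nonneg.2 h2)
  unfold En y
  nlinarith

theorem abs_nn_le {s : ℝ} (hs : s < b) : |C.nn γ s| ≤ 2 * (2 * π) ^ 2 * C.En γ s := by
  have k1 := continuous_slice C.cu hs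
  have k2 := continuous_slice C.cus hs
  have e1 : C.nn γ s = 2 * γ ^ 2 *
      cavg (fun θ => (C.u s θ - C.y s) * (C.us s θ - cavg (C.us s))) := by
    unfold nn y
    rw [cavg_sub_mul k1 k2]
  have h1 := C.var_le γ hs
  have h2 := cavg_sub_sq k2
  have h3 : γ ^ 2 * cavg (fun θ => (C.us s θ - cavg (C.us s)) ^ 2) ≤ C.En γ s := by
    rw [h2]
    unfold En
    have : 0 ≤ cavg (fun θ => C.ut s θ ^ 2) := cavg_nonneg fun θ => sq_nonneg _
    nlinarith [mul_nonneg (sq_nonneg γ) this]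
  have h4 : |2 * cavg (fun θ => (C.u s θ - C.y s) * (C.us s θ - cavg (C.us s)))|
      ≤ cavg (fun θ => (C.u s θ - C.y s) ^ 2)
        + cavg (fun θ => (C.us s θ - cavg (C.us s)) ^ 2) := by
    rw [← cavg_add (by fun_prop) (by fun_prop), ← cavg_const_mul, abs_le, ← cavg_neg]
    constructor
    · refine cavg_mono (by fun_prop) (by fun_prop) fun θ => ?_
      nlinarith [sq_nonneg (C.u s θ - C.y s + (C.us s θ - cavg (C.us s)))]
    · refine cavg_mono (by fun_prop) (by fun_prop) fun θ => ?_
      nlinarith [sq_nonneg (C.u s θ - C.y s - (C.us s θ - cavg (C.us s)))]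
  have h5 : |C.nn γ s| = γ ^ 2 *
      |2 * cavg (fun θ => (C.u s θ - C.y s) * (C.us s θ - cavg (C.us s)))| := by
    rw [e1, ← abs_of_nonneg (sq_nonneg γ), ← abs_mul, abs_of_nonneg (sq_nonneg γ)]
    congr 1; ring
  rw [h5]
  have h6 := mul_le_mul_of_nonneg_left h4 (sq_nonneg γ)
  have hE := C.En_nonneg γ hs
  have hπ : (1:ℝ) ≤ (2 * π) ^ 2 := by nlinarith [Real.pi_gt_three]
  nlinarith [mul_le_mul_of_nonneg_right hπ hE]

theorem abs_nn_le' {s : ℝ} (hs : s < b) {D : ℝ} (hγ : 0 < γ)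
    (h1 : ∀ θ, |C.u s θ - C.y s| ≤ D / γ) (h2 : ∀ θ, |C.us s θ - cavg (C.us s)| ≤ D / γ) :
    |C.nn γ s| ≤ 2 * D ^ 2 := by
  have k1 := continuous_slice C.cu hs
  have k2 := continuous_slice C.cus hs
  have e1 : C.nn γ s = 2 * γ ^ 2 *
      cavg (fun θ => (C.u s θ - C.y s) * (C.us s θ - cavg (C.us s))) := by
    unfold nn y
    rw [cavg_sub_mul k1 k2]
  have h3 : |cavg (fun θ => (C.u s θ - C.y s) * (C.us s θ - cavg (C.us s)))|
      ≤ D / γ * (D / γ) := by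
    refine abs_cavg_le fun θ => ?_
    rw [abs_mul]
    exact mul_le_mul (h1 θ) (h2 θ) (abs_nonneg _) ((abs_nonneg _).trans (h1 θ))
  rw [e1, abs_mul, abs_of_nonneg (by positivity)]
  calc 2 * γ ^ 2 * _ ≤ 2 * γ ^ 2 * (D / γ * (D / γ)) := by gcongr
    _ = 2 * D ^ 2 := by field_simp

end Cyl

namespace Cyl

variable {b lam : ℝ} (C : Cyl b lam) (s : ℝ)

/-- first moment of the Hopf-type differential -/
def M : ℂ := cavg (fun θ => Complex.exp (-(s + θ * Complex.I)) *
  ((C.us s θ : ℂ) - Complex.I * C.ut s θ) ^ 2)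

/-- potential correction to the first moment -/
def X : ℂ := cavg (fun θ => (lam : ℂ) * (Complex.exp (s - θ * Complex.I) *
  ((C.f s θ : ℂ) * ((exp (C.u s θ ^ 2) - 1 : ℝ) : ℂ))))

theorem hasDerivAt_moment {s : ℝ} (hs : s < b) :
    HasDerivAt (fun t => C.M t + C.X t)
      (cavg (fun θ => (lam : ℂ) * (Complex.exp (s - θ * Complex.I) *
        (((C.fs s θ : ℂ) - Complex.I * C.ft s θ) * ((exp (C.u s θ ^ 2) - 1 : ℝ) : ℂ))))) s := by
  have c0 := C.cu
  have c1 := C.cus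
  have c2 := C.cut
  have c3 := C.cuss
  have c4 := C.cust
  have c5 := C.cf
  have c6 := C.cfs
  have c7 := C.cft
  have c8 := C.cg
  have c9 := C.cexp
  have hexp1 : ∀ t θ : ℝ, HasDerivAt (fun t : ℝ => Complex.exp (-(t + θ * Complex.I)))
      (-Complex.exp (-(t + θ * Complex.I))) t := by
    intro t θ
    have := (((hasDerivAt_id t).ofReal_comp.add_const (θ * Complex.I)).neg).cexp
    refine this.congr_deriv ?_
    simp
  have hexp2 : ∀ t θ : ℝ, HasDerivAt (fun t : ℝ => Complex.exp (t - θ * Complex.I))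
      (Complex.exp (t - θ * Complex.I)) t := by
    intro t θ
    have := (((hasDerivAt_id t).ofReal_comp.sub_const (θ * Complex.I))).cexp
    refine this.congr_deriv ?_
    simp
  have hexp1' : ∀ t θ : ℝ, HasDerivAt (fun θ : ℝ => Complex.exp (-(t + θ * Complex.I)))
      (-Complex.I * Complex.exp (-(t + θ * Complex.I))) θ := by
    intro t θ
    have := ((((hasDerivAt_id θ).ofReal_comp.mul_const Complex.I).const_add (t : ℂ)).neg).cexp
    refine this.congr_deriv ?_
    simp [mul_comm]
  have hexp2' : ∀ t θ : ℝ, HasDerivAt (fun θ : ℝ => Complex.exp (t - θ * Complex.I))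
      (-Complex.I * Complex.exp (t - θ * Complex.I)) θ := by
    intro t θ
    have := ((((hasDerivAt_id θ).ofReal_comp.mul_const Complex.I).const_sub (t : ℂ))).cexp
    refine this.congr_deriv ?_
    simp [mul_comm]
  have hes : ∀ t < b, ∀ θ, HasDerivAt (fun t => exp (C.u t θ ^ 2) - 1)
      (2 * (C.u t θ * exp (C.u t θ ^ 2)) * C.us t θ) t := by
    intro t ht θ
    refine ((((C.hus t ht θ).pow 2).exp).sub_const 1).congr_deriv ?_
    simp only [Nat.cast_ofNat, Nat.add_one_sub_one, pow_one, Pi.pow_apply]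
    ring
  have het : ∀ t < b, ∀ θ, HasDerivAt (fun θ => exp (C.u t θ ^ 2) - 1)
      (2 * (C.u t θ * exp (C.u t θ ^ 2)) * C.ut t θ) θ := by
    intro t ht θ
    refine ((((C.hut t ht θ).pow 2).exp).sub_const 1).congr_deriv ?_
    simp only [Nat.cast_ofNat, Nat.add_one_sub_one, pow_one, Pi.pow_apply]
    ring
  have dM := hasDerivAt_cavg (b := b) (s := s)
    (F := fun s θ => Complex.exp (-(s + θ * Complex.I)) *
      ((C.us s θ : ℂ) - Complex.I * C.ut s θ) ^ 2)
    (F' := fun s θ => -Complex.exp (-(s + θ * Complex.I)) *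
      ((C.us s θ : ℂ) - Complex.I * C.ut s θ) ^ 2 + Complex.exp (-(s + θ * Complex.I)) *
      (2 * ((C.us s θ : ℂ) - Complex.I * C.ut s θ) * ((C.uss s θ : ℂ) - Complex.I * C.ust s θ)))
    (fun t ht θ => by
      refine ((hexp1 t θ).mul (((C.huss t ht θ).ofReal_comp.sub
        ((C.hust t ht θ).ofReal_comp.const_mul Complex.I)).pow 2)).congr_deriv ?_
      simp only [Nat.cast_ofNat, Nat.add_one_sub_one, pow_one, Pi.pow_apply, Pi.sub_apply])
    (by simp only [Function.uncurry_def] at *; fun_prop)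
    (by simp only [Function.uncurry_def] at *; fun_prop) hs
  have dX := hasDerivAt_cavg (b := b) (s := s)
    (F := fun s θ => (lam : ℂ) * (Complex.exp (s - θ * Complex.I) *
      ((C.f s θ : ℂ) * ((exp (C.u s θ ^ 2) - 1 : ℝ) : ℂ))))
    (F' := fun s θ => (lam : ℂ) * (Complex.exp (s - θ * Complex.I) *
      ((C.f s θ : ℂ) * ((exp (C.u s θ ^ 2) - 1 : ℝ) : ℂ))
      + Complex.exp (s - θ * Complex.I) *
      ((C.fs s θ : ℂ) * ((exp (C.u s θ ^ 2) - 1 : ℝ) : ℂ) + 2 * (C.g s θ : ℂ) * C.us s θ)))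
    (fun t ht θ => by
      refine (((hexp2 t θ).mul ((C.hfs t ht θ).ofReal_comp.mul
        (hes t ht θ).ofReal_comp)).const_mul (lam : ℂ)).congr_deriv ?_
      unfold g
      push_cast
      simp only [Pi.mul_apply]
      ring)
    (by simp only [Function.uncurry_def] at *; fun_prop)
    (by simp only [Function.uncurry_def] at *; fun_prop) hs
  refine (dM.add dX).congr_deriv ?_
  have k0 := continuous_slice C.cu hs
  have k1 := continuous_slice C.cus hs
  have k2 := continuous_slice C.cut hs
  have k3 := continuous_slice C.cuss hs
  have k4 := continuous_slice C.cust hs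
  have k5 := continuous_slice C.cf hs
  have k6 := continuous_slice C.cfs hs
  have k7 := continuous_slice C.cft hs
  have k8 := C.cg' hs
  have k10 := continuous_slice C.cutt hs
  rw [← cavg_add (by fun_prop) (by fun_prop), ← sub_eq_zero, ← cavg_sub (by fun_prop) (by fun_prop)]
  -- the difference is a total angular derivative
  have hT : ∀ θ : ℝ, HasDerivAt (fun θ : ℝ => -Complex.I * (Complex.exp (-(s + θ * Complex.I)) *
      ((C.us s θ : ℂ) - Complex.I * C.ut s θ) ^ 2) +
      Complex.I * lam * (Complex.exp (s - θ * Complex.I) *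
      ((C.f s θ : ℂ) * ((exp (C.u s θ ^ 2) - 1 : ℝ) : ℂ))))
      (-Complex.I * (-Complex.I * Complex.exp (-(s + θ * Complex.I)) *
      ((C.us s θ : ℂ) - Complex.I * C.ut s θ) ^ 2 + Complex.exp (-(s + θ * Complex.I)) *
      (2 * ((C.us s θ : ℂ) - Complex.I * C.ut s θ) *
        ((C.ust s θ : ℂ) - Complex.I * C.utt s θ))) +
      Complex.I * lam * (-Complex.I * Complex.exp (s - θ * Complex.I) *
      ((C.f s θ : ℂ) * ((exp (C.u s θ ^ 2) - 1 : ℝ) : ℂ)) + Complex.exp (s - θ * Complex.I) *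
      ((C.ft s θ : ℂ) * ((exp (C.u s θ ^ 2) - 1 : ℝ) : ℂ) + 2 * C.g s θ * C.ut s θ))) θ := by
    intro θ
    refine ((((hexp1' s θ).mul (((C.hust' s hs θ).ofReal_comp.sub
        ((C.hutt s hs θ).ofReal_comp.const_mul Complex.I)).pow 2)).const_mul (-Complex.I)).add
      (((hexp2' s θ).mul ((C.hft s hs θ).ofReal_comp.mul
        (het s hs θ).ofReal_comp)).const_mul (Complex.I * lam))).congr_deriv ?_
    simp only [Nat.cast_ofNat, Nat.add_one_sub_one, pow_one, Pi.pow_apply, Pi.sub_apply,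
      Pi.mul_apply]
    unfold g
    push_cast
    ring
  have hper : Complex.exp (-(s + ((2 * π : ℝ) : ℂ) * Complex.I))
      = Complex.exp (-(s + ((0 : ℝ) : ℂ) * Complex.I)) := by
    rw [Complex.exp_eq_exp_iff_exists_int]
    exact ⟨-1, by push_cast; ring⟩
  have hper2 : Complex.exp (s - ((2 * π : ℝ) : ℂ) * Complex.I)
      = Complex.exp (s - ((0 : ℝ) : ℂ) * Complex.I) := by
    rw [Complex.exp_eq_exp_iff_exists_int]
    exact ⟨-1, by push_cast; ring⟩
  have h0 := cavg_deriv_eq_zero hT (by fun_prop)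
    (by simp only [hper, hper2, C.pus s hs, C.put s hs, C.pf s hs, C.pu s hs])
  rw [← h0]
  congr 1
  ext θ
  have hp : (C.uss s θ : ℂ) = - (lam * Complex.exp (2 * s) * C.g s θ) - C.utt s θ := by
    have := C.pde s hs θ
    have h2 : C.uss s θ = - (lam * exp (2 * s) * C.g s θ) - C.utt s θ := by
      unfold g; linarith
    rw [h2]; push_cast; ring
  have he : Complex.exp (s - θ * Complex.I)
      = Complex.exp (-(s + θ * Complex.I)) * Complex.exp (2 * s) := by
    rw [← Complex.exp_add]; congr 1; ring
  rw [hp, he]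
  have hI : Complex.I ^ 2 = -1 := Complex.I_sq
  linear_combination (-(Complex.exp (-(s + θ * Complex.I)) *
    ((C.us s θ : ℂ) - Complex.I * C.ut s θ) ^ 2) - 2 * Complex.exp (-(s + θ * Complex.I)) *
    ((C.us s θ : ℂ) - Complex.I * C.ut s θ) * C.utt s θ + lam * (Complex.exp (-(s + θ * Complex.I))
    * Complex.exp (2 * s)) * C.f s θ * ((exp (C.u s θ ^ 2) - 1 : ℝ) : ℂ)) * hI

end Cyl

/-- the constant in `weight_bounds` -/
def wconst (K K₁ : ℝ) : ℝ := 64 * (K + 3) * exp (2 * K + 2 * K₁ + K ^ 2)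

theorem add_one_le_eight_exp (x : ℝ) : x + 1 ≤ 8 * exp (x / 8) := by
  have := Real.add_one_le_exp (x / 8)
  linarith

theorem one_le_wconst {K K₁ : ℝ} (hK : 0 ≤ K) (hK₁ : 0 ≤ K₁) : 1 ≤ wconst K K₁ := by
  unfold wconst
  have : 1 ≤ exp (2 * K + 2 * K₁ + K ^ 2) := Real.one_le_exp (by positivity)
  nlinarith

set_option maxHeartbeats 600000 in
theorem weight_bounds {K K₁ γ σ φ : ℝ} (hK : 0 ≤ K) (hK₁ : 0 ≤ K₁) (hγ : 1 ≤ γ)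
    (h0 : 0 ≤ φ) (h1 : φ ≤ γ ^ 2 + K) (h2 : σ - K₁ ≤ φ) {y W m E1 E2 : ℝ}
    (hy : y = (γ ^ 2 - φ) / γ) (hW : W = exp (σ - γ ^ 2 + y ^ 2))
    (hm0 : 0 ≤ m) (hm1 : m ≤ 1) (hm2 : m ≤ y ^ 2 + 1 / γ ^ 2)
    (hE1 : E1 = exp (-σ / 8)) (hE2 : E2 = exp (-(γ ^ 2 - σ) / 8)) :
    W * (|y| / γ + 1 / γ ^ 2) ≤ wconst K K₁ * (E1 + E2 / γ ^ 2) ∧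
    W * m ≤ wconst K K₁ * (E1 + E2 / γ ^ 2) ∧
    W * (1 + y ^ 2) / γ ^ 2 ≤ wconst K K₁ * (E1 + E2 / γ ^ 2) ∧
    (|φ| + 1) / γ ^ 2 * W * m + exp (σ - γ ^ 2) * (|y| / γ + 1 / γ ^ 2)
      ≤ wconst K K₁ * ((E1 + E2) / γ ^ 2) := by
  have hγ0 : 0 < γ := by linarith
  have hγ2 : 1 ≤ γ ^ 2 := one_le_pow₀ hγ
  have hγ20 : 0 < γ ^ 2 := by positivity
  have hW0 : 0 < W := hW ▸ exp_pos _
  have hE10 : 0 < E1 := hE1 ▸ exp_pos _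
  have hE20 : 0 < E2 := hE2 ▸ exp_pos _
  have hinv : 1 / γ ^ 2 ≤ 1 := by rw [div_le_one hγ20]; exact hγ2
  have hyy : y ^ 2 = γ ^ 2 - 2 * φ + φ ^ 2 / γ ^ 2 := by
    rw [hy]; field_simp; ring
  have habsφ : |φ| = φ := abs_of_nonneg h0
  set c := wconst K K₁ with hc
  have hec : exp (2 * K₁) ≤ exp (2 * K + 2 * K₁ + K ^ 2) := by
    apply exp_le_exp.2; linarith [sq_nonneg K]
  have hc1 : 64 * exp (2 * K₁) ≤ c := by
    rw [hc]; unfold wconst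
    linarith [mul_nonneg hK (exp_pos (2 * K + 2 * K₁ + K ^ 2)).le, hec, exp_pos (2 * K₁)]
  have hcpos : 0 < c := by linarith [exp_pos (2 * K₁)]
  rcases le_total φ (3 / 4 * γ ^ 2) with hA | hB
  · -- far from the boundary of the bubble
    have hq : φ ^ 2 / γ ^ 2 ≤ 3 / 4 * φ := by
      rw [div_le_iff₀ hγ20]; linarith [mul_nonneg h0 (sub_nonneg.2 hA)]
    have hWle : W ≤ exp (2 * K₁) * E1 * exp (-φ / 8) := by
      rw [hW, hE1, ← exp_add, ← exp_add]
      apply exp_le_exp.2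
      rw [hyy]; linarith
    have hy0 : 0 ≤ y := by rw [hy]; apply div_nonneg _ hγ0.le; linarith
    have hyg : y ≤ γ := by
      rw [hy, div_le_iff₀ hγ0]; linarith
    have hyd : |y| / γ ≤ 1 := by
      rw [abs_of_nonneg hy0, div_le_one hγ0]; exact hyg
    have hyd0 : 0 ≤ |y| / γ + 1 / γ ^ 2 := by positivity
    have he1 : exp (-φ / 8) ≤ 1 := exp_le_one_iff.2 (by linarith)
    have hWle' : W ≤ exp (2 * K₁) * E1 := by
      refine hWle.trans ?_
      exact mul_le_of_le_one_right (by positivity) he1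
    have hEE : 0 ≤ E2 / γ ^ 2 := by positivity
    have hK2 := exp_pos (2 * K₁)
    have big : 2 * W ≤ c * (E1 + E2 / γ ^ 2) := by
      have h2 : 2 * exp (2 * K₁) * E1 ≤ c * E1 := by gcongr; linarith
      have h3 := mul_nonneg hcpos.le hEE
      linarith
    refine ⟨?_, ?_, ?_, ?_⟩
    · refine le_trans ?_ big
      calc W * (|y| / γ + 1 / γ ^ 2) ≤ W * 2 := by gcongr; linarith
        _ = 2 * W := mul_comm _ _
    · refine le_trans ?_ big
      calc W * m ≤ W * 2 := by gcongr; linarith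
        _ = 2 * W := mul_comm _ _
    · refine le_trans ?_ big
      rw [div_le_iff₀ hγ20]
      have : y ^ 2 ≤ γ ^ 2 := by gcongr
      calc W * (1 + y ^ 2) ≤ W * (2 * γ ^ 2) := by gcongr; linarith
        _ = _ := by ring
    · have e1 : (φ + 1) * W ≤ 8 * (exp (2 * K₁) * E1) := by
        have h8 := add_one_le_eight_exp φ
        have h9 : exp (φ / 8) * exp (-φ / 8) = 1 := by
          rw [← exp_add, ← exp_zero]; congr 1; ring
        calc (φ + 1) * W ≤ (8 * exp (φ / 8)) * (exp (2 * K₁) * E1 * exp (-φ / 8)) := by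
              gcongr
          _ = 8 * (exp (2 * K₁) * E1) * (exp (φ / 8) * exp (-φ / 8)) := by ring
          _ = _ := by rw [h9, mul_one]
      have e2 : exp (σ - γ ^ 2) ≤ exp (2 * K₁) * E2 * exp (-γ ^ 2 / 8) := by
        rw [hE2, ← exp_add, ← exp_add]
        apply exp_le_exp.2
        linarith
      have e3 : exp (-γ ^ 2 / 8) * γ ^ 2 ≤ 8 := by
        have h8 := add_one_le_eight_exp (γ ^ 2)
        have h9 : exp (γ ^ 2 / 8) * exp (-γ ^ 2 / 8) = 1 := by
          rw [← exp_add, ← exp_zero]; congr 1; ring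
        linarith [mul_le_mul_of_nonneg_right h8 (exp_pos (-γ ^ 2 / 8)).le, exp_pos (-γ ^ 2 / 8)]
      rw [habsφ]
      have e4 : exp (σ - γ ^ 2) * γ ^ 2 ≤ 8 * (exp (2 * K₁) * E2) := by
        calc _ ≤ exp (2 * K₁) * E2 * exp (-γ ^ 2 / 8) * γ ^ 2 := by gcongr
          _ = exp (2 * K₁) * E2 * (exp (-γ ^ 2 / 8) * γ ^ 2) := by ring
          _ ≤ exp (2 * K₁) * E2 * 8 := by gcongr
          _ = _ := by ring
      have e5 : (φ + 1) / γ ^ 2 * W * m ≤ 8 * (exp (2 * K₁) * E1) / γ ^ 2 := by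
        calc (φ + 1) / γ ^ 2 * W * m ≤ (φ + 1) / γ ^ 2 * W * 1 := by gcongr
          _ = (φ + 1) * W / γ ^ 2 := by ring
          _ ≤ _ := by gcongr
      have e6 : exp (σ - γ ^ 2) * (|y| / γ + 1 / γ ^ 2) ≤ 16 * (exp (2 * K₁) * E2) / γ ^ 2 := by
        calc _ ≤ exp (σ - γ ^ 2) * 2 := by
              gcongr; linarith
          _ = 2 * (exp (σ - γ ^ 2) * γ ^ 2) / γ ^ 2 := by field_simp
          _ ≤ 2 * (8 * (exp (2 * K₁) * E2)) / γ ^ 2 := by gcongr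
          _ = _ := by ring
      calc _ ≤ 8 * (exp (2 * K₁) * E1) / γ ^ 2 + 16 * (exp (2 * K₁) * E2) / γ ^ 2 :=
            add_le_add e5 e6
        _ = (8 * exp (2 * K₁) * E1 + 16 * exp (2 * K₁) * E2) / γ ^ 2 := by ring
        _ ≤ (c * E1 + c * E2) / γ ^ 2 := by gcongr <;> linarith
        _ = _ := by ring
  · -- near the boundary
    set x := γ ^ 2 - σ + (2 * K + K₁) with hx
    have hxK : K ≤ x := by rw [hx]; linarith
    have hx0 : 0 ≤ x := hK.trans hxK
    have hyx : |y| ≤ x / γ := by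
      rw [hy, abs_div, abs_of_pos hγ0]
      gcongr
      rw [abs_le]
      constructor <;> linarith
    have hy2x : y ^ 2 ≤ x ^ 2 / γ ^ 2 := by
      rw [← sq_abs, ← div_pow]
      gcongr
    have hy2 : y ^ 2 ≤ x / 4 + K ^ 2 := by
      rcases le_total φ (γ ^ 2) with hle | hle
      · have hy0 : 0 ≤ y := by rw [hy]; apply div_nonneg _ hγ0.le; linarith
        have hyg : y ≤ γ / 4 := by
          rw [hy, div_le_iff₀ hγ0]; linarith
        rw [abs_of_nonneg hy0] at hyx
        calc y ^ 2 = y * y := sq y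
          _ ≤ (γ / 4) * (x / γ) := by gcongr
          _ = x / 4 := by field_simp
          _ ≤ _ := by linarith [sq_nonneg K]
      · have : |y| ≤ K := by
          rw [hy, abs_div, abs_of_pos hγ0, div_le_iff₀ hγ0, abs_le]
          constructor <;> linarith [mul_le_mul_of_nonneg_left hγ hK]
        rw [← sq_abs]
        have := pow_le_pow_left₀ (abs_nonneg y) this 2
        linarith
    set c0 := exp (2 * K + 2 * K₁ + K ^ 2) with hc0
    have hc0pos : 0 < c0 := exp_pos _
    have hWle : W ≤ c0 * E2 * exp (-x / 2) := by
      rw [hW, hE2, ← exp_add, ← exp_add]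
      apply exp_le_exp.2
      have hxe : γ ^ 2 - σ = x - (2 * K + K₁) := by rw [hx]; ring
      have : σ - γ ^ 2 = -(x - (2 * K + K₁)) := by linarith
      rw [this, hxe]
      linarith
    have hζ : exp (σ - γ ^ 2) ≤ c0 * E2 * exp (-x / 2) := by
      rw [hE2, ← exp_add, ← exp_add]
      apply exp_le_exp.2
      have hxe : γ ^ 2 - σ = x - (2 * K + K₁) := by rw [hx]; ring
      have : σ - γ ^ 2 = -(x - (2 * K + K₁)) := by linarith
      rw [this, hxe]
      linarith [sq_nonneg K]
    have hexp : exp (-x / 2) * (x + 1) ^ 2 ≤ 64 := by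
      have h8 := add_one_le_eight_exp x
      have h9 : exp (x / 8) ^ 2 * exp (-x / 2) ≤ 1 := by
        rw [← exp_nat_mul, ← exp_add]
        apply exp_le_one_iff.2
        push_cast; linarith
      calc exp (-x / 2) * (x + 1) ^ 2 ≤ exp (-x / 2) * (8 * exp (x / 8)) ^ 2 := by gcongr
        _ = 64 * (exp (x / 8) ^ 2 * exp (-x / 2)) := by ring
        _ ≤ _ := by linarith
    have hkey : ∀ V, V ≤ c0 * E2 * exp (-x / 2) →
        V * (x + 1) ^ 2 / γ ^ 2 ≤ 64 * c0 * (E2 / γ ^ 2) := by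
      intro V hV
      rw [mul_div_assoc', div_le_div_iff_of_pos_right hγ20]
      calc V * (x + 1) ^ 2 ≤ c0 * E2 * exp (-x / 2) * (x + 1) ^ 2 := by gcongr
        _ = c0 * E2 * (exp (-x / 2) * (x + 1) ^ 2) := by ring
        _ ≤ c0 * E2 * 64 := by gcongr
        _ = _ := by ring
    have hcc : 64 * (K + 3) * c0 = c := by rw [hc, hc0]; rfl
    have hE2g : 0 < E2 / γ ^ 2 := by positivity
    have big : 64 * c0 * (E2 / γ ^ 2) ≤ c * (E1 + E2 / γ ^ 2) := by
      have h2 : 64 * c0 ≤ c := by rw [← hcc]; linarith [mul_nonneg hK hc0pos.le]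
      have h3 := mul_pos hcpos hE10
      have h4 := mul_le_mul_of_nonneg_right h2 hE2g.le
      linarith
    have hyterm : |y| / γ + 1 / γ ^ 2 ≤ (x + 1) ^ 2 / γ ^ 2 := by
      have : |y| / γ ≤ x / γ ^ 2 := by
        calc |y| / γ ≤ x / γ / γ := by gcongr
          _ = x / γ ^ 2 := by field_simp
      calc _ ≤ x / γ ^ 2 + 1 / γ ^ 2 := by gcongr
        _ = (x + 1) / γ ^ 2 := by ring
        _ ≤ _ := by gcongr; linarith [sq_nonneg x]
    have hmterm : m ≤ (x + 1) ^ 2 / γ ^ 2 := by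
      refine hm2.trans ?_
      calc _ ≤ x ^ 2 / γ ^ 2 + 1 / γ ^ 2 := by gcongr
        _ = (x ^ 2 + 1) / γ ^ 2 := by ring
        _ ≤ _ := by gcongr; linarith [sq_nonneg x]
    have g1 : W * m ≤ 64 * c0 * (E2 / γ ^ 2) := by
      refine le_trans ?_ (hkey W hWle)
      rw [mul_div_assoc]
      gcongr
    refine ⟨?_, g1.trans big, ?_, ?_⟩
    · refine le_trans (le_trans ?_ (hkey W hWle)) big
      rw [mul_div_assoc]
      gcongr
    · refine le_trans (le_trans ?_ (hkey W hWle)) big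
      gcongr
      have : y ^ 2 ≤ x ^ 2 := hy2x.trans (div_le_self (sq_nonneg x) hγ2)
      linarith [show (x + 1) ^ 2 = x ^ 2 + 2 * x + 1 by ring]
    · have hφ1 : (|φ| + 1) / γ ^ 2 ≤ K + 2 := by
        rw [habsφ, div_le_iff₀ hγ20]
        linarith [mul_le_mul_of_nonneg_left hγ2 (by linarith : 0 ≤ K + 1)]
      have g2 : exp (σ - γ ^ 2) * (|y| / γ + 1 / γ ^ 2) ≤ 64 * c0 * (E2 / γ ^ 2) := by
        refine le_trans ?_ (hkey _ hζ)
        rw [mul_div_assoc]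
        gcongr
      calc _ ≤ (K + 2) * (64 * c0 * (E2 / γ ^ 2)) + 64 * c0 * (E2 / γ ^ 2) := by
            refine add_le_add ?_ g2
            rw [mul_assoc]
            exact mul_le_mul hφ1 g1 (by positivity) (by linarith)
        _ = c * (E2 / γ ^ 2) := by rw [← hcc]; ring
        _ ≤ c * ((E1 + E2) / γ ^ 2) := by
            gcongr; linarith

theorem le_of_hasDerivAt_nonneg {F F' : ℝ → ℝ} {a b : ℝ} (hab : a ≤ b)
    (h : ∀ x ∈ Icc a b, HasDerivAt F (F' x) x) (h0 : ∀ x ∈ Icc a b, 0 ≤ F' x) : F a ≤ F b := by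
  have := monotoneOn_of_deriv_nonneg (convex_Icc a b) (f := F)
    (fun x hx => (h x hx).continuousAt.continuousWithinAt)
    (fun x hx => (h x (interior_subset hx)).differentiableAt.differentiableWithinAt)
    (fun x hx => by rw [(h x (interior_subset hx)).deriv]; exact h0 x (interior_subset hx))
  exact this ⟨le_rfl, hab⟩ ⟨hab, le_rfl⟩ hab

theorem abs_sub_le_of_abs_deriv_le {F F' G G' : ℝ → ℝ} {a b : ℝ} (hab : a ≤ b)
    (hF : ∀ x ∈ Icc a b, HasDerivAt F (F' x) x) (hG : ∀ x ∈ Icc a b, HasDerivAt G (G' x) x)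
    (h : ∀ x ∈ Icc a b, |F' x| ≤ G' x) : |F b - F a| ≤ G b - G a := by
  have h1 := le_of_hasDerivAt_nonneg (F := fun x => G x - F x) hab
    (fun x hx => (hG x hx).sub (hF x hx)) (fun x hx => by linarith [le_abs_self (F' x), h x hx])
  have h2 := le_of_hasDerivAt_nonneg (F := fun x => G x + F x) hab
    (fun x hx => (hG x hx).add (hF x hx)) (fun x hx => by linarith [neg_abs_le (F' x), h x hx])
  rw [abs_le]
  constructor <;> linarith

/-- Continuous induction: a function which is positive at the left endpoint and whose
nonnegativity up to a point forces positivity at that point is positive. -/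
theorem pos_of_bootstrap {g : ℝ → ℝ} {a b : ℝ} (hg : ContinuousOn g (Icc a b)) (ha : 0 < g a)
    (hstep : ∀ c ∈ Icc a b, (∀ t ∈ Icc a c, 0 ≤ g t) → 0 < g c) : ∀ t ∈ Icc a b, 0 < g t := by
  by_contra! hcon
  obtain ⟨t, ht, hgt⟩ := hcon
  set S := {x ∈ Icc a b | g x ≤ 0} with hS
  have hSne : S.Nonempty := ⟨t, ht, hgt⟩
  have hSc : IsClosed S := by
    have : S = Icc a b ∩ g ⁻¹' Iic 0 := by ext; simp [hS]
    rw [this]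
    exact hg.preimage_isClosed_of_isClosed isClosed_Icc isClosed_Iic
  have hbdd : BddBelow S := ⟨a, fun x hx => hx.1.1⟩
  have hmem : sInf S ∈ S := hSc.csInf_mem hSne hbdd
  have hpos : ∀ x ∈ Icc a (sInf S), x ≠ sInf S → 0 < g x := by
    intro x hx hne
    by_contra! hle
    have : x ∈ S := ⟨⟨hx.1, hx.2.trans hmem.1.2⟩, hle⟩
    exact hne (le_antisymm hx.2 (csInf_le hbdd this))
  have hlt : a < sInf S := by
    rcases hmem.1.1.eq_or_lt with h | h
    · exact absurd hmem.2 (by rw [← h]; exact not_le.2 ha)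
    · exact h
  have h0 : 0 ≤ g (sInf S) := by
    have hcw : ContinuousWithinAt g (Ico a (sInf S)) (sInf S) :=
      (hg (sInf S) hmem.1).mono fun x hx => ⟨hx.1, hx.2.le.trans hmem.1.2⟩
    have hne : (𝓝[Ico a (sInf S)] (sInf S)).NeBot := by
      rw [← mem_closure_iff_nhdsWithin_neBot, closure_Ico hlt.ne]
      exact ⟨hlt.le, le_rfl⟩
    refine ge_of_tendsto hcw ?_
    filter_upwards [self_mem_nhdsWithin] with x hx
    exact (hpos x ⟨hx.1, hx.2.le⟩ hx.2.ne).le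
  refine absurd hmem.2 (not_le.2 (hstep _ hmem.1 fun x hx => ?_))
  rcases eq_or_ne x (sInf S) with rfl | hne
  · exact h0
  · exact (hpos x hx hne).le

/-- twice the logarithmic distance to the bubble scale -/
def sg (μ s : ℝ) : ℝ := 2 * (s - log μ)
/-- value of the solution at flux coordinate `φ` -/
def yv (γ φ : ℝ) : ℝ := (γ ^ 2 - φ) / γ
/-- size of the nonlinearity at flux coordinate `φ` -/
def Wv (γ μ s φ : ℝ) : ℝ := exp (sg μ s - γ ^ 2 + yv γ φ ^ 2)
/-- truncated square of the solution -/
def mv (γ φ : ℝ) : ℝ := min 1 (yv γ φ ^ 2 + 1 / γ ^ 2)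

/-- The differential relations and inequalities satisfied on `[a, b]` by the angular means of a
solution. -/
structure Dyn (γ μ a b A A₂ K : ℝ) (φ p q Q Qh Fq Z E nn err : ℝ → ℝ) : Prop where
  dphi : ∀ s ∈ Icc a b, HasDerivAt φ (p s) s
  dp : ∀ s ∈ Icc a b, HasDerivAt p (q s) s
  dZ : ∀ s ∈ Icc a b, HasDerivAt Z (2 * (Q s - q s) + Fq s) s
  dnn : ∀ s ∈ Icc a b, HasDerivAt nn (2 * E s - 2 * err s) s
  E0 : ∀ s ∈ Icc a b, 0 ≤ E s
  poh : ∀ s ∈ Icc a b, |p s ^ 2 + Q s - 2 * p s - Z s| ≤ E s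
  nnE : ∀ s ∈ Icc a b, |nn s| ≤ A * E s
  nnA : ∀ s ∈ Icc a b, |nn s| ≤ A₂
  phi_le : ∀ s ∈ Icc a b, φ s ≤ γ ^ 2 + K
  hq : ∀ s ∈ Icc a b, 0 ≤ φ s →
    |q s| ≤ A * (Wv γ μ s (φ s) * (|yv γ (φ s)| / γ + 1 / γ ^ 2))
  hQ : ∀ s ∈ Icc a b, 0 ≤ φ s → |Q s| ≤ A * (Wv γ μ s (φ s) * mv γ (φ s))
  hQh : ∀ s ∈ Icc a b, 0 ≤ φ s → |Qh s| ≤ A * (Wv γ μ s (φ s) * mv γ (φ s))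
  hF : ∀ s ∈ Icc a b, 0 ≤ φ s → |Fq s| ≤ A * exp s * (Wv γ μ s (φ s) * mv γ (φ s))
  hQq : ∀ s ∈ Icc a b, 0 ≤ φ s → |Q s - q s| ≤ A * ((|φ s| + 1) / γ ^ 2 * Wv γ μ s (φ s) *
    mv γ (φ s) + exp (sg μ s - γ ^ 2) * (|yv γ (φ s)| / γ + 1 / γ ^ 2))
  herr : ∀ s ∈ Icc a b, 0 ≤ φ s →
    |err s| ≤ A * exp s * (Wv γ μ s (φ s) * (|yv γ (φ s)| / γ + 1 / γ ^ 2))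
      + A * (Wv γ μ s (φ s) * (1 + yv γ (φ s) ^ 2) / γ ^ 2) * E s

theorem Dyn.mono {γ μ a b b' A A₂ K : ℝ} {φ p q Q Qh Fq Z E nn err : ℝ → ℝ}
    (D : Dyn γ μ a b A A₂ K φ p q Q Qh Fq Z E nn err) (hb : b' ≤ b) :
    Dyn γ μ a b' A A₂ K φ p q Q Qh Fq Z E nn err := by
  have hs : ∀ s ∈ Icc a b', s ∈ Icc a b := fun s hs => ⟨hs.1, hs.2.trans hb⟩
  exact ⟨fun s h => D.dphi s (hs s h), fun s h => D.dp s (hs s h), fun s h => D.dZ s (hs s h),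
    fun s h => D.dnn s (hs s h), fun s h => D.E0 s (hs s h), fun s h => D.poh s (hs s h),
    fun s h => D.nnE s (hs s h), fun s h => D.nnA s (hs s h), fun s h => D.phi_le s (hs s h),
    fun s h => D.hq s (hs s h), fun s h => D.hQ s (hs s h), fun s h => D.hQh s (hs s h),
    fun s h => D.hF s (hs s h),
    fun s h => D.hQq s (hs s h), fun s h => D.herr s (hs s h)⟩

/-- pointwise decay profile -/
def E1v (μ s : ℝ) : ℝ := exp (-sg μ s / 8)
/-- pointwise decay profile at the far end -/
def E2v (γ μ s : ℝ) : ℝ := exp (-(γ ^ 2 - sg μ s) / 8)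
/-- combined decay profile -/
def Psi (γ μ s : ℝ) : ℝ := E1v μ s + E2v γ μ s / γ ^ 2
/-- antiderivative of `Psi` -/
def Theta (γ μ s : ℝ) : ℝ := -4 * E1v μ s + 4 * E2v γ μ s / γ ^ 2

theorem hasDerivAt_sg (μ s : ℝ) : HasDerivAt (sg μ) 2 s := by
  refine (((hasDerivAt_id s).sub_const (log μ)).const_mul 2).congr_deriv ?_
  norm_num

theorem hasDerivAt_E1v (μ s : ℝ) : HasDerivAt (E1v μ) (-(1 / 4) * E1v μ s) s := by
  refine ((((hasDerivAt_sg μ s).neg).div_const 8).exp).congr_deriv ?_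
  simp only [E1v, Pi.neg_apply]; ring

theorem hasDerivAt_E2v (γ μ s : ℝ) : HasDerivAt (E2v γ μ) (1 / 4 * E2v γ μ s) s := by
  refine (((((hasDerivAt_sg μ s).const_sub (γ ^ 2)).neg).div_const 8).exp).congr_deriv ?_
  simp only [E2v, Pi.neg_apply]; ring

theorem hasDerivAt_Theta (γ μ s : ℝ) : HasDerivAt (Theta γ μ) (Psi γ μ s) s := by
  refine (((hasDerivAt_E1v μ s).const_mul (-4)).add
    (((hasDerivAt_E2v γ μ s).const_mul 4).div_const (γ ^ 2))).congr_deriv ?_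
  unfold Psi; ring

theorem Dyn.psi_bounds {γ μ a b A A₂ K K₁ : ℝ} {φ p q Q Qh Fq Z E nn err : ℝ → ℝ}
    (D : Dyn γ μ a b A A₂ K φ p q Q Qh Fq Z E nn err) (hA : 0 ≤ A) (hK : 0 ≤ K) (hK₁ : 0 ≤ K₁)
    (hγ : 1 ≤ γ) {s : ℝ} (hs : s ∈ Icc a b) (h0 : 0 ≤ φ s) (h2 : sg μ s - K₁ ≤ φ s) :
    |q s| ≤ A * wconst K K₁ * Psi γ μ s ∧ |Q s| ≤ A * wconst K K₁ * Psi γ μ s ∧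
    |Qh s| ≤ A * wconst K K₁ * Psi γ μ s ∧
    |Fq s| ≤ A * wconst K K₁ * (exp s * Psi γ μ s) ∧
    |Q s - q s| ≤ A * wconst K K₁ * ((E1v μ s + E2v γ μ s) / γ ^ 2) ∧
    |err s| ≤ A * wconst K K₁ * (exp s * Psi γ μ s) + A * wconst K K₁ * Psi γ μ s * E s := by
  have hm0 : 0 ≤ mv γ (φ s) := le_min zero_le_one (by positivity)
  obtain ⟨w1, w2, w3, w4⟩ := weight_bounds hK hK₁ hγ h0 (D.phi_le s hs) h2
    (y := yv γ (φ s)) (W := Wv γ μ s (φ s)) (m := mv γ (φ s)) (E1 := E1v μ s) (E2 := E2v γ μ s)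
    rfl rfl hm0 (min_le_left _ _) (min_le_right _ _) rfl rfl
  have hE := D.E0 s hs
  have hAe : 0 ≤ A * exp s := by positivity
  refine ⟨?_, ?_, ?_, ?_, ?_, ?_⟩
  · rw [mul_assoc]
    exact (D.hq s hs h0).trans (mul_le_mul_of_nonneg_left w1 hA)
  · rw [mul_assoc]
    exact (D.hQ s hs h0).trans (mul_le_mul_of_nonneg_left w2 hA)
  · rw [mul_assoc]
    exact (D.hQh s hs h0).trans (mul_le_mul_of_nonneg_left w2 hA)
  · refine ((D.hF s hs h0).trans (mul_le_mul_of_nonneg_left w2 hAe)).trans_eq ?_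
    unfold Psi; ring
  · rw [mul_assoc]
    exact (D.hQq s hs h0).trans (mul_le_mul_of_nonneg_left w4 hA)
  · refine ((D.herr s hs h0).trans (add_le_add (mul_le_mul_of_nonneg_left w1 hAe)
      (mul_le_mul_of_nonneg_right (mul_le_mul_of_nonneg_left w3 hA) hE))).trans_eq ?_
    unfold Psi; ring

/-- depth constant in the lower bound `σ - K₁ ≤ φ` -/
def K1c (A₂ : ℝ) : ℝ := A₂ + 4
/-- multiplicative constant of the profile bounds -/
def c1c (A A₂ K : ℝ) : ℝ := A * wconst K (K1c A₂)
/-- bound for the far profile -/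
def c2c (A₂ K : ℝ) : ℝ := exp (K + K1c A₂)
/-- final error constant -/
def C3c (A A₂ K : ℝ) : ℝ :=
  8 * c1c A A₂ K * (1 + c2c A₂ K) + 1 + 4 * c1c A A₂ K * (1 + c2c A₂ K)
    + (2 * (1 + 4 * c1c A A₂ K * (1 + c2c A₂ K)) + (1 + 8 * c1c A A₂ K)) * (1 + (K + K1c A₂)) / 2
    + 1 + 48 * c1c A A₂ K * c2c A₂ K + 2 * c1c A A₂ K

/-- Smallness assumptions on the data at the starting point `a`. -/
structure DynStart (γ μ a A A₂ K h κ φa pa Za nna : ℝ) : Prop where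
  hA : 1 ≤ A
  hA₂ : 0 ≤ A₂
  hK : 0 ≤ K
  hγ : 1 ≤ γ
  ha : a < 0
  h0 : 0 ≤ h
  hC : C3c A A₂ K * h ≤ 1
  hK₁ : h ≤ exp (-K1c A₂ / 8)
  hE1 : E1v μ a ≤ h
  hγ2 : 1 / γ ^ 2 ≤ h
  hμ : exp (log μ / 4) ≤ h
  hp : |pa - 2| ≤ h
  hnn : |nna| ≤ h
  hφ : |φa - sg μ a + log 4| ≤ h
  κ0 : 0 ≤ κ
  κ4 : κ ≤ 4
  hZ : |Za - κ / γ ^ 2| ≤ h / γ ^ 2 + h / |a|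

/-- decay profile for the oscillation of the weight -/
def omv (μ s : ℝ) : ℝ := exp (3 / 4 * s + log μ / 4)

theorem hasDerivAt_omv (μ s : ℝ) : HasDerivAt (omv μ) (3 / 4 * omv μ s) s := by
  refine ((((hasDerivAt_id s).const_mul (3 / 4)).add_const (log μ / 4)).exp).congr_deriv ?_
  simp only [omv, id]; ring

theorem exp_mul_E1v (μ s : ℝ) : exp s * E1v μ s = omv μ s := by
  unfold E1v omv sg
  rw [← exp_add]; congr 1; ring

theorem sg_mono {μ a s : ℝ} (h : a ≤ s) : sg μ a ≤ sg μ s := by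
  unfold sg; linarith

theorem E1v_anti {μ a s : ℝ} (h : a ≤ s) : E1v μ s ≤ E1v μ a := by
  unfold E1v
  apply exp_le_exp.2
  linarith [sg_mono (μ := μ) h]

section
variable {γ μ a b A A₂ K h κ : ℝ} {φ p q Q Qh Fq Z E nn err : ℝ → ℝ}

theorem DynStart.sg_ge {φa pa Za nna : ℝ} (S : DynStart γ μ a A A₂ K h κ φa pa Za nna) :
    K1c A₂ ≤ sg μ a := by
  have := S.hE1.trans S.hK₁
  unfold E1v at this
  have := exp_le_exp.1 this
  linarith

theorem DynStart.c1_pos {φa pa Za nna : ℝ} (S : DynStart γ μ a A A₂ K h κ φa pa Za nna) :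
    1 ≤ c1c A A₂ K := by
  have h2 : 0 ≤ K1c A₂ := by unfold K1c; linarith [S.hA₂]
  have h1 := one_le_wconst S.hK h2
  have := S.hA
  unfold c1c
  nlinarith

theorem DynStart.c2_pos {φa pa Za nna : ℝ} (S : DynStart γ μ a A A₂ K h κ φa pa Za nna) :
    1 ≤ c2c A₂ K := by
  unfold c2c
  apply Real.one_le_exp
  unfold K1c; linarith [S.hA₂, S.hK]

/-- One step of the bootstrap argument. -/
theorem Dyn.step (D : Dyn γ μ a b A A₂ K φ p q Q Qh Fq Z E nn err)
    (S : DynStart γ μ a A A₂ K h κ (φ a) (p a) (Z a) (nn a)) (hab : a ≤ b) (hb : b ≤ 0)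
    (hlow : ∀ s ∈ Icc a b, sg μ s - K1c A₂ ≤ φ s) :
    ∀ s ∈ Icc a b, |p s - 2| ≤ C3c A A₂ K * h ∧
      |φ s - φ a - (2 + κ / (2 * γ ^ 2)) * (s - a)| ≤ C3c A A₂ K * h + A₂ * exp ((s - b) / A) := by
  have hc1 := S.c1_pos
  have hc2 := S.c2_pos
  have hK := S.hK
  have hA₂ := S.hA₂
  have hh := S.h0
  have hK1 : 0 ≤ K1c A₂ := by unfold K1c; linarith
  have hγ := S.hγ
  have hγ2 : 1 ≤ γ ^ 2 := one_le_pow₀ hγ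
  have hA := S.hA
  have hA0 : 0 < A := by linarith
  obtain ⟨L, hL⟩ : ∃ L, L = K + K1c A₂ := ⟨_, rfl⟩
  have hL0 : 0 ≤ L := by linarith
  have hC3 : C3c A A₂ K = 8 * c1c A A₂ K * (1 + c2c A₂ K) + 1 + 4 * c1c A A₂ K * (1 + c2c A₂ K)
    + (2 * (1 + 4 * c1c A A₂ K * (1 + c2c A₂ K)) + (1 + 8 * c1c A A₂ K)) * (1 + L) / 2
    + 1 + 48 * c1c A A₂ K * c2c A₂ K + 2 * c1c A A₂ K := by rw [hL]; rfl
  have hCh := S.hC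
  have hc2d : c2c A₂ K = exp L := by rw [hL]; rfl
  have hc1d : c1c A A₂ K = A * wconst K (K1c A₂) := rfl
  have hγh := S.hγ2
  have hE1a := S.hE1
  have hωh := S.hμ
  have hsga := S.sg_ge
  have hZa := S.hZ
  have hκ0 := S.κ0
  have hκ4 := S.κ4
  have hnna := S.hnn
  have hpa := S.hp
  have ha := S.ha
  generalize C3c A A₂ K = C3 at *
  generalize c1c A A₂ K = c1 at *
  generalize c2c A₂ K = c2 at *
  have hb0 : ∀ s ∈ Icc a b, 0 ≤ φ s := fun s hs => by
    linarith [hlow s hs, sg_mono (μ := μ) hs.1]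
  have hζ : ∀ s ∈ Icc a b, sg μ s ≤ γ ^ 2 + L := fun s hs => by
    linarith [hlow s hs, D.phi_le s hs]
  have PB := fun s (hs : s ∈ Icc a b) =>
    D.psi_bounds (by linarith) hK hK1 hγ hs (hb0 s hs) (hlow s hs)
  rw [← hc1d] at PB
  have hE1 : ∀ s ∈ Icc a b, E1v μ s ≤ h := fun s hs => (E1v_anti hs.1).trans hE1a
  have hE10 : ∀ s, 0 < E1v μ s := fun s => exp_pos _
  have hE20 : ∀ s, 0 < E2v γ μ s := fun s => exp_pos _
  have hE2 : ∀ s ∈ Icc a b, E2v γ μ s ≤ c2 := fun s hs => by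
    rw [hc2d]; unfold E2v; apply exp_le_exp.2; linarith [hζ s hs]
  have hig : 0 < 1 / γ ^ 2 := by positivity
  have hE2γ : ∀ s ∈ Icc a b, E2v γ μ s / γ ^ 2 ≤ c2 * h := fun s hs => by
    rw [div_eq_mul_one_div]
    exact mul_le_mul (hE2 s hs) hγh hig.le (by linarith)
  have hE2γ0 : ∀ s, 0 < E2v γ μ s / γ ^ 2 := fun s => by have := hE20 s; positivity
  have hΨ0 : ∀ s, 0 < Psi γ μ s := fun s => add_pos (hE10 s) (hE2γ0 s)
  have hΨ : ∀ s ∈ Icc a b, Psi γ μ s ≤ (1 + c2) * h := fun s hs => by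
    unfold Psi; linarith [hE1 s hs, hE2γ s hs]
  have hΘ : ∀ s ∈ Icc a b, Theta γ μ s - Theta γ μ a ≤ 4 * ((1 + c2) * h) := fun s hs => by
    unfold Theta
    have e1 := hE2γ s hs
    have e2 := hE2γ0 a
    have e3 := hE10 s
    rw [mul_div_assoc, mul_div_assoc]
    linarith
  have hc12 : 0 ≤ c1 * (1 + c2) * h := by positivity
  have hc12' : 0 ≤ c1 * c2 * h := by positivity
  have hc1h : 0 ≤ c1 * h := by positivity
  have hrest : 0 ≤ (2 * (1 + 4 * c1 * (1 + c2)) + (1 + 8 * c1)) * (1 + L) / 2 * h := by positivity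
  have hC3h : C3 * h = 12 * (c1 * (1 + c2) * h) + 2 * h
      + (2 * (1 + 4 * c1 * (1 + c2)) + (1 + 8 * c1)) * (1 + L) / 2 * h
      + 48 * (c1 * c2 * h) + 2 * (c1 * h) := by rw [hC3]; ring
  have hsub : ∀ s ∈ Icc a b, ∀ t ∈ Icc a s, t ∈ Icc a b := fun s hs t ht => ⟨ht.1, ht.2.trans hs.2⟩
  obtain ⟨δ₁, hδ₁⟩ : ∃ δ₁, δ₁ = h + 4 * (c1 * (1 + c2) * h) := ⟨_, rfl⟩
  have hδC : δ₁ ≤ C3 * h := by linarith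
  have hδ0 : 0 ≤ δ₁ := by linarith
  have hp : ∀ s ∈ Icc a b, |p s - 2| ≤ δ₁ := fun s hs => by
    have h1 := abs_sub_le_of_abs_deriv_le hs.1 (fun t ht => D.dp t (hsub s hs t ht))
      (fun t ht => (hasDerivAt_Theta γ μ t).const_mul c1) (fun t ht => (PB t (hsub s hs t ht)).1)
    have h2 := mul_le_mul_of_nonneg_left (hΘ s hs) (by linarith : 0 ≤ c1)
    have h3 := abs_add_le (p s - p a) (p a - 2)
    rw [show p s - p a + (p a - 2) = p s - 2 by ring] at h3
    linarith
  have hexp1 : ∀ s ∈ Icc a b, exp s ≤ 1 := fun s hs => exp_le_one_iff.2 (hs.2.trans hb)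
  set N : ℝ → ℝ := fun s => nn s + 2 * c1 * (Theta γ μ s - Theta γ μ a) with hN
  have hN' : ∀ s ∈ Icc a b, HasDerivAt N (2 * E s - 2 * err s + 2 * c1 * Psi γ μ s) s :=
    fun s hs => (D.dnn s hs).add (((hasDerivAt_Theta γ μ s).sub_const _).const_mul (2 * c1))
  have hN'E : ∀ s ∈ Icc a b, E s ≤ 2 * E s - 2 * err s + 2 * c1 * Psi γ μ s := fun s hs => by
    have h1 := (le_abs_self _).trans (PB s hs).2.2.2.2.2
    have h2 : c1 * (exp s * Psi γ μ s) ≤ c1 * Psi γ μ s :=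
      mul_le_mul_of_nonneg_left (by
        have := mul_le_mul_of_nonneg_right (hexp1 s hs) (hΨ0 s).le
        linarith) (by linarith)
    have h3 : c1 * Psi γ μ s ≤ c1 * (1 + c2) * h := by
      rw [mul_assoc]; exact mul_le_mul_of_nonneg_left (hΨ s hs) (by linarith)
    have h4 : 2 * (c1 * Psi γ μ s) ≤ 1 := by linarith
    have h5 := mul_le_mul_of_nonneg_right h4 (D.E0 s hs)
    linarith
  obtain ⟨ε₀, hε₀⟩ : ∃ ε₀, ε₀ = 8 * (c1 * (1 + c2) * h) := ⟨_, rfl⟩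
  have hNs : ∀ s ∈ Icc a b, N s ≤ nn s + ε₀ := fun s hs => by
    have := mul_le_mul_of_nonneg_left (hΘ s hs) (by linarith : 0 ≤ 2 * c1)
    simp only [hN]; linarith
  have hNinc : ∀ s ∈ Icc a b, N s ≤ ε₀ + A₂ * exp ((s - b) / A) := fun s hs => by
    have hd : ∀ t ∈ Icc s b, HasDerivAt (fun t => exp (-(t / A)) * (N t - ε₀))
        (exp (-(t / A)) * (-(1 / A)) * (N t - ε₀) + exp (-(t / A)) *
          (2 * E t - 2 * err t + 2 * c1 * Psi γ μ t)) t := fun t ht => by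
      have ht' : t ∈ Icc a b := ⟨hs.1.trans ht.1, ht.2⟩
      exact (((hasDerivAt_id t).div_const A).neg.exp).mul ((hN' t ht').sub_const ε₀)
    have hmono := le_of_hasDerivAt_nonneg hs.2 hd (fun t ht => by
      have ht' : t ∈ Icc a b := ⟨hs.1.trans ht.1, ht.2⟩
      have h1 := hNs t ht'
      have h2 := (le_abs_self _).trans (D.nnE t ht')
      have h3 := hN'E t ht'
      have h4 : (N t - ε₀) / A ≤ E t := by
        rw [div_le_iff₀ hA0]; linarith
      have h5 : 0 ≤ 2 * E t - 2 * err t + 2 * c1 * Psi γ μ t - (N t - ε₀) / A := by linarith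
      have h6 := mul_nonneg (exp_pos (-(t / A))).le h5
      have h7 : exp (-(t / A)) * (2 * E t - 2 * err t + 2 * c1 * Psi γ μ t - (N t - ε₀) / A)
        = exp (-(t / A)) * (-(1 / A)) * (N t - ε₀) + exp (-(t / A)) *
          (2 * E t - 2 * err t + 2 * c1 * Psi γ μ t) := by ring
      linarith)
    have hbm : b ∈ Icc a b := ⟨hab, le_rfl⟩
    have h1 : N b - ε₀ ≤ A₂ := by
      linarith [hNs b hbm, (le_abs_self _).trans (D.nnA b hbm)]
    have h2 : exp (-(s / A)) * (N s - ε₀) ≤ exp (-(b / A)) * A₂ :=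
      hmono.trans (mul_le_mul_of_nonneg_left h1 (exp_pos _).le)
    have h3 := mul_le_mul_of_nonneg_left h2 (exp_pos (s / A)).le
    have h4 : exp (s / A) * (exp (-(s / A)) * (N s - ε₀)) = N s - ε₀ := by
      rw [← mul_assoc, ← exp_add]; simp
    have h5 : exp (s / A) * (exp (-(b / A)) * A₂) = A₂ * exp ((s - b) / A) := by
      rw [← mul_assoc, ← exp_add, mul_comm]; congr 2; ring
    linarith
  have hNa : -h ≤ N a := by
    simp only [hN, sub_self, mul_zero, add_zero]
    linarith [neg_abs_le (nn a)]
  have hω0 : ∀ s, 0 < omv μ s := fun s => exp_pos _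
  set e : ℝ := h / γ ^ 2 with he
  have he0 : 0 ≤ e := by positivity
  have hha0 : 0 ≤ h / |a| := by positivity
  have hZ : ∀ s ∈ Icc a b, |Z s - κ / γ ^ 2| ≤ (1 + 8 * c1) * e + h / |a|
      + 12 * c1 * (E2v γ μ s / γ ^ 2) + 4 / 3 * c1 * omv μ s := fun s hs => by
    have hG : ∀ t ∈ Icc a s, HasDerivAt (fun t => -8 * c1 * (E1v μ t / γ ^ 2)
        + 12 * c1 * (E2v γ μ t / γ ^ 2) + 4 / 3 * c1 * omv μ t)
        (-8 * c1 * (-(1 / 4) * E1v μ t / γ ^ 2) + 12 * c1 * (1 / 4 * E2v γ μ t / γ ^ 2)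
          + 4 / 3 * c1 * (3 / 4 * omv μ t)) t := fun t ht =>
      ((((hasDerivAt_E1v μ t).div_const _).const_mul _).add
        (((hasDerivAt_E2v γ μ t).div_const _).const_mul _)).add
        ((hasDerivAt_omv μ t).const_mul _)
    have h1 := abs_sub_le_of_abs_deriv_le hs.1 (fun t ht => D.dZ t (hsub s hs t ht)) hG
      (fun t ht => by
        have ht' := hsub s hs t ht
        have h1 := (PB t ht').2.2.2.1
        have h2 := (PB t ht').2.2.2.2.1
        have h3 := abs_add_le (2 * (Q t - q t)) (Fq t)
        rw [abs_mul, abs_two] at h3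
        have h4 : exp t * Psi γ μ t ≤ omv μ t + E2v γ μ t / γ ^ 2 := by
          have := mul_le_mul_of_nonneg_right (hexp1 t ht') (hE2γ0 t).le
          unfold Psi; rw [mul_add, exp_mul_E1v]; linarith
        have h5 := mul_le_mul_of_nonneg_left h4 (by linarith : 0 ≤ c1)
        have h6 : -8 * c1 * (-(1 / 4) * E1v μ t / γ ^ 2) + 12 * c1 * (1 / 4 * E2v γ μ t / γ ^ 2)
          + 4 / 3 * c1 * (3 / 4 * omv μ t) = 2 * (c1 * ((E1v μ t + E2v γ μ t) / γ ^ 2))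
            + c1 * (omv μ t + E2v γ μ t / γ ^ 2) := by ring
        rw [h6]; linarith)
    have h2 := abs_add_le (Z s - Z a) (Z a - κ / γ ^ 2)
    rw [show Z s - Z a + (Z a - κ / γ ^ 2) = Z s - κ / γ ^ 2 by ring] at h2
    have h3 : E1v μ a / γ ^ 2 ≤ e := div_le_div_of_nonneg_right hE1a (by positivity)
    have h4 : 0 < E1v μ s / γ ^ 2 := by have := hE10 s; positivity
    have h5 := hE2γ0 a
    have h6 := hω0 a
    have h7 := mul_le_mul_of_nonneg_left h3 (by linarith : 0 ≤ c1)
    have h8 : 0 ≤ c1 * (E1v μ s / γ ^ 2) := by positivity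
    have h9 : 0 ≤ c1 * (E2v γ μ a / γ ^ 2) := by positivity
    have h10 : 0 ≤ c1 * omv μ a := by positivity
    linarith
  set B : ℝ := 2 * δ₁ * (1 / γ ^ 2) + (1 + 8 * c1) * e + h / |a| with hB
  have hB0 : 0 ≤ B := by positivity
  have hP : ∀ s ∈ Icc a b, |p s - (2 + κ / (2 * γ ^ 2))|
      ≤ (2 * E s - 2 * err s + 2 * c1 * Psi γ μ s)
      + c1 * Psi γ μ s + B + 48 * c1 * (1 / 4 * E2v γ μ s / γ ^ 2)
      + 16 / 9 * c1 * (3 / 4 * omv μ s) := fun s hs => by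
    have h1 := hN'E s hs
    have h2 := (PB s hs).2.1
    have h3 := hZ s hs
    have h4 := D.poh s hs
    have h5 := hp s hs
    have hE := D.E0 s hs
    have hk : 0 ≤ κ / γ ^ 2 := by positivity
    have hk4 : κ / γ ^ 2 ≤ 4 * (1 / γ ^ 2) := by
      rw [div_eq_mul_one_div]; exact mul_le_mul_of_nonneg_right hκ4 hig.le
    have hp1 : 1 ≤ p s := by linarith [neg_abs_le (p s - 2)]
    generalize c1 * Psi γ μ s = ψ at *
    obtain ⟨z, hz⟩ : ∃ z, z = |Z s - κ / γ ^ 2| := ⟨_, rfl⟩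
    have hz0 : 0 ≤ z := hz ▸ abs_nonneg _
    have hZabs : |Z s| ≤ κ / γ ^ 2 + z := by
      have := abs_add_le (Z s - κ / γ ^ 2) (κ / γ ^ 2)
      rw [sub_add_cancel, abs_of_nonneg hk] at this
      linarith
    have hd : |p s - 2| ≤ κ / γ ^ 2 + z + ψ + E s := by
      have e1 : |p s * (p s - 2)| ≤ κ / γ ^ 2 + z + ψ + E s := by
        rw [show p s * (p s - 2) = (p s ^ 2 + Q s - 2 * p s - Z s) - Q s + Z s by ring]
        have := abs_add_le (p s ^ 2 + Q s - 2 * p s - Z s - Q s) (Z s)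
        have := abs_sub (p s ^ 2 + Q s - 2 * p s - Z s) (Q s)
        linarith
      rw [abs_mul, abs_of_nonneg (by linarith : 0 ≤ p s)] at e1
      have := mul_le_mul_of_nonneg_right hp1 (abs_nonneg (p s - 2))
      linarith
    have hd2 : (p s - 2) ^ 2 ≤ δ₁ * (4 * (1 / γ ^ 2)) + z + ψ + E s := by
      have e0 : 0 ≤ z + ψ + E s := by linarith [(abs_nonneg (Q s)).trans h2]
      have e1 : (p s - 2) ^ 2 ≤ δ₁ * (κ / γ ^ 2 + z + ψ + E s) := by
        rw [← sq_abs, sq]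
        exact mul_le_mul h5 hd (abs_nonneg _) hδ0
      have e2 := mul_le_mul_of_nonneg_left hk4 hδ0
      have e3 := mul_le_mul_of_nonneg_right (by linarith : δ₁ ≤ 1) e0
      linarith
    have hk2 : κ / (2 * γ ^ 2) = κ / γ ^ 2 / 2 := by rw [div_div, mul_comm]
    have hmain : |p s - (2 + κ / (2 * γ ^ 2))| ≤ E s + ψ + z + 2 * δ₁ * (1 / γ ^ 2) := by
      rw [hk2]
      have i1 := abs_le.1 h4
      have i2 := abs_le.1 h2
      have i3 := abs_le.1 (hz ▸ le_refl z : |Z s - κ / γ ^ 2| ≤ z)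
      have i4 := sq_nonneg (p s - 2)
      have i5 : (p s - 2) ^ 2 = p s ^ 2 - 4 * p s + 4 := by ring
      rw [abs_le]
      constructor <;> linarith
    rw [← hz] at h3
    have e7 : 48 * c1 * (1 / 4 * E2v γ μ s / γ ^ 2) = 12 * c1 * (E2v γ μ s / γ ^ 2) := by ring
    rw [hB, e7]
    linarith
  intro s hs
  refine ⟨(hp s hs).trans hδC, ?_⟩
  have hG : ∀ t ∈ Icc a s, HasDerivAt (fun t => N t + c1 * Theta γ μ t + B * t
      + 48 * c1 * (E2v γ μ t / γ ^ 2) + 16 / 9 * c1 * omv μ t)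
      ((2 * E t - 2 * err t + 2 * c1 * Psi γ μ t)
      + c1 * Psi γ μ t + B + 48 * c1 * (1 / 4 * E2v γ μ t / γ ^ 2)
      + 16 / 9 * c1 * (3 / 4 * omv μ t)) t := fun t ht => by
    have := (((((hN' t (hsub s hs t ht)).add ((hasDerivAt_Theta γ μ t).const_mul c1)).add
      ((hasDerivAt_id t).const_mul B)).add
      (((hasDerivAt_E2v γ μ t).div_const (γ ^ 2)).const_mul (48 * c1))).add
      ((hasDerivAt_omv μ t).const_mul (16 / 9 * c1)))
    refine this.congr_deriv ?_
    ring
  have hfin := abs_sub_le_of_abs_deriv_le (F := fun t => φ t - (2 + κ / (2 * γ ^ 2)) * t)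
    (F' := fun t => p t - (2 + κ / (2 * γ ^ 2))) hs.1
    (fun t ht => ((D.dphi t (hsub s hs t ht)).sub
      ((hasDerivAt_id t).const_mul (2 + κ / (2 * γ ^ 2)))).congr_deriv (by ring)) hG
    (fun t ht => hP t (hsub s hs t ht))
  rw [show φ s - (2 + κ / (2 * γ ^ 2)) * s - (φ a - (2 + κ / (2 * γ ^ 2)) * a)
    = φ s - φ a - (2 + κ / (2 * γ ^ 2)) * (s - a) by ring] at hfin
  refine hfin.trans ?_
  have hsa : 0 ≤ s - a := by linarith [hs.1]
  have i1 := hNinc s hs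
  have i2 := mul_le_mul_of_nonneg_left (hΘ s hs) (by linarith : 0 ≤ c1)
  have i3 : h / |a| * (s - a) ≤ h := by
    rw [div_mul_eq_mul_div, div_le_iff₀ (abs_pos.2 ha.ne), abs_of_neg ha]
    exact mul_le_mul_of_nonneg_left (by linarith [hs.2]) hh
  have i4 : (s - a) * (1 / γ ^ 2) ≤ (1 + L) / 2 := by
    have j1 : s - a ≤ (γ ^ 2 + L) / 2 := by
      have := hζ s hs
      have : sg μ s - sg μ a = 2 * (s - a) := by unfold sg; ring
      linarith
    rw [mul_one_div, div_le_iff₀ (by positivity)]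
    have := mul_le_mul_of_nonneg_left hγ2 hL0
    linarith
  have i5 : (2 * δ₁ * (1 / γ ^ 2) + (1 + 8 * c1) * e) * (s - a) ≤
      (2 * (1 + 4 * c1 * (1 + c2)) + (1 + 8 * c1)) * (1 + L) / 2 * h := by
    have : (2 * δ₁ * (1 / γ ^ 2) + (1 + 8 * c1) * e) * (s - a)
        = (2 * (1 + 4 * c1 * (1 + c2)) + (1 + 8 * c1)) * h * ((s - a) * (1 / γ ^ 2)) := by
      rw [he, hδ₁]; ring
    rw [this]
    have := mul_le_mul_of_nonneg_left i4
      (by positivity : 0 ≤ (2 * (1 + 4 * c1 * (1 + c2)) + (1 + 8 * c1)) * h)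
    linarith
  have i6 := mul_le_mul_of_nonneg_left (hE2γ s hs) (by linarith : 0 ≤ c1)
  have i7 : c1 * omv μ s ≤ c1 * h := by
    refine mul_le_mul_of_nonneg_left (le_trans ?_ hωh) (by linarith)
    unfold omv; apply exp_le_exp.2; linarith [hs.2]
  have i8 : 0 ≤ c1 * omv μ a := by have := hω0 a; positivity
  have i9 : 0 ≤ c1 * (E2v γ μ a / γ ^ 2) := by have := hE2γ0 a; positivity
  have i10 : B * s - B * a = (2 * δ₁ * (1 / γ ^ 2) + (1 + 8 * c1) * e) * (s - a)
    + h / |a| * (s - a) := by rw [hB]; ring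
  linarith

theorem Dyn.lower (D : Dyn γ μ a b A A₂ K φ p q Q Qh Fq Z E nn err)
    (S : DynStart γ μ a A A₂ K h κ (φ a) (p a) (Z a) (nn a)) (hb : b ≤ 0) :
    ∀ s ∈ Icc a b, sg μ s - K1c A₂ < φ s := by
  have hc1 := S.c1_pos
  have hc2 := S.c2_pos
  have hA₂ := S.hA₂
  have hh := S.h0
  have hK1 : K1c A₂ = A₂ + 4 := rfl
  have hA := S.hA
  have hl4 : log 4 < 1.4 := by
    rw [show (4 : ℝ) = 2 ^ 2 by norm_num, Real.log_pow]
    have := Real.log_two_lt_d9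
    push_cast; linarith
  have hC : 1 ≤ C3c A A₂ K := by
    have : 0 ≤ K1c A₂ := by linarith
    have := S.hK
    unfold C3c
    have : 0 ≤ (2 * (1 + 4 * c1c A A₂ K * (1 + c2c A₂ K)) + (1 + 8 * c1c A A₂ K))
      * (1 + (K + K1c A₂)) / 2 := by positivity
    have : 0 ≤ 8 * c1c A A₂ K * (1 + c2c A₂ K) := by positivity
    have : 0 ≤ 4 * c1c A A₂ K * (1 + c2c A₂ K) := by positivity
    have : 0 ≤ 48 * c1c A A₂ K * c2c A₂ K := by positivity
    linarith
  have hh1 : h ≤ 1 := by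
    have := mul_le_mul_of_nonneg_right hC hh
    linarith [S.hC]
  have hφa := abs_le.1 S.hφ
  have key : ∀ t ∈ Icc a b, 0 < φ t - (sg μ t - K1c A₂) := by
    refine pos_of_bootstrap (fun t ht => ?_) (by linarith) (fun c hc hcpos => ?_)
    · exact (((D.dphi t ht).sub ((hasDerivAt_sg μ t).sub_const _)).continuousAt).continuousWithinAt
    · have h1 := ((D.mono hc.2).step S hc.1 (hc.2.trans hb) (fun s hs => by
        linarith [hcpos s hs]) c ⟨hc.1, le_rfl⟩).2
      rw [sub_self, zero_div, exp_zero, mul_one] at h1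
      have h2 := (abs_le.1 h1).1
      have h3 : 0 ≤ κ / (2 * γ ^ 2) * (c - a) :=
        mul_nonneg (div_nonneg S.κ0 (by positivity)) (by linarith [hc.1])
      have h4 : sg μ c - sg μ a = 2 * (c - a) := by unfold sg; ring
      linarith [S.hC]
  intro s hs
  linarith [key s hs]

/-- Main conclusion of the dynamical argument. -/
theorem Dyn.main (D : Dyn γ μ a b A A₂ K φ p q Q Qh Fq Z E nn err)
    (S : DynStart γ μ a A A₂ K h κ (φ a) (p a) (Z a) (nn a)) (hab : a ≤ b) (hb : b ≤ 0) :
    ∀ s ∈ Icc a b, sg μ s - K1c A₂ ≤ φ s ∧ 0 ≤ φ s ∧ |p s - 2| ≤ C3c A A₂ K * h ∧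
      |φ s - φ a - (2 + κ / (2 * γ ^ 2)) * (s - a)| ≤ C3c A A₂ K * h + A₂ * exp ((s - b) / A) := by
  intro s hs
  have h1 := D.lower S hb
  have h2 := D.step S hab hb (fun s hs => (h1 s hs).le) s hs
  exact ⟨(h1 s hs).le, by linarith [h1 s hs, sg_mono (μ := μ) hs.1, S.sg_ge], h2.1, h2.2⟩

/-- exponential comparison constant -/
def Cec (D K : ℝ) : ℝ := exp (2 * D * (1 + K) + D ^ 2)

section pointwise
variable {γ D K y u : ℝ}

theorem sq_le_of_close (hγ : 1 ≤ γ) (hD : 0 ≤ D) (hy : |y| ≤ (1 + K) * γ)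
    (h : |u - y| ≤ D / γ) : u ^ 2 ≤ y ^ 2 + (2 * D * (1 + K) + D ^ 2) := by
  have hγ0 : 0 < γ := by linarith
  have h1 : |y| * |u - y| ≤ (1 + K) * γ * (D / γ) :=
    mul_le_mul hy h (abs_nonneg _) ((abs_nonneg _).trans hy)
  have h2 : (1 + K) * γ * (D / γ) = (1 + K) * D := by field_simp
  have h3 : |u - y| ≤ D := h.trans (div_le_self hD hγ)
  have h4 : |u - y| ^ 2 ≤ D ^ 2 := pow_le_pow_left₀ (abs_nonneg _) h3 2
  rw [sq_abs] at h4
  have h5 := le_abs_self (y * (u - y))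
  rw [abs_mul] at h5
  have h6 : u ^ 2 = y ^ 2 + 2 * (y * (u - y)) + (u - y) ^ 2 := by ring
  linarith

theorem exp_sq_le_of_close (hγ : 1 ≤ γ) (hD : 0 ≤ D) (hy : |y| ≤ (1 + K) * γ)
    (h : |u - y| ≤ D / γ) : exp (u ^ 2) ≤ Cec D K * exp (y ^ 2) := by
  unfold Cec
  rw [← exp_add]
  apply exp_le_exp.2
  linarith [sq_le_of_close hγ hD hy h]

theorem one_le_Cec (hD : 0 ≤ D) (hK : 0 ≤ K) : 1 ≤ Cec D K := Real.one_le_exp (by positivity)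

theorem abs_le_of_close (hγ : 1 ≤ γ) (hD : 0 ≤ D) (h : |u - y| ≤ D / γ) :
    |u| ≤ (1 + D) * (|y| + 1 / γ) := by
  have h1 := abs_add_le (u - y) y
  rw [sub_add_cancel] at h1
  have h2 : 0 ≤ D * |y| := by positivity
  have h3 : 0 < 1 / γ := by positivity
  rw [div_eq_mul_one_div] at h
  linarith

theorem exp_sub_one_le_of_close (hγ : 1 ≤ γ) (hD : 0 ≤ D) (hy : |y| ≤ (1 + K) * γ)
    (h : |u - y| ≤ D / γ) :
    |exp (u ^ 2) - 1| ≤ (2 + 2 * D ^ 2) * Cec D K * exp (y ^ 2) * min 1 (y ^ 2 + 1 / γ ^ 2) := by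
  have hγ0 : 0 < γ := by linarith
  have h1 := exp_sq_le_of_close hγ hD hy h
  have h0 : 0 ≤ exp (u ^ 2) - 1 := by linarith [Real.add_one_le_exp (u ^ 2), sq_nonneg u]
  rw [abs_of_nonneg h0]
  have h2 : exp (u ^ 2) - 1 ≤ u ^ 2 * exp (u ^ 2) := by
    have e1 := Real.add_one_le_exp (-u ^ 2)
    have e2 := mul_le_mul_of_nonneg_right e1 (exp_pos (u ^ 2)).le
    rw [← exp_add] at e2
    simp only [neg_add_cancel, exp_zero] at e2
    linarith
  have h3 : u ^ 2 ≤ (2 + 2 * D ^ 2) * (y ^ 2 + 1 / γ ^ 2) := by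
    have e1 : (u - y) ^ 2 ≤ D ^ 2 * (1 / γ ^ 2) := by
      have := pow_le_pow_left₀ (abs_nonneg _) h 2
      rw [sq_abs, div_pow] at this
      rw [mul_one_div]; exact this
    have e2 : u ^ 2 ≤ 2 * y ^ 2 + 2 * (u - y) ^ 2 := by
      have := sq_nonneg (u - y - y)
      linarith [show (u - y - y) ^ 2 = 2 * y ^ 2 + 2 * (u - y) ^ 2 - u ^ 2 by ring]
    have e3 : 0 ≤ D ^ 2 * y ^ 2 := by positivity
    have e4 : 0 < 1 / γ ^ 2 := by positivity
    linarith
  have hE : 0 < Cec D K * exp (y ^ 2) := mul_pos (exp_pos _) (exp_pos _)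
  have e5 : 0 ≤ D ^ 2 * (Cec D K * exp (y ^ 2)) := by positivity
  rcases le_total 1 (y ^ 2 + 1 / γ ^ 2) with hm | hm
  · rw [min_eq_left hm]
    linarith
  · rw [min_eq_right hm]
    have := mul_le_mul h3 h1 (exp_pos _).le (by positivity)
    linarith

theorem mul_exp_sub_le_of_close (hγ : 1 ≤ γ) (hD : 0 ≤ D) (hy : |y| ≤ (1 + K) * γ)
    (h : |u - y| ≤ D / γ) :
    |u * exp (u ^ 2) - y * exp (y ^ 2)|
      ≤ (4 + 4 * D ^ 2) * Cec D K * ((1 + y ^ 2) * exp (y ^ 2)) * |u - y| := by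
  have hγ0 : 0 < γ := by linarith
  have hd : ∀ x ∈ uIcc y u, HasDerivWithinAt (fun x => x * exp (x ^ 2))
      ((1 + 2 * x ^ 2) * exp (x ^ 2)) (uIcc y u) x := fun x _ => by
    refine (((hasDerivAt_id x).mul ((hasDerivAt_pow 2 x).exp)).congr_deriv ?_).hasDerivWithinAt
    simp; ring
  have hb : ∀ x ∈ uIcc y u, ‖(1 + 2 * x ^ 2) * exp (x ^ 2)‖ ≤
      (4 + 4 * D ^ 2) * Cec D K * ((1 + y ^ 2) * exp (y ^ 2)) := fun x hx => by
    have hx1 : |x - y| ≤ |u - y| := abs_sub_left_of_mem_uIcc hx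
    have hx2 := hx1.trans h
    have h1 := exp_sq_le_of_close hγ hD hy hx2
    have e1 : (x - y) ^ 2 ≤ D ^ 2 := by
      rw [← sq_abs]
      exact pow_le_pow_left₀ (abs_nonneg _) (hx2.trans (div_le_self hD hγ)) 2
    have e2 : x ^ 2 ≤ 2 * y ^ 2 + 2 * (x - y) ^ 2 := by
      have := sq_nonneg (x - y - y)
      linarith [show (x - y - y) ^ 2 = 2 * y ^ 2 + 2 * (x - y) ^ 2 - x ^ 2 by ring]
    have e3 : 1 + 2 * x ^ 2 ≤ (4 + 4 * D ^ 2) * (1 + y ^ 2) := by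
      have : 0 ≤ D ^ 2 * y ^ 2 := by positivity
      linarith
    rw [Real.norm_of_nonneg (by positivity)]
    have := mul_le_mul e3 h1 (exp_pos _).le (by positivity)
    linarith
  have := (convex_uIcc y u).norm_image_sub_le_of_norm_hasDerivWithin_le hd hb left_mem_uIcc
    right_mem_uIcc
  simpa [Real.norm_eq_abs] using this

end pointwise

/-- Quantitative hypotheses on a cylindrical solution at height `s`. -/
structure CylBd {b lam : ℝ} (C : Cyl b lam) (γ μ f0 C₀ Cf D K s : ℝ) : Prop where
  hs : s < b
  hs0 : s ≤ 0
  hγ : 1 ≤ γ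
  hμ : 0 < μ
  hC₀ : 0 < C₀
  hCf : 0 ≤ Cf
  hD : 0 ≤ D
  hK : 0 ≤ K
  hf0 : C₀⁻¹ ≤ f0
  hf0' : f0 ≤ C₀
  hnorm : μ ^ 2 * (lam * f0 * γ ^ 2 * exp (γ ^ 2)) = 1
  hu : ∀ θ, |C.u s θ - C.y s| ≤ D / γ
  hus : ∀ θ, |C.us s θ - cavg (C.us s)| ≤ D / γ
  hf : ∀ θ, |C.f s θ - f0| ≤ Cf * exp s
  hfs : ∀ θ, |C.fs s θ| ≤ Cf * exp s
  hφ : C.phi γ s ≤ γ ^ 2 + K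

/-- constant produced by `Cyl.dyn` -/
def Ac (C₀ Cf D K : ℝ) : ℝ :=
  2 * (2 * π) ^ 2 * ((1 + C₀) * (1 + C₀ + Cf) * (4 + 4 * D ^ 2) * (1 + D) * Cec D K)

theorem Ac_ge {C₀ Cf D K : ℝ} (h1 : 0 ≤ C₀) (h2 : 0 ≤ Cf) (h3 : 0 ≤ D)
    {a1 a2 a3 a4 a5 a6 : ℝ} (b01 : 0 ≤ a1) (b02 : 0 ≤ a2) (b03 : 0 ≤ a3) (b04 : 0 ≤ a4)
    (b05 : 0 ≤ a5)
    (b6 : a6 ≤ 2 * (2 * π) ^ 2) (b1 : a1 ≤ 1 + C₀) (b2 : a2 ≤ 1 + C₀ + Cf)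
    (b3 : a3 ≤ 4 + 4 * D ^ 2) (b4 : a4 ≤ 1 + D) (b5 : a5 ≤ Cec D K) :
    a6 * (a1 * a2 * a3 * a4 * a5) ≤ Ac C₀ Cf D K := by
  unfold Ac
  gcongr

theorem one_le_two_pi_sq : 1 ≤ 2 * (2 * π) ^ 2 := by
  have := Real.pi_gt_three
  nlinarith

theorem one_le_Ac {C₀ Cf D K : ℝ} (h1 : 0 ≤ C₀) (h2 : 0 ≤ Cf) (h3 : 0 ≤ D) (h4 : 0 ≤ K) :
    2 * (2 * π) ^ 2 ≤ Ac C₀ Cf D K := by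
  have := Ac_ge h1 h2 h3 (a1 := 1) (a2 := 1) (a3 := 1) (a4 := 1) (a5 := 1)
    (a6 := 2 * (2 * π) ^ 2) (by norm_num) (by norm_num) (by norm_num) (by norm_num)
    (by norm_num) le_rfl (by linarith) (by linarith) (by nlinarith) (by linarith) (one_le_Cec h3 h4)
  linarith

namespace CylBd
variable {b lam : ℝ} {C : Cyl b lam} {γ μ f0 C₀ Cf D K s : ℝ}

theorem f0_pos (H : CylBd C γ μ f0 C₀ Cf D K s) : 0 < f0 :=
  (inv_pos.2 H.hC₀).trans_le H.hf0

theorem weight (H : CylBd C γ μ f0 C₀ Cf D K s) :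
    γ ^ 2 * lam * exp (2 * s) = exp (sg μ s - γ ^ 2) * (1 / f0) := by
  have h1 := H.f0_pos
  have h2 : exp (sg μ s - γ ^ 2) = exp (2 * s) / (μ ^ 2 * exp (γ ^ 2)) := by
    have : μ ^ 2 = exp (2 * log μ) := by
      rw [two_mul, exp_add, exp_log H.hμ, sq]
    rw [this, ← exp_add, ← exp_sub]
    congr 1; unfold sg; ring
  have h3 := H.hnorm
  have hμ := H.hμ
  rw [h2]
  field_simp
  linear_combination h3

theorem inv_f0 (H : CylBd C γ μ f0 C₀ Cf D K s) : 1 / f0 ≤ C₀ := by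
  rw [one_div]
  exact inv_le_of_inv_le₀ H.hC₀ H.hf0

theorem abs_f (H : CylBd C γ μ f0 C₀ Cf D K s) (θ : ℝ) : |C.f s θ| ≤ 1 + C₀ + Cf := by
  have h1 := abs_add_le (C.f s θ - f0) f0
  rw [sub_add_cancel, abs_of_pos H.f0_pos] at h1
  have h2 : Cf * exp s ≤ Cf := by
    have := mul_le_mul_of_nonneg_left (exp_le_one_iff.2 H.hs0) H.hCf
    linarith
  linarith [H.hf θ, H.hf0']

theorem y_eq (H : CylBd C γ μ f0 C₀ Cf D K s) : C.y s = yv γ (C.phi γ s) := by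
  have : γ ≠ 0 := by linarith [H.hγ]
  unfold yv Cyl.phi
  field_simp
  ring

theorem abs_y (H : CylBd C γ μ f0 C₀ Cf D K s) (h0 : 0 ≤ C.phi γ s) :
    |C.y s| ≤ (1 + K) * γ := by
  have hγ := H.hγ
  have hφ := H.hφ
  have hK := H.hK
  have h1 : γ * C.y s = γ ^ 2 - C.phi γ s := by unfold Cyl.phi; ring
  have h2 : |γ * C.y s| ≤ γ ^ 2 + K := by
    rw [h1, abs_le]; constructor <;> nlinarith
  rw [abs_mul, abs_of_pos (by linarith : 0 < γ)] at h2
  have h3 : K ≤ K * γ ^ 2 := le_mul_of_one_le_right hK (one_le_pow₀ hγ)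
  have h4 : γ * |C.y s| ≤ γ * ((1 + K) * γ) := by
    linarith [show γ * ((1 + K) * γ) = γ ^ 2 + K * γ ^ 2 by ring]
  exact le_of_mul_le_mul_left h4 (by linarith)

/-- abbreviation-free form of the weight `Wv` -/
theorem W_eq (H : CylBd C γ μ f0 C₀ Cf D K s) :
    Wv γ μ s (C.phi γ s) = exp (sg μ s - γ ^ 2) * exp (C.y s ^ 2) := by
  rw [Wv, ← H.y_eq, exp_add]

theorem bound_q (H : CylBd C γ μ f0 C₀ Cf D K s) (h0 : 0 ≤ C.phi γ s) :
    |C.q γ s| ≤ Ac C₀ Cf D K *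
      (Wv γ μ s (C.phi γ s) * (|yv γ (C.phi γ s)| / γ + 1 / γ ^ 2)) := by
  have hγ0 : 0 < γ := by linarith [H.hγ]
  have hf0 := H.f0_pos
  have h1 : |cavg (C.g s)| ≤ (1 + C₀ + Cf) * ((1 + D) * (|C.y s| + 1 / γ)) *
      (Cec D K * exp (C.y s ^ 2)) := by
    refine abs_cavg_le fun θ => ?_
    unfold Cyl.g
    rw [abs_mul, abs_mul, abs_of_pos (exp_pos _)]
    have := H.hC₀
    have := H.hCf
    exact mul_le_mul (mul_le_mul (H.abs_f θ) (abs_le_of_close H.hγ H.hD (H.hu θ)) (abs_nonneg _)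
      (by positivity)) (exp_sq_le_of_close H.hγ H.hD (H.abs_y h0) (H.hu θ)) (exp_pos _).le
      (by have := H.hD; positivity)
  have h2 : C.q γ s = exp (sg μ s - γ ^ 2) * (1 / f0) * (1 / γ) * cavg (C.g s) := by
    rw [← H.weight, Cyl.q]; field_simp
  have h3 : 0 ≤ exp (sg μ s - γ ^ 2) * (1 / f0) * (1 / γ) := by positivity
  rw [h2, abs_mul, abs_of_nonneg h3, H.W_eq, ← H.y_eq]
  refine (mul_le_mul_of_nonneg_left h1 h3).trans ?_
  have h4 := Ac_ge H.hC₀.le H.hCf H.hD (a1 := 1 / f0) (a2 := 1 + C₀ + Cf) (a3 := 1)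
    (a4 := 1 + D) (a5 := Cec D K) (a6 := 1) (by positivity)
    (by linarith [H.hC₀, H.hCf]) zero_le_one (by linarith [H.hD]) (exp_pos _).le one_le_two_pi_sq
    (by linarith [H.inv_f0]) le_rfl (by nlinarith) le_rfl le_rfl
  have h5 : 0 ≤ exp (sg μ s - γ ^ 2) * exp (C.y s ^ 2) * (|C.y s| / γ + 1 / γ ^ 2) := by positivity
  refine (mul_le_mul_of_nonneg_right h4 h5).trans' (le_of_eq ?_)
  field_simp

/-- common bound for the potential terms -/
theorem bound_pot (H : CylBd C γ μ f0 C₀ Cf D K s) (h0 : 0 ≤ C.phi γ s) {w : ℝ → ℝ} {B : ℝ}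
    (hB : 0 ≤ B) (hw : ∀ θ, |w θ| ≤ B) :
    |γ ^ 2 * lam * exp (2 * s) * cavg (fun θ => w θ * (exp (C.u s θ ^ 2) - 1))|
      ≤ (1 / f0) * B * (2 + 2 * D ^ 2) * Cec D K *
        (Wv γ μ s (C.phi γ s) * mv γ (C.phi γ s)) := by
  have hf0 := H.f0_pos
  have h1 : |cavg (fun θ => w θ * (exp (C.u s θ ^ 2) - 1))| ≤
      B * ((2 + 2 * D ^ 2) * Cec D K * exp (C.y s ^ 2) * mv γ (C.phi γ s)) := by
    refine abs_cavg_le fun θ => ?_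
    rw [abs_mul, mv, ← H.y_eq]
    exact mul_le_mul (hw θ) (exp_sub_one_le_of_close H.hγ H.hD (H.abs_y h0) (H.hu θ))
      (abs_nonneg _) hB
  have h3 : 0 ≤ exp (sg μ s - γ ^ 2) * (1 / f0) := by positivity
  rw [H.weight, abs_mul, abs_of_nonneg h3, H.W_eq]
  refine (mul_le_mul_of_nonneg_left h1 h3).trans (le_of_eq ?_)
  ring

theorem Wm_nonneg : 0 ≤ Wv γ μ s (C.phi γ s) * mv γ (C.phi γ s) :=
  mul_nonneg (exp_pos _).le (le_min zero_le_one (by positivity))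

theorem bound_Q (H : CylBd C γ μ f0 C₀ Cf D K s) (h0 : 0 ≤ C.phi γ s) :
    |C.Q γ s| ≤ Ac C₀ Cf D K * (Wv γ μ s (C.phi γ s) * mv γ (C.phi γ s)) := by
  have hf0 := H.f0_pos
  have hF : 0 ≤ 1 + C₀ + Cf := by linarith [H.hC₀, H.hCf]
  refine (H.bound_pot h0 hF H.abs_f).trans
    (mul_le_mul_of_nonneg_right ?_ Wm_nonneg)
  have h4 := Ac_ge H.hC₀.le H.hCf H.hD (a1 := 1 / f0) (a2 := 1 + C₀ + Cf)
    (a3 := 2 + 2 * D ^ 2)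
    (a4 := 1) (a5 := Cec D K) (a6 := 1) (by positivity)
    hF (by positivity) zero_le_one (exp_pos _).le one_le_two_pi_sq
    (by linarith [H.inv_f0]) le_rfl (by nlinarith) (by linarith [H.hD]) le_rfl
  linarith

theorem bound_Qhat (H : CylBd C γ μ f0 C₀ Cf D K s) (h0 : 0 ≤ C.phi γ s) :
    |C.Qhat γ s| ≤ Ac C₀ Cf D K * (Wv γ μ s (C.phi γ s) * mv γ (C.phi γ s)) := by
  have hf0 := H.f0_pos
  have h1 := H.bound_pot h0 (w := fun _ => 1) zero_le_one (by simp)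
  simp only [one_mul] at h1
  refine h1.trans (mul_le_mul_of_nonneg_right ?_ Wm_nonneg)
  have h4 := Ac_ge H.hC₀.le H.hCf H.hD (a1 := 1 / f0) (a2 := 1)
    (a3 := 2 + 2 * D ^ 2)
    (a4 := 1) (a5 := Cec D K) (a6 := 1) (by positivity)
    zero_le_one (by positivity) zero_le_one (exp_pos _).le one_le_two_pi_sq
    (by linarith [H.inv_f0]) (by linarith [H.hC₀, H.hCf]) (by nlinarith) (by linarith [H.hD]) le_rfl
  linarith

theorem bound_Fq (H : CylBd C γ μ f0 C₀ Cf D K s) (h0 : 0 ≤ C.phi γ s) :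
    |C.Fq γ s| ≤ Ac C₀ Cf D K * exp s * (Wv γ μ s (C.phi γ s) * mv γ (C.phi γ s)) := by
  have hf0 := H.f0_pos
  refine (H.bound_pot h0 (by have := H.hCf; positivity) H.hfs).trans
    (mul_le_mul_of_nonneg_right ?_ Wm_nonneg)
  have h4 := Ac_ge H.hC₀.le H.hCf H.hD (a1 := 1 / f0) (a2 := Cf)
    (a3 := 2 + 2 * D ^ 2)
    (a4 := 1) (a5 := Cec D K) (a6 := 1) (by positivity)
    H.hCf (by positivity) zero_le_one (exp_pos _).le one_le_two_pi_sq
    (by linarith [H.inv_f0]) (by linarith [H.hC₀, H.hCf]) (by nlinarith) (by linarith [H.hD]) le_rfl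
  have := mul_le_mul_of_nonneg_right h4 (exp_pos s).le
  linarith

theorem bound_Qq (H : CylBd C γ μ f0 C₀ Cf D K s) (h0 : 0 ≤ C.phi γ s) :
    |C.Q γ s - C.q γ s| ≤ Ac C₀ Cf D K * ((|C.phi γ s| + 1) / γ ^ 2 * Wv γ μ s (C.phi γ s) *
      mv γ (C.phi γ s) + exp (sg μ s - γ ^ 2) * (|yv γ (C.phi γ s)| / γ + 1 / γ ^ 2)) := by
  have hγ0 : 0 < γ := by linarith [H.hγ]
  have hf0 := H.f0_pos
  have hD := H.hD
  have hF : 0 ≤ 1 + C₀ + Cf := by linarith [H.hC₀, H.hCf]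
  have cu := continuous_slice C.cu H.hs
  have cf := continuous_slice C.cf H.hs
  have h1 : C.Q γ s - C.q γ s = exp (sg μ s - γ ^ 2) * (1 / f0) * (1 / γ) *
      cavg (fun θ => C.f s θ * ((γ - C.u s θ) * (exp (C.u s θ ^ 2) - 1) - C.u s θ)) := by
    have e1 : (fun θ => C.f s θ * ((γ - C.u s θ) * (exp (C.u s θ ^ 2) - 1) - C.u s θ))
        = fun θ => γ * (C.f s θ * (exp (C.u s θ ^ 2) - 1)) - C.g s θ := by
      ext θ; unfold Cyl.g; ring
    have cg := C.cg' H.hs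
    rw [e1, cavg_sub (by fun_prop) cg, cavg_const_mul, ← H.weight, Cyl.Q, Cyl.q]
    field_simp
  obtain ⟨X, hX⟩ : ∃ X, X = exp (C.y s ^ 2) * mv γ (C.phi γ s) := ⟨_, rfl⟩
  have hX0 : 0 ≤ X := hX ▸ mul_nonneg (exp_pos _).le (le_min zero_le_one (by positivity))
  have hCe : 1 ≤ Cec D K := one_le_Cec hD H.hK
  have h2 : |cavg (fun θ => C.f s θ * ((γ - C.u s θ) * (exp (C.u s θ ^ 2) - 1) - C.u s θ))|
      ≤ (1 + C₀ + Cf) * ((4 + 4 * D ^ 2) * (1 + D) * Cec D K * ((|C.phi γ s| + 1) / γ * X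
          + (|C.y s| + 1 / γ))) := by
    refine abs_cavg_le fun θ => ?_
    rw [abs_mul]
    refine mul_le_mul (H.abs_f θ) ?_ (abs_nonneg _) hF
    have e1 : |γ - C.u s θ| ≤ (1 + D) * ((|C.phi γ s| + 1) / γ) := by
      have i1 : γ - C.u s θ = C.phi γ s / γ - (C.u s θ - C.y s) := by
        unfold Cyl.phi; field_simp; ring
      have i2 := abs_sub (C.phi γ s / γ) (C.u s θ - C.y s)
      rw [← i1, abs_div, abs_of_pos hγ0] at i2
      have i3 : (1 + D) * ((|C.phi γ s| + 1) / γ) = |C.phi γ s| / γ + D / γ + 1 / γ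
        + D * (|C.phi γ s| / γ) := by ring
      have : 0 ≤ 1 / γ := by positivity
      have : 0 ≤ D * (|C.phi γ s| / γ) := by positivity
      linarith [H.hu θ]
    have e2 := exp_sub_one_le_of_close H.hγ H.hD (H.abs_y h0) (H.hu θ)
    have e3 := abs_le_of_close H.hγ H.hD (H.hu θ)
    have e4 := abs_sub ((γ - C.u s θ) * (exp (C.u s θ ^ 2) - 1)) (C.u s θ)
    rw [abs_mul] at e4
    have e5 := mul_le_mul e1 e2 (abs_nonneg _) (by positivity)
    have e6 : (1 + D) * ((|C.phi γ s| + 1) / γ) * ((2 + 2 * D ^ 2) * Cec D K * exp (C.y s ^ 2) *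
        min 1 (C.y s ^ 2 + 1 / γ ^ 2)) = (2 + 2 * D ^ 2) * (1 + D) * Cec D K *
          ((|C.phi γ s| + 1) / γ * X) := by
      rw [hX, mv, ← H.y_eq]; ring
    rw [e6] at e5
    have e7 : (2 + 2 * D ^ 2) * (1 + D) * Cec D K * ((|C.phi γ s| + 1) / γ * X) ≤
        (4 + 4 * D ^ 2) * (1 + D) * Cec D K * ((|C.phi γ s| + 1) / γ * X) := by
      gcongr <;> norm_num
    have e8 : (1 + D) * (|C.y s| + 1 / γ) ≤ (4 + 4 * D ^ 2) * (1 + D) * Cec D K *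
        (|C.y s| + 1 / γ) := by
      refine mul_le_mul_of_nonneg_right ?_ (by positivity)
      have j1 : 1 * (1 + D) * 1 ≤ (4 + 4 * D ^ 2) * (1 + D) * Cec D K := by
        gcongr
        linarith [sq_nonneg D]
      linarith
    linarith
  have h3 : 0 ≤ exp (sg μ s - γ ^ 2) * (1 / f0) * (1 / γ) := by positivity
  rw [h1, abs_mul, abs_of_nonneg h3, H.W_eq, ← H.y_eq]
  refine (mul_le_mul_of_nonneg_left h2 h3).trans ?_
  have h4 := Ac_ge H.hC₀.le H.hCf H.hD (a1 := 1 / f0) (a2 := 1 + C₀ + Cf)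
    (a3 := 4 + 4 * D ^ 2)
    (a4 := 1 + D) (a5 := Cec D K) (a6 := 1) (by positivity)
    hF (by positivity) (by linarith) (exp_pos _).le one_le_two_pi_sq
    (by linarith [H.inv_f0]) le_rfl le_rfl le_rfl le_rfl
  have h5 : 0 ≤ (|C.phi γ s| + 1) / γ ^ 2 * exp (sg μ s - γ ^ 2) * X
      + exp (sg μ s - γ ^ 2) * (|C.y s| / γ + 1 / γ ^ 2) := by positivity
  have h6 := mul_le_mul_of_nonneg_right h4 h5
  have h7 : (|C.phi γ s| + 1) / γ ^ 2 * (exp (sg μ s - γ ^ 2) * exp (C.y s ^ 2)) *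
      mv γ (C.phi γ s) = (|C.phi γ s| + 1) / γ ^ 2 * exp (sg μ s - γ ^ 2) * X := by rw [hX]; ring
  rw [h7]
  refine h6.trans' (le_of_eq ?_)
  field_simp

theorem bound_err (H : CylBd C γ μ f0 C₀ Cf D K s) (h0 : 0 ≤ C.phi γ s) :
    |C.err γ s| ≤ Ac C₀ Cf D K * exp s *
        (Wv γ μ s (C.phi γ s) * (|yv γ (C.phi γ s)| / γ + 1 / γ ^ 2))
      + Ac C₀ Cf D K * (Wv γ μ s (C.phi γ s) * (1 + yv γ (C.phi γ s) ^ 2) / γ ^ 2) * C.En γ s := by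
  have hγ0 : 0 < γ := by linarith [H.hγ]
  have hf0 := H.f0_pos
  have hD := H.hD
  have hCf := H.hCf
  have hC₀ := H.hC₀
  have cu := continuous_slice C.cu H.hs
  have cg := C.cg' H.hs
  rw [H.W_eq, ← H.y_eq]
  obtain ⟨y, hy⟩ : ∃ y, y = C.y s := ⟨_, rfl⟩
  have hCe : 1 ≤ Cec D K := one_le_Cec hD H.hK
  obtain ⟨a, ha⟩ : ∃ a, a = D / γ * (Cf * exp s) * ((1 + D) * (|y| + 1 / γ)) *
      (Cec D K * exp (y ^ 2)) := ⟨_, rfl⟩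
  obtain ⟨c, hc⟩ : ∃ c, c = f0 * ((4 + 4 * D ^ 2) * Cec D K * ((1 + y ^ 2) * exp (y ^ 2))) :=
    ⟨_, rfl⟩
  have hc0 : 0 ≤ c := by rw [hc]; positivity
  have h1 : |cavg (fun θ => C.u s θ * C.g s θ) - C.y s * cavg (C.g s)|
      ≤ a + c * cavg (fun θ => (C.u s θ - C.y s) ^ 2) := by
    have e0 : cavg (fun θ => C.u s θ * C.g s θ) - C.y s * cavg (C.g s)
      = cavg (fun θ => (C.u s θ - C.y s) * (C.g s θ - f0 * (y * exp (y ^ 2)))) :=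
      Cyl.cavg_sub_mul cu cg (f0 * (y * exp (y ^ 2)))
    have e1 : a + c * cavg (fun θ => (C.u s θ - C.y s) ^ 2)
        = cavg (fun θ => a + c * (C.u s θ - C.y s) ^ 2) := by
      rw [cavg_add (by fun_prop) (by fun_prop), cavg_const, cavg_const_mul]
    have hpt : ∀ θ, |(C.u s θ - C.y s) * (C.g s θ - f0 * (y * exp (y ^ 2)))|
        ≤ a + c * (C.u s θ - C.y s) ^ 2 := fun θ => by
      rw [abs_mul]
      have i1 : |C.g s θ - f0 * (y * exp (y ^ 2))| ≤ (Cf * exp s) * ((1 + D) * (|y| + 1 / γ)) *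
          (Cec D K * exp (y ^ 2)) + c * |C.u s θ - C.y s| := by
        have j0 : C.g s θ - f0 * (y * exp (y ^ 2)) = (C.f s θ - f0) * C.u s θ * exp (C.u s θ ^ 2)
            + f0 * (C.u s θ * exp (C.u s θ ^ 2) - y * exp (y ^ 2)) := by unfold Cyl.g; ring
        rw [j0]
        refine (abs_add_le _ _).trans (add_le_add ?_ ?_)
        · rw [abs_mul, abs_mul, abs_of_pos (exp_pos (C.u s θ ^ 2)), hy]
          exact mul_le_mul (mul_le_mul (H.hf θ) (abs_le_of_close H.hγ H.hD (H.hu θ)) (abs_nonneg _)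
            (by positivity)) (exp_sq_le_of_close H.hγ H.hD (H.abs_y h0) (H.hu θ)) (exp_pos _).le
            (by positivity)
        · rw [abs_mul, abs_of_pos hf0, hc, mul_assoc, hy]
          exact mul_le_mul_of_nonneg_left
            (mul_exp_sub_le_of_close H.hγ H.hD (H.abs_y h0) (H.hu θ)) hf0.le
      have i2 := mul_le_mul_of_nonneg_left i1 (abs_nonneg (C.u s θ - C.y s))
      have i3 := mul_le_mul_of_nonneg_right (H.hu θ)
        (by positivity : 0 ≤ (Cf * exp s) * ((1 + D) * (|y| + 1 / γ)) * (Cec D K * exp (y ^ 2)))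
      rw [← sq_abs (C.u s θ - C.y s)]
      have i4 : a =
          D / γ * ((Cf * exp s) * ((1 + D) * (|y| + 1 / γ)) * (Cec D K * exp (y ^ 2))) := by
        rw [ha]; ring
      rw [i4]
      linarith
    rw [e0, e1, abs_le, ← cavg_neg]
    constructor
    · exact cavg_mono (by fun_prop) (by fun_prop) fun θ => (abs_le.1 (hpt θ)).1
    · exact cavg_mono (by fun_prop) (by fun_prop) fun θ => (abs_le.1 (hpt θ)).2
  have hv := C.var_le γ H.hs
  have hv' : cavg (fun θ => (C.u s θ - C.y s) ^ 2) ≤ (2 * π) ^ 2 * C.En γ s / γ ^ 2 := by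
    rw [le_div_iff₀ (by positivity)]; linarith
  have h3 : 0 ≤ exp (sg μ s - γ ^ 2) * (1 / f0) := by positivity
  rw [Cyl.err, H.weight, abs_mul, abs_of_nonneg h3]
  have h2 := mul_le_mul_of_nonneg_left
    (h1.trans (add_le_add_right (mul_le_mul_of_nonneg_left hv' hc0) a)) h3
  refine h2.trans ?_
  have h4 := Ac_ge H.hC₀.le H.hCf H.hD (a1 := 1 / f0) (a2 := Cf)
    (a3 := D)
    (a4 := 1 + D) (a5 := Cec D K) (a6 := 1) (by positivity)
    H.hCf hD (by linarith) (exp_pos _).le one_le_two_pi_sq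
    (by linarith [H.inv_f0]) (by linarith) (by nlinarith [sq_nonneg (D - 1)]) le_rfl le_rfl
  have h5 := Ac_ge H.hC₀.le H.hCf H.hD (a1 := 1) (a2 := 1)
    (a3 := 4 + 4 * D ^ 2)
    (a4 := 1) (a5 := Cec D K) (a6 := (2 * π) ^ 2) zero_le_one
    zero_le_one (by positivity) zero_le_one (exp_pos _).le (by linarith [sq_nonneg (2 * π)])
    (by linarith) (by linarith) le_rfl (by linarith) le_rfl
  have hE := C.En_nonneg γ H.hs
  have h6 := mul_le_mul_of_nonneg_right h4 (by positivity :
    0 ≤ exp s * (exp (sg μ s - γ ^ 2) * exp (y ^ 2) * (|y| / γ + 1 / γ ^ 2)))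
  have h7 := mul_le_mul_of_nonneg_right h5 (by positivity :
    0 ≤ exp (sg μ s - γ ^ 2) * exp (y ^ 2) * (1 + y ^ 2) / γ ^ 2 * C.En γ s)
  rw [← hy]
  calc _ = 1 * (1 / f0 * Cf * D * (1 + D) * Cec D K) *
        (exp s * (exp (sg μ s - γ ^ 2) * exp (y ^ 2) * (|y| / γ + 1 / γ ^ 2)))
      + (2 * π) ^ 2 * (1 * 1 * (4 + 4 * D ^ 2) * 1 * Cec D K) *
        (exp (sg μ s - γ ^ 2) * exp (y ^ 2) * (1 + y ^ 2) / γ ^ 2 * C.En γ s) := by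
        rw [ha, hc]; field_simp
    _ ≤ _ := add_le_add h6 h7
    _ = _ := by ring

end CylBd

theorem Cyl.dyn {b lam : ℝ} (C : Cyl b lam) {γ μ f0 C₀ Cf D K a b' : ℝ}
    (H : ∀ s ∈ Icc a b', CylBd C γ μ f0 C₀ Cf D K s) :
    Dyn γ μ a b' (Ac C₀ Cf D K) (2 * D ^ 2) K (C.phi γ) (C.p γ) (C.q γ) (C.Q γ) (C.Qhat γ)
      (C.Fq γ) (C.Z γ) (C.En γ) (C.nn γ) (C.err γ) where
  dphi s hs := C.hasDerivAt_phi γ (H s hs).hs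
  dp s hs := C.hasDerivAt_p γ (H s hs).hs
  dZ s hs := C.hasDerivAt_Z γ (H s hs).hs
  dnn s hs := C.hasDerivAt_nn γ (H s hs).hs
  E0 s hs := C.En_nonneg γ (H s hs).hs
  poh s hs := C.abs_pohozaev_le γ (H s hs).hs
  nnE s hs := (C.abs_nn_le γ (H s hs).hs).trans (mul_le_mul_of_nonneg_right
    (one_le_Ac (H s hs).hC₀.le (H s hs).hCf (H s hs).hD (H s hs).hK) (C.En_nonneg γ (H s hs).hs))
  nnA s hs := C.abs_nn_le' γ (H s hs).hs (by linarith [(H s hs).hγ]) (H s hs).hu (H s hs).hus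
  phi_le s hs := (H s hs).hφ
  hq s hs h0 := (H s hs).bound_q h0
  hQ s hs h0 := (H s hs).bound_Q h0
  hQh s hs h0 := (H s hs).bound_Qhat h0
  hF s hs h0 := (H s hs).bound_Fq h0
  hQq s hs h0 := (H s hs).bound_Qq h0
  herr s hs h0 := (H s hs).bound_err h0

/-- minus the bubble profile in logarithmic coordinates -/
def TT (μ s : ℝ) : ℝ := log (1 + exp (sg μ s) / 4)
/-- its derivative -/
def TT' (μ s : ℝ) : ℝ := exp (sg μ s) / 2 * exp (-TT μ s)
/-- limit profile of the rescaled Pohozaev quantity -/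
def kk (μ s : ℝ) : ℝ := 4 * (1 - (1 + TT μ s) * exp (-TT μ s))

theorem exp_TT (μ s : ℝ) : exp (TT μ s) = 1 + exp (sg μ s) / 4 := exp_log (by positivity)

theorem TT_nonneg (μ s : ℝ) : 0 ≤ TT μ s := Real.log_nonneg (by linarith [exp_pos (sg μ s)])

theorem TT_mono {μ a s : ℝ} (h : s ≤ a) : TT μ s ≤ TT μ a := by
  unfold TT
  have := exp_le_exp.2 (sg_mono (μ := μ) h)
  exact Real.log_le_log (by positivity) (by linarith)

theorem hasDerivAt_TT (μ s : ℝ) : HasDerivAt (TT μ) (TT' μ s) s := by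
  refine (((((hasDerivAt_sg μ s).exp.div_const 4).const_add 1).log (by positivity))).congr_deriv ?_
  rw [TT', exp_neg, exp_TT]
  field_simp
  ring

theorem hasDerivAt_kk (μ s : ℝ) :
    HasDerivAt (kk μ) (2 * (exp (sg μ s) * (TT μ s * exp (-(2 * TT μ s))))) s := by
  have h := hasDerivAt_TT μ s
  refine ((((h.const_add 1).mul h.neg.exp).const_sub 1).const_mul 4).congr_deriv ?_
  have : exp (-(2 * TT μ s)) = exp (-TT μ s) * exp (-TT μ s) := by rw [← exp_add]; congr 1; ring
  rw [this, TT']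
  simp only [Pi.neg_apply]
  ring

theorem tendsto_sg_atBot (μ : ℝ) : Tendsto (sg μ) atBot atBot := by
  unfold sg
  exact Tendsto.const_mul_atBot (by norm_num) (tendsto_atBot_add_const_right _ _ tendsto_id)

theorem tendsto_exp_sg (μ : ℝ) : Tendsto (fun s => exp (sg μ s)) atBot (𝓝 0) :=
  Real.tendsto_exp_atBot.comp (tendsto_sg_atBot μ)

theorem tendsto_TT (μ : ℝ) : Tendsto (TT μ) atBot (𝓝 0) := by
  unfold TT
  have h1 : Tendsto (fun s => 1 + exp (sg μ s) / 4) atBot (𝓝 (1 + 0 / 4)) :=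
    ((tendsto_exp_sg μ).div_const 4).const_add 1
  have := h1.log (by norm_num)
  simpa using this

theorem tendsto_kk (μ : ℝ) : Tendsto (kk μ) atBot (𝓝 0) := by
  have h := tendsto_TT μ
  have := (((h.const_add 1).mul h.neg.rexp).const_sub 1).const_mul 4
  unfold kk
  simpa using this

theorem kk_mem (μ s : ℝ) : 0 ≤ kk μ s ∧ kk μ s ≤ 4 := by
  have h0 := TT_nonneg μ s
  have h1 := Real.add_one_le_exp (TT μ s)
  have h2 := exp_pos (-TT μ s)
  have h3 : exp (TT μ s) * exp (-TT μ s) = 1 := by rw [← exp_add]; simp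
  have h4 := mul_le_mul_of_nonneg_right h1 h2.le
  have h5 : 0 ≤ (1 + TT μ s) * exp (-TT μ s) := by positivity
  unfold kk
  constructor <;> linarith

theorem abs_le_of_deriv_le_atBot {F F' G G' : ℝ → ℝ} {a : ℝ}
    (hF : ∀ x ≤ a, HasDerivAt F (F' x) x) (hG : ∀ x ≤ a, HasDerivAt G (G' x) x)
    (h : ∀ x ≤ a, |F' x| ≤ G' x) (hF0 : Tendsto F atBot (𝓝 0)) (hG0 : Tendsto G atBot (𝓝 0)) :
    |F a| ≤ G a := by
  have h1 : Tendsto (fun t => |F a - F t|) atBot (𝓝 |F a - 0|) := (hF0.const_sub _).abs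
  have h2 : Tendsto (fun t => G a - G t) atBot (𝓝 (G a - 0)) := hG0.const_sub _
  rw [sub_zero] at h1 h2
  refine le_of_tendsto_of_tendsto h1 h2 ?_
  filter_upwards [eventually_le_atBot a] with t ht
  exact abs_sub_le_of_abs_deriv_le ht (fun x hx => hF x hx.2) (fun x hx => hG x hx.2)
    (fun x hx => h x hx.2)

/-- Closeness of a cylindrical solution to the bubble for `s ≤ a`. -/
structure Bub {b lam : ℝ} (C : Cyl b lam) (γ μ f0 C₀ Cf η a : ℝ) : Prop where
  hab : a < b
  ha0 : a ≤ 0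
  hγ : 1 ≤ γ
  hμ : 0 < μ
  hC₀ : 0 < C₀
  hCf : 0 ≤ Cf
  hf0 : C₀⁻¹ ≤ f0
  hf0' : f0 ≤ C₀
  hnorm : μ ^ 2 * (lam * f0 * γ ^ 2 * exp (γ ^ 2)) = 1
  hη1 : η ≤ 1
  hw : ∀ s ≤ a, ∀ θ, |γ * (C.u s θ - γ) + TT μ s| ≤ η
  hus : ∀ s ≤ a, ∀ θ, |γ * C.us s θ + TT' μ s| ≤ η
  hut : ∀ s ≤ a, ∀ θ, |γ * C.ut s θ| ≤ η
  hder : ∃ M, ∀ s ≤ a, ∀ θ, |C.us s θ| ≤ M * exp s ∧ |C.ut s θ| ≤ M * exp s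
  hf : ∀ s ≤ a, ∀ θ, |C.f s θ - f0| ≤ Cf * exp s
  hfs : ∀ s ≤ a, ∀ θ, |C.fs s θ| ≤ Cf * exp s
  hm : (TT μ a + 1) ^ 2 / γ ^ 2 ≤ η
  hexp : γ ^ 2 * exp (-γ ^ 2) ≤ η
  hCa : Cf * exp a ≤ η

namespace Bub
variable {b lam : ℝ} {C : Cyl b lam} {γ μ f0 C₀ Cf η a s : ℝ}

theorem f0_pos (H : Bub C γ μ f0 C₀ Cf η a) : 0 < f0 := (inv_pos.2 H.hC₀).trans_le H.hf0

theorem η0 (H : Bub C γ μ f0 C₀ Cf η a) : 0 ≤ η := (abs_nonneg _).trans (H.hw a le_rfl 0)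

theorem weight (H : Bub C γ μ f0 C₀ Cf η a) (s : ℝ) :
    γ ^ 2 * lam * exp (2 * s) = exp (sg μ s - γ ^ 2) * (1 / f0) := by
  have h1 := H.f0_pos
  have h2 : exp (sg μ s - γ ^ 2) = exp (2 * s) / (μ ^ 2 * exp (γ ^ 2)) := by
    have : μ ^ 2 = exp (2 * log μ) := by
      rw [two_mul, exp_add, exp_log H.hμ, sq]
    rw [this, ← exp_add, ← exp_sub]
    congr 1; unfold sg; ring
  have h3 := H.hnorm
  have hμ := H.hμ
  rw [h2]
  field_simp
  linear_combination h3

theorem inv_f0 (H : Bub C γ μ f0 C₀ Cf η a) : 1 / f0 ≤ C₀ := by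
  rw [one_div]
  exact inv_le_of_inv_le₀ H.hC₀ H.hf0

theorem w_sq (H : Bub C γ μ f0 C₀ Cf η a) (hs : s ≤ a) (θ : ℝ) :
    (γ * (C.u s θ - γ)) ^ 2 / γ ^ 2 ≤ η := by
  refine le_trans ?_ H.hm
  have hγ := H.hγ
  apply div_le_div_of_nonneg_right _ (by positivity)
  have h1 := abs_le.1 (H.hw s hs θ)
  have h2 := TT_mono (μ := μ) hs
  have h3 := TT_nonneg μ s
  have := H.hη1
  rw [sq_le_sq, abs_of_nonneg (by linarith : 0 ≤ TT μ a + 1), abs_le]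
  constructor <;> linarith

theorem u_sq (H : Bub C γ μ f0 C₀ Cf η a) (s θ : ℝ) : C.u s θ ^ 2 =
    γ ^ 2 + (2 * (γ * (C.u s θ - γ)) + (γ * (C.u s θ - γ)) ^ 2 / γ ^ 2) := by
  have : γ ≠ 0 := by linarith [H.hγ]
  field_simp
  ring

theorem exp_u_sq (H : Bub C γ μ f0 C₀ Cf η a) (hs : s ≤ a) (θ : ℝ) :
    exp (C.u s θ ^ 2) ≤ exp (γ ^ 2) * exp 3 := by
  rw [← exp_add, H.u_sq]
  apply exp_le_exp.2
  have h1 := abs_le.1 (H.hw s hs θ)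
  have h3 := TT_nonneg μ s
  have := H.hη1
  have := H.w_sq hs θ
  linarith

theorem bound_pot (H : Bub C γ μ f0 C₀ Cf η a) (hs : s ≤ a) {w : ℝ → ℝ} {B : ℝ}
    (hB : 0 ≤ B) (hw : ∀ θ, |w θ| ≤ B) :
    |γ ^ 2 * lam * exp (2 * s) * cavg (fun θ => w θ * (exp (C.u s θ ^ 2) - 1))|
      ≤ C₀ * B * exp 3 * exp (sg μ s) := by
  have hf0 := H.f0_pos
  have h1 : |cavg (fun θ => w θ * (exp (C.u s θ ^ 2) - 1))| ≤ B * (exp (γ ^ 2) * exp 3) := by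
    refine abs_cavg_le fun θ => ?_
    rw [abs_mul]
    refine mul_le_mul (hw θ) ?_ (abs_nonneg _) hB
    rw [abs_of_nonneg (by linarith [Real.add_one_le_exp (C.u s θ ^ 2), sq_nonneg (C.u s θ)])]
    linarith [H.exp_u_sq hs θ]
  have h3 : 0 ≤ exp (sg μ s - γ ^ 2) * (1 / f0) := by positivity
  rw [H.weight, abs_mul, abs_of_nonneg h3]
  refine (mul_le_mul_of_nonneg_left h1 h3).trans ?_
  have h4 : exp (sg μ s - γ ^ 2) * exp (γ ^ 2) = exp (sg μ s) := by rw [← exp_add]; simp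
  calc _ = (1 / f0) * (B * exp 3 * (exp (sg μ s - γ ^ 2) * exp (γ ^ 2))) := by ring
    _ ≤ C₀ * (B * exp 3 * (exp (sg μ s - γ ^ 2) * exp (γ ^ 2))) :=
      mul_le_mul_of_nonneg_right H.inv_f0 (by positivity)
    _ = _ := by rw [h4]; ring

theorem abs_f (H : Bub C γ μ f0 C₀ Cf η a) (hs : s ≤ a) (θ : ℝ) : |C.f s θ| ≤ C₀ + Cf := by
  have h1 := abs_add_le (C.f s θ - f0) f0
  rw [sub_add_cancel, abs_of_pos H.f0_pos] at h1
  have h2 : Cf * exp s ≤ Cf := by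
    have := mul_le_mul_of_nonneg_left (exp_le_one_iff.2 (hs.trans H.ha0)) H.hCf
    linarith
  linarith [H.hf s hs θ, H.hf0']

theorem bound_Q (H : Bub C γ μ f0 C₀ Cf η a) (hs : s ≤ a) :
    |C.Q γ s| ≤ C₀ * (C₀ + Cf) * exp 3 * exp (sg μ s) :=
  H.bound_pot hs (by linarith [H.hC₀, H.hCf]) (H.abs_f hs)

theorem bound_Qhat (H : Bub C γ μ f0 C₀ Cf η a) (hs : s ≤ a) :
    |C.Qhat γ s| ≤ C₀ * exp 3 * exp (sg μ s) := by
  have := H.bound_pot hs (w := fun _ => 1) zero_le_one (by simp)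
  simpa [Cyl.Qhat] using this

theorem bound_Fq (H : Bub C γ μ f0 C₀ Cf η a) (hs : s ≤ a) :
    |C.Fq γ s| ≤ C₀ * (Cf * exp s) * exp 3 * exp (sg μ s) :=
  H.bound_pot hs (by have := H.hCf; positivity) (H.hfs s hs)

theorem Qq_eq (H : Bub C γ μ f0 C₀ Cf η a) (hs : s ≤ a) : γ ^ 2 * (C.Q γ s - C.q γ s)
    = exp (sg μ s) * ((1 / f0) * cavg (fun θ => C.f s θ * (-(γ * (C.u s θ - γ)) *
      exp (2 * (γ * (C.u s θ - γ)) + (γ * (C.u s θ - γ)) ^ 2 / γ ^ 2) - γ ^ 2 * exp (-γ ^ 2)))) := by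
  have hsb := hs.trans_lt H.hab
  have cu := continuous_slice C.cu hsb
  have cf := continuous_slice C.cf hsb
  have cg := C.cg' hsb
  have hγ : γ ≠ 0 := by linarith [H.hγ]
  have h4 : exp (sg μ s - γ ^ 2) * exp (γ ^ 2) = exp (sg μ s) := by rw [← exp_add]; simp
  have e1 : (fun θ => C.f s θ * (-(γ * (C.u s θ - γ)) *
      exp (2 * (γ * (C.u s θ - γ)) + (γ * (C.u s θ - γ)) ^ 2 / γ ^ 2) - γ ^ 2 * exp (-γ ^ 2)))
      = fun θ => exp (-γ ^ 2) * (γ ^ 2 * (C.f s θ * (exp (C.u s θ ^ 2) - 1)) - γ * C.g s θ) := by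
    ext θ
    have e2 : exp (2 * (γ * (C.u s θ - γ)) + (γ * (C.u s θ - γ)) ^ 2 / γ ^ 2)
        = exp (-γ ^ 2) * exp (C.u s θ ^ 2) := by
      rw [← exp_add, H.u_sq]; congr 1; ring
    rw [e2]
    unfold Cyl.g
    ring
  rw [e1, cavg_const_mul, cavg_sub (by fun_prop) (by fun_prop), cavg_const_mul, cavg_const_mul]
  have h5 : exp (sg μ s) * (1 / f0) * exp (-γ ^ 2) = γ ^ 2 * lam * exp (2 * s) := by
    rw [H.weight, ← h4]
    have : exp (γ ^ 2) * exp (-γ ^ 2) = 1 := by rw [← exp_add]; simp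
    linear_combination exp (sg μ s - γ ^ 2) * (1 / f0) * this
  rw [Cyl.Q, Cyl.q]
  linear_combination -(γ ^ 2 * cavg (fun θ => C.f s θ * (exp (C.u s θ ^ 2) - 1))
    - γ * cavg (C.g s)) * h5

/-- constant in the bubble estimate -/
def Yc (C₀ M : ℝ) : ℝ := C₀ * ((M + 1) * exp 3 + 1) + (exp 3 * (1 + 3 * M) + 1)

theorem bound_Qq (H : Bub C γ μ f0 C₀ Cf η a) (hs : s ≤ a) :
    |γ ^ 2 * (C.Q γ s - C.q γ s) - exp (sg μ s) * (TT μ s * exp (-(2 * TT μ s)))|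
      ≤ Yc C₀ (TT μ a) * η * exp (sg μ s) := by
  have hsb := hs.trans_lt H.hab
  have cu := continuous_slice C.cu hsb
  have cf := continuous_slice C.cf hsb
  have hf0 := H.f0_pos
  have hη1 := H.hη1
  have hη0 := H.η0
  have hC₀ := H.hC₀
  obtain ⟨T, hT⟩ : ∃ T, T = TT μ s := ⟨_, rfl⟩
  obtain ⟨M, hM⟩ : ∃ M, M = TT μ a := ⟨_, rfl⟩
  have hT0 : 0 ≤ T := hT ▸ TT_nonneg μ s
  have hTM : T ≤ M := by rw [hT, hM]; exact TT_mono hs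
  have hM0 := hT0.trans hTM
  obtain ⟨X, hX⟩ : ∃ X : ℝ → ℝ, X = fun θ => -(γ * (C.u s θ - γ)) *
      exp (2 * (γ * (C.u s θ - γ)) + (γ * (C.u s θ - γ)) ^ 2 / γ ^ 2) - γ ^ 2 * exp (-γ ^ 2) :=
    ⟨_, rfl⟩
  have cX : Continuous X := by rw [hX]; fun_prop
  have key : ∀ θ, |X θ| ≤ (M + 1) * exp 3 + 1 ∧
      |X θ - T * exp (-(2 * T))| ≤ (exp 3 * (1 + 3 * M) + 1) * η := fun θ => by
    have h1 := H.hw s hs θ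
    have h2 := H.w_sq hs θ
    have h3 : 0 ≤ (γ * (C.u s θ - γ)) ^ 2 / γ ^ 2 := by positivity
    rw [hX]
    simp only
    rw [← hT] at h1
    generalize γ * (C.u s θ - γ) = w at *
    obtain ⟨x, hx⟩ : ∃ x, x = 2 * w + w ^ 2 / γ ^ 2 := ⟨_, rfl⟩
    rw [← hx]
    have hw := abs_le.1 h1
    have hx3 : x ≤ 3 := by rw [hx]; linarith
    have he3 : exp x ≤ exp 3 := exp_le_exp.2 hx3
    have hed : |exp x - exp (-(2 * T))| ≤ exp 3 * (3 * η) := by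
      have i1 : |x - -(2 * T)| ≤ 3 * η := by
        rw [hx, abs_le]; constructor <;> linarith
      have := (convex_Iic (3 : ℝ)).norm_image_sub_le_of_norm_hasDerivWithin_le (f := exp)
        (f' := exp) (C := exp 3) (fun z _ => (Real.hasDerivAt_exp z).hasDerivWithinAt)
        (fun z hz => by rw [Real.norm_of_nonneg (exp_pos z).le]; exact exp_le_exp.2 hz)
        (show -(2 * T) ∈ Iic (3 : ℝ) by simp only [mem_Iic]; linarith)
        (show x ∈ Iic (3 : ℝ) from hx3)
      simp only [Real.norm_eq_abs] at this
      exact this.trans (mul_le_mul_of_nonneg_left i1 (exp_pos _).le)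
    have hγe : 0 ≤ γ ^ 2 * exp (-γ ^ 2) := by positivity
    have hγe' := H.hexp
    have hwa : |w| ≤ M + 1 := by rw [abs_le]; constructor <;> linarith
    constructor
    · have i1 := abs_sub (-w * exp x) (γ ^ 2 * exp (-γ ^ 2))
      rw [abs_mul, abs_neg, abs_of_pos (exp_pos x), abs_of_nonneg hγe] at i1
      have i2 := mul_le_mul hwa he3 (exp_pos x).le (by linarith)
      linarith
    · have e : -w * exp x - γ ^ 2 * exp (-γ ^ 2) - T * exp (-(2 * T))
          = -((w + T) * exp x) + T * (exp x - exp (-(2 * T))) - γ ^ 2 * exp (-γ ^ 2) := by ring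
      rw [e]
      have i1 := abs_sub (-((w + T) * exp x) + T * (exp x - exp (-(2 * T)))) (γ ^ 2 * exp (-γ ^ 2))
      have i2 := abs_add_le (-((w + T) * exp x)) (T * (exp x - exp (-(2 * T))))
      rw [abs_neg, abs_mul, abs_mul, abs_of_pos (exp_pos x), abs_of_nonneg hT0] at i2
      rw [abs_of_nonneg hγe] at i1
      have i3 := mul_le_mul h1 he3 (exp_pos x).le hη0
      have i4 := mul_le_mul hTM hed (abs_nonneg _) hM0
      linarith
  have hdiff : |1 / f0 * cavg (fun θ => C.f s θ * X θ) - T * exp (-(2 * T))| ≤ Yc C₀ M * η := by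
    have e1 : 1 / f0 * cavg (fun θ => C.f s θ * X θ) - T * exp (-(2 * T))
        = cavg (fun θ => 1 / f0 * ((C.f s θ - f0) * X θ) + (X θ - T * exp (-(2 * T)))) := by
      have : (fun θ => 1 / f0 * ((C.f s θ - f0) * X θ) + (X θ - T * exp (-(2 * T))))
          = fun θ => 1 / f0 * (C.f s θ * X θ) - T * exp (-(2 * T)) := by
        ext θ; field_simp; ring
      rw [this, cavg_sub (by fun_prop) (by fun_prop), cavg_const_mul, cavg_const]
    rw [e1]
    refine abs_cavg_le fun θ => ?_
    obtain ⟨k1, k2⟩ := key θ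
    refine (abs_add_le _ _).trans ?_
    rw [abs_mul, abs_mul, abs_of_nonneg (by positivity : 0 ≤ 1 / f0)]
    have i1 : |C.f s θ - f0| ≤ η := (H.hf s hs θ).trans
      ((mul_le_mul_of_nonneg_left (exp_le_exp.2 hs) H.hCf).trans H.hCa)
    have i2 := mul_le_mul i1 k1 (abs_nonneg _) hη0
    have i3 := mul_le_mul H.inv_f0 i2 (by positivity) hC₀.le
    unfold Yc
    linarith
  have e2 : (fun θ => C.f s θ * (-(γ * (C.u s θ - γ)) *
      exp (2 * (γ * (C.u s θ - γ)) + (γ * (C.u s θ - γ)) ^ 2 / γ ^ 2) - γ ^ 2 * exp (-γ ^ 2)))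
      = fun θ => C.f s θ * X θ := by rw [hX]
  rw [H.Qq_eq hs, e2, ← hT, ← hM, ← mul_sub, abs_mul, abs_of_pos (exp_pos _), mul_comm]
  exact mul_le_mul_of_nonneg_right hdiff (exp_pos _).le

theorem abs_phi_sub (H : Bub C γ μ f0 C₀ Cf η a) (hs : s ≤ a) : |C.phi γ s - TT μ s| ≤ η := by
  have hsb := hs.trans_lt H.hab
  have cu := continuous_slice C.cu hsb
  have e : C.phi γ s - TT μ s = -cavg (fun θ => γ * (C.u s θ - γ) + TT μ s) := by
    have : (fun θ => γ * (C.u s θ - γ) + TT μ s) = fun θ => γ * C.u s θ - (γ * γ - TT μ s) := by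
      ext θ; ring
    rw [this, cavg_sub (by fun_prop) (by fun_prop), cavg_const_mul, cavg_const, Cyl.phi, Cyl.y]
    ring
  rw [e, abs_neg]
  exact abs_cavg_le (H.hw s hs)

theorem abs_p_sub (H : Bub C γ μ f0 C₀ Cf η a) (hs : s ≤ a) : |C.p γ s - TT' μ s| ≤ η := by
  have hsb := hs.trans_lt H.hab
  have cu := continuous_slice C.cus hsb
  have e : C.p γ s - TT' μ s = -cavg (fun θ => γ * C.us s θ + TT' μ s) := by
    rw [cavg_add (by fun_prop) (by fun_prop), cavg_const_mul, cavg_const, Cyl.p]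
    ring
  rw [e, abs_neg]
  exact abs_cavg_le (H.hus s hs)

theorem abs_nn_le (H : Bub C γ μ f0 C₀ Cf η a) (hs : s ≤ a) : |C.nn γ s| ≤ 2 * (2 * η) ^ 2 := by
  have hsb := hs.trans_lt H.hab
  have hγ : 0 < γ := by linarith [H.hγ]
  refine C.abs_nn_le' γ hsb hγ (fun θ => ?_) (fun θ => ?_)
  · have h1 := abs_le.1 (H.hw s hs θ)
    have h2 := abs_le.1 (H.abs_phi_sub hs)
    have h3 : γ * |C.u s θ - C.y s| = |γ * (C.u s θ - C.y s)| := by rw [abs_mul, abs_of_pos hγ]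
    rw [le_div_iff₀ hγ, mul_comm, h3, abs_le]
    unfold Cyl.phi at h2
    constructor <;> linarith
  · have h1 := abs_le.1 (H.hus s hs θ)
    have h2 := abs_le.1 (H.abs_p_sub hs)
    have h3 : γ * |C.us s θ - cavg (C.us s)| = |γ * (C.us s θ - cavg (C.us s))| := by
      rw [abs_mul, abs_of_pos hγ]
    rw [le_div_iff₀ hγ, mul_comm, h3, abs_le]
    unfold Cyl.p at h2
    constructor <;> linarith

theorem tendsto_p (H : Bub C γ μ f0 C₀ Cf η a) : Tendsto (C.p γ) atBot (𝓝 0) := by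
  obtain ⟨M, hM⟩ := H.hder
  have h0 : Tendsto (fun s => γ * (M * exp s)) atBot (𝓝 (γ * (M * 0))) :=
    (Real.tendsto_exp_atBot.const_mul M).const_mul γ
  simp only [mul_zero] at h0
  refine squeeze_zero_norm' ?_ h0
  filter_upwards [eventually_le_atBot a] with s hs
  have hγ : 0 < γ := by linarith [H.hγ]
  rw [Cyl.p, Real.norm_eq_abs, abs_mul, abs_neg, abs_of_pos hγ]
  exact mul_le_mul_of_nonneg_left (abs_cavg_le fun θ => (hM s hs θ).1) hγ.le

theorem tendsto_Q (H : Bub C γ μ f0 C₀ Cf η a) : Tendsto (C.Q γ) atBot (𝓝 0) := by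
  have h0 := (tendsto_exp_sg μ).const_mul (C₀ * (C₀ + Cf) * exp 3)
  rw [mul_zero] at h0
  refine squeeze_zero_norm' ?_ h0
  filter_upwards [eventually_le_atBot a] with s hs
  exact H.bound_Q hs

theorem tendsto_Z (H : Bub C γ μ f0 C₀ Cf η a) : Tendsto (C.Z γ) atBot (𝓝 0) := by
  have h1 : Tendsto (fun s => γ ^ 2 * cavg (fun θ => C.us s θ ^ 2 - C.ut s θ ^ 2)) atBot (𝓝 0) := by
    obtain ⟨M, hM⟩ := H.hder
    have h0 : Tendsto (fun s => γ ^ 2 * ((M * exp s) ^ 2 + (M * exp s) ^ 2)) atBot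
        (𝓝 (γ ^ 2 * ((M * 0) ^ 2 + (M * 0) ^ 2))) := by
      have h := (Real.tendsto_exp_atBot.const_mul M).pow 2
      exact (h.add h).const_mul _
    simp only [mul_zero, ne_eq, OfNat.ofNat_ne_zero, not_false_eq_true, zero_pow, add_zero] at h0
    refine squeeze_zero_norm' ?_ h0
    filter_upwards [eventually_le_atBot a] with s hs
    rw [Real.norm_eq_abs, abs_mul, abs_of_nonneg (sq_nonneg γ)]
    refine mul_le_mul_of_nonneg_left (abs_cavg_le fun θ => ?_) (sq_nonneg γ)
    refine (abs_sub _ _).trans ?_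
    rw [abs_pow, abs_pow]
    obtain ⟨k1, k2⟩ := hM s hs θ
    gcongr
  have := (h1.add H.tendsto_Q).sub (H.tendsto_p.const_mul 2)
  unfold Cyl.Z
  simpa using this

theorem abs_Z_sub (H : Bub C γ μ f0 C₀ Cf η a) :
    |C.Z γ a - kk μ a / γ ^ 2| ≤ Yc C₀ (TT μ a) * η * exp (sg μ a) / γ ^ 2
      + C₀ * Cf * exp 3 * (exp a * exp (sg μ a)) / 3 := by
  have hγ : 0 < γ := by linarith [H.hγ]
  refine abs_le_of_deriv_le_atBot (F := fun s => C.Z γ s - kk μ s / γ ^ 2)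
    (G := fun s => Yc C₀ (TT μ a) * η * exp (sg μ s) / γ ^ 2
      + C₀ * Cf * exp 3 * (exp s * exp (sg μ s)) / 3)
    (F' := fun s => 2 * (C.Q γ s - C.q γ s) + C.Fq γ s
      - 2 * (exp (sg μ s) * (TT μ s * exp (-(2 * TT μ s)))) / γ ^ 2)
    (G' := fun s => 2 * (Yc C₀ (TT μ a) * η * exp (sg μ s)) / γ ^ 2
      + C₀ * Cf * exp 3 * (exp s * exp (sg μ s))) ?_ ?_ ?_ ?_ ?_
  · intro s hs
    have h1 := C.hasDerivAt_Z γ (hs.trans_lt H.hab)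
    exact (h1.sub ((hasDerivAt_kk μ s).div_const _)).congr_deriv (by ring)
  · intro s hs
    have h1 := (hasDerivAt_sg μ s).exp
    have h2 := (Real.hasDerivAt_exp s).mul h1
    refine (((h1.const_mul (Yc C₀ (TT μ a) * η)).div_const (γ ^ 2)).add
      ((h2.const_mul (C₀ * Cf * exp 3)).div_const 3)).congr_deriv ?_
    ring
  · intro s hs
    have h1 := H.bound_Qq hs
    have h2 := H.bound_Fq hs
    have e : 2 * (C.Q γ s - C.q γ s) + C.Fq γ s
      - 2 * (exp (sg μ s) * (TT μ s * exp (-(2 * TT μ s)))) / γ ^ 2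
      = 2 * (γ ^ 2 * (C.Q γ s - C.q γ s) - exp (sg μ s) * (TT μ s * exp (-(2 * TT μ s)))) / γ ^ 2
        + C.Fq γ s := by field_simp; ring
    rw [e]
    refine (abs_add_le _ _).trans (add_le_add ?_ (h2.trans (le_of_eq (by ring))))
    rw [abs_div, abs_mul, abs_of_pos (by positivity : (0:ℝ) < γ ^ 2), abs_two]
    gcongr
  · have := H.tendsto_Z.sub ((tendsto_kk μ).div_const (γ ^ 2))
    simpa using this
  · have h1 := ((tendsto_exp_sg μ).const_mul (Yc C₀ (TT μ a) * η)).div_const (γ ^ 2)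
    have h2 := ((Real.tendsto_exp_atBot.mul (tendsto_exp_sg μ)).const_mul
      (C₀ * Cf * exp 3)).div_const 3
    simpa using h1.add h2

end Bub

theorem kk_eq_of_sg {μ a x : ℝ} (h : sg μ a = x) :
    kk μ a = 4 * (1 - (1 + log (1 + exp x / 4)) * exp (-log (1 + exp x / 4))) := by
  unfold kk TT
  rw [h]

/-- limit of the rescaled Pohozaev quantity at logarithmic bubble radius `ℓ` -/
def kap (ℓ : ℝ) : ℝ :=
  4 * (1 - (1 + log (1 + exp (2 * ℓ) / 4)) * exp (-log (1 + exp (2 * ℓ) / 4)))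

theorem exists_dynStart {A A₂ K C₀ Cf h : ℝ} (hA : 1 ≤ A) (hA₂ : 0 ≤ A₂) (hK : 0 ≤ K)
    (hC₀ : 0 < C₀) (hCf : 0 ≤ Cf)
    (h0 : 0 < h) (hC : C3c A A₂ K * h ≤ 1) (hK₁ : h ≤ exp (-K1c A₂ / 8)) :
    ∃ ℓ₀ : ℝ, ∀ ℓ ≥ ℓ₀, ∃ η N : ℝ, 0 < η ∧ η ≤ 1 ∧ ∀ (b lam : ℝ) (C : Cyl b lam) (γ μ f0 : ℝ),
      Bub C γ μ f0 C₀ Cf η (ℓ + log μ) → 1 / γ ^ 2 ≤ h → log μ ≤ -N →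
      DynStart γ μ (ℓ + log μ) A A₂ K h (kap ℓ) (C.phi γ (ℓ + log μ)) (C.p γ (ℓ + log μ))
        (C.Z γ (ℓ + log μ)) (C.nn γ (ℓ + log μ)) := by
  have t1 : Tendsto (fun ℓ : ℝ => exp (-(2 * ℓ) / 8)) atTop (𝓝 0) := by
    refine Real.tendsto_exp_atBot.comp ?_
    have : (fun ℓ : ℝ => -(2 * ℓ) / 8) = fun ℓ => (-1 / 4) * ℓ := by ext; ring
    rw [this]
    exact tendsto_id.const_mul_atTop_of_neg (by norm_num)
  have t2 : Tendsto (fun ℓ : ℝ => 8 * exp (-(2 * ℓ))) atTop (𝓝 (8 * 0)) := by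
    refine Tendsto.const_mul _ (Real.tendsto_exp_atBot.comp ?_)
    have : (fun ℓ : ℝ => -(2 * ℓ)) = fun ℓ => (-2) * ℓ := by ext; ring
    rw [this]
    exact tendsto_id.const_mul_atTop_of_neg (by norm_num)
  rw [mul_zero] at t2
  obtain ⟨ℓ₀, hℓ₀⟩ := ((t1.eventually_le_const h0).and
    (t2.eventually_le_const (half_pos h0))).exists_forall_of_atTop
  refine ⟨ℓ₀, fun ℓ hℓ => ?_⟩
  obtain ⟨l1, l2⟩ := hℓ₀ ℓ hℓ
  obtain ⟨x, hx⟩ : ∃ x, x = 2 * ℓ := ⟨_, rfl⟩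
  obtain ⟨T, hT⟩ : ∃ T, T = log (1 + exp x / 4) := ⟨_, rfl⟩
  have hT0 : 0 ≤ T := by rw [hT]; exact Real.log_nonneg (by linarith [exp_pos x])
  have hY : 0 < Bub.Yc C₀ T := by unfold Bub.Yc; positivity
  have hYx : 0 < 8 + Bub.Yc C₀ T * exp x := by positivity
  obtain ⟨Nc, hNc⟩ : ∃ Nc, Nc = C₀ * Cf * exp 3 * exp x / 3 * 2 := ⟨_, rfl⟩
  have hNc0 : 0 ≤ Nc := by rw [hNc]; positivity
  have t3 : Tendsto (fun m : ℝ => Nc * exp ((ℓ + m) / 2)) atBot (𝓝 (Nc * 0)) :=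
    Tendsto.const_mul _ (Real.tendsto_exp_atBot.comp
      (Tendsto.atBot_div_const (by norm_num) (tendsto_atBot_add_const_left _ _ tendsto_id)))
  rw [mul_zero] at t3
  obtain ⟨m₀, hm₀⟩ := ((t3.eventually_le_const h0).and
    ((eventually_le_atBot (4 * log h)).and (eventually_le_atBot (-ℓ - 1)))).exists_forall_of_atBot
  refine ⟨min 1 (min (h / 8) (min (h / 2) (h / (8 + Bub.Yc C₀ T * exp x)))), -m₀, ?_,
    min_le_left _ _, ?_⟩
  · positivity
  intro b lam C γ μ f0 H hγ2 hm
  rw [neg_neg] at hm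
  obtain ⟨m1, m2, m3⟩ := hm₀ _ hm
  obtain ⟨a, ha⟩ : ∃ a, a = ℓ + log μ := ⟨_, rfl⟩
  rw [← ha] at H m1 ⊢
  have hsg : sg μ a = x := by rw [sg, ha, hx]; ring
  have hTT : TT μ a = T := by rw [TT, hsg, hT]
  obtain ⟨η, hη⟩ : ∃ η, η = min 1 (min (h / 8) (min (h / 2) (h / (8 + Bub.Yc C₀ T * exp x)))) :=
    ⟨_, rfl⟩
  rw [← hη] at H
  have hη0 := H.η0
  have e1 : η ≤ 1 := by rw [hη]; exact min_le_left _ _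
  have e2 : η ≤ h / 8 := by
    rw [hη]; exact (min_le_right _ _).trans (min_le_left _ _)
  have e3 : η ≤ h / 2 := by linarith
  have e4 : η ≤ h / (8 + Bub.Yc C₀ T * exp x) := by
    rw [hη]
    exact (min_le_right _ _).trans ((min_le_right _ _).trans (min_le_right _ _))
  have e4' : Bub.Yc C₀ T * η * exp x ≤ h := by
    rw [le_div_iff₀ hYx] at e4
    linarith
  have hexpT : exp T = 1 + exp x / 4 := by rw [hT, exp_log (by positivity)]
  have hxx : exp (-x) * exp x = 1 := by rw [← exp_add]; simp
  have hTT' : |TT' μ a - 2| ≤ h / 2 := by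
    rw [TT', hTT, hsg, exp_neg, hexpT, abs_le]
    have : exp x / 2 * (1 + exp x / 4)⁻¹ - 2 = -(8 / (4 + exp x)) := by field_simp; ring
    rw [this]
    have k1 : 8 / (4 + exp x) ≤ 8 * exp (-x) := by
      rw [div_le_iff₀ (by positivity)]
      have := exp_pos (-x)
      linarith
    have k2 : 0 ≤ 8 / (4 + exp x) := by positivity
    rw [← hx] at l2
    constructor <;> linarith
  have hTx : |T - x + log 4| ≤ h / 2 := by
    have : T - x + log 4 = log (1 + 4 * exp (-x)) := by
      have k1 : 1 + 4 * exp (-x) = (1 + exp x / 4) * (4 * exp (-x)) := by linear_combination -hxx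
      rw [k1, Real.log_mul (by positivity) (by positivity), Real.log_mul (by norm_num)
        (by positivity), Real.log_exp, hT]
      ring
    rw [this, abs_of_nonneg (Real.log_nonneg (by linarith [exp_pos (-x)]))]
    have := Real.log_le_sub_one_of_pos (show 0 < 1 + 4 * exp (-x) by positivity)
    rw [← hx] at l2
    linarith [exp_pos (-x)]
  have hκ := kk_mem μ a
  have hZ := H.abs_Z_sub
  have hphi := H.abs_phi_sub le_rfl
  have hp := H.abs_p_sub le_rfl
  have hnn := H.abs_nn_le le_rfl
  have hkap : kk μ a = kap ℓ := by rw [kk_eq_of_sg hsg, kap, hx]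
  rw [hkap] at hκ hZ
  have ha0 : a < 0 := by rw [ha]; linarith
  refine ⟨hA, hA₂, hK, H.hγ, ha0, h0.le, hC, hK₁, ?_, hγ2, ?_, ?_, ?_, ?_, hκ.1, hκ.2, ?_⟩
  · rw [E1v, hsg, hx]; exact l1
  · calc exp (log μ / 4) ≤ exp (log h) := exp_le_exp.2 (by linarith)
      _ = h := exp_log h0
  · have := abs_add_le (C.p γ a - TT' μ a) (TT' μ a - 2)
    rw [sub_add_sub_cancel] at this
    linarith
  · have : η * η ≤ η * 1 := mul_le_mul_of_nonneg_left e1 hη0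
    linarith
  · have := abs_add_le (C.phi γ a - TT μ a) (T - x + log 4)
    rw [hTT] at this hphi
    have e : C.phi γ a - T + (T - x + log 4) = C.phi γ a - x + log 4 := by ring
    rw [e] at this
    rw [hsg]
    linarith
  · refine hZ.trans (add_le_add ?_ ?_)
    · rw [hTT, hsg]
      exact div_le_div_of_nonneg_right e4' (by positivity)
    · rw [hsg, le_div_iff₀ (abs_pos.2 ha0.ne)]
      have k1 := Real.add_one_le_exp (-a / 2)
      have k2 : exp (-a / 2) * exp a = exp (a / 2) := by rw [← exp_add]; congr 1; ring
      have k3 : |a| * exp a ≤ 2 * exp (a / 2) := by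
        rw [abs_of_neg ha0, ← k2]
        have := mul_le_mul_of_nonneg_right k1 (exp_pos a).le
        linarith [exp_pos a]
      calc _ = C₀ * Cf * exp 3 * exp x / 3 * (|a| * exp a) := by ring
        _ ≤ C₀ * Cf * exp 3 * exp x / 3 * (2 * exp (a / 2)) := by gcongr
        _ = Nc * exp (a / 2) := by rw [hNc]; ring
        _ ≤ h := m1

theorem hasDerivAt_TT' (μ s : ℝ) :
    HasDerivAt (TT' μ) (exp (sg μ s) * exp (-(2 * TT μ s))) s := by
  have h := hasDerivAt_TT μ s
  refine (((hasDerivAt_sg μ s).exp.div_const 2).mul h.neg.exp).congr_deriv ?_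
  have h2 : exp (-(2 * TT μ s)) = exp (-TT μ s) * exp (-TT μ s) := by
    rw [← exp_add]; congr 1; ring
  have h3 : exp (-TT μ s) * (1 + exp (sg μ s) / 4) = 1 := by rw [← exp_TT, ← exp_add]; simp
  rw [h2, TT']
  simp only [Pi.neg_apply]
  linear_combination -exp (sg μ s) * exp (-TT μ s) * h3

theorem tendsto_TT' (μ : ℝ) : Tendsto (TT' μ) atBot (𝓝 0) := by
  have := ((tendsto_exp_sg μ).div_const 2).mul (tendsto_TT μ).neg.rexp
  unfold TT'
  simpa using this

theorem abs_exp_sub_exp_le {x y M : ℝ} (hx : x ≤ M) (hy : y ≤ M) :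
    |exp x - exp y| ≤ exp M * |x - y| := by
  have := (convex_Iic M).norm_image_sub_le_of_norm_hasDerivWithin_le (f := exp)
    (f' := exp) (C := exp M) (fun z _ => (Real.hasDerivAt_exp z).hasDerivWithinAt)
    (fun z hz => by rw [Real.norm_of_nonneg (exp_pos z).le]; exact exp_le_exp.2 hz)
    (show y ∈ Iic M from hy) (show x ∈ Iic M from hx)
  simpa only [Real.norm_eq_abs] using this

theorem abs_bubble_source_sub_le {γ T M φ : ℝ} (hγ : 1 ≤ γ) (hT : 0 ≤ T) (hTM : T ≤ M)
    (hM : (M + 1) ^ 2 / γ ^ 2 ≤ 1) (hφ : |φ - T| ≤ 1) :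
    |(1 - φ / γ ^ 2) * exp (-2 * φ + φ ^ 2 / γ ^ 2) - exp (-(2 * T))|
      ≤ 2 * exp 3 * |φ - T| + 2 * exp 3 * ((M + 1) ^ 2 / γ ^ 2) := by
  have h1 := abs_le.1 hφ
  have hφM : |φ| ≤ M + 1 := by rw [abs_le]; constructor <;> linarith
  have h2 : φ ^ 2 / γ ^ 2 ≤ (M + 1) ^ 2 / γ ^ 2 := by
    apply div_le_div_of_nonneg_right _ (by positivity)
    rw [← sq_abs]
    exact pow_le_pow_left₀ (abs_nonneg _) hφM 2
  have h3 : 0 ≤ φ ^ 2 / γ ^ 2 := by positivity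
  obtain ⟨x, hx⟩ : ∃ x, x = -2 * φ + φ ^ 2 / γ ^ 2 := ⟨_, rfl⟩
  rw [← hx]
  have hx3 : x ≤ 3 := by rw [hx]; linarith
  have h4 := abs_exp_sub_exp_le hx3 (show -(2 * T) ≤ 3 by linarith)
  have h5 : |x - -(2 * T)| ≤ 2 * |φ - T| + (M + 1) ^ 2 / γ ^ 2 := by
    have e : x - -(2 * T) = -2 * (φ - T) + φ ^ 2 / γ ^ 2 := by rw [hx]; ring
    rw [e]
    refine (abs_add_le _ _).trans ?_
    rw [abs_mul, abs_neg, abs_two, abs_of_nonneg h3]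
    linarith
  have h6 : |φ| / γ ^ 2 ≤ (M + 1) ^ 2 / γ ^ 2 := by
    apply div_le_div_of_nonneg_right _ (by positivity)
    have : 1 * (M + 1) ≤ (M + 1) * (M + 1) := mul_le_mul_of_nonneg_right (by linarith) (by linarith)
    linarith
  have e : (1 - φ / γ ^ 2) * exp x - exp (-(2 * T))
      = exp x - exp (-(2 * T)) - φ / γ ^ 2 * exp x := by ring
  rw [e]
  refine (abs_sub _ _).trans ?_
  rw [abs_mul, abs_div, abs_of_pos (exp_pos x), abs_of_nonneg (sq_nonneg γ)]
  have i1 := mul_le_mul_of_nonneg_left h5 (exp_pos 3).le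
  have i2 := mul_le_mul h6 (exp_le_exp.2 hx3) (exp_pos x).le (by positivity)
  linarith

/-- Closeness of a radial solution to the bubble. -/
theorem bubble_ode {φ p : ℝ → ℝ} {γ μ a L ε : ℝ} (hγ : 1 ≤ γ)
    (hφ : ∀ s ≤ a, HasDerivAt φ (p s) s)
    (hp : ∀ s ≤ a, HasDerivAt p (exp (sg μ s) *
      ((1 - φ s / γ ^ 2) * exp (-2 * φ s + φ s ^ 2 / γ ^ 2))) s)
    (hφ0 : Tendsto φ atBot (𝓝 0)) (hp0 : Tendsto p atBot (𝓝 0))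
    (hL : L = 2 * exp 3) (hε : ε = (TT μ a + 1) ^ 2 / γ ^ 2)
    (hsmall : ε * exp (L * exp (sg μ a)) ≤ 1) :
    ∀ s ≤ a, |φ s - TT μ s| ≤ ε * exp (L * exp (sg μ a)) ∧
      |p s - TT' μ s| ≤ 2 * L * exp (sg μ a) * (ε * exp (L * exp (sg μ a))) := by
  have hL0 : 0 < L := by rw [hL]; positivity
  have hε0 : 0 < ε := by rw [hε]; have := TT_nonneg μ a; positivity
  have hε1 : ε ≤ 1 := by
    refine le_trans ?_ hsmall
    have : 1 ≤ exp (L * exp (sg μ a)) := Real.one_le_exp (by positivity)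
    have := mul_le_mul_of_nonneg_left this hε0.le
    linarith
  let β : ℝ → ℝ := fun s => ε * exp (L * exp (sg μ s))
  let β' : ℝ → ℝ := fun s => 2 * L * exp (sg μ s) * β s
  have hβ : ∀ s, HasDerivAt β (β' s) s := fun s => by
    refine ((((hasDerivAt_sg μ s).exp.const_mul L).exp).const_mul ε).congr_deriv ?_
    simp only [β', β]; ring
  have hβ' : ∀ s, HasDerivAt β' (4 * L * exp (sg μ s) * β s
      + 4 * L ^ 2 * exp (sg μ s) ^ 2 * β s) s := fun s => by
    refine (((hasDerivAt_sg μ s).exp.const_mul (2 * L)).mul (hβ s)).congr_deriv ?_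
    simp only [β', β]; ring
  have hβpos : ∀ s, ε ≤ β s := fun s => by
    have : 1 ≤ exp (L * exp (sg μ s)) := Real.one_le_exp (by positivity)
    have := mul_le_mul_of_nonneg_left this hε0.le
    simp only [β]; linarith
  have hβmono : ∀ {s t}, s ≤ t → β s ≤ β t := fun {s t} h => by
    have := exp_le_exp.2 (sg_mono (μ := μ) h)
    simp only [β]; gcongr
  have hβlim : Tendsto (fun s => β s - ε) atBot (𝓝 0) := by
    have := ((((tendsto_exp_sg μ).const_mul L).rexp).const_mul ε).sub_const ε
    simpa [β] using this
  have hβ'lim : Tendsto β' atBot (𝓝 0) := by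
    have := ((tendsto_exp_sg μ).const_mul (2 * L)).mul (hβlim.add_const ε)
    simpa [β'] using this
  have hdlim : Tendsto (fun s => φ s - TT μ s) atBot (𝓝 0) := by
    simpa using hφ0.sub (tendsto_TT μ)
  have hd'lim : Tendsto (fun s => p s - TT' μ s) atBot (𝓝 0) := by
    simpa using hp0.sub (tendsto_TT' μ)
  have improve : ∀ s₀ ≤ a, (∀ s ≤ s₀, |φ s - TT μ s| ≤ β s) →
      (∀ s ≤ s₀, |p s - TT' μ s| ≤ β' s) ∧ |φ s₀ - TT μ s₀| ≤ β s₀ - ε := by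
    intro s₀ hs₀ hyp
    have h1 : ∀ s ≤ s₀, |p s - TT' μ s| ≤ β' s := fun s₁ hs₁ => by
      refine abs_le_of_deriv_le_atBot (F := fun s => p s - TT' μ s) (G := β') (a := s₁)
        (fun s hs => (hp s (by linarith)).sub (hasDerivAt_TT' μ s)) (fun s _ => hβ' s)
        (fun s hs => ?_) hd'lim hβ'lim
      have hsa : s ≤ a := by linarith
      have hb : |φ s - TT μ s| ≤ β s := hyp s (by linarith)
      have hb1 : β s ≤ 1 := (hβmono hsa).trans hsmall
      have := abs_bubble_source_sub_le hγ (TT_nonneg μ s) (TT_mono hsa) (hε ▸ hε1)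
        (hb.trans hb1)
      rw [← mul_sub, abs_mul, abs_of_pos (exp_pos _)]
      rw [← hε, ← hL] at this
      have k1 : L * |φ s - TT μ s| ≤ L * β s := mul_le_mul_of_nonneg_left hb hL0.le
      have k2 : L * ε ≤ L * β s := mul_le_mul_of_nonneg_left (hβpos s) hL0.le
      have k3 : 0 ≤ L * β s := mul_nonneg hL0.le (hε0.le.trans (hβpos s))
      have k4 := mul_le_mul_of_nonneg_left (show |(1 - φ s / γ ^ 2) *
        exp (-2 * φ s + φ s ^ 2 / γ ^ 2) - exp (-(2 * TT μ s))| ≤ 4 * (L * β s) by linarith)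
        (exp_pos (sg μ s)).le
      have k5 : 0 ≤ 4 * L ^ 2 * exp (sg μ s) ^ 2 * β s :=
        mul_nonneg (by positivity) (hε0.le.trans (hβpos s))
      linarith
    refine ⟨h1, ?_⟩
    exact abs_le_of_deriv_le_atBot (F := fun s => φ s - TT μ s) (G := fun s => β s - ε)
      (fun s hs => (hφ s (by linarith)).sub (hasDerivAt_TT μ s))
      (fun s _ => (hβ s).sub_const ε) h1 hdlim hβlim
  have all : ∀ s ≤ a, |φ s - TT μ s| ≤ β s := by
    by_contra! hcon
    obtain ⟨s₁, hs₁a, hs₁⟩ := hcon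
    obtain ⟨t, ht⟩ := ((hdlim.abs.eventually_lt_const (u := ε)
      (by rw [abs_zero]; exact hε0))).exists_forall_of_atBot
    have hts : t ≤ s₁ := by
      by_contra! h
      exact absurd (ht s₁ h.le) (not_lt.2 ((hβpos s₁).trans hs₁.le))
    have hcd : ContinuousOn (fun s => |φ s - TT μ s|) (Icc t s₁) := fun s hs =>
      (((hφ s (hs.2.trans hs₁a)).continuousAt.sub (hasDerivAt_TT μ s).continuousAt).abs).continuousWithinAt
    have hcβ : Continuous β := continuous_iff_continuousAt.2 fun s => (hβ s).continuousAt
    have hcl : IsClosed {s ∈ Icc t s₁ | β s ≤ |φ s - TT μ s|} :=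
      isClosed_Icc.isClosed_le hcβ.continuousOn hcd
    have hcpt : IsCompact {s ∈ Icc t s₁ | β s ≤ |φ s - TT μ s|} :=
      isCompact_Icc.of_isClosed_subset hcl (fun s hs => hs.1)
    obtain ⟨s₀, ⟨hs₀I, hs₀⟩, hmin⟩ := hcpt.exists_isLeast ⟨s₁, ⟨hts, le_rfl⟩, hs₁.le⟩
    have hbelow : ∀ s < s₀, |φ s - TT μ s| ≤ β s := fun s hs => by
      by_cases h : s ≤ t
      · exact (ht s h).le.trans (hβpos s)
      · by_contra! h'
        exact absurd (hmin ⟨⟨(not_le.1 h).le, hs.le.trans hs₀I.2⟩, h'.le⟩) (not_le.2 hs)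
    have hs₀a : s₀ ≤ a := hs₀I.2.trans hs₁a
    have hat : |φ s₀ - TT μ s₀| ≤ β s₀ := by
      have c1 : ContinuousAt (fun s => |φ s - TT μ s|) s₀ :=
        ((hφ s₀ hs₀a).continuousAt.sub (hasDerivAt_TT μ s₀).continuousAt).abs
      refine le_of_tendsto_of_tendsto (c1.tendsto.mono_left nhdsWithin_le_nhds)
        (hcβ.continuousAt.tendsto.mono_left nhdsWithin_le_nhds) ?_ (b := 𝓝[<] s₀)
      filter_upwards [self_mem_nhdsWithin] with s hs using hbelow s hs
    have := (improve s₀ hs₀a fun s hs => by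
      rcases hs.lt_or_eq with h | h
      · exact hbelow s h
      · rw [h]; exact hat).2
    linarith
  intro s hs
  refine ⟨(all s hs).trans (hβmono hs), ?_⟩
  refine ((improve s hs fun t ht => all t (ht.trans hs)).1 s le_rfl).trans ?_
  have h1 := hβmono hs
  have h2 := exp_le_exp.2 (sg_mono (μ := μ) hs)
  have h3 := hε0.le.trans (hβpos s)
  exact mul_le_mul (by gcongr) h1 h3 (by positivity)

/-- logarithmic polar coordinates -/
def pol (s θ : ℝ) : ℂ := Complex.exp (s + θ * Complex.I)

theorem norm_pol (s θ : ℝ) : ‖pol s θ‖ = exp s := by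
  rw [pol, Complex.norm_exp]; simp

theorem pol_mem {s : ℝ} (hs : s < 0) (θ : ℝ) : pol s θ ∈ ball (0 : ℂ) 1 := by
  rw [mem_ball_zero_iff, norm_pol]; exact Real.exp_lt_one_iff.2 hs

theorem hasDerivAt_pol_left (s θ : ℝ) : HasDerivAt (fun t => pol t θ) (pol s θ) s := by
  have := (((Complex.ofRealCLM.hasDerivAt (x := s)).add_const (θ * Complex.I))).cexp
  simpa [pol] using this

theorem hasDerivAt_pol_right (s θ : ℝ) : HasDerivAt (pol s) (Complex.I * pol s θ) θ := by
  have := ((((Complex.ofRealCLM.hasDerivAt (x := θ)).mul_const Complex.I).const_add (s : ℂ))).cexp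
  refine this.congr_deriv ?_
  simp [pol, mul_comm]

theorem continuous_pol : Continuous (Function.uncurry pol) := by
  simp only [Function.uncurry_def, pol]; fun_prop

theorem pol_period (s : ℝ) : pol s (2 * π) = pol s 0 := by
  simp only [pol, Complex.exp_add]
  have := Complex.exp_two_pi_mul_I
  push_cast
  rw [this]; simp

/-- A smooth positive-weight solution on the unit disc in complex notation. -/
structure PlaneSol (lam : ℝ) (f v : ℂ → ℝ) : Prop where
  cf : ContDiffOn ℝ (⊤ : ℕ∞) f (ball 0 1)
  cv : ContDiffOn ℝ (⊤ : ℕ∞) v (ball 0 1)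
  pde : ∀ z ∈ ball (0 : ℂ) 1, fderiv ℝ (fderiv ℝ v) z 1 1
    + fderiv ℝ (fderiv ℝ v) z Complex.I Complex.I = -(lam * f z * v z * exp (v z ^ 2))

section smooth
variable {g : ℂ → ℝ} {z : ℂ}

theorem hasFDerivAt_of_smooth (hg : ContDiffOn ℝ (⊤ : ℕ∞) g (ball 0 1)) (hz : z ∈ ball (0 : ℂ) 1) :
    HasFDerivAt g (fderiv ℝ g z) z :=
  ((hg.contDiffAt (isOpen_ball.mem_nhds hz)).differentiableAt (by simp)).hasFDerivAt

theorem contDiffOn_fderiv_ball (hg : ContDiffOn ℝ (⊤ : ℕ∞) g (ball 0 1)) :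
    ContDiffOn ℝ (⊤ : ℕ∞) (fderiv ℝ g) (ball 0 1) :=
  hg.fderiv_of_isOpen isOpen_ball (by simp)

theorem hasFDerivAt_fderiv_of_smooth (hg : ContDiffOn ℝ (⊤ : ℕ∞) g (ball 0 1))
    (hz : z ∈ ball (0 : ℂ) 1) : HasFDerivAt (fderiv ℝ g) (fderiv ℝ (fderiv ℝ g) z) z :=
  (((contDiffOn_fderiv_ball hg).contDiffAt (isOpen_ball.mem_nhds hz)).differentiableAt
    (by simp)).hasFDerivAt

theorem continuousOn_fderiv_fderiv (hg : ContDiffOn ℝ (⊤ : ℕ∞) g (ball 0 1)) :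
    ContinuousOn (fderiv ℝ (fderiv ℝ g)) (ball 0 1) :=
  ((contDiffOn_fderiv_ball hg).fderiv_of_isOpen (m := (⊤ : ℕ∞)) isOpen_ball (by simp)).continuousOn

theorem fderiv_fderiv_symm (hg : ContDiffOn ℝ (⊤ : ℕ∞) g (ball 0 1)) (hz : z ∈ ball (0 : ℂ) 1)
    (h k : ℂ) : fderiv ℝ (fderiv ℝ g) z h k = fderiv ℝ (fderiv ℝ g) z k h := by
  have := (hg.contDiffAt (isOpen_ball.mem_nhds hz)).isSymmSndFDerivAt
    (by simp only [minSmoothness_of_isRCLikeNormedField]; exact ENat.LEInfty.out)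
  exact this h k

end smooth

theorem sndDeriv_rotate (T : ℂ →L[ℝ] ℂ →L[ℝ] ℝ) (x : ℂ) :
    T x x + T (Complex.I * x) (Complex.I * x) = ‖x‖ ^ 2 * (T 1 1 + T Complex.I Complex.I) := by
  have h1 : x = x.re • (1 : ℂ) + x.im • Complex.I := by
    simp only [Complex.real_smul, mul_one]; exact (Complex.re_add_im x).symm
  have h2 : Complex.I * x = (-x.im) • (1 : ℂ) + x.re • Complex.I := by
    apply Complex.ext <;> simp
  rw [h2]
  have h3 : ‖x‖ ^ 2 = x.re ^ 2 + x.im ^ 2 := by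
    rw [← Complex.normSq_eq_norm_sq, Complex.normSq_apply]; ring
  rw [h3]
  have e1 : T x x = T (x.re • (1 : ℂ) + x.im • Complex.I) (x.re • (1 : ℂ) + x.im • Complex.I) := by
    rw [← h1]
  rw [e1]
  simp only [map_add, map_smul, add_apply, smul_apply,
    smul_eq_mul]
  ring

theorem continuousOn_comp_pol {E : Type*} [TopologicalSpace E] {g : ℂ → E}
    (hg : ContinuousOn g (ball 0 1)) :
    ContinuousOn (fun x : ℝ × ℝ => g (pol x.1 x.2)) (Iio 0 ×ˢ univ) :=
  hg.comp continuous_pol.continuousOn fun x hx => pol_mem hx.1 x.2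

theorem hasDerivAt_comp_pol_left {E : Type*} [NormedAddCommGroup E] [NormedSpace ℝ E] {g : ℂ → E}
    {g' : ℂ →L[ℝ] E} {s θ : ℝ} (h : HasFDerivAt g g' (pol s θ)) :
    HasDerivAt (fun t => g (pol t θ)) (g' (pol s θ)) s :=
  h.comp_hasDerivAt s (hasDerivAt_pol_left s θ)

theorem hasDerivAt_comp_pol_right {E : Type*} [NormedAddCommGroup E] [NormedSpace ℝ E] {g : ℂ → E}
    {g' : ℂ →L[ℝ] E} {s θ : ℝ} (h : HasFDerivAt g g' (pol s θ)) :
    HasDerivAt (fun t => g (pol s t)) (g' (Complex.I * pol s θ)) θ :=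
  h.comp_hasDerivAt θ (hasDerivAt_pol_right s θ)

/-- A planar solution in logarithmic polar coordinates. -/
def PlaneSol.cyl {lam : ℝ} {f v : ℂ → ℝ} (S : PlaneSol lam f v) : Cyl 0 lam where
  u s θ := v (pol s θ)
  us s θ := fderiv ℝ v (pol s θ) (pol s θ)
  ut s θ := fderiv ℝ v (pol s θ) (Complex.I * pol s θ)
  uss s θ := fderiv ℝ (fderiv ℝ v) (pol s θ) (pol s θ) (pol s θ) + fderiv ℝ v (pol s θ) (pol s θ)
  ust s θ := fderiv ℝ (fderiv ℝ v) (pol s θ) (pol s θ) (Complex.I * pol s θ)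
    + fderiv ℝ v (pol s θ) (Complex.I * pol s θ)
  utt s θ := fderiv ℝ (fderiv ℝ v) (pol s θ) (Complex.I * pol s θ) (Complex.I * pol s θ)
    - fderiv ℝ v (pol s θ) (pol s θ)
  f s θ := f (pol s θ)
  fs s θ := fderiv ℝ f (pol s θ) (pol s θ)
  ft s θ := fderiv ℝ f (pol s θ) (Complex.I * pol s θ)
  hus s hs θ := hasDerivAt_comp_pol_left (hasFDerivAt_of_smooth S.cv (pol_mem hs θ))
  hut s hs θ := hasDerivAt_comp_pol_right (hasFDerivAt_of_smooth S.cv (pol_mem hs θ))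
  huss s hs θ := (hasDerivAt_comp_pol_left
    (hasFDerivAt_fderiv_of_smooth S.cv (pol_mem hs θ))).clm_apply (hasDerivAt_pol_left s θ)
  hust s hs θ := (hasDerivAt_comp_pol_left
    (hasFDerivAt_fderiv_of_smooth S.cv (pol_mem hs θ))).clm_apply
      ((hasDerivAt_pol_left s θ).const_mul Complex.I)
  hust' s hs θ := by
    refine ((hasDerivAt_comp_pol_right (hasFDerivAt_fderiv_of_smooth S.cv
      (pol_mem hs θ))).clm_apply (hasDerivAt_pol_right s θ)).congr_deriv ?_
    rw [fderiv_fderiv_symm S.cv (pol_mem hs θ)]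
  hutt s hs θ := by
    refine ((hasDerivAt_comp_pol_right (hasFDerivAt_fderiv_of_smooth S.cv
      (pol_mem hs θ))).clm_apply ((hasDerivAt_pol_right s θ).const_mul Complex.I)).congr_deriv ?_
    have : Complex.I * (Complex.I * pol s θ) = - pol s θ := by
      rw [← mul_assoc, Complex.I_mul_I, neg_one_mul]
    rw [this, map_neg]; ring
  hfs s hs θ := hasDerivAt_comp_pol_left (hasFDerivAt_of_smooth S.cf (pol_mem hs θ))
  hft s hs θ := hasDerivAt_comp_pol_right (hasFDerivAt_of_smooth S.cf (pol_mem hs θ))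
  cu := continuousOn_comp_pol S.cv.continuousOn
  cus := (continuousOn_comp_pol (contDiffOn_fderiv_ball S.cv).continuousOn).clm_apply
    continuous_pol.continuousOn
  cut := (continuousOn_comp_pol (contDiffOn_fderiv_ball S.cv).continuousOn).clm_apply
    (continuous_pol.const_mul Complex.I).continuousOn
  cuss := (((continuousOn_comp_pol (continuousOn_fderiv_fderiv S.cv)).clm_apply
    continuous_pol.continuousOn).clm_apply continuous_pol.continuousOn).add
    ((continuousOn_comp_pol (contDiffOn_fderiv_ball S.cv).continuousOn).clm_apply
    continuous_pol.continuousOn)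
  cust := (((continuousOn_comp_pol (continuousOn_fderiv_fderiv S.cv)).clm_apply
    continuous_pol.continuousOn).clm_apply (continuous_pol.const_mul Complex.I).continuousOn).add
    ((continuousOn_comp_pol (contDiffOn_fderiv_ball S.cv).continuousOn).clm_apply
    (continuous_pol.const_mul Complex.I).continuousOn)
  cutt := (((continuousOn_comp_pol (continuousOn_fderiv_fderiv S.cv)).clm_apply
    (continuous_pol.const_mul Complex.I).continuousOn).clm_apply
    (continuous_pol.const_mul Complex.I).continuousOn).sub
    ((continuousOn_comp_pol (contDiffOn_fderiv_ball S.cv).continuousOn).clm_apply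
    continuous_pol.continuousOn)
  cf := continuousOn_comp_pol S.cf.continuousOn
  cfs := (continuousOn_comp_pol (contDiffOn_fderiv_ball S.cf).continuousOn).clm_apply
    continuous_pol.continuousOn
  cft := (continuousOn_comp_pol (contDiffOn_fderiv_ball S.cf).continuousOn).clm_apply
    (continuous_pol.const_mul Complex.I).continuousOn
  pu s _ := by simp only [pol_period]
  pus s _ := by simp only [pol_period]
  put s _ := by simp only [pol_period]
  pf s _ := by simp only [pol_period]
  pde s hs θ := by
    have h1 := sndDeriv_rotate (fderiv ℝ (fderiv ℝ v) (pol s θ)) (pol s θ)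
    rw [S.pde _ (pol_mem hs θ), norm_pol] at h1
    have h2 : exp (2 * s) = exp s ^ 2 := by rw [two_mul, exp_add, sq]
    rw [h2]
    linear_combination h1

/-- A smooth solution of the radial equation. -/
structure RadSol (lam f0 : ℝ) (B : ℝ → ℝ) : Prop where
  cB : ContDiff ℝ (⊤ : ℕ∞) B
  ode : ∀ r > (0 : ℝ), deriv (deriv B) r + deriv B r / r = -(lam * f0 * B r * exp (B r ^ 2))

namespace RadSol
variable {lam f0 : ℝ} {B : ℝ → ℝ}

theorem hasDerivAt (S : RadSol lam f0 B) (r : ℝ) : HasDerivAt B (deriv B r) r :=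
  (S.cB.differentiable (by simp) r).hasDerivAt

theorem cB' (S : RadSol lam f0 B) : ContDiff ℝ (⊤ : ℕ∞) (deriv B) :=
  (contDiff_infty_iff_deriv.1 S.cB).2

theorem hasDerivAt' (S : RadSol lam f0 B) (r : ℝ) : HasDerivAt (deriv B) (deriv (deriv B) r) r :=
  (S.cB'.differentiable (by simp) r).hasDerivAt

theorem cB'' (S : RadSol lam f0 B) : ContDiff ℝ (⊤ : ℕ∞) (deriv (deriv B)) :=
  (contDiff_infty_iff_deriv.1 S.cB').2

/-- A radial solution in logarithmic polar coordinates. -/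
def cyl (S : RadSol lam f0 B) : Cyl 1 lam where
  u s _ := B (exp s)
  us s _ := deriv B (exp s) * exp s
  ut _ _ := 0
  uss s _ := deriv (deriv B) (exp s) * exp s * exp s + deriv B (exp s) * exp s
  ust _ _ := 0
  utt _ _ := 0
  f _ _ := f0
  fs _ _ := 0
  ft _ _ := 0
  hus s _ _ := (S.hasDerivAt (exp s)).comp s (Real.hasDerivAt_exp s)
  hut s _ θ := hasDerivAt_const _ _
  huss s _ _ := ((S.hasDerivAt' (exp s)).comp s (Real.hasDerivAt_exp s)).mul (Real.hasDerivAt_exp s)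
  hust s _ θ := hasDerivAt_const _ _
  hust' s _ θ := hasDerivAt_const _ _
  hutt s _ θ := hasDerivAt_const _ _
  hfs s _ θ := hasDerivAt_const _ _
  hft s _ θ := hasDerivAt_const _ _
  cu := by
    have := S.cB.continuous
    simp only [Function.uncurry_def]; fun_prop
  cus := by
    have := S.cB'.continuous
    simp only [Function.uncurry_def]; fun_prop
  cut := continuousOn_const
  cuss := by
    have := S.cB'.continuous
    have := S.cB''.continuous
    simp only [Function.uncurry_def]; fun_prop
  cust := continuousOn_const
  cutt := continuousOn_const
  cf := continuousOn_const
  cfs := continuousOn_const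
  cft := continuousOn_const
  pu _ _ := rfl
  pus _ _ := rfl
  put _ _ := rfl
  pf _ _ := rfl
  pde s _ θ := by
    have h1 := S.ode (exp s) (exp_pos s)
    have h2 : exp (2 * s) = exp s * exp s := by rw [two_mul, exp_add]
    have h3 : deriv B (exp s) / exp s * exp s = deriv B (exp s) := by
      field_simp
    rw [h2]
    linear_combination exp s * exp s * h1 - exp s * h3

end RadSol

theorem pol_periodic (s : ℝ) : Function.Periodic (pol s) (2 * π) := fun θ => by
  have := pol_period s
  simp only [pol] at *
  rw [show (s : ℂ) + ((θ + 2 * π : ℝ) : ℂ) * Complex.I = (s + θ * Complex.I) + 2 * π * Complex.I by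
    push_cast; ring, Complex.exp_add, Complex.exp_two_pi_mul_I, mul_one]

/-- The rescaled blow-up data on the unit disc at a fixed parameter. -/
structure Sys (γ μ lam C₀ Cf D : ℝ) (f v : ℂ → ℝ) (B : ℝ → ℝ) : Prop where
  sol : PlaneSol lam f v
  rad : RadSol lam (f 0) B
  hγ : 1 ≤ γ
  hμ : 0 < μ
  hC₀ : 0 < C₀
  hCf : 0 ≤ Cf
  hD : 0 ≤ D
  hf0 : C₀⁻¹ ≤ f 0
  hf0' : f 0 ≤ C₀
  hnorm : μ ^ 2 * (lam * f 0 * γ ^ 2 * exp (γ ^ 2)) = 1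
  hvpos : ∀ z ∈ ball (0 : ℂ) 1, 0 < v z
  hdf : ∀ z ∈ ball (0 : ℂ) 1, ‖fderiv ℝ f z‖ ≤ Cf
  hddf : ∀ z ∈ ball (0 : ℂ) 1, ‖fderiv ℝ (fderiv ℝ f) z‖ ≤ Cf
  hdv : ∀ z ∈ ball (0 : ℂ) 1, ‖z‖ * ‖fderiv ℝ v z‖ ≤ D / γ
  hB0 : B 0 = γ

/-- Closeness of the rescaled solution to the bubble on the disc of radius `exp ℓ`. -/
def BubClose (γ μ : ℝ) (v : ℂ → ℝ) (ℓ η : ℝ) : Prop :=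
  ∀ x : ℂ, ‖x‖ ≤ exp ℓ → |γ * (v (μ • x) - γ) + log (1 + ‖x‖ ^ 2 / 4)| ≤ η ∧
    ∀ e : ℂ, |γ * (μ * fderiv ℝ v (μ • x) e)
      + (x.re * e.re + x.im * e.im) / 2 / (1 + ‖x‖ ^ 2 / 4)| ≤ η * exp (-ℓ) * ‖e‖

theorem norm_sub_le_of_fderiv_ball {E : Type*} [NormedAddCommGroup E] [NormedSpace ℝ E]
    {g : ℂ → E} {g' : ℂ → ℂ →L[ℝ] E} {C : ℝ} (hg : ∀ z ∈ ball (0 : ℂ) 1, HasFDerivAt g (g' z) z)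
    (hC : ∀ z ∈ ball (0 : ℂ) 1, ‖g' z‖ ≤ C) {z : ℂ} (hz : z ∈ ball (0 : ℂ) 1) :
    ‖g z - g 0‖ ≤ C * ‖z‖ := by
  have := (convex_ball (0 : ℂ) 1).norm_image_sub_le_of_norm_hasFDerivWithin_le
    (fun z hz => (hg z hz).hasFDerivWithinAt) hC (mem_ball_self one_pos) hz
  simpa using this

namespace Sys
variable {γ μ lam C₀ Cf D : ℝ} {f v : ℂ → ℝ} {B : ℝ → ℝ} {s : ℝ}

theorem abs_us (S : Sys γ μ lam C₀ Cf D f v B) (hs : s < 0) (θ : ℝ) :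
    |S.sol.cyl.us s θ| ≤ D / γ := by
  have h1 := S.hdv _ (pol_mem hs θ)
  rw [mul_comm] at h1
  exact ((fderiv ℝ v (pol s θ)).le_opNorm _).trans h1

theorem abs_ut (S : Sys γ μ lam C₀ Cf D f v B) (hs : s < 0) (θ : ℝ) :
    |S.sol.cyl.ut s θ| ≤ D / γ := by
  have h1 := S.hdv _ (pol_mem hs θ)
  rw [mul_comm] at h1
  refine ((fderiv ℝ v (pol s θ)).le_opNorm _).trans ?_
  rwa [norm_mul, Complex.norm_I, one_mul]

theorem abs_u_sub (S : Sys γ μ lam C₀ Cf D f v B) (hs : s < 0) (θ θ' : ℝ) :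
    |S.sol.cyl.u s θ - S.sol.cyl.u s θ'| ≤ 2 * π * D / γ := by
  have hper : Function.Periodic (S.sol.cyl.u s) (2 * π) := fun t => by
    change v (pol s (t + 2 * π)) = v (pol s t)
    rw [pol_periodic]
  obtain ⟨t, ht, het⟩ := hper.exists_mem_Ico Real.two_pi_pos θ' θ
  rw [het]
  have h := (convex_univ (𝕜 := ℝ) (E := ℝ)).norm_image_sub_le_of_norm_hasDerivWithin_le
    (fun θ _ => (S.sol.cyl.hut s hs θ).hasDerivWithinAt) (fun θ _ => S.abs_ut hs θ)
    (mem_univ t) (mem_univ θ)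
  rw [Real.norm_eq_abs, Real.norm_eq_abs] at h
  rw [abs_sub_comm]
  have h0 : 0 ≤ D / γ := div_nonneg S.hD (by linarith [S.hγ])
  have h1 : |θ - t| ≤ 2 * π := by
    rw [abs_le]; constructor <;> linarith [ht.1, ht.2]
  rw [abs_sub_comm] at h
  calc _ ≤ D / γ * |θ - t| := h
    _ ≤ D / γ * (2 * π) := mul_le_mul_of_nonneg_left h1 h0
    _ = _ := by ring

theorem two_le_two_pi : (2 : ℝ) ≤ 2 * π := by linarith [Real.pi_gt_three]

theorem cylBd (S : Sys γ μ lam C₀ Cf D f v B) (hs : s < 0) :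
    CylBd S.sol.cyl γ μ (f 0) C₀ Cf (2 * π * D) 0 s where
  hs := hs
  hs0 := hs.le
  hγ := S.hγ
  hμ := S.hμ
  hC₀ := S.hC₀
  hCf := S.hCf
  hD := by have := S.hD; positivity
  hK := le_rfl
  hf0 := S.hf0
  hf0' := S.hf0'
  hnorm := S.hnorm
  hu θ := by
    have c := continuous_slice S.sol.cyl.cu hs
    have e : S.sol.cyl.u s θ - S.sol.cyl.y s
        = cavg (fun _ => S.sol.cyl.u s θ) - cavg (S.sol.cyl.u s) := by rw [cavg_const]; rfl
    rw [e]
    exact abs_cavg_sub_le continuous_const c fun t => S.abs_u_sub hs θ t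
  hus θ := by
    refine (abs_sub _ _).trans ?_
    have h0 : 0 ≤ D / γ := div_nonneg S.hD (by linarith [S.hγ])
    have h1 := S.abs_us hs θ
    have h2 := abs_cavg_le (S.abs_us hs)
    have h3 : 2 * (D / γ) ≤ 2 * π * (D / γ) := mul_le_mul_of_nonneg_right two_le_two_pi h0
    calc _ ≤ 2 * (D / γ) := by linarith
      _ ≤ 2 * π * (D / γ) := h3
      _ = _ := by ring
  hf θ := by
    have := norm_sub_le_of_fderiv_ball (fun z hz => hasFDerivAt_of_smooth S.sol.cf hz) S.hdf
      (pol_mem hs θ)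
    rwa [norm_pol] at this
  hfs θ := by
    have := ((fderiv ℝ f (pol s θ)).le_opNorm (pol s θ)).trans
      (mul_le_mul_of_nonneg_right (S.hdf _ (pol_mem hs θ)) (norm_nonneg _))
    rwa [norm_pol] at this
  hφ := by
    have h1 : 0 ≤ S.sol.cyl.y s := cavg_nonneg fun θ => (S.hvpos _ (pol_mem hs θ)).le
    have h2 : 0 ≤ γ * S.sol.cyl.y s := mul_nonneg (by linarith [S.hγ]) h1
    unfold Cyl.phi
    linarith

theorem exp_sg (S : Sys γ μ lam C₀ Cf D f v B) (s : ℝ) : exp (sg μ s) = (exp s / μ) ^ 2 := by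
  rw [sg, two_mul, exp_add, exp_sub, exp_log S.hμ, sq]

theorem bub (S : Sys γ μ lam C₀ Cf D f v B) {ℓ η : ℝ} (hη : η ≤ 1)
    (hcl : BubClose γ μ v ℓ η) (ha : ℓ + log μ < 0)
    (hm : (log (1 + exp (2 * ℓ) / 4) + 1) ^ 2 / γ ^ 2 ≤ η) (hexp : γ ^ 2 * exp (-γ ^ 2) ≤ η)
    (hCa : Cf * exp (ℓ + log μ) ≤ η) :
    Bub S.sol.cyl γ μ (f 0) C₀ Cf η (ℓ + log μ) := by
  have hμ := S.hμ
  have hη0 : 0 ≤ η := (by have := S.hCf; positivity : 0 ≤ Cf * exp (ℓ + log μ)).trans hCa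
  have hx : ∀ s ≤ ℓ + log μ, ∀ θ, ∃ x : ℂ, ‖x‖ ≤ exp ℓ ∧ μ • x = pol s θ ∧
      ‖x‖ ^ 2 = exp (sg μ s) := fun s hs θ => by
    refine ⟨μ⁻¹ • pol s θ, ?_, ?_, ?_⟩
    · rw [norm_smul, norm_pol, Real.norm_of_nonneg (by positivity), ← Real.exp_log hμ, ← exp_neg,
        ← exp_add]
      exact exp_le_exp.2 (by linarith)
    · rw [smul_smul, mul_inv_cancel₀ hμ.ne', one_smul]
    · rw [norm_smul, norm_pol, Real.norm_of_nonneg (by positivity), S.exp_sg]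
      congr 1; field_simp
  have hsg : sg μ (ℓ + log μ) = 2 * ℓ := by rw [sg]; ring
  refine ⟨ha, ha.le, S.hγ, hμ, S.hC₀, S.hCf, S.hf0, S.hf0', S.hnorm, hη, ?_, ?_, ?_, ?_, ?_, ?_,
    ?_, hexp, hCa⟩
  · intro s hs θ
    obtain ⟨x, h1, h2, h3⟩ := hx s hs θ
    have := (hcl x h1).1
    rw [h2, h3] at this
    exact this
  · intro s hs θ
    obtain ⟨x, h1, h2, h3⟩ := hx s hs θ
    have h4 := (hcl x h1).2 x
    have e1 : γ * (μ * fderiv ℝ v (μ • x) x) = γ * S.sol.cyl.us s θ := by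
      change _ = γ * fderiv ℝ v (pol s θ) (pol s θ)
      rw [← h2, map_smul, smul_eq_mul]
    have e2 : (x.re * x.re + x.im * x.im) / 2 / (1 + ‖x‖ ^ 2 / 4) = TT' μ s := by
      rw [← Complex.normSq_apply, Complex.normSq_eq_norm_sq, h3, TT', exp_neg, exp_TT]
      rfl
    rw [e1, e2] at h4
    refine h4.trans ?_
    rw [mul_assoc]
    have : exp (-ℓ) * ‖x‖ ≤ 1 := by
      have := mul_le_mul_of_nonneg_left h1 (exp_pos (-ℓ)).le
      rwa [← exp_add, neg_add_cancel, exp_zero] at this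
    have := mul_le_mul_of_nonneg_left this hη0
    linarith
  · intro s hs θ
    obtain ⟨x, h1, h2, h3⟩ := hx s hs θ
    have h4 := (hcl x h1).2 (Complex.I * x)
    have e1 : γ * (μ * fderiv ℝ v (μ • x) (Complex.I * x)) = γ * S.sol.cyl.ut s θ := by
      change _ = γ * fderiv ℝ v (pol s θ) (Complex.I * pol s θ)
      rw [← h2, mul_smul_comm, map_smul, smul_eq_mul]
    have e2 : (x.re * (Complex.I * x).re + x.im * (Complex.I * x).im) / 2 / (1 + ‖x‖ ^ 2 / 4)
        = 0 := by
      have : x.re * (Complex.I * x).re + x.im * (Complex.I * x).im = 0 := by simp; ring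
      rw [this]; simp
    rw [e1, e2, add_zero, norm_mul, Complex.norm_I, one_mul] at h4
    refine h4.trans ?_
    rw [mul_assoc]
    have : exp (-ℓ) * ‖x‖ ≤ 1 := by
      have := mul_le_mul_of_nonneg_left h1 (exp_pos (-ℓ)).le
      rwa [← exp_add, neg_add_cancel, exp_zero] at this
    have := mul_le_mul_of_nonneg_left this hη0
    linarith
  · obtain ⟨a, haa⟩ : ∃ a, a = ℓ + log μ := ⟨_, rfl⟩
    rw [← haa] at ha ⊢
    have hsub : closedBall (0 : ℂ) (exp a) ⊆ ball 0 1 :=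
      closedBall_subset_ball (Real.exp_lt_one_iff.2 ha)
    obtain ⟨M, hM⟩ := (isCompact_closedBall (0 : ℂ) (exp a)).exists_bound_of_continuousOn
      ((contDiffOn_fderiv_ball S.sol.cv).continuousOn.mono hsub)
    refine ⟨M, fun s hs θ => ?_⟩
    have hin : pol s θ ∈ closedBall (0 : ℂ) (exp a) := by
      rw [mem_closedBall_zero_iff, norm_pol]; exact exp_le_exp.2 hs
    have h1 := hM _ hin
    constructor
    · have := ((fderiv ℝ v (pol s θ)).le_opNorm (pol s θ)).trans
        (mul_le_mul_of_nonneg_right h1 (norm_nonneg _))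
      rwa [norm_pol] at this
    · have := ((fderiv ℝ v (pol s θ)).le_opNorm (Complex.I * pol s θ)).trans
        (mul_le_mul_of_nonneg_right h1 (norm_nonneg _))
      rwa [norm_mul, Complex.norm_I, one_mul, norm_pol] at this
  · exact fun s hs θ => (S.cylBd (hs.trans_lt ha)).hf θ
  · exact fun s hs θ => (S.cylBd (hs.trans_lt ha)).hfs θ
  · rw [TT, hsg]; exact hm

end Sys

/-- error factor in the comparison of the radial solution with the bubble -/
def bubErr (ℓ : ℝ) : ℝ := (log (1 + exp (2 * ℓ) / 4) + 1) ^ 2 *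
  exp (2 * exp 3 * exp (2 * ℓ)) * (1 + 2 * (2 * exp 3) * exp (2 * ℓ))

theorem sg_add_log (μ ℓ : ℝ) : sg μ (ℓ + log μ) = 2 * ℓ := by rw [sg]; ring

theorem sq_le_bubErr (ℓ : ℝ) : (log (1 + exp (2 * ℓ) / 4) + 1) ^ 2 ≤ bubErr ℓ := by
  unfold bubErr
  have h1 : 1 ≤ exp (2 * exp 3 * exp (2 * ℓ)) := Real.one_le_exp (by positivity)
  have h2 : 1 ≤ 1 + 2 * (2 * exp 3) * exp (2 * ℓ) := by
    have : 0 < 2 * (2 * exp 3) * exp (2 * ℓ) := by positivity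
    linarith
  rw [mul_assoc]
  exact le_mul_of_one_le_right (sq_nonneg _) (one_le_mul_of_one_le_of_one_le h1 h2)

namespace Sys
variable {γ μ lam C₀ Cf D : ℝ} {f v : ℂ → ℝ} {B : ℝ → ℝ} {s : ℝ}

theorem phi_rad (S : Sys γ μ lam C₀ Cf D f v B) (s : ℝ) :
    S.rad.cyl.phi γ s = γ ^ 2 - γ * B (exp s) := by
  have : S.rad.cyl.y s = B (exp s) := cavg_const _
  rw [Cyl.phi, this]

theorem p_rad (S : Sys γ μ lam C₀ Cf D f v B) (s : ℝ) :
    S.rad.cyl.p γ s = -γ * (deriv B (exp s) * exp s) := by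
  have : cavg (S.rad.cyl.us s) = deriv B (exp s) * exp s := cavg_const _
  rw [Cyl.p, this]

theorem q_rad (S : Sys γ μ lam C₀ Cf D f v B) (s : ℝ) :
    S.rad.cyl.q γ s = exp (sg μ s) * ((1 - S.rad.cyl.phi γ s / γ ^ 2) *
      exp (-2 * S.rad.cyl.phi γ s + S.rad.cyl.phi γ s ^ 2 / γ ^ 2)) := by
  have hγ : 0 < γ := by linarith [S.hγ]
  have hμ := S.hμ
  have : cavg (S.rad.cyl.g s) = f 0 * B (exp s) * exp (B (exp s) ^ 2) :=
    cavg_const (f 0 * B (exp s) * exp (B (exp s) ^ 2))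
  rw [Cyl.q, this, S.phi_rad, S.exp_sg]
  have e1 : -2 * (γ ^ 2 - γ * B (exp s)) + (γ ^ 2 - γ * B (exp s)) ^ 2 / γ ^ 2
      = B (exp s) ^ 2 - γ ^ 2 := by field_simp; ring
  have e2 : exp (B (exp s) ^ 2) = exp (B (exp s) ^ 2 - γ ^ 2) * exp (γ ^ 2) := by
    rw [← exp_add]; ring_nf
  have e3 : exp (2 * s) = exp s ^ 2 := by rw [two_mul, exp_add, sq]
  rw [e1, e2, e3]
  have h := S.hnorm
  have e4 : exp s ^ 2 = (exp s / μ) ^ 2 * μ ^ 2 := by field_simp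
  have e5 : 1 - (γ ^ 2 - γ * B (exp s)) / γ ^ 2 = B (exp s) / γ := by field_simp; ring
  rw [e5, e4]
  have e6 : γ * lam * ((exp s / μ) ^ 2 * μ ^ 2) *
      (f 0 * B (exp s) * (exp (B (exp s) ^ 2 - γ ^ 2) * exp (γ ^ 2)))
      = (exp s / μ) ^ 2 * (B (exp s) / γ * exp (B (exp s) ^ 2 - γ ^ 2)) *
        (μ ^ 2 * (lam * f 0 * γ ^ 2 * exp (γ ^ 2))) := by field_simp
  rw [e6, h, mul_one]

theorem bub_rad (S : Sys γ μ lam C₀ Cf D f v B) {ℓ η : ℝ} (hη : η ≤ 1)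
    (ha : ℓ + log μ < 0) (hm : bubErr ℓ / γ ^ 2 ≤ η) (hexp : γ ^ 2 * exp (-γ ^ 2) ≤ η)
    (hCa : Cf * exp (ℓ + log μ) ≤ η) :
    Bub S.rad.cyl γ μ (f 0) C₀ Cf η (ℓ + log μ) := by
  have hγ0 : 0 < γ := by linarith [S.hγ]
  have hγ2 : 0 < γ ^ 2 := by positivity
  have hCf := S.hCf
  have hsg := sg_add_log μ ℓ
  obtain ⟨ε, hε⟩ : ∃ ε, ε = (TT μ (ℓ + log μ) + 1) ^ 2 / γ ^ 2 := ⟨_, rfl⟩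
  obtain ⟨X, hX⟩ : ∃ X, X = exp (2 * exp 3 * exp (sg μ (ℓ + log μ))) := ⟨_, rfl⟩
  obtain ⟨Y, hY⟩ : ∃ Y, Y = 2 * (2 * exp 3) * exp (sg μ (ℓ + log μ)) := ⟨_, rfl⟩
  have hbe : bubErr ℓ / γ ^ 2 = ε * X * (1 + Y) := by
    rw [hε, hX, hY, TT, hsg, bubErr]; ring
  have hε0 : 0 ≤ ε := by rw [hε]; positivity
  have hX1 : 0 ≤ X := by rw [hX]; positivity
  have hY1 : 0 ≤ Y := by rw [hY]; positivity
  rw [hbe] at hm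
  have hεX : 0 ≤ ε * X := mul_nonneg hε0 hX1
  have k1 : ε * X ≤ η := by nlinarith
  have k2 : Y * (ε * X) ≤ η := by nlinarith
  have ae : Tendsto (fun s : ℝ => exp s) atBot (𝓝 0) := Real.tendsto_exp_atBot
  have key := bubble_ode (φ := S.rad.cyl.phi γ) (p := S.rad.cyl.p γ) (γ := γ) (μ := μ)
    (a := ℓ + log μ) (L := 2 * exp 3) (ε := ε) S.hγ
    (fun s hs => S.rad.cyl.hasDerivAt_phi γ (by linarith))
    (fun s hs => S.q_rad s ▸ S.rad.cyl.hasDerivAt_p γ (by linarith))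
    (by
      have h1 : Tendsto (fun s => γ ^ 2 - γ * B (exp s)) atBot (𝓝 (γ ^ 2 - γ * B 0)) :=
        tendsto_const_nhds.sub (((S.rad.cB.continuous.tendsto 0).comp ae).const_mul γ)
      rw [S.hB0, sq, sub_self] at h1
      exact h1.congr fun s => by rw [S.phi_rad, sq])
    (by
      have h1 : Tendsto (fun s => -γ * (deriv B (exp s) * exp s)) atBot
          (𝓝 (-γ * (deriv B 0 * 0))) :=
        (((S.rad.cB'.continuous.tendsto 0).comp ae).mul ae).const_mul (-γ)
      rw [mul_zero, mul_zero] at h1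
      exact h1.congr fun s => (S.p_rad s).symm)
    rfl hε (hX ▸ k1.trans hη)
  rw [← hX, ← hY] at key
  refine ⟨by linarith, ha.le, S.hγ, S.hμ, S.hC₀, S.hCf, S.hf0, S.hf0', S.hnorm, hη, ?_, ?_, ?_, ?_,
    ?_, ?_, ?_, hexp, hCa⟩
  · intro s hs θ
    have h1 := (key s hs).1.trans k1
    rw [S.phi_rad] at h1
    refine le_of_eq_of_le ?_ h1
    rw [← abs_neg]
    change |-(γ * (B (exp s) - γ) + TT μ s)| = _
    congr 1; ring
  · intro s hs θ
    have h1 := (key s hs).2.trans k2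
    rw [S.p_rad] at h1
    refine le_of_eq_of_le ?_ h1
    rw [← abs_neg]
    change |-(γ * (deriv B (exp s) * exp s) + TT' μ s)| = _
    congr 1; ring
  · intro s hs θ
    change |γ * 0| ≤ η
    rw [mul_zero, abs_zero]; exact hεX.trans k1
  · obtain ⟨M, hM⟩ := (isCompact_Icc (a := (0 : ℝ)) (b := exp (ℓ + log μ))).exists_bound_of_continuousOn
      S.rad.cB'.continuous.continuousOn
    refine ⟨M, fun s hs θ => ?_⟩
    have h1 := hM (exp s) ⟨(exp_pos s).le, exp_le_exp.2 hs⟩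
    constructor
    · change |deriv B (exp s) * exp s| ≤ _
      rw [abs_mul, abs_of_pos (exp_pos s)]
      exact mul_le_mul_of_nonneg_right h1 (exp_pos s).le
    · change |(0 : ℝ)| ≤ _
      rw [abs_zero]
      exact mul_nonneg ((norm_nonneg _).trans h1) (exp_pos s).le
  · intro s hs θ
    change |f 0 - f 0| ≤ _
    rw [sub_self, abs_zero]; positivity
  · intro s hs θ
    change |(0 : ℝ)| ≤ _
    rw [abs_zero]; positivity
  · rw [← hε]
    refine le_trans ?_ k1
    refine le_mul_of_one_le_right hε0 ?_
    rw [hX]; exact Real.one_le_exp (by positivity)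

theorem cylBd_rad (S : Sys γ μ lam C₀ Cf D f v B) {K : ℝ} (hK : 0 ≤ K) (hs : s ≤ 0)
    (hφ : S.rad.cyl.phi γ s ≤ γ ^ 2 + K) :
    CylBd S.rad.cyl γ μ (f 0) C₀ Cf 0 K s where
  hs := by linarith
  hs0 := hs
  hγ := S.hγ
  hμ := S.hμ
  hC₀ := S.hC₀
  hCf := S.hCf
  hD := le_rfl
  hK := hK
  hf0 := S.hf0
  hf0' := S.hf0'
  hnorm := S.hnorm
  hu θ := by
    have : S.rad.cyl.y s = S.rad.cyl.u s θ := cavg_const _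
    rw [this]; simp
  hus θ := by
    have : cavg (S.rad.cyl.us s) = S.rad.cyl.us s θ := cavg_const _
    rw [this]; simp
  hf θ := by
    have := S.hCf
    change |f 0 - f 0| ≤ _
    rw [sub_self, abs_zero]; positivity
  hfs θ := by
    have := S.hCf
    change |(0 : ℝ)| ≤ _
    rw [abs_zero]; positivity
  hφ := hφ

end Sys

/-- constants attached to the solution -/
abbrev Av (C₀ Cf D : ℝ) : ℝ := Ac C₀ Cf (2 * π * D) 0
abbrev A2 (D : ℝ) : ℝ := 2 * (2 * π * D) ^ 2
/-- constants attached to the radial solution -/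
abbrev KB (D : ℝ) : ℝ := A2 D + 6
abbrev AB (C₀ Cf D : ℝ) : ℝ := Ac C₀ Cf 0 (KB D)
abbrev A2B : ℝ := 2 * (0 : ℝ) ^ 2

theorem A2_nonneg (D : ℝ) : 0 ≤ A2 D := by unfold A2; positivity

namespace Sys
variable {γ μ lam C₀ Cf D : ℝ} {f v : ℂ → ℝ} {B : ℝ → ℝ} {s : ℝ}

theorem dyn_v (S : Sys γ μ lam C₀ Cf D f v B) {b a : ℝ} (hb : b < 0) :
    Dyn γ μ a b (Av C₀ Cf D) (A2 D) 0 (S.sol.cyl.phi γ) (S.sol.cyl.p γ) (S.sol.cyl.q γ)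
      (S.sol.cyl.Q γ) (S.sol.cyl.Qhat γ) (S.sol.cyl.Fq γ) (S.sol.cyl.Z γ) (S.sol.cyl.En γ)
      (S.sol.cyl.nn γ) (S.sol.cyl.err γ) :=
  S.sol.cyl.dyn fun _ hs => S.cylBd (hs.2.trans_lt hb)

theorem main_v (S : Sys γ μ lam C₀ Cf D f v B) {a h κ : ℝ}
    (DS : DynStart γ μ a (Av C₀ Cf D) (A2 D) 0 h κ (S.sol.cyl.phi γ a) (S.sol.cyl.p γ a)
      (S.sol.cyl.Z γ a) (S.sol.cyl.nn γ a)) (hs : s ∈ Ico a 0) :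
    sg μ s - K1c (A2 D) ≤ S.sol.cyl.phi γ s ∧ 0 ≤ S.sol.cyl.phi γ s ∧
    |S.sol.cyl.p γ s - 2| ≤ C3c (Av C₀ Cf D) (A2 D) 0 * h ∧
    |S.sol.cyl.phi γ s - S.sol.cyl.phi γ a - (2 + κ / (2 * γ ^ 2)) * (s - a)|
      ≤ C3c (Av C₀ Cf D) (A2 D) 0 * h + A2 D * exp (s / (2 * Av C₀ Cf D)) := by
  have h1 : s / 2 < 0 := by linarith [hs.2]
  obtain ⟨k1, k2, k3, k4⟩ := (S.dyn_v (a := a) h1).main DS (by linarith [hs.1, hs.2]) h1.le s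
    ⟨hs.1, by linarith [hs.2]⟩
  refine ⟨k1, k2, k3, ?_⟩
  convert k4 using 4
  ring

theorem main_rad (S : Sys γ μ lam C₀ Cf D f v B) {a h κ : ℝ} (hh : h ≤ 1)
    (DS : DynStart γ μ a (Av C₀ Cf D) (A2 D) 0 h κ (S.sol.cyl.phi γ a) (S.sol.cyl.p γ a)
      (S.sol.cyl.Z γ a) (S.sol.cyl.nn γ a))
    (DB : DynStart γ μ a (AB C₀ Cf D) A2B (KB D) h κ (S.rad.cyl.phi γ a) (S.rad.cyl.p γ a)
      (S.rad.cyl.Z γ a) (S.rad.cyl.nn γ a)) :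
    |S.rad.cyl.phi γ 0 - S.rad.cyl.phi γ a - (2 + κ / (2 * γ ^ 2)) * (0 - a)|
      ≤ C3c (AB C₀ Cf D) A2B (KB D) * h := by
  have ha := DS.ha
  have hA2 := A2_nonneg D
  have hKB : 0 ≤ KB D := by unfold KB; linarith
  obtain ⟨m, hm⟩ : ∃ m, m = 2 + κ / (2 * γ ^ 2) := ⟨_, rfl⟩
  have hm4 : m ≤ 4 := by
    have h1 : 1 ≤ γ ^ 2 := one_le_pow₀ S.hγ
    have : κ / (2 * γ ^ 2) ≤ 2 := by
      rw [div_le_iff₀ (by positivity)]; linarith [DS.κ4]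
    linarith
  have hm0 : 0 ≤ m := by rw [hm]; have := DS.κ0; positivity
  rw [← hm]
  have step : ∀ c ∈ Icc a 0, (∀ t ∈ Icc a c, S.rad.cyl.phi γ t ≤ γ ^ 2 + KB D) →
      |S.rad.cyl.phi γ c - S.rad.cyl.phi γ a - m * (c - a)| ≤
        C3c (AB C₀ Cf D) A2B (KB D) * h := fun c hc H => by
    have Dy := S.rad.cyl.dyn (μ := μ) (f0 := f 0) (C₀ := C₀) (Cf := Cf) (D := 0) (K := KB D)
      (a := a) (b' := c) (γ := γ) fun t ht => S.cylBd_rad hKB (ht.2.trans hc.2) (H t ht)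
    have := (Dy.main DB hc.1 hc.2 c ⟨hc.1, le_rfl⟩).2.2.2
    rw [← hm] at this
    refine this.trans (le_of_eq ?_)
    ring
  have hv : ∀ c ∈ Ico a 0, S.sol.cyl.phi γ a + m * (c - a) ≤ γ ^ 2 + 1 + A2 D := fun c hc => by
    have h1 := (S.main_v DS hc).2.2.2
    rw [← hm] at h1
    have h2 := (S.cylBd (D := D) hc.2).hφ
    have h3 : exp (c / (2 * Av C₀ Cf D)) ≤ 1 := by
      rw [Real.exp_le_one_iff]
      exact div_nonpos_of_nonpos_of_nonneg hc.2.le (by linarith [DS.hA])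
    have h4 := mul_le_mul_of_nonneg_left h3 hA2
    have := abs_le.1 h1
    linarith [DS.hC]
  have hv' : ∀ c ∈ Icc a 0, S.sol.cyl.phi γ a + m * (c - a) ≤ γ ^ 2 + 2 + A2 D := fun c hc => by
    rcases lt_or_eq_of_le hc.2 with h0 | h0
    · linarith [hv c ⟨hc.1, h0⟩]
    · have h1 := hv (max a (-1 / 4)) ⟨le_max_left _ _, max_lt ha (by norm_num)⟩
      have h2 : -1 / 4 ≤ max a (-1 / 4) := le_max_right _ _
      have h3 : 0 ≤ (4 - m) * (-(max a (-1 / 4)) + 1 / 4) + m * (max a (-1 / 4) + 1 / 4) := by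
        have : max a (-1 / 4) < 0 := max_lt ha (by norm_num)
        have := mul_nonneg (sub_nonneg.2 hm4) (by linarith : 0 ≤ -(max a (-1 / 4)) + 1 / 4)
        have := mul_nonneg hm0 (by linarith : 0 ≤ max a (-1 / 4) + 1 / 4)
        linarith
      have h4 : m * (max a (-1 / 4) + 1 / 4) ≥ 0 :=
        mul_nonneg hm0 (by linarith)
      rw [h0]
      linarith
  have hdiff : S.rad.cyl.phi γ a ≤ S.sol.cyl.phi γ a + 2 := by
    have h1 := abs_le.1 DS.hφ
    have h2 := abs_le.1 DB.hφ
    linarith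
  have boot := pos_of_bootstrap (a := a) (b := 0)
    (g := fun t => γ ^ 2 + KB D - S.rad.cyl.phi γ t)
    (fun t ht => (((S.rad.cyl.hasDerivAt_phi γ (by linarith [ht.2])).const_sub
      _).continuousAt.continuousWithinAt))
    (by
      have h1 := hv' a ⟨le_rfl, ha.le⟩
      rw [sub_self, mul_zero] at h1
      change 0 < γ ^ 2 + (A2 D + 6) - _
      linarith)
    (fun c hc H => by
      have h1 := abs_le.1 (step c hc fun t ht => by linarith [H t ht])
      have h2 := hv' c hc
      change 0 < γ ^ 2 + (A2 D + 6) - _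
      linarith [DB.hC])
  exact step 0 ⟨ha.le, le_rfl⟩ fun t ht => by linarith [boot t ht]

/-- Comparison of the mean of the solution with the radial solution on the unit circle. -/
theorem compare (S : Sys γ μ lam C₀ Cf D f v B) {a h κ : ℝ} (hh : h ≤ 1)
    (DS : DynStart γ μ a (Av C₀ Cf D) (A2 D) 0 h κ (S.sol.cyl.phi γ a) (S.sol.cyl.p γ a)
      (S.sol.cyl.Z γ a) (S.sol.cyl.nn γ a))
    (DB : DynStart γ μ a (AB C₀ Cf D) A2B (KB D) h κ (S.rad.cyl.phi γ a) (S.rad.cyl.p γ a)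
      (S.rad.cyl.Z γ a) (S.rad.cyl.nn γ a)) (hs : s ∈ Ico a 0) :
    |γ * (S.sol.cyl.y s - B 1) + 2 * s| ≤
      (4 + C3c (AB C₀ Cf D) A2B (KB D) + C3c (Av C₀ Cf D) (A2 D) 0) * h + 2 * |s| / γ ^ 2
        + A2 D * exp (s / (2 * Av C₀ Cf D)) := by
  have h1 := abs_le.1 (S.main_rad hh DS DB)
  have h2 := abs_le.1 (S.main_v DS hs).2.2.2
  have h3 := abs_le.1 DS.hφ
  have h4 := abs_le.1 DB.hφ
  have h0 := DS.h0
  have e1 : S.rad.cyl.phi γ 0 = γ ^ 2 - γ * B 1 := by rw [S.phi_rad, exp_zero]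
  have e2 : S.sol.cyl.phi γ s = γ ^ 2 - γ * S.sol.cyl.y s := rfl
  have hγ2 : 0 < γ ^ 2 := by have := S.hγ; positivity
  have h5 : |κ / (2 * γ ^ 2) * s| ≤ 2 * |s| / γ ^ 2 := by
    rw [abs_mul, abs_of_nonneg (by have := DS.κ0; positivity)]
    have : κ / (2 * γ ^ 2) ≤ 2 / γ ^ 2 := by
      rw [div_le_div_iff₀ (by positivity) hγ2]
      have := mul_le_mul_of_nonneg_right DS.κ4 hγ2.le
      linarith
    calc _ ≤ 2 / γ ^ 2 * |s| := mul_le_mul_of_nonneg_right this (abs_nonneg s)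
      _ = _ := by ring
  have h6 := abs_le.1 h5
  have e3 : γ * (S.sol.cyl.y s - B 1) + 2 * s
      = (S.rad.cyl.phi γ 0 - S.rad.cyl.phi γ a - (2 + κ / (2 * γ ^ 2)) * (0 - a))
        - (S.sol.cyl.phi γ s - S.sol.cyl.phi γ a - (2 + κ / (2 * γ ^ 2)) * (s - a))
        + (S.rad.cyl.phi γ a - S.sol.cyl.phi γ a) - κ / (2 * γ ^ 2) * s := by
    rw [e1, e2]; ring
  rw [e3, abs_le]
  constructor <;> linarith

end Sys

theorem norm_cavg_le_cavg {E : Type*} [NormedAddCommGroup E] [NormedSpace ℝ E] {g : ℝ → E}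
    {h : ℝ → ℝ} (hh : Continuous h) (hle : ∀ θ, ‖g θ‖ ≤ h θ) : ‖cavg g‖ ≤ cavg h := by
  unfold cavg
  rw [norm_smul, norm_inv, Real.norm_of_nonneg (by positivity : (0 : ℝ) ≤ 2 * π), smul_eq_mul]
  refine mul_le_mul_of_nonneg_left ?_ (by positivity)
  exact intervalIntegral.norm_integral_le_of_norm_le (by positivity)
    (Eventually.of_forall fun t _ => hle t) (hh.intervalIntegrable _ _)

theorem norm_sub_le_of_norm_deriv_le {E : Type*} [NormedAddCommGroup E] [NormedSpace ℝ E]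
    {F F' : ℝ → E} {G G' : ℝ → ℝ} {a b : ℝ} (hab : a ≤ b)
    (hF : ∀ x ∈ Icc a b, HasDerivAt F (F' x) x) (hG : ∀ x, HasDerivAt G (G' x) x)
    (h : ∀ x ∈ Icc a b, ‖F' x‖ ≤ G' x) : ‖F b - F a‖ ≤ G b - G a := by
  refine image_norm_le_of_norm_deriv_right_le_deriv_boundary (f := fun x => F x - F a)
    (B := fun x => G x - G a) (a := a) (b := b)
    (fun x hx => ((hF x hx).sub_const _).continuousAt.continuousWithinAt)
    (fun x hx => ((hF x ⟨hx.1, hx.2.le⟩).sub_const _).hasDerivWithinAt) (by simp)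
    (fun x => (hG x).sub_const _) (fun x hx => h x ⟨hx.1, hx.2.le⟩) ⟨hab, le_rfl⟩

theorem norm_le_of_norm_deriv_le_atBot {E : Type*} [NormedAddCommGroup E] [NormedSpace ℝ E]
    {F F' : ℝ → E} {G G' : ℝ → ℝ} {a : ℝ}
    (hF : ∀ x ≤ a, HasDerivAt F (F' x) x) (hG : ∀ x, HasDerivAt G (G' x) x)
    (h : ∀ x ≤ a, ‖F' x‖ ≤ G' x) (hF0 : Tendsto F atBot (𝓝 0)) (hG0 : Tendsto G atBot (𝓝 0)) :
    ‖F a‖ ≤ G a := by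
  have h1 : Tendsto (fun t => ‖F a - F t‖) atBot (𝓝 ‖F a - 0‖) := (hF0.const_sub _).norm
  have h2 : Tendsto (fun t => G a - G t) atBot (𝓝 (G a - 0)) := hG0.const_sub _
  rw [sub_zero] at h1 h2
  refine le_of_tendsto_of_tendsto h1 h2 ?_
  filter_upwards [eventually_le_atBot a] with t ht
  exact norm_sub_le_of_norm_deriv_le ht (fun x hx => hF x hx.2) hG fun x hx => h x hx.2

/-- twice the complex derivative `∂_z` of a real function -/
def dz (f : ℂ → ℝ) (z : ℂ) : ℂ := (fderiv ℝ f z 1 : ℂ) - Complex.I * (fderiv ℝ f z Complex.I : ℂ)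

theorem clm_apply_complex (L : ℂ →L[ℝ] ℝ) (w : ℂ) : L w = w.re * L 1 + w.im * L Complex.I := by
  conv_lhs => rw [← Complex.re_add_im w]
  rw [map_add]
  have h1 : (w.re : ℂ) = w.re • (1 : ℂ) := by simp
  have h2 : (w.im : ℂ) * Complex.I = w.im • Complex.I := by simp
  rw [h1, h2, map_smul, map_smul, smul_eq_mul, smul_eq_mul]

theorem dz_mul (f : ℂ → ℝ) (z w : ℂ) :
    w * dz f z = (fderiv ℝ f z w : ℂ) - Complex.I * (fderiv ℝ f z (Complex.I * w) : ℂ) := by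
  rw [clm_apply_complex _ w, clm_apply_complex _ (Complex.I * w), dz]
  apply Complex.ext <;> simp

theorem norm_clm_sub_le (L : ℂ →L[ℝ] ℝ) :
    ‖(L 1 : ℂ) - Complex.I * (L Complex.I : ℂ)‖ ≤ 2 * ‖L‖ := by
  refine (norm_sub_le _ _).trans ?_
  rw [norm_mul, Complex.norm_I, one_mul, Complex.norm_real, Complex.norm_real]
  have h1 := L.le_opNorm 1
  have h2 := L.le_opNorm Complex.I
  rw [norm_one, mul_one] at h1
  rw [Complex.norm_I, mul_one] at h2
  linarith

theorem norm_dz_le (f : ℂ → ℝ) (z : ℂ) : ‖dz f z‖ ≤ 2 * ‖fderiv ℝ f z‖ := norm_clm_sub_le _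

theorem norm_dz_sub_le (f : ℂ → ℝ) (z w : ℂ) :
    ‖dz f z - dz f w‖ ≤ 2 * ‖fderiv ℝ f z - fderiv ℝ f w‖ := by
  refine (norm_clm_sub_le (fderiv ℝ f z - fderiv ℝ f w)).trans' (le_of_eq ?_)
  congr 1
  simp only [dz, sub_apply]
  push_cast; ring

theorem Cyl.moment_split {b lam : ℝ} (C : Cyl b lam) (γ : ℝ) {s : ℝ} (hs : s < b) (c : ℂ) :
    (γ : ℂ) ^ 2 * cavg (fun θ : ℝ => (lam : ℂ) * (Complex.exp (s - θ * Complex.I) *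
        (((C.fs s θ : ℂ) - Complex.I * C.ft s θ) *
          ((exp (C.u s θ ^ 2) - 1 : ℝ) : ℂ)))) - c * (C.q γ s : ℂ) =
    cavg (fun θ : ℝ => (γ : ℂ) ^ 2 * ((lam : ℂ) * (Complex.exp (s - θ * Complex.I) *
        (((C.fs s θ : ℂ) - Complex.I * C.ft s θ) *
          ((exp (C.u s θ ^ 2) - 1 : ℝ) : ℂ))))
        - (c * (γ ^ 2 * lam * exp (2 * s) : ℝ)) *
          ((C.f s θ * (exp (C.u s θ ^ 2) - 1) : ℝ) : ℂ))
        + c * ((C.Q γ s - C.q γ s : ℝ) : ℂ) := by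
  have cu := continuous_slice C.cu hs
  have cf := continuous_slice C.cf hs
  have cfs := continuous_slice C.cfs hs
  have cft := continuous_slice C.cft hs
  rw [cavg_sub (by fun_prop) (by fun_prop)]
  have h1 : ∀ (c : ℂ) (g : ℝ → ℂ), cavg (fun θ => c * g θ) = c * cavg g :=
    fun c g => cavg_smul c g
  have h2 : cavg (fun θ => ((C.f s θ * (exp (C.u s θ ^ 2) - 1) : ℝ) : ℂ))
      = ((cavg fun θ => C.f s θ * (exp (C.u s θ ^ 2) - 1) : ℝ) : ℂ) := by
    unfold cavg
    rw [intervalIntegral.integral_ofReal]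
    simp
  rw [h1 (_ ^ 2), h1 (_ * _) (fun θ => ((C.f s θ * (exp (C.u s θ ^ 2) - 1) : ℝ) : ℂ)), h2, Cyl.Q]
  push_cast; ring

namespace Sys
variable {γ μ lam C₀ Cf D : ℝ} {f v : ℂ → ℝ} {B : ℝ → ℝ} {s : ℝ}

/-- corrected first moment of the gradient -/
def mom (S : Sys γ μ lam C₀ Cf D f v B) (s : ℝ) : ℂ :=
  (γ : ℂ) ^ 2 * (S.sol.cyl.M s + S.sol.cyl.X s) - dz f 0 / f 0 * (S.sol.cyl.p γ s : ℂ)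

/-- derivative of the corrected first moment -/
def mom' (S : Sys γ μ lam C₀ Cf D f v B) (s : ℝ) : ℂ :=
  (γ : ℂ) ^ 2 * cavg (fun θ => (lam : ℂ) * (Complex.exp (s - θ * Complex.I) *
        (((S.sol.cyl.fs s θ : ℂ) - Complex.I * S.sol.cyl.ft s θ) *
          ((exp (S.sol.cyl.u s θ ^ 2) - 1 : ℝ) : ℂ)))) - dz f 0 / f 0 * (S.sol.cyl.q γ s : ℂ)

theorem hasDerivAt_mom (S : Sys γ μ lam C₀ Cf D f v B) (hs : s < 0) :
    HasDerivAt S.mom (S.mom' s) s :=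
  ((S.sol.cyl.hasDerivAt_moment hs).const_mul _).sub
    ((S.sol.cyl.hasDerivAt_p γ hs).ofReal_comp.const_mul _)

theorem f0_pos (S : Sys γ μ lam C₀ Cf D f v B) : 0 < f 0 := (inv_pos.2 S.hC₀).trans_le S.hf0

theorem lam_pos (S : Sys γ μ lam C₀ Cf D f v B) : 0 < lam := by
  by_contra! hl
  have h0 := S.f0_pos
  have h := S.hnorm
  have : μ ^ 2 * (lam * f 0 * γ ^ 2 * exp (γ ^ 2))
      = lam * (μ ^ 2 * (f 0 * γ ^ 2 * exp (γ ^ 2))) := by ring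
  rw [this] at h
  have : lam * (μ ^ 2 * (f 0 * γ ^ 2 * exp (γ ^ 2))) ≤ 0 :=
    mul_nonpos_of_nonpos_of_nonneg hl (by positivity)
  linarith

theorem inv_f0 (S : Sys γ μ lam C₀ Cf D f v B) : 1 / f 0 ≤ C₀ := by
  rw [one_div]
  exact inv_le_of_inv_le₀ S.hC₀ S.hf0

/-- constant in the derivative bound for the corrected first moment -/
def momC (C₀ Cf : ℝ) : ℝ := 2 * Cf + 2 * Cf * C₀ * Cf + 2 * Cf * C₀

theorem momC_nonneg (S : Sys γ μ lam C₀ Cf D f v B) : 0 ≤ momC C₀ Cf := by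
  have := S.hC₀
  have := S.hCf
  unfold momC
  positivity

theorem norm_coef (S : Sys γ μ lam C₀ Cf D f v B) : ‖dz f 0 / f 0‖ ≤ 2 * Cf * C₀ := by
  have h0 := S.f0_pos
  have h1 := (norm_dz_le f 0).trans (mul_le_mul_of_nonneg_left
    (S.hdf 0 (mem_ball_self one_pos)) zero_le_two)
  rw [norm_div, Complex.norm_real, Real.norm_of_nonneg h0.le, div_eq_mul_one_div]
  exact mul_le_mul h1 S.inv_f0 (by positivity) (by have := S.hCf; positivity)

theorem norm_mom'_le (S : Sys γ μ lam C₀ Cf D f v B) (hs : s < 0) :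
    ‖S.mom' s‖ ≤ momC C₀ Cf * (exp s * |S.sol.cyl.Qhat γ s|
      + |S.sol.cyl.Q γ s - S.sol.cyl.q γ s|) := by
  have cu := continuous_slice S.sol.cyl.cu hs
  have cf := continuous_slice S.sol.cyl.cf hs
  have cfs := continuous_slice S.sol.cyl.cfs hs
  have cft := continuous_slice S.sol.cyl.cft hs
  have hCf := S.hCf
  have hC₀ := S.hC₀
  have hl := S.lam_pos
  have hc := S.norm_coef
  have e1 := S.sol.cyl.moment_split γ hs (dz f 0 / f 0)
  have e2 : ∀ θ : ℝ, ‖(γ : ℂ) ^ 2 * ((lam : ℂ) * (Complex.exp (s - θ * Complex.I) *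
        (((S.sol.cyl.fs s θ : ℂ) - Complex.I * S.sol.cyl.ft s θ) *
          ((exp (S.sol.cyl.u s θ ^ 2) - 1 : ℝ) : ℂ))))
        - (dz f 0 / f 0 * (γ ^ 2 * lam * exp (2 * s) : ℝ)) *
          ((S.sol.cyl.f s θ * (exp (S.sol.cyl.u s θ ^ 2) - 1) : ℝ) : ℂ)‖
      ≤ (2 * Cf + 2 * Cf * C₀ * Cf) * exp s * (γ ^ 2 * lam * exp (2 * s)) *
        (exp (S.sol.cyl.u s θ ^ 2) - 1) := fun θ => by
    have h1 : (S.sol.cyl.fs s θ : ℂ) - Complex.I * S.sol.cyl.ft s θ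
        = pol s θ * dz f (pol s θ) := (dz_mul f _ _).symm
    have h2 : Complex.exp (s - θ * Complex.I) * pol s θ = ((exp (2 * s) : ℝ) : ℂ) := by
      rw [pol, ← Complex.exp_add, Complex.ofReal_exp]
      congr 1; push_cast; ring
    have h3 : (γ : ℂ) ^ 2 * ((lam : ℂ) * (Complex.exp (s - θ * Complex.I) *
        (((S.sol.cyl.fs s θ : ℂ) - Complex.I * S.sol.cyl.ft s θ) *
          ((exp (S.sol.cyl.u s θ ^ 2) - 1 : ℝ) : ℂ))))
        - (dz f 0 / f 0 * (γ ^ 2 * lam * exp (2 * s) : ℝ)) *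
          ((S.sol.cyl.f s θ * (exp (S.sol.cyl.u s θ ^ 2) - 1) : ℝ) : ℂ)
        = (((γ ^ 2 * lam * exp (2 * s)) * (exp (S.sol.cyl.u s θ ^ 2) - 1) : ℝ) : ℂ) *
          ((dz f (pol s θ) - dz f 0) - dz f 0 / f 0 * ((S.sol.cyl.f s θ - f 0 : ℝ) : ℂ)) := by
      have hne : (f 0 : ℂ) ≠ 0 := Complex.ofReal_ne_zero.2 S.f0_pos.ne'
      have : (γ : ℂ) ^ 2 * ((lam : ℂ) * (Complex.exp (s - θ * Complex.I) *
        ((pol s θ * dz f (pol s θ)) * ((exp (S.sol.cyl.u s θ ^ 2) - 1 : ℝ) : ℂ))))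
        = (γ : ℂ) ^ 2 * ((lam : ℂ) * ((Complex.exp (s - θ * Complex.I) * pol s θ) *
        ((dz f (pol s θ)) * ((exp (S.sol.cyl.u s θ ^ 2) - 1 : ℝ) : ℂ)))) := by ring
      rw [h1, this, h2]
      push_cast
      field_simp
      ring
    have h4 : 0 ≤ exp (S.sol.cyl.u s θ ^ 2) - 1 := by
      linarith [Real.one_le_exp (sq_nonneg (S.sol.cyl.u s θ))]
    have h5 : ‖dz f (pol s θ) - dz f 0‖ ≤ 2 * (Cf * exp s) := by
      have := norm_sub_le_of_fderiv_ball
        (fun z hz => hasFDerivAt_fderiv_of_smooth S.sol.cf hz) S.hddf (pol_mem hs θ)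
      rw [norm_pol] at this
      exact (norm_dz_sub_le _ _ _).trans (mul_le_mul_of_nonneg_left this zero_le_two)
    have h6 : ‖dz f 0 / f 0 * ((S.sol.cyl.f s θ - f 0 : ℝ) : ℂ)‖ ≤ 2 * Cf * C₀ * (Cf * exp s) := by
      rw [norm_mul, Complex.norm_real]
      exact mul_le_mul hc ((S.cylBd hs).hf θ) (norm_nonneg _) (by positivity)
    rw [h3, norm_mul, Complex.norm_real, Real.norm_of_nonneg (by positivity)]
    have h7 := mul_le_mul_of_nonneg_left ((norm_sub_le _ _).trans (add_le_add h5 h6))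
      (by positivity : 0 ≤ (γ ^ 2 * lam * exp (2 * s)) * (exp (S.sol.cyl.u s θ ^ 2) - 1))
    refine h7.trans (le_of_eq ?_)
    ring
  have e3 : cavg (fun θ => (2 * Cf + 2 * Cf * C₀ * Cf) * exp s * (γ ^ 2 * lam * exp (2 * s)) *
        (exp (S.sol.cyl.u s θ ^ 2) - 1))
      = (2 * Cf + 2 * Cf * C₀ * Cf) * exp s * S.sol.cyl.Qhat γ s := by
    rw [cavg_const_mul, Cyl.Qhat]; ring
  have h1 := (norm_cavg_le_cavg (continuous_const.mul ((cu.pow 2).rexp.sub continuous_const))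
    e2).trans_eq e3
  rw [mom', e1]
  refine (norm_add_le _ _).trans ?_
  rw [norm_mul, Complex.norm_real, Real.norm_eq_abs]
  have h2 := mul_le_mul_of_nonneg_right hc (abs_nonneg (S.sol.cyl.Q γ s - S.sol.cyl.q γ s))
  have h3 : (2 * Cf + 2 * Cf * C₀ * Cf) * exp s * S.sol.cyl.Qhat γ s
      ≤ (2 * Cf + 2 * Cf * C₀ * Cf) * exp s * |S.sol.cyl.Qhat γ s| :=
    mul_le_mul_of_nonneg_left (le_abs_self _) (by positivity)
  have h4 : 0 ≤ 2 * Cf * C₀ * (exp s * |S.sol.cyl.Qhat γ s|) := by positivity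
  have h5 : 0 ≤ (2 * Cf + 2 * Cf * C₀ * Cf) * |S.sol.cyl.Q γ s - S.sol.cyl.q γ s| := by positivity
  unfold momC
  linarith

theorem tendsto_mom (S : Sys γ μ lam C₀ Cf D f v B) {η ℓ : ℝ}
    (H : Bub S.sol.cyl γ μ (f 0) C₀ Cf η (ℓ + log μ)) : Tendsto S.mom atBot (𝓝 0) := by
  have ae : Tendsto (fun s : ℝ => exp s) atBot (𝓝 0) := Real.tendsto_exp_atBot
  have hM : Tendsto S.sol.cyl.M atBot (𝓝 0) := by
    obtain ⟨M, hM⟩ := H.hder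
    have h0 : Tendsto (fun s : ℝ => 4 * M ^ 2 * exp s) atBot (𝓝 (4 * M ^ 2 * 0)) :=
      ae.const_mul _
    rw [mul_zero] at h0
    refine squeeze_zero_norm' ?_ h0
    filter_upwards [eventually_le_atBot (ℓ + log μ)] with s hs
    refine norm_cavg_le fun θ => ?_
    obtain ⟨h1, h2⟩ := hM s hs θ
    have h3 : ‖(S.sol.cyl.us s θ : ℂ) - Complex.I * S.sol.cyl.ut s θ‖ ≤ 2 * M * exp s := by
      refine (norm_sub_le _ _).trans ?_
      rw [norm_mul, Complex.norm_I, one_mul, Complex.norm_real, Complex.norm_real,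
        Real.norm_eq_abs, Real.norm_eq_abs]
      linarith
    rw [norm_mul, norm_pow, Complex.norm_exp]
    have e : (-((s : ℂ) + θ * Complex.I)).re = -s := by simp
    rw [e]
    refine (mul_le_mul_of_nonneg_left (pow_le_pow_left₀ (norm_nonneg _) h3 2)
      (exp_pos _).le).trans (le_of_eq ?_)
    have : exp (-s) * exp s = 1 := by rw [← exp_add, neg_add_cancel, exp_zero]
    calc _ = 4 * M ^ 2 * exp s * (exp (-s) * exp s) := by ring
      _ = _ := by rw [this, mul_one]
  have hX : Tendsto S.sol.cyl.X atBot (𝓝 0) := by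
    obtain ⟨K, hK⟩ : ∃ K, ∀ s ≤ ℓ + log μ, ∀ θ, |S.sol.cyl.u s θ| ≤ K := by
      have hsub : closedBall (0 : ℂ) (exp (ℓ + log μ)) ⊆ ball 0 1 :=
        closedBall_subset_ball (Real.exp_lt_one_iff.2 H.hab)
      obtain ⟨K, hK⟩ := (isCompact_closedBall (0 : ℂ) (exp (ℓ + log μ))).exists_bound_of_continuousOn
        (S.sol.cv.continuousOn.mono hsub)
      refine ⟨K, fun s hs θ => hK _ ?_⟩
      rw [mem_closedBall_zero_iff, norm_pol]; exact exp_le_exp.2 hs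
    have h0 : Tendsto (fun s : ℝ => lam * ((C₀ + Cf) * exp (K ^ 2)) * exp s) atBot
        (𝓝 (lam * ((C₀ + Cf) * exp (K ^ 2)) * 0)) := ae.const_mul _
    rw [mul_zero] at h0
    refine squeeze_zero_norm' ?_ h0
    filter_upwards [eventually_le_atBot (ℓ + log μ)] with s hs
    refine norm_cavg_le fun θ => ?_
    have hs0 : s < 0 := hs.trans_lt H.hab
    rw [norm_mul, norm_mul, norm_mul, Complex.norm_exp, Complex.norm_real, Complex.norm_real,
      Complex.norm_real, Real.norm_of_nonneg S.lam_pos.le, Real.norm_eq_abs, Real.norm_eq_abs]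
    have e : ((s : ℂ) - θ * Complex.I).re = s := by simp
    rw [e]
    have h1 : |S.sol.cyl.f s θ| ≤ C₀ + Cf := by
      have h2 := abs_le.1 ((S.cylBd hs0).hf θ)
      have h3 : Cf * exp s ≤ Cf := mul_le_of_le_one_right S.hCf (Real.exp_le_one_iff.2 hs0.le)
      have := S.f0_pos
      have := S.hf0'
      rw [abs_le]; constructor <;> linarith
    have h2 : |exp (S.sol.cyl.u s θ ^ 2) - 1| ≤ exp (K ^ 2) := by
      have h3 : S.sol.cyl.u s θ ^ 2 ≤ K ^ 2 := sq_le_sq' (abs_le.1 (hK s hs θ)).1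
        (abs_le.1 (hK s hs θ)).2
      have h4 := exp_le_exp.2 h3
      have h5 := Real.one_le_exp (sq_nonneg (S.sol.cyl.u s θ))
      rw [abs_of_nonneg (by linarith)]
      linarith
    have h3 := mul_le_mul h1 h2 (abs_nonneg _) ((abs_nonneg _).trans h1)
    have h4 := mul_le_mul_of_nonneg_left h3 (mul_nonneg S.lam_pos.le (exp_pos s).le)
    linarith
  have hp := (Complex.continuous_ofReal.tendsto 0).comp H.tendsto_p
  have := ((hM.add hX).const_mul ((γ : ℂ) ^ 2)).sub (hp.const_mul (dz f 0 / f 0))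
  simp only [add_zero, mul_zero, sub_zero, Complex.ofReal_zero] at this
  exact this

theorem norm_mom_start (S : Sys γ μ lam C₀ Cf D f v B) {η ℓ : ℝ}
    (H : Bub S.sol.cyl γ μ (f 0) C₀ Cf η (ℓ + log μ)) :
    ‖S.mom (ℓ + log μ)‖ ≤ momC C₀ Cf * (exp (ℓ + log μ) * (C₀ * exp 3) +
      (TT μ (ℓ + log μ) + Bub.Yc C₀ (TT μ (ℓ + log μ))) / γ ^ 2) * (exp (2 * ℓ) / 2) := by
  obtain ⟨a, ha⟩ : ∃ a, a = ℓ + log μ := ⟨_, rfl⟩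
  obtain ⟨Cc, hCc⟩ : ∃ Cc, Cc = momC C₀ Cf * (exp a * (C₀ * exp 3) +
      (TT μ a + Bub.Yc C₀ (TT μ a)) / γ ^ 2) := ⟨_, rfl⟩
  have key := norm_le_of_norm_deriv_le_atBot (F := S.mom) (F' := S.mom') (a := a)
    (G := fun s => Cc * (exp (sg μ s) / 2)) (G' := fun s => Cc * exp (sg μ s))
    (fun s hs => S.hasDerivAt_mom (hs.trans_lt (ha ▸ H.hab)))
    (fun s => by
      have := (((hasDerivAt_sg μ s).exp).div_const 2).const_mul Cc
      refine this.congr_deriv ?_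
      ring)
    (fun s hs => by
      have hs' := hs
      rw [ha] at hs'
      have h1 := H.bound_Qhat hs'
      have h2 := H.bound_Qq hs'
      rw [← ha] at h2
      have hγ2 : 0 < γ ^ 2 := by have := S.hγ; positivity
      have hT0 := TT_nonneg μ s
      have hTa := TT_mono (μ := μ) hs
      have hE : 0 < exp (sg μ s) := exp_pos _
      have hYc : 0 ≤ Bub.Yc C₀ (TT μ a) := by
        have := S.hC₀
        have := TT_nonneg μ a
        unfold Bub.Yc; positivity
      have h3 : |S.sol.cyl.Q γ s - S.sol.cyl.q γ s|
          ≤ (TT μ a + Bub.Yc C₀ (TT μ a)) / γ ^ 2 * exp (sg μ s) := by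
        have e : |S.sol.cyl.Q γ s - S.sol.cyl.q γ s|
            = |γ ^ 2 * (S.sol.cyl.Q γ s - S.sol.cyl.q γ s)| / γ ^ 2 := by
          rw [abs_mul, abs_of_pos hγ2, mul_div_cancel_left₀ _ hγ2.ne']
        rw [e, div_mul_eq_mul_div]
        refine div_le_div_of_nonneg_right ?_ hγ2.le
        have k1 : exp (sg μ s) * (TT μ s * exp (-(2 * TT μ s))) ≤ TT μ a * exp (sg μ s) := by
          have : TT μ s * exp (-(2 * TT μ s)) ≤ TT μ a :=
            (mul_le_of_le_one_right hT0 (Real.exp_le_one_iff.2 (by linarith))).trans hTa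
          have := mul_le_mul_of_nonneg_left this hE.le
          linarith
        have k0 : 0 ≤ exp (sg μ s) * (TT μ s * exp (-(2 * TT μ s))) := by positivity
        have k2 : Bub.Yc C₀ (TT μ a) * η * exp (sg μ s) ≤ Bub.Yc C₀ (TT μ a) * exp (sg μ s) :=
          mul_le_mul_of_nonneg_right (mul_le_of_le_one_right hYc H.hη1) hE.le
        have := abs_le.1 h2
        rw [abs_le]
        constructor <;> linarith
      have h4 : exp s * |S.sol.cyl.Qhat γ s| ≤ exp a * (C₀ * exp 3) * exp (sg μ s) := by
        have := mul_le_mul (exp_le_exp.2 hs) h1 (abs_nonneg _) (exp_pos _).le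
        linarith
      refine (S.norm_mom'_le (hs'.trans_lt H.hab)).trans ?_
      have := mul_le_mul_of_nonneg_left (add_le_add h4 h3) S.momC_nonneg
      rw [hCc]
      linarith)
    (S.tendsto_mom H)
    (by
      have := ((tendsto_exp_sg μ).div_const 2).const_mul Cc
      simpa using this)
  have e : sg μ a = 2 * ℓ := by rw [ha, sg_add_log]
  simp only [e] at key
  rw [← ha, ← hCc]
  exact key

theorem sg_le (S : Sys γ μ lam C₀ Cf D f v B) {a h κ : ℝ}
    (DS : DynStart γ μ a (Av C₀ Cf D) (A2 D) 0 h κ (S.sol.cyl.phi γ a) (S.sol.cyl.p γ a)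
      (S.sol.cyl.Z γ a) (S.sol.cyl.nn γ a)) (hs : s ∈ Ico a 0) :
    E2v γ μ s ≤ exp (K1c (A2 D) / 8) := by
  have h1 := (S.main_v DS hs).1
  have h2 := (S.cylBd (D := D) hs.2).hφ
  unfold E2v
  exact exp_le_exp.2 (by linarith)

theorem psi_v (S : Sys γ μ lam C₀ Cf D f v B) {a h κ : ℝ}
    (DS : DynStart γ μ a (Av C₀ Cf D) (A2 D) 0 h κ (S.sol.cyl.phi γ a) (S.sol.cyl.p γ a)
      (S.sol.cyl.Z γ a) (S.sol.cyl.nn γ a)) (hs : s ∈ Ico a 0) :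
    |S.sol.cyl.Qhat γ s| ≤ Av C₀ Cf D * wconst 0 (K1c (A2 D)) * Psi γ μ s ∧
    |S.sol.cyl.Q γ s - S.sol.cyl.q γ s|
      ≤ Av C₀ Cf D * wconst 0 (K1c (A2 D)) * ((E1v μ s + E2v γ μ s) / γ ^ 2) := by
  obtain ⟨h1, h2, -⟩ := S.main_v DS hs
  have hs2 : s / 2 < 0 := by linarith [hs.2]
  obtain ⟨-, -, k3, -, k5, -⟩ := (S.dyn_v (a := a) hs2).psi_bounds (by linarith [DS.hA]) le_rfl
    (by unfold K1c; linarith [DS.hA₂]) S.hγ ⟨hs.1, by linarith [hs.2]⟩ h2 h1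
  exact ⟨k3, k5⟩

theorem norm_mom_le (S : Sys γ μ lam C₀ Cf D f v B) {a h κ : ℝ}
    (DS : DynStart γ μ a (Av C₀ Cf D) (A2 D) 0 h κ (S.sol.cyl.phi γ a) (S.sol.cyl.p γ a)
      (S.sol.cyl.Z γ a) (S.sol.cyl.nn γ a)) (hs : s ∈ Ico a 0) :
    ‖S.mom s‖ ≤ ‖S.mom a‖ + momC C₀ Cf * (Av C₀ Cf D * wconst 0 (K1c (A2 D))) *
      (4 / 3 * exp (log μ / 4) + (4 * E1v μ a + 8 * exp (K1c (A2 D) / 8)) / γ ^ 2) := by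
  obtain ⟨c, hc⟩ : ∃ c, c = Av C₀ Cf D * wconst 0 (K1c (A2 D)) := ⟨_, rfl⟩
  have hγ2 : 0 < γ ^ 2 := by have := S.hγ; positivity
  have hK1 : 0 ≤ K1c (A2 D) := by unfold K1c; linarith [DS.hA₂]
  have hc0 : 0 ≤ c := by
    rw [hc]
    exact mul_nonneg (by linarith [DS.hA]) (by linarith [one_le_wconst le_rfl hK1])
  have hm := S.momC_nonneg
  have key := norm_sub_le_of_norm_deriv_le (F := S.mom) (F' := S.mom') (a := a) (b := s)
    (G := fun s => momC C₀ Cf * c * (4 / 3 * omv μ s + (-4 * E1v μ s + 8 * E2v γ μ s) / γ ^ 2))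
    (G' := fun s => momC C₀ Cf * c * (omv μ s + (E1v μ s + 2 * E2v γ μ s) / γ ^ 2)) hs.1
    (fun x hx => S.hasDerivAt_mom (hx.2.trans_lt hs.2))
    (fun x => by
      have := ((((hasDerivAt_omv μ x).const_mul (4 / 3)).add
        ((((hasDerivAt_E1v μ x).const_mul (-4)).add
          ((hasDerivAt_E2v γ μ x).const_mul 8)).div_const (γ ^ 2))).const_mul (momC C₀ Cf * c))
      refine this.congr_deriv ?_
      ring)
    (fun x hx => by
      have hx' : x ∈ Ico a 0 := ⟨hx.1, hx.2.trans_lt hs.2⟩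
      refine (S.norm_mom'_le hx'.2).trans ?_
      rw [mul_assoc]
      refine mul_le_mul_of_nonneg_left ?_ hm
      obtain ⟨h1, h2⟩ := S.psi_v DS hx'
      rw [← hc] at h1 h2
      have hE2 : 0 ≤ E2v γ μ x := (exp_pos _).le
      have h3 : exp x * |S.sol.cyl.Qhat γ x| ≤ c * (omv μ x + E2v γ μ x / γ ^ 2) := by
        have k1 := mul_le_mul_of_nonneg_left h1 (exp_pos x).le
        have k2 : exp x * Psi γ μ x ≤ omv μ x + E2v γ μ x / γ ^ 2 := by
          rw [Psi, mul_add, exp_mul_E1v]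
          have := mul_le_of_le_one_left (by positivity : 0 ≤ E2v γ μ x / γ ^ 2)
            (Real.exp_le_one_iff.2 hx'.2.le)
          linarith
        have k3 := mul_le_mul_of_nonneg_left k2 hc0
        linarith
      have e : c * (omv μ x + (E1v μ x + 2 * E2v γ μ x) / γ ^ 2)
        = c * (omv μ x + E2v γ μ x / γ ^ 2) + c * ((E1v μ x + E2v γ μ x) / γ ^ 2) := by ring
      rw [e]
      exact add_le_add h3 h2)
  have h1 : ‖S.mom s‖ ≤ ‖S.mom a‖ + ‖S.mom s - S.mom a‖ := by
    have := norm_add_le (S.mom a) (S.mom s - S.mom a)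
    rwa [add_sub_cancel] at this
  refine h1.trans (add_le_add le_rfl (key.trans ?_))
  rw [← hc, ← mul_sub]
  refine mul_le_mul_of_nonneg_left ?_ (mul_nonneg hm hc0)
  have e1 : omv μ s ≤ exp (log μ / 4) := by
    unfold omv; exact exp_le_exp.2 (by linarith [hs.2])
  have e2 : 0 ≤ omv μ a := (exp_pos _).le
  have e3 : 0 ≤ E2v γ μ a := (exp_pos _).le
  have e4 : 0 ≤ E1v μ s := (exp_pos _).le
  have e5 : (-4 * E1v μ s + 8 * E2v γ μ s) / γ ^ 2 - (-4 * E1v μ a + 8 * E2v γ μ a) / γ ^ 2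
      ≤ (4 * E1v μ a + 8 * exp (K1c (A2 D) / 8)) / γ ^ 2 := by
    rw [← sub_div]
    refine div_le_div_of_nonneg_right ?_ hγ2.le
    linarith [S.sg_le DS hs]
  linarith

end Sys

namespace CylBd
variable {b lam : ℝ} {C : Cyl b lam} {γ μ f0 C₀ Cf D K s : ℝ}

theorem bound_g (H : CylBd C γ μ f0 C₀ Cf D K s) (h0 : 0 ≤ C.phi γ s) (θ : ℝ) :
    |γ * lam * exp (2 * s) * C.g s θ| ≤ Ac C₀ Cf D K *
      (Wv γ μ s (C.phi γ s) * (|yv γ (C.phi γ s)| / γ + 1 / γ ^ 2)) := by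
  have hγ0 : 0 < γ := by linarith [H.hγ]
  have hf0 := H.f0_pos
  have h1 : |C.g s θ| ≤ (1 + C₀ + Cf) * ((1 + D) * (|C.y s| + 1 / γ)) *
      (Cec D K * exp (C.y s ^ 2)) := by
    unfold Cyl.g
    rw [abs_mul, abs_mul, abs_of_pos (exp_pos _)]
    have := H.hC₀
    have := H.hCf
    exact mul_le_mul (mul_le_mul (H.abs_f θ) (abs_le_of_close H.hγ H.hD (H.hu θ)) (abs_nonneg _)
      (by positivity)) (exp_sq_le_of_close H.hγ H.hD (H.abs_y h0) (H.hu θ)) (exp_pos _).le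
      (by have := H.hD; positivity)
  have h2 : γ * lam * exp (2 * s) * C.g s θ
      = exp (sg μ s - γ ^ 2) * (1 / f0) * (1 / γ) * C.g s θ := by
    rw [← H.weight]; field_simp
  have h3 : 0 ≤ exp (sg μ s - γ ^ 2) * (1 / f0) * (1 / γ) := by positivity
  rw [h2, abs_mul, abs_of_nonneg h3, H.W_eq, ← H.y_eq]
  refine (mul_le_mul_of_nonneg_left h1 h3).trans ?_
  have h4 := Ac_ge H.hC₀.le H.hCf H.hD (a1 := 1 / f0) (a2 := 1 + C₀ + Cf) (a3 := 1)
    (a4 := 1 + D) (a5 := Cec D K) (a6 := 1) (by positivity)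
    (by linarith [H.hC₀, H.hCf]) zero_le_one (by linarith [H.hD]) (exp_pos _).le one_le_two_pi_sq
    (by linarith [H.inv_f0]) le_rfl (by nlinarith) le_rfl le_rfl
  have h5 : 0 ≤ exp (sg μ s - γ ^ 2) * exp (C.y s ^ 2) * (|C.y s| / γ + 1 / γ ^ 2) := by positivity
  refine (mul_le_mul_of_nonneg_right h4 h5).trans' (le_of_eq ?_)
  field_simp

theorem norm_X_le (H : CylBd C γ μ f0 C₀ Cf D K s) (hl : 0 ≤ lam) :
    ‖(γ : ℂ) ^ 2 * C.X s‖ ≤ exp (-s) * (1 + C₀ + Cf) * |C.Qhat γ s| := by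
  have c := continuous_slice C.cu H.hs
  have h1 : ‖C.X s‖ ≤ cavg (fun θ => lam * exp s * (1 + C₀ + Cf) * (exp (C.u s θ ^ 2) - 1)) := by
    refine norm_cavg_le_cavg (by fun_prop) fun θ => ?_
    have h2 : 0 ≤ exp (C.u s θ ^ 2) - 1 := by
      linarith [Real.one_le_exp (sq_nonneg (C.u s θ))]
    rw [norm_mul, norm_mul, norm_mul, Complex.norm_exp, Complex.norm_real, Complex.norm_real,
      Complex.norm_real, Real.norm_of_nonneg hl, Real.norm_of_nonneg h2]
    have e : ((s : ℂ) - θ * Complex.I).re = s := by simp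
    rw [e, Real.norm_eq_abs]
    have := mul_le_mul_of_nonneg_left (mul_le_mul_of_nonneg_right (H.abs_f θ) h2)
      (mul_nonneg hl (exp_pos s).le)
    linarith
  rw [cavg_const_mul] at h1
  have h3 : exp (-s) * exp (2 * s) = exp s := by rw [← exp_add]; congr 1; ring
  have h4 : exp (-s) * (1 + C₀ + Cf) * C.Qhat γ s = γ ^ 2 * (lam * exp s * (1 + C₀ + Cf) *
      cavg (fun θ => exp (C.u s θ ^ 2) - 1)) := by
    rw [Cyl.Qhat, ← h3]; ring
  have h5 : 0 ≤ exp (-s) * (1 + C₀ + Cf) := by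
    have := H.hC₀
    have := H.hCf
    positivity
  have h6 := mul_le_mul_of_nonneg_left (le_abs_self (C.Qhat γ s)) h5
  rw [norm_mul, norm_pow, Complex.norm_real, Real.norm_eq_abs, sq_abs]
  have h7 := mul_le_mul_of_nonneg_left h1 (sq_nonneg γ)
  linarith

end CylBd

namespace Sys
variable {γ μ lam C₀ Cf D : ℝ} {f v : ℂ → ℝ} {B : ℝ → ℝ} {s : ℝ}

theorem psi_le (S : Sys γ μ lam C₀ Cf D f v B) {a h κ : ℝ}
    (DS : DynStart γ μ a (Av C₀ Cf D) (A2 D) 0 h κ (S.sol.cyl.phi γ a) (S.sol.cyl.p γ a)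
      (S.sol.cyl.Z γ a) (S.sol.cyl.nn γ a)) (hs : s ∈ Ico a 0) :
    Psi γ μ s ≤ exp (-s / 4) * exp (log μ / 4) + exp (K1c (A2 D) / 8) / γ ^ 2 := by
  have hγ2 : 0 < γ ^ 2 := by have := S.hγ; positivity
  refine add_le_add (le_of_eq ?_) (div_le_div_of_nonneg_right (S.sg_le DS hs) hγ2.le)
  rw [E1v, ← exp_add, sg]
  congr 1; ring

theorem abs_density_le (S : Sys γ μ lam C₀ Cf D f v B) {a h κ : ℝ}
    (DS : DynStart γ μ a (Av C₀ Cf D) (A2 D) 0 h κ (S.sol.cyl.phi γ a) (S.sol.cyl.p γ a)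
      (S.sol.cyl.Z γ a) (S.sol.cyl.nn γ a)) (hs : s ∈ Ico a 0) (θ : ℝ) :
    |γ * lam * exp (2 * s) * S.sol.cyl.g s θ|
      ≤ Av C₀ Cf D * wconst 0 (K1c (A2 D)) * Psi γ μ s := by
  obtain ⟨h1, h2, -⟩ := S.main_v DS hs
  have H := S.cylBd hs.2
  have hK1 : 0 ≤ K1c (A2 D) := by unfold K1c; linarith [DS.hA₂]
  have := (weight_bounds le_rfl hK1 S.hγ h2 H.hφ h1 (y := yv γ (S.sol.cyl.phi γ s))
    (W := Wv γ μ s (S.sol.cyl.phi γ s)) (m := 0) (E1 := E1v μ s) (E2 := E2v γ μ s) rfl rfl le_rfl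
    zero_le_one (by positivity) rfl rfl).1
  rw [mul_assoc (Av C₀ Cf D)]
  exact (H.bound_g h2 θ).trans (mul_le_mul_of_nonneg_left this (by linarith [DS.hA]))

end Sys

/-- A blow-up sequence on the unit disc. -/
structure BlowUp (γ μ lam : ℕ → ℝ) (C₀ Cf D : ℝ) (f v : ℕ → ℂ → ℝ) (B : ℕ → ℝ → ℝ) : Prop where
  sys : ∀ n, Sys (γ n) (μ n) (lam n) C₀ Cf D (f n) (v n) (B n)
  hγ : Tendsto γ atTop atTop
  hμ : Tendsto μ atTop (𝓝 0)
  close : ∀ ℓ η : ℝ, 0 < η → ∀ᶠ n in atTop, BubClose (γ n) (μ n) (v n) ℓ η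

namespace BlowUp
variable {γ μ lam : ℕ → ℝ} {C₀ Cf D : ℝ} {f v : ℕ → ℂ → ℝ} {B : ℕ → ℝ → ℝ}

theorem tendsto_log (S : BlowUp γ μ lam C₀ Cf D f v B) :
    Tendsto (fun n => log (μ n)) atTop atBot :=
  Real.tendsto_log_nhdsGT_zero.comp (tendsto_nhdsWithin_iff.2
    ⟨S.hμ, Eventually.of_forall fun n => (S.sys n).hμ⟩)

theorem tendsto_sq (S : BlowUp γ μ lam C₀ Cf D f v B) :
    Tendsto (fun n => γ n ^ 2) atTop atTop :=
  (tendsto_pow_atTop two_ne_zero).comp S.hγ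

theorem tendsto_div (S : BlowUp γ μ lam C₀ Cf D f v B) (c : ℝ) :
    Tendsto (fun n => c / γ n ^ 2) atTop (𝓝 0) :=
  tendsto_const_nhds.div_atTop S.tendsto_sq

theorem tendsto_exp_mul (S : BlowUp γ μ lam C₀ Cf D f v B) :
    Tendsto (fun n => exp (log (μ n) / 4)) atTop (𝓝 0) :=
  Real.tendsto_exp_atBot.comp (S.tendsto_log.atBot_div_const (by norm_num))

theorem tendsto_exp_add (S : BlowUp γ μ lam C₀ Cf D f v B) (ℓ : ℝ) :
    Tendsto (fun n => exp (ℓ + log (μ n))) atTop (𝓝 0) :=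
  Real.tendsto_exp_atBot.comp (tendsto_atBot_add_const_left _ ℓ S.tendsto_log)

theorem eventually_bub (S : BlowUp γ μ lam C₀ Cf D f v B) (ℓ : ℝ) {η : ℝ} (h0 : 0 < η)
    (h1 : η ≤ 1) : ∀ᶠ n in atTop,
      Bub (S.sys n).sol.cyl (γ n) (μ n) (f n 0) C₀ Cf η (ℓ + log (μ n)) ∧
      Bub (S.sys n).rad.cyl (γ n) (μ n) (f n 0) C₀ Cf η (ℓ + log (μ n)) := by
  have t1 : Tendsto (fun n => γ n ^ 2 * exp (-γ n ^ 2)) atTop (𝓝 0) := by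
    have := (Real.tendsto_pow_mul_exp_neg_atTop_nhds_zero 1).comp S.tendsto_sq
    simpa [Function.comp_def] using this
  have t2 := (S.tendsto_exp_add ℓ).const_mul Cf
  rw [mul_zero] at t2
  filter_upwards [S.close ℓ η h0, t1.eventually_le_const h0, t2.eventually_le_const h0,
    (S.tendsto_div (bubErr ℓ)).eventually_le_const h0,
    (tendsto_atBot_add_const_left _ ℓ S.tendsto_log).eventually_lt_atBot 0] with n k1 k2 k3 k4 k5
  refine ⟨(S.sys n).bub h1 k1 k5 ?_ k2 k3, (S.sys n).bub_rad h1 k5 k4 k2 k3⟩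
  have hγ2 : 0 < γ n ^ 2 := by have := (S.sys n).hγ; positivity
  exact (div_le_div_of_nonneg_right (sq_le_bubErr ℓ) hγ2.le).trans k4

theorem exists_small {A A₂ K : ℝ} : ∃ h₀ > 0, ∀ h, 0 < h → h ≤ h₀ →
    C3c A A₂ K * h ≤ 1 ∧ h ≤ exp (-K1c A₂ / 8) := by
  refine ⟨min (exp (-K1c A₂ / 8)) (1 / (|C3c A A₂ K| + 1)), by positivity, fun h h0 hh => ?_⟩
  refine ⟨?_, hh.trans (min_le_left _ _)⟩
  have h1 := hh.trans (min_le_right _ _)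
  rw [le_div_iff₀ (by positivity)] at h1
  have := mul_le_mul_of_nonneg_right (le_abs_self (C3c A A₂ K)) h0.le
  linarith

theorem exists_start (S : BlowUp γ μ lam C₀ Cf D f v B) {ε : ℝ} (hε : 0 < ε) :
    ∃ h ℓ : ℝ, 0 < h ∧ h ≤ ε ∧ h ≤ 1 ∧ ∀ᶠ n in atTop,
      Bub (S.sys n).sol.cyl (γ n) (μ n) (f n 0) C₀ Cf 1 (ℓ + log (μ n)) ∧
      DynStart (γ n) (μ n) (ℓ + log (μ n)) (Av C₀ Cf D) (A2 D) 0 h (kap ℓ)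
        ((S.sys n).sol.cyl.phi (γ n) (ℓ + log (μ n))) ((S.sys n).sol.cyl.p (γ n) (ℓ + log (μ n)))
        ((S.sys n).sol.cyl.Z (γ n) (ℓ + log (μ n)))
        ((S.sys n).sol.cyl.nn (γ n) (ℓ + log (μ n))) ∧
      DynStart (γ n) (μ n) (ℓ + log (μ n)) (AB C₀ Cf D) A2B (KB D) h (kap ℓ)
        ((S.sys n).rad.cyl.phi (γ n) (ℓ + log (μ n))) ((S.sys n).rad.cyl.p (γ n) (ℓ + log (μ n)))
        ((S.sys n).rad.cyl.Z (γ n) (ℓ + log (μ n)))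
        ((S.sys n).rad.cyl.nn (γ n) (ℓ + log (μ n))) := by
  have S0 := S.sys 0
  have hC₀ := S0.hC₀
  have hCf := S0.hCf
  have hD := S0.hD
  have hA2 := A2_nonneg D
  have hKB : 0 ≤ KB D := by unfold KB; linarith
  obtain ⟨h₁, p₁, k₁⟩ := exists_small (A := Av C₀ Cf D) (A₂ := A2 D) (K := 0)
  obtain ⟨h₂, p₂, k₂⟩ := exists_small (A := AB C₀ Cf D) (A₂ := A2B) (K := KB D)
  obtain ⟨h, hh⟩ : ∃ h, h = min (min h₁ h₂) (min ε 1) := ⟨_, rfl⟩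
  have h0 : 0 < h := by rw [hh]; positivity
  obtain ⟨a1, a2⟩ := k₁ h h0 (by rw [hh]; exact (min_le_left _ _).trans (min_le_left _ _))
  obtain ⟨b1, b2⟩ := k₂ h h0 (by rw [hh]; exact (min_le_left _ _).trans (min_le_right _ _))
  obtain ⟨l₁, hl₁⟩ := exists_dynStart (A := Av C₀ Cf D)
    (one_le_two_pi_sq.trans (one_le_Ac hC₀.le hCf (by positivity) le_rfl)) hA2 le_rfl hC₀ hCf h0
    a1 a2
  obtain ⟨l₂, hl₂⟩ := exists_dynStart (A := AB C₀ Cf D)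
    (one_le_two_pi_sq.trans (one_le_Ac hC₀.le hCf le_rfl hKB)) (by unfold A2B; positivity)
    hKB hC₀ hCf h0 b1 b2
  obtain ⟨η₁, N₁, q₁, r₁, hd₁⟩ := hl₁ (max l₁ l₂) (le_max_left _ _)
  obtain ⟨η₂, N₂, q₂, r₂, hd₂⟩ := hl₂ (max l₁ l₂) (le_max_right _ _)
  refine ⟨h, max l₁ l₂, h0, by rw [hh]; exact (min_le_right _ _).trans (min_le_left _ _),
    by rw [hh]; exact (min_le_right _ _).trans (min_le_right _ _), ?_⟩
  filter_upwards [S.eventually_bub (max l₁ l₂) q₁ r₁, S.eventually_bub (max l₁ l₂) q₂ r₂,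
    S.eventually_bub (max l₁ l₂) one_pos le_rfl,
    (S.tendsto_div 1).eventually_le_const h0, S.tendsto_log.eventually_le_atBot (-N₁),
    S.tendsto_log.eventually_le_atBot (-N₂)] with n m1 m2 m3 m4 m5 m6
  exact ⟨m3.1, hd₁ _ _ _ _ _ _ m1.1 m4 m5, hd₂ _ _ _ _ _ _ m2.2 m4 m6⟩

theorem eventually_mem (S : BlowUp γ μ lam C₀ Cf D f v B) (ℓ s : ℝ) :
    ∀ᶠ n in atTop, ℓ + log (μ n) ≤ s :=
  (tendsto_atBot_add_const_left _ ℓ S.tendsto_log).eventually_le_atBot s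

theorem eventually_abs_p_sub (S : BlowUp γ μ lam C₀ Cf D f v B) {s ε : ℝ} (hs : s < 0)
    (hε : 0 < ε) : ∀ᶠ n in atTop, |(S.sys n).sol.cyl.p (γ n) s - 2| ≤ ε := by
  obtain ⟨c, hc⟩ : ∃ c, c = |C3c (Av C₀ Cf D) (A2 D) 0| + 1 := ⟨_, rfl⟩
  have hc0 : 0 < c := by rw [hc]; positivity
  obtain ⟨h, ℓ, h0, h1, -, H⟩ := S.exists_start (div_pos hε hc0)
  filter_upwards [H, S.eventually_mem ℓ s] with n k1 k2
  refine ((S.sys n).main_v k1.2.1 ⟨k2, hs⟩).2.2.1.trans ?_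
  rw [le_div_iff₀ hc0, hc] at h1
  have := mul_le_mul_of_nonneg_right (le_abs_self (C3c (Av C₀ Cf D) (A2 D) 0)) h0.le
  linarith

theorem eventually_compare (S : BlowUp γ μ lam C₀ Cf D f v B) {s ε : ℝ} (hs : s < 0)
    (hε : 0 < ε) : ∀ᶠ n in atTop,
      |γ n * ((S.sys n).sol.cyl.y s - B n 1) + 2 * s|
        ≤ ε + A2 D * exp (s / (2 * Av C₀ Cf D)) := by
  obtain ⟨c, hc⟩ : ∃ c, c = 4 + C3c (AB C₀ Cf D) A2B (KB D) + C3c (Av C₀ Cf D) (A2 D) 0 := ⟨_, rfl⟩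
  have hc0 : 0 < |c| + 1 := by positivity
  obtain ⟨h, ℓ, h0, h1, h2, H⟩ := S.exists_start (div_pos (half_pos hε) hc0)
  filter_upwards [H, S.eventually_mem ℓ s,
    (S.tendsto_div (2 * |s|)).eventually_le_const (half_pos hε)] with n k1 k2 k3
  refine ((S.sys n).compare h2 k1.2.1 k1.2.2 ⟨k2, hs⟩).trans ?_
  rw [le_div_iff₀ hc0] at h1
  have := mul_le_mul_of_nonneg_right (le_abs_self c) h0.le
  rw [← hc]
  linarith

theorem eventually_density (S : BlowUp γ μ lam C₀ Cf D f v B) (s₁ : ℝ) {ε : ℝ}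
    (hε : 0 < ε) : ∀ᶠ n in atTop, ∀ s ∈ Ico s₁ 0, ∀ θ,
      |γ n * lam n * exp (2 * s) * (S.sys n).sol.cyl.g s θ| ≤ ε ∧
      |(S.sys n).sol.cyl.Qhat (γ n) s| ≤ ε := by
  obtain ⟨h, ℓ, h0, h1, h2, H⟩ := S.exists_start one_pos
  obtain ⟨c, hc⟩ : ∃ c, c = Av C₀ Cf D * wconst 0 (K1c (A2 D)) := ⟨_, rfl⟩
  have t := (((S.tendsto_exp_mul.const_mul (exp (-s₁ / 4))).add
    (S.tendsto_div (exp (K1c (A2 D) / 8)))).const_mul c)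
  simp only [mul_zero, add_zero] at t
  filter_upwards [H, S.eventually_mem ℓ s₁, t.eventually_le_const hε] with n k1 k2 k3 s hs θ
  have DS := k1.2.1
  have hs' : s ∈ Ico (ℓ + log (μ n)) 0 := ⟨k2.trans hs.1, hs.2⟩
  have hK1 : 0 ≤ K1c (A2 D) := by unfold K1c; linarith [DS.hA₂]
  have hc0 : 0 ≤ c := by
    rw [hc]
    exact mul_nonneg (by linarith [DS.hA]) (by linarith [one_le_wconst le_rfl hK1])
  have e1 := (S.sys n).abs_density_le DS hs' θ
  have e2 := ((S.sys n).psi_v DS hs').1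
  rw [← hc] at e1 e2
  have e3 : c * Psi (γ n) (μ n) s ≤ ε := by
    refine le_trans (mul_le_mul_of_nonneg_left (((S.sys n).psi_le DS hs').trans ?_) hc0) k3
    refine add_le_add (mul_le_mul_of_nonneg_right (exp_le_exp.2 ?_) (exp_pos _).le) le_rfl
    linarith [hs.1]
  exact ⟨e1.trans e3, e2.trans e3⟩

theorem tendsto_mom (S : BlowUp γ μ lam C₀ Cf D f v B) {s : ℝ} (hs : s < 0) :
    Tendsto (fun n => (S.sys n).mom s) atTop (𝓝 0) := by
  obtain ⟨h, ℓ, h0, h1, h2, H⟩ := S.exists_start one_pos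
  obtain ⟨T, hT⟩ : ∃ T, T = log (1 + exp (2 * ℓ) / 4) := ⟨_, rfl⟩
  have t1 := ((((S.tendsto_exp_add ℓ).mul_const (C₀ * exp 3)).add
    (S.tendsto_div (T + Bub.Yc C₀ T))).const_mul (Sys.momC C₀ Cf)).mul_const (exp (2 * ℓ) / 2)
  have t2 := ((S.tendsto_exp_mul.const_mul (4 / 3)).add
    (S.tendsto_div (4 * exp (-(2 * ℓ) / 8) + 8 * exp (K1c (A2 D) / 8)))).const_mul
    (Sys.momC C₀ Cf * (Av C₀ Cf D * wconst 0 (K1c (A2 D))))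
  have t := t1.add t2
  simp only [mul_zero, add_zero, zero_mul] at t
  refine squeeze_zero_norm' ?_ t
  filter_upwards [H, S.eventually_mem ℓ s] with n k1 k2
  have e1 := (S.sys n).norm_mom_le k1.2.1 ⟨k2, hs⟩
  have e2 := (S.sys n).norm_mom_start k1.1
  simp only [TT, E1v, sg_add_log, ← hT] at e1 e2
  linarith

theorem tendsto_M (S : BlowUp γ μ lam C₀ Cf D f v B) {s : ℝ} (hs : s < 0) :
    Tendsto (fun n => (γ n : ℂ) ^ 2 * (S.sys n).sol.cyl.M s - 2 * (dz (f n) 0 / f n 0))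
      atTop (𝓝 0) := by
  have t1 := S.tendsto_mom hs
  have t2 : Tendsto (fun n => (γ n : ℂ) ^ 2 * (S.sys n).sol.cyl.X s) atTop (𝓝 0) := by
    have hC₀ := (S.sys 0).hC₀
    have hCf := (S.sys 0).hCf
    have hc : 0 < exp (-s) * (1 + C₀ + Cf) := by positivity
    rw [NormedAddGroup.tendsto_nhds_zero]
    intro ε hε
    filter_upwards [S.eventually_density s (div_pos (half_pos hε) hc)] with n k
    have := (k s ⟨le_rfl, hs⟩ 0).2
    rw [le_div_iff₀ hc] at this
    have := ((S.sys n).cylBd hs).norm_X_le (S.sys n).lam_pos.le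
    linarith
  have t3 : Tendsto (fun n => dz (f n) 0 / f n 0 * (((S.sys n).sol.cyl.p (γ n) s - 2 : ℝ) : ℂ))
      atTop (𝓝 0) := by
    have hC₀ := (S.sys 0).hC₀
    have hCf := (S.sys 0).hCf
    have hc : 0 < 2 * Cf * C₀ + 1 := by positivity
    rw [NormedAddGroup.tendsto_nhds_zero]
    intro ε hε
    filter_upwards [S.eventually_abs_p_sub hs (div_pos (half_pos hε) hc)] with n k
    rw [le_div_iff₀ hc] at k
    rw [norm_mul, Complex.norm_real, Real.norm_eq_abs]
    have := mul_le_mul_of_nonneg_right (S.sys n).norm_coef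
      (abs_nonneg ((S.sys n).sol.cyl.p (γ n) s - 2))
    have := abs_nonneg ((S.sys n).sol.cyl.p (γ n) s - 2)
    linarith
  have := (t1.sub t2).add t3
  simp only [sub_zero, add_zero] at this
  refine this.congr fun n => ?_
  unfold Sys.mom
  push_cast
  ring

end BlowUp

theorem tendsto_cavg_pol {E : Type*} [NormedAddCommGroup E] [NormedSpace ℝ E] [CompleteSpace E]
    {G : ℂ → E} (hG : ContinuousOn G (ball 0 1)) :
    Tendsto (fun s => cavg (fun θ => G (pol s θ))) atBot (𝓝 (G 0)) := by
  rw [Metric.tendsto_nhds]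
  intro ε hε
  have h0 := hG.continuousAt (isOpen_ball.mem_nhds (mem_ball_self one_pos))
  obtain ⟨δ, hδ, H⟩ := Metric.continuousAt_iff.1 h0 (ε / 2) (half_pos hε)
  filter_upwards [tendsto_exp_atBot.eventually (gt_mem_nhds hδ), eventually_lt_atBot (0 : ℝ)]
    with s h1 h2
  have hc : Continuous fun θ => G (pol s θ) := by
    have h := continuousOn_comp_pol hG
    exact continuous_slice (F := fun s θ => G (pol s θ)) h h2
  rw [dist_eq_norm]
  have e : cavg (fun θ => G (pol s θ)) - G 0 = cavg (fun θ => G (pol s θ) - G 0) := by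
    rw [cavg_sub hc continuous_const, cavg_const]
  rw [e]
  refine (norm_cavg_le (C := ε / 2) fun θ => ?_).trans_lt (by linarith)
  rw [← dist_eq_norm]
  refine (H ?_).le
  rw [dist_zero_right, norm_pol]; exact h1

section

variable {g : ℂ → ℝ}

/-- The complexified second derivative acting on a direction. -/
def dzz (g : ℂ → ℝ) (z w : ℂ) : ℂ :=
  (fderiv ℝ (fderiv ℝ g) z w 1 : ℂ) - Complex.I * (fderiv ℝ (fderiv ℝ g) z w Complex.I : ℂ)

theorem dzz_add_I_mul (hg : ContDiffOn ℝ (⊤ : ℕ∞) g (ball 0 1)) {z : ℂ} (hz : z ∈ ball (0 : ℂ) 1)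
    (w : ℂ) : dzz g z w + Complex.I * dzz g z (Complex.I * w) = (starRingEnd ℂ) w *
      ((fderiv ℝ (fderiv ℝ g) z 1 1 + fderiv ℝ (fderiv ℝ g) z Complex.I Complex.I : ℝ) : ℂ) := by
  have key : ∀ (e w : ℂ), fderiv ℝ (fderiv ℝ g) z w e = w.re * fderiv ℝ (fderiv ℝ g) z 1 e
      + w.im * fderiv ℝ (fderiv ℝ g) z Complex.I e := fun e w =>
    clm_apply_complex ((fderiv ℝ (fderiv ℝ g) z).flip e) w
  simp only [dzz]
  rw [key 1 w, key Complex.I w, key 1 (Complex.I * w), key Complex.I (Complex.I * w),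
    fderiv_fderiv_symm hg hz Complex.I 1]
  apply Complex.ext <;> simp <;> ring

theorem hasFDerivAt_dz (hg : ContDiffOn ℝ (⊤ : ℕ∞) g (ball 0 1)) {z : ℂ} (hz : z ∈ ball (0 : ℂ) 1) :
    ∃ L : ℂ →L[ℝ] ℂ, HasFDerivAt (dz g) L z ∧ ∀ w, L w = dzz g z w := by
  have h := hasFDerivAt_fderiv_of_smooth hg hz
  have h1 := h.clm_apply (hasFDerivAt_const (1 : ℂ) z)
  have h2 := h.clm_apply (hasFDerivAt_const (Complex.I : ℂ) z)
  have h3 := (Complex.ofRealCLM.hasFDerivAt.comp z h1).sub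
    ((Complex.ofRealCLM.hasFDerivAt.comp z h2).const_mul Complex.I)
  refine ⟨_, h3, fun w => ?_⟩
  simp [dzz]

theorem continuousOn_dz (hg : ContDiffOn ℝ (⊤ : ℕ∞) g (ball 0 1)) :
    ContinuousOn (dz g) (ball 0 1) := fun z hz => by
  obtain ⟨L, h, -⟩ := hasFDerivAt_dz hg hz
  exact h.continuousAt.continuousWithinAt

theorem continuousOn_dzz_pol (hg : ContDiffOn ℝ (⊤ : ℕ∞) g (ball 0 1)) {c : ℂ} :
    ContinuousOn (fun x : ℝ × ℝ => dzz g (pol x.1 x.2) (c * pol x.1 x.2)) (Iio 0 ×ˢ univ) := by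
  have h1 := (continuousOn_comp_pol (continuousOn_fderiv_fderiv hg)).clm_apply
    (continuous_pol.const_mul c).continuousOn
  have h2 := Complex.continuous_ofReal.comp_continuousOn
    (h1.clm_apply (continuousOn_const (c := (1 : ℂ))))
  have h3 := Complex.continuous_ofReal.comp_continuousOn
    (h1.clm_apply (continuousOn_const (c := Complex.I)))
  exact h2.sub (h3.const_mul Complex.I)

/-- Differentiation of the circular means of the complex gradient. -/
theorem hasDerivAt_cavg_dz (hg : ContDiffOn ℝ (⊤ : ℕ∞) g (ball 0 1)) {s : ℝ} (hs : s < 0) :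
    HasDerivAt (fun t => cavg fun θ => dz g (pol t θ))
      (cavg fun θ => (starRingEnd ℂ) (pol s θ) * ((fderiv ℝ (fderiv ℝ g) (pol s θ) 1 1
        + fderiv ℝ (fderiv ℝ g) (pol s θ) Complex.I Complex.I : ℝ) : ℂ)) s := by
  have c1 : ContinuousOn (Function.uncurry fun s θ => dzz g (pol s θ) (pol s θ))
      (Iio 0 ×ˢ univ) := by
    have := continuousOn_dzz_pol hg (c := 1)
    simp only [one_mul] at this
    exact this
  have c2 : ContinuousOn (Function.uncurry fun s θ => dzz g (pol s θ) (Complex.I * pol s θ))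
      (Iio 0 ×ˢ univ) := continuousOn_dzz_pol hg (c := Complex.I)
  have h := hasDerivAt_cavg (F := fun s θ => dz g (pol s θ))
    (F' := fun s θ => dzz g (pol s θ) (pol s θ)) (b := 0) (fun s hs θ => by
      obtain ⟨L, h, h'⟩ := hasFDerivAt_dz hg (pol_mem hs θ)
      exact h' _ ▸ hasDerivAt_comp_pol_left h) (continuousOn_comp_pol (continuousOn_dz hg)) c1 hs
  refine h.congr_deriv ?_
  have h0 : cavg (fun θ => dzz g (pol s θ) (Complex.I * pol s θ)) = 0 := by
    refine cavg_deriv_eq_zero (g := fun θ => dz g (pol s θ)) (fun θ => ?_)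
      (continuous_slice (F := fun s θ => dzz g (pol s θ) (Complex.I * pol s θ)) c2 hs) ?_
    · obtain ⟨L, h, h'⟩ := hasFDerivAt_dz hg (pol_mem hs θ)
      exact h' _ ▸ hasDerivAt_comp_pol_right h
    · simp only [pol_period]
  have h1 : cavg (fun θ => dzz g (pol s θ) (pol s θ)
      + Complex.I * dzz g (pol s θ) (Complex.I * pol s θ)) =
      cavg (fun θ => dzz g (pol s θ) (pol s θ)) := by
    rw [cavg_add (continuous_slice (F := fun s θ => dzz g (pol s θ) (pol s θ)) c1 hs)
      ((continuous_slice (F := fun s θ => dzz g (pol s θ) (Complex.I * pol s θ)) c2 hs).const_mul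
        Complex.I)]
    have := cavg_smul Complex.I (fun θ => dzz g (pol s θ) (Complex.I * pol s θ))
    simp only [smul_eq_mul] at this
    rw [this, h0, mul_zero, add_zero]
  rw [← h1]
  exact congrArg cavg (funext fun θ => dzz_add_I_mul hg (pol_mem hs θ) _)

theorem norm_cavg_dz_sub_le (hg : ContDiffOn ℝ (⊤ : ℕ∞) g (ball 0 1)) {ε : ℝ}
    (hε : ∀ z ∈ ball (0 : ℂ) 1, |fderiv ℝ (fderiv ℝ g) z 1 1
      + fderiv ℝ (fderiv ℝ g) z Complex.I Complex.I| ≤ ε) {s : ℝ} (hs : s < 0) :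
    ‖(cavg fun θ => dz g (pol s θ)) - dz g 0‖ ≤ ε * exp s := by
  refine norm_le_of_norm_deriv_le_atBot (F := fun s => (cavg fun θ => dz g (pol s θ)) - dz g 0)
    (fun x hx => (hasDerivAt_cavg_dz hg (hx.trans_lt hs)).sub_const _)
    (fun x => (Real.hasDerivAt_exp x).const_mul ε) (fun x hx => norm_cavg_le fun θ => ?_) ?_ ?_
  · rw [norm_mul, RCLike.norm_conj, norm_pol, Complex.norm_real, Real.norm_eq_abs, mul_comm]
    exact mul_le_mul_of_nonneg_right (hε _ (pol_mem (hx.trans_lt hs) θ)) (exp_pos _).le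
  · simpa using (tendsto_cavg_pol (continuousOn_dz hg)).sub_const (dz g 0)
  · simpa using tendsto_exp_atBot.const_mul ε

theorem hasDerivAt_cavg_pol_mul (hg : ContDiffOn ℝ (⊤ : ℕ∞) g (ball 0 1)) {s : ℝ} (hs : s < 0) :
    HasDerivAt (fun t => cavg fun θ => pol t (-θ) * (g (pol t θ) : ℂ))
      ((exp (2 * s) : ℝ) • cavg fun θ => dz g (pol s θ)) s := by
  have cn : Continuous fun x : ℝ × ℝ => pol x.1 (-x.2) :=
    continuous_pol.comp (f := fun x : ℝ × ℝ => (x.1, -x.2)) (by fun_prop)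
  have cg := Complex.continuous_ofReal.comp_continuousOn (continuousOn_comp_pol hg.continuousOn)
  have cd := (continuousOn_comp_pol (contDiffOn_fderiv_ball hg).continuousOn)
  have cl := Complex.continuous_ofReal.comp_continuousOn (cd.clm_apply continuous_pol.continuousOn)
  have cr := Complex.continuous_ofReal.comp_continuousOn
    (cd.clm_apply (continuous_pol.const_mul Complex.I).continuousOn)
  have c1 : ContinuousOn (Function.uncurry fun s θ => pol s (-θ) * (g (pol s θ) : ℂ)
      + pol s (-θ) * (fderiv ℝ g (pol s θ) (pol s θ) : ℂ)) (Iio 0 ×ˢ univ) :=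
    (cn.continuousOn.mul cg).add (cn.continuousOn.mul cl)
  have c2 : ContinuousOn (Function.uncurry fun s θ => -Complex.I * pol s (-θ) * (g (pol s θ) : ℂ)
      + pol s (-θ) * (fderiv ℝ g (pol s θ) (Complex.I * pol s θ) : ℂ)) (Iio 0 ×ˢ univ) :=
    ((cn.const_mul _).continuousOn.mul cg).add (cn.continuousOn.mul cr)
  have h := hasDerivAt_cavg (F := fun s θ => pol s (-θ) * (g (pol s θ) : ℂ))
    (F' := fun s θ => pol s (-θ) * (g (pol s θ) : ℂ)
      + pol s (-θ) * (fderiv ℝ g (pol s θ) (pol s θ) : ℂ)) (b := 0) (fun s hs θ =>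
      (hasDerivAt_pol_left s (-θ)).mul
        (hasDerivAt_comp_pol_left (hasFDerivAt_of_smooth hg (pol_mem hs θ))).ofReal_comp)
      (cn.continuousOn.mul cg) c1 hs
  refine h.congr_deriv ?_
  have h0 : cavg (fun θ => -Complex.I * pol s (-θ) * (g (pol s θ) : ℂ)
      + pol s (-θ) * (fderiv ℝ g (pol s θ) (Complex.I * pol s θ) : ℂ)) = 0 := by
    refine cavg_deriv_eq_zero (g := fun θ => pol s (-θ) * (g (pol s θ) : ℂ)) (fun θ => ?_)
      (continuous_slice (F := fun s θ => -Complex.I * pol s (-θ) * (g (pol s θ) : ℂ)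
      + pol s (-θ) * (fderiv ℝ g (pol s θ) (Complex.I * pol s θ) : ℂ)) c2 hs) ?_
    · refine (((hasDerivAt_pol_right s (-θ)).scomp θ (hasDerivAt_neg θ)).mul
        (hasDerivAt_comp_pol_right
          (hasFDerivAt_of_smooth hg (pol_mem hs θ))).ofReal_comp).congr_deriv ?_
      simp
    · have : pol s (-(2 * π)) = pol s 0 := by
        have := pol_periodic s (-(2 * π))
        rw [← this]; simp
      simp only [pol_period, this, neg_zero]
  have h1 : cavg (fun θ => (pol s (-θ) * (g (pol s θ) : ℂ)
      + pol s (-θ) * (fderiv ℝ g (pol s θ) (pol s θ) : ℂ)) - Complex.I *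
      (-Complex.I * pol s (-θ) * (g (pol s θ) : ℂ)
      + pol s (-θ) * (fderiv ℝ g (pol s θ) (Complex.I * pol s θ) : ℂ))) =
      cavg (fun θ => pol s (-θ) * (g (pol s θ) : ℂ)
      + pol s (-θ) * (fderiv ℝ g (pol s θ) (pol s θ) : ℂ)) := by
    have e := cavg_sub (continuous_slice (F := fun s θ => pol s (-θ) * (g (pol s θ) : ℂ)
      + pol s (-θ) * (fderiv ℝ g (pol s θ) (pol s θ) : ℂ)) c1 hs)
      ((continuous_slice (F := fun s θ => -Complex.I * pol s (-θ) * (g (pol s θ) : ℂ)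
      + pol s (-θ) * (fderiv ℝ g (pol s θ) (Complex.I * pol s θ) : ℂ)) c2 hs).const_mul Complex.I)
    have := cavg_smul Complex.I (fun θ => -Complex.I * pol s (-θ) * (g (pol s θ) : ℂ)
      + pol s (-θ) * (fderiv ℝ g (pol s θ) (Complex.I * pol s θ) : ℂ))
    simp only [smul_eq_mul] at this
    rw [e, this, h0, mul_zero, sub_zero]
  rw [← h1, ← cavg_smul]
  refine congrArg cavg (funext fun θ => ?_)
  have e1 : pol s (-θ) * pol s θ = ((exp (2 * s) : ℝ) : ℂ) := by
    simp only [pol, ← Complex.exp_add, Complex.ofReal_exp]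
    congr 1; push_cast; ring
  rw [Complex.real_smul, ← e1]
  have h2 := Complex.I_mul_I
  have h3 := dz_mul g (pol s θ) (pol s θ)
  linear_combination (pol s (-θ) * (g (pol s θ) : ℂ)) * h2 - pol s (-θ) * h3

/-- The gradient at the centre of a disc is controlled by the first Fourier coefficient of the
function on a circle. -/
theorem norm_dz_sub_fourier_le (hg : ContDiffOn ℝ (⊤ : ℕ∞) g (ball 0 1)) {ε : ℝ}
    (hε : ∀ z ∈ ball (0 : ℂ) 1, |fderiv ℝ (fderiv ℝ g) z 1 1
      + fderiv ℝ (fderiv ℝ g) z Complex.I Complex.I| ≤ ε) {s : ℝ} (hs : s < 0) :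
    ‖dz g 0 - (2 * exp (-(2 * s)) : ℝ) • cavg fun θ => pol s (-θ) * (g (pol s θ) : ℂ)‖
      ≤ ε * exp s := by
  have hε0 : 0 ≤ ε := (abs_nonneg _).trans (hε 0 (mem_ball_self one_pos))
  have hG : ∀ x : ℝ, HasDerivAt (fun x => ε * (exp (3 * x) / 3)) (ε * exp (3 * x)) x := fun x => by
    refine ((((hasDerivAt_id x).const_mul 3).exp.div_const 3).const_mul ε).congr_deriv ?_
    simp
  have hE : ∀ x : ℝ, HasDerivAt (fun x => (exp (2 * x) / 2) • dz g 0)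
      (exp (2 * x) • dz g 0) x := fun x => by
    refine (((((hasDerivAt_id x).const_mul 2).exp.div_const 2)).smul_const _).congr_deriv ?_
    simp
  have key := norm_le_of_norm_deriv_le_atBot (a := s)
    (F := fun s => (cavg fun θ => pol s (-θ) * (g (pol s θ) : ℂ)) - (exp (2 * s) / 2) • dz g 0)
    (fun x hx => (hasDerivAt_cavg_pol_mul hg (hx.trans_lt hs)).sub (hE x)) hG
    (fun x hx => ?_) ?_ ?_
  · have e : dz g 0 - (2 * exp (-(2 * s)) : ℝ) • cavg (fun θ => pol s (-θ) * (g (pol s θ) : ℂ))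
        = (-(2 * exp (-(2 * s))) : ℝ) • ((cavg fun θ => pol s (-θ) * (g (pol s θ) : ℂ))
          - (exp (2 * s) / 2) • dz g 0) := by
      have h2 : exp (-(2 * s)) * exp (2 * s) = 1 := by rw [← exp_add]; simp
      rw [smul_sub, smul_smul]
      have : -(2 * exp (-(2 * s))) * (exp (2 * s) / 2) = -1 := by linarith
      rw [this]; module
    rw [e, norm_smul, norm_neg, Real.norm_of_nonneg (by positivity)]
    refine (mul_le_mul_of_nonneg_left key (by positivity)).trans ?_
    have h3 : exp (-(2 * s)) * exp (3 * s) = exp s := by rw [← exp_add]; congr 1; ring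
    have h4 := mul_nonneg hε0 (exp_pos s).le
    have : 2 * exp (-(2 * s)) * (ε * (exp (3 * s) / 3))
      = 2 / 3 * (ε * (exp (-(2 * s)) * exp (3 * s))) := by ring
    rw [this, h3]; linarith
  · rw [← smul_sub, norm_smul, Real.norm_of_nonneg (exp_pos _).le]
    refine (mul_le_mul_of_nonneg_left (norm_cavg_dz_sub_le hg hε (hx.trans_lt hs))
      (exp_pos _).le).trans (le_of_eq ?_)
    have : exp (3 * x) = exp (2 * x) * exp x := by rw [← exp_add]; congr 1; ring
    rw [this]; ring
  · have t1 : Tendsto (fun s => cavg fun θ => pol s (-θ) * (g (pol s θ) : ℂ)) atBot (𝓝 0) := by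
      have := tendsto_cavg_pol (G := fun z => (starRingEnd ℂ) z * (g z : ℂ))
        ((Complex.continuous_conj.continuousOn).mul
          (Complex.continuous_ofReal.comp_continuousOn hg.continuousOn))
      rw [map_zero, zero_mul] at this
      refine this.congr fun s => congrArg cavg (funext fun θ => ?_)
      congr 1
      simp only [pol, ← Complex.exp_conj]
      congr 1
      simp
    have t2 : Tendsto (fun x : ℝ => exp (2 * x) / 2) atBot (𝓝 0) := by
      simpa using (tendsto_exp_atBot.comp
        (tendsto_id.const_mul_atBot (two_pos (α := ℝ)))).div_const 2
    simpa using t1.sub (t2.smul_const (dz g 0))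
  · simpa using ((tendsto_exp_atBot.comp
        (tendsto_id.const_mul_atBot (three_pos (α := ℝ)))).div_const 3).const_mul ε

end

section affine

variable {E F : Type*} [NormedAddCommGroup E] [NormedSpace ℝ E] [NormedAddCommGroup F]
  [NormedSpace ℝ F] {g : F → ℝ} {O : Set F} (c : F) (A : E →L[ℝ] F)

theorem hasFDerivAt_affine (x : E) : HasFDerivAt (fun w => c + A w) A x :=
  A.hasFDerivAt.const_add c

theorem contDiffOn_comp_affine (hg : ContDiffOn ℝ (⊤ : ℕ∞) g O) :
    ContDiffOn ℝ (⊤ : ℕ∞) (fun w => g (c + A w)) ((fun w => c + A w) ⁻¹' O) :=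
  hg.comp (contDiff_const.add A.contDiff).contDiffOn fun _ h => h

theorem fderiv_comp_affine (hO : IsOpen O) (hg : ContDiffOn ℝ (⊤ : ℕ∞) g O) {x : E}
    (hx : c + A x ∈ O) :
    fderiv ℝ (fun w => g (c + A w)) x = (fderiv ℝ g (c + A x)).comp A :=
  ((((hg.contDiffAt (hO.mem_nhds hx)).differentiableAt (by simp)).hasFDerivAt).comp x
    (hasFDerivAt_affine c A x)).fderiv

theorem fderiv_fderiv_comp_affine (hO : IsOpen O) (hg : ContDiffOn ℝ (⊤ : ℕ∞) g O) {x : E}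
    (hx : c + A x ∈ O) (a b : E) :
    fderiv ℝ (fderiv ℝ (fun w => g (c + A w))) x a b
      = fderiv ℝ (fderiv ℝ g) (c + A x) (A a) (A b) := by
  have hO' : IsOpen ((fun w => c + A w) ⁻¹' O) := hO.preimage (by fun_prop)
  have h1 : fderiv ℝ (fun w => g (c + A w)) =ᶠ[𝓝 x] fun w => (fderiv ℝ g (c + A w)).comp A := by
    filter_upwards [hO'.mem_nhds hx] with w hw using fderiv_comp_affine c A hO hg hw
  have h2 : HasFDerivAt (fderiv ℝ g) (fderiv ℝ (fderiv ℝ g) (c + A x)) (c + A x) :=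
    (((hg.fderiv_of_isOpen (m := (⊤ : ℕ∞)) hO (by simp)).contDiffAt
      (hO.mem_nhds hx)).differentiableAt
      (by simp)).hasFDerivAt
  have h3 : HasFDerivAt (fun w => fderiv ℝ g (c + A w))
    ((fderiv ℝ (fderiv ℝ g) (c + A x)).comp A) x := h2.comp x (hasFDerivAt_affine c A x)
  rw [h1.fderiv_eq, (h3.clm_comp (hasFDerivAt_const A x)).fderiv]
  simp

end affine

/-- The real linear form with complex gradient `ζ`. -/
def reMul : ℂ →L[ℝ] ℂ →L[ℝ] ℝ :=
  (ContinuousLinearMap.compL ℝ ℂ ℂ ℝ Complex.reCLM).comp (ContinuousLinearMap.mul ℝ ℂ)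

@[simp] theorem reMul_apply (ζ w : ℂ) : reMul ζ w = (ζ * w).re := rfl

theorem fderiv_eq_reMul (g : ℂ → ℝ) (z : ℂ) : fderiv ℝ g z = reMul (dz g z) := by
  ext w
  rw [reMul_apply, mul_comm, dz_mul]
  simp

theorem dz_of_hasFDerivAt {g : ℂ → ℝ} {z ζ : ℂ} (h : HasFDerivAt g (reMul ζ) z) : dz g z = ζ := by
  rw [dz, h.fderiv]
  apply Complex.ext <;> simp

/-- Interior gradient estimate on a disc. -/
theorem norm_dz_le_of_lap_le {g : ℂ → ℝ} {z : ℂ} {R ε η : ℝ} (hR : 0 < R)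
    (hg : ContDiffOn ℝ (⊤ : ℕ∞) g (ball z R))
    (hε : ∀ w ∈ ball z R, |fderiv ℝ (fderiv ℝ g) w 1 1
      + fderiv ℝ (fderiv ℝ g) w Complex.I Complex.I| ≤ ε)
    (hη : ∀ w ∈ ball z R, |g w| ≤ η) : ‖dz g z‖ ≤ R * ε + 2 * exp 1 * η / R := by
  obtain ⟨A, hA⟩ : ∃ A : ℂ →L[ℝ] ℂ, ∀ w, A w = R * w :=
    ⟨R • ContinuousLinearMap.id ℝ ℂ, fun w => by simp⟩
  have hm : ∀ w ∈ ball (0 : ℂ) 1, z + A w ∈ ball z R := fun w hw => by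
    rw [mem_ball_iff_norm, hA, add_sub_cancel_left, norm_mul, Complex.norm_real,
      Real.norm_of_nonneg hR.le]
    rw [mem_ball_zero_iff] at hw
    simpa using mul_lt_mul_of_pos_left hw hR
  have hG : ContDiffOn ℝ (⊤ : ℕ∞) (fun w => g (z + A w)) (ball 0 1) :=
    (contDiffOn_comp_affine z A hg).mono hm
  have h0 : dz (fun w => g (z + A w)) 0 = R * dz g z := by
    have e := fderiv_comp_affine z A isOpen_ball hg (x := 0) (hm 0 (mem_ball_self one_pos))
    rw [dz_of_hasFDerivAt (ζ := R * dz g z)]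
    have e2 := (hasFDerivAt_of_smooth hG (mem_ball_self one_pos))
    rw [e] at e2
    convert e2 using 1
    ext w
    rw [reMul_apply, ContinuousLinearMap.comp_apply, map_zero, add_zero, hA, fderiv_eq_reMul,
      reMul_apply]
    congr 1; ring
  have key := norm_dz_sub_fourier_le hG (ε := R ^ 2 * ε) (fun w hw => ?_)
    (show (-1 : ℝ) < 0 by norm_num)
  · rw [h0] at key
    have k2 : ‖cavg fun θ => pol (-1) (-θ) * ((g (z + A (pol (-1) θ)) : ℝ) : ℂ)‖
        ≤ exp (-1) * η := by
      refine norm_cavg_le fun θ => ?_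
      rw [norm_mul, norm_pol, Complex.norm_real, Real.norm_eq_abs]
      exact mul_le_mul_of_nonneg_left (hη _ (hm _ (pol_mem (by norm_num) θ))) (exp_pos _).le
    have k3 := norm_sub_norm_le (R * dz g z) ((2 * exp (-(2 * (-1)))) •
      cavg fun θ => pol (-1) (-θ) * ((g (z + A (pol (-1) θ)) : ℝ) : ℂ))
    rw [norm_smul, Real.norm_of_nonneg (by positivity), norm_mul, Complex.norm_real,
      Real.norm_of_nonneg hR.le] at k3
    have k4 := mul_le_mul_of_nonneg_left k2 (show 0 ≤ 2 * exp (-(2 * (-1))) by positivity)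
    have k5 : 2 * exp (-(2 * (-1))) * (exp (-1) * η) = 2 * exp 1 * η := by
      have : exp (-(2 * (-1))) * exp (-1) = exp 1 := by rw [← exp_add]; norm_num
      rw [← this]; ring
    rw [k5] at k4
    have hε0 : 0 ≤ ε := (abs_nonneg _).trans (hε z (mem_ball_self hR))
    have k6 : R ^ 2 * ε * exp (-1) ≤ R ^ 2 * ε := by
      have h1 : exp (-1) ≤ 1 := exp_le_one_iff.2 (by norm_num)
      have := mul_le_mul_of_nonneg_left h1 (show 0 ≤ R ^ 2 * ε by positivity)
      linarith
    have k7 : R * ‖dz g z‖ ≤ R * (R * ε + 2 * exp 1 * η / R) := by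
      have : R * (R * ε + 2 * exp 1 * η / R) = R ^ 2 * ε + 2 * exp 1 * η := by field_simp
      rw [this]; linarith
    exact le_of_mul_le_mul_left k7 hR
  · rw [fderiv_fderiv_comp_affine z A isOpen_ball hg (hm w hw),
      fderiv_fderiv_comp_affine z A isOpen_ball hg (hm w hw)]
    have e1 : A 1 = R • 1 := by rw [hA]; simp
    have e2 : A Complex.I = R • Complex.I := by rw [hA]; simp
    rw [e1, e2]
    simp only [map_smul, smul_apply, smul_eq_mul]
    rw [← mul_add, ← mul_add, ← mul_assoc, ← sq, abs_mul, abs_of_nonneg (sq_nonneg R)]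
    exact mul_le_mul_of_nonneg_left (hε _ (hm w hw)) (sq_nonneg R)

/-- A sequence of equi-Lipschitz functions that is Cauchy on a dense subset of a compact set is
uniformly Cauchy. -/
theorem uniformCauchySeqOn_of_lipschitz {X : Type*} [PseudoMetricSpace X] {F : ℕ → X → ℝ}
    {K D : Set X} {L : ℝ} (hK : IsCompact K) (hDK : D ⊆ K) (hD : K ⊆ closure D)
    (hL : ∀ n, ∀ x ∈ K, ∀ y ∈ K, |F n x - F n y| ≤ L * dist x y)
    (hc : ∀ x ∈ D, CauchySeq fun n => F n x) : UniformCauchySeqOn F atTop K := by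
  rw [Metric.uniformCauchySeqOn_iff]
  intro ε hε
  have hL' : 0 < |L| + 1 := by positivity
  obtain ⟨η, hη0, hη⟩ : ∃ η > 0, (|L| + 1) * η = ε / 4 :=
    ⟨ε / 4 / (|L| + 1), by positivity, by field_simp⟩
  obtain ⟨t, ht⟩ := hK.elim_finite_subcover (fun d : D => ball (d : X) η) (fun _ => isOpen_ball)
    (fun x hx => by
      obtain ⟨d, hd, hxd⟩ := Metric.mem_closure_iff.1 (hD hx) η hη0
      exact mem_iUnion.2 ⟨⟨d, hd⟩, hxd⟩)
  have : ∀ᶠ N in atTop, ∀ d ∈ t, ∀ m ≥ N, ∀ n ≥ N, dist (F m d) (F n d) < ε / 4 := by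
    rw [Filter.eventually_all_finset]
    intro d _
    obtain ⟨N, hN⟩ := Metric.cauchySeq_iff.1 (hc d d.2) (ε / 4) (by positivity)
    filter_upwards [eventually_ge_atTop N] with M hM m hm n hn
    exact hN m (hM.trans hm) n (hM.trans hn)
  obtain ⟨N, hN⟩ := this.exists
  refine ⟨N, fun m hm n hn x hx => ?_⟩
  obtain ⟨d, hdt, hxd⟩ := mem_iUnion₂.1 (ht hx)
  have h1 := hN d hdt m hm n hn
  have hl : ∀ k, |F k x - F k d| ≤ ε / 4 := fun k => by
    refine (hL k x hx d (hDK d.2)).trans ?_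
    rw [← hη]
    exact mul_le_mul ((le_abs_self L).trans (by linarith)) (mem_ball.1 hxd).le dist_nonneg hL'.le
  have h2 := hl m
  have h3 := hl n
  rw [Real.dist_eq] at h1 ⊢
  rw [abs_le] at h2 h3
  rw [abs_lt] at h1 ⊢
  constructor <;> linarith [h1.1, h1.2, h2.1, h2.2, h3.1, h3.2]

/-- The punctured unit disc. -/
def PD : Set ℂ := ball 0 1 \ {0}

theorem isOpen_PD : IsOpen PD := isOpen_ball.sdiff isClosed_singleton

theorem pol_mem_PD {s : ℝ} (hs : s < 0) (θ : ℝ) : pol s θ ∈ PD :=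
  ⟨pol_mem hs θ, by simp [pol, Complex.exp_ne_zero]⟩

theorem exists_pol {z : ℂ} (hz : z ∈ PD) : ∃ s < 0, ∃ θ, z = pol s θ := by
  have h0 : z ≠ 0 := hz.2
  refine ⟨log ‖z‖, Real.log_neg (norm_pos_iff.2 h0) (mem_ball_zero_iff.1 hz.1), z.arg, ?_⟩
  have := Complex.exp_log h0
  rw [Complex.log] at this
  exact this.symm

theorem exists_closedBall_PD {z : ℂ} (hz : z ∈ PD) :
    ∃ r > 0, closedBall z (2 * r) ⊆ PD ∧ ∃ m > 0, ∀ w ∈ closedBall z (2 * r), m ≤ ‖w‖ := by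
  have h0 : 0 < ‖z‖ := norm_pos_iff.2 hz.2
  have h1 : ‖z‖ < 1 := mem_ball_zero_iff.1 hz.1
  have hr : 0 < min ‖z‖ (1 - ‖z‖) := lt_min h0 (by linarith)
  have e1 := min_le_left ‖z‖ (1 - ‖z‖)
  have e2 := min_le_right ‖z‖ (1 - ‖z‖)
  have key : ∀ w ∈ closedBall z (2 * (min ‖z‖ (1 - ‖z‖) / 4)), ‖z‖ / 2 ≤ ‖w‖ ∧ ‖w‖ < 1 := by
    intro w hw
    rw [mem_closedBall_iff_norm] at hw
    have h2 := norm_sub_norm_le w z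
    have h3 := norm_sub_norm_le z w
    rw [norm_sub_rev] at h3
    constructor <;> linarith
  refine ⟨min ‖z‖ (1 - ‖z‖) / 4, by positivity, fun w hw => ⟨?_, ?_⟩, ‖z‖ / 2, by positivity,
    fun w hw => (key w hw).1⟩
  · exact mem_ball_zero_iff.2 (key w hw).2
  · intro h
    rw [mem_singleton_iff] at h
    have := (key w hw).1
    rw [h, norm_zero] at this
    linarith

section sub
variable {g h : ℂ → ℝ} {O : Set ℂ} {z : ℂ}

theorem dz_sub_of_smooth (hO : IsOpen O) (hg : ContDiffOn ℝ (⊤ : ℕ∞) g O)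
    (hh : ContDiffOn ℝ (⊤ : ℕ∞) h O) (hz : z ∈ O) :
    dz (fun w => g w - h w) z = dz g z - dz h z := by
  have h1 := (hg.contDiffAt (hO.mem_nhds hz)).differentiableAt (by simp)
  have h2 := (hh.contDiffAt (hO.mem_nhds hz)).differentiableAt (by simp)
  rw [dz, fderiv_fun_sub h1 h2]
  simp only [dz, sub_apply]
  push_cast; ring

theorem sndDeriv_sub_of_smooth (hO : IsOpen O) (hg : ContDiffOn ℝ (⊤ : ℕ∞) g O)
    (hh : ContDiffOn ℝ (⊤ : ℕ∞) h O) (hz : z ∈ O) :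
    fderiv ℝ (fderiv ℝ fun w => g w - h w) z
      = fderiv ℝ (fderiv ℝ g) z - fderiv ℝ (fderiv ℝ h) z := by
  have h0 : fderiv ℝ (fun w => g w - h w) =ᶠ[𝓝 z] fun w => fderiv ℝ g w - fderiv ℝ h w := by
    filter_upwards [hO.mem_nhds hz] with w hw
    exact fderiv_fun_sub ((hg.contDiffAt (hO.mem_nhds hw)).differentiableAt (by simp))
      ((hh.contDiffAt (hO.mem_nhds hw)).differentiableAt (by simp))
  rw [h0.fderiv_eq, fderiv_fun_sub]
  · exact ((hg.fderiv_of_isOpen (m := (⊤ : ℕ∞)) hO (by simp)).contDiffAt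
      (hO.mem_nhds hz)).differentiableAt (by simp)
  · exact ((hh.fderiv_of_isOpen (m := (⊤ : ℕ∞)) hO (by simp)).contDiffAt
      (hO.mem_nhds hz)).differentiableAt (by simp)

end sub

/-- A sequence of functions on the unit disc behaving asymptotically like multiples of the Green
function. -/
structure GreenSeq (V : ℕ → ℂ → ℝ) (D K A c : ℝ) (d : ℂ) : Prop where
  smooth : ∀ n, ContDiffOn ℝ (⊤ : ℕ∞) (V n) (ball 0 1)
  grad : ∀ n, ∀ z ∈ ball (0 : ℂ) 1, ‖z‖ * ‖fderiv ℝ (V n) z‖ ≤ D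
  osc : ∀ n, ∀ s < 0, ∀ θ θ', |V n (pol s θ) - V n (pol s θ')| ≤ K
  lapl : ∀ r > 0, ∀ ε > 0, ∀ᶠ n in atTop, ∀ z : ℂ, r ≤ ‖z‖ → ‖z‖ < 1 →
    |fderiv ℝ (fderiv ℝ (V n)) z 1 1 + fderiv ℝ (fderiv ℝ (V n)) z Complex.I Complex.I| ≤ ε
  hc : 0 < c
  mean : ∀ s < 0, ∀ ε > 0, ∀ᶠ n in atTop,
    |(cavg fun θ => V n (pol s θ)) + 2 * s| ≤ ε + A * exp (s / c)
  flux : ∀ s < 0, Tendsto (fun n => cavg fun θ => pol s θ * dz (V n) (pol s θ)) atTop (𝓝 (-2))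
  mom : ∀ s < 0, Tendsto (fun n => cavg fun θ => pol s θ * dz (V n) (pol s θ) ^ 2)
    atTop (𝓝 (2 * d))

namespace GreenSeq

variable {V : ℕ → ℂ → ℝ} {D K A c : ℝ} {d : ℂ}

theorem comp (G : GreenSeq V D K A c d) {φ : ℕ → ℕ} (hφ : Tendsto φ atTop atTop) :
    GreenSeq (fun n => V (φ n)) D K A c d where
  smooth _ := G.smooth _
  grad _ := G.grad _
  osc _ := G.osc _
  lapl r hr ε hε := hφ.eventually (G.lapl r hr ε hε)
  hc := G.hc
  mean s hs ε hε := hφ.eventually (G.mean s hs ε hε)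
  flux s hs := (G.flux s hs).comp hφ
  mom s hs := (G.mom s hs).comp hφ

theorem exists_bound (G : GreenSeq V D K A c d) {z : ℂ} (hz : z ∈ PD) :
    ∃ M, ∀ n, |V n z| ≤ M := by
  obtain ⟨s, hs, θ, rfl⟩ := exists_pol hz
  have h1 : ∀ᶠ n in atTop, |V n (pol s θ)| ≤ K + |2 * s| + (1 + A * exp (s / c)) := by
    filter_upwards [G.mean s hs 1 one_pos] with n hn
    have hcont : Continuous fun θ => V n (pol s θ) :=
      continuous_slice (F := fun s θ => V n (pol s θ))
        (continuousOn_comp_pol (G.smooth n).continuousOn) hs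
    have h2 := abs_cavg_sub_le continuous_const hcont (fun θ' => G.osc n s hs θ θ')
    rw [cavg_const] at h2
    have h3 : V n (pol s θ) = (V n (pol s θ) - cavg fun θ => V n (pol s θ)) - 2 * s
      + ((cavg fun θ => V n (pol s θ)) + 2 * s) := by ring
    rw [h3]
    refine (abs_add_le _ _).trans (add_le_add ((abs_sub _ _).trans (add_le_add h2 le_rfl)) hn)
  have h2 : IsBoundedUnder (· ≤ ·) atTop fun n => |V n (pol s θ)| := ⟨_, h1⟩
  obtain ⟨M, hM⟩ := h2.bddAbove_range
  exact ⟨M, fun n => hM (mem_range_self n)⟩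

theorem exists_dense_subseq (G : GreenSeq V D K A c d) : ∃ φ : ℕ → ℕ, StrictMono φ ∧
    ∃ Q : Set ℂ, Dense Q ∧ ∀ q ∈ Q ∩ PD, CauchySeq fun n => V (φ n) q := by
  classical
  have hM : ∀ k, ∃ M, ∀ n, (if TopologicalSpace.denseSeq ℂ k ∈ PD then
      V n (TopologicalSpace.denseSeq ℂ k) else 0) ∈ Icc (-M) M := by
    intro k
    by_cases hk : TopologicalSpace.denseSeq ℂ k ∈ PD
    · obtain ⟨M, hM⟩ := G.exists_bound hk
      exact ⟨M, fun n => by rw [if_pos hk]; exact abs_le.1 (hM n)⟩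
    · exact ⟨0, fun n => by rw [if_neg hk]; simp⟩
  choose M hM using hM
  have hcpt : IsCompact (Set.pi univ fun k => Icc (-M k) (M k)) :=
    isCompact_univ_pi fun k => isCompact_Icc
  obtain ⟨a, -, φ, hφ, ht⟩ := hcpt.tendsto_subseq
    (x := fun n k => if TopologicalSpace.denseSeq ℂ k ∈ PD then
      V n (TopologicalSpace.denseSeq ℂ k) else 0)
    (fun n k _ => hM k n)
  refine ⟨φ, hφ, range (TopologicalSpace.denseSeq ℂ), TopologicalSpace.denseRange_denseSeq ℂ, ?_⟩
  rintro _ ⟨⟨k, rfl⟩, hk⟩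
  have := (tendsto_pi_nhds.1 ht k).cauchySeq
  simpa only [Function.comp_def, if_pos hk] using this

theorem lipschitz (G : GreenSeq V D K A c d) {z : ℂ} {r m : ℝ} (hr : closedBall z r ⊆ PD)
    (hm0 : 0 < m) (hm : ∀ w ∈ closedBall z r, m ≤ ‖w‖) (n : ℕ) {x y : ℂ} (hx : x ∈ closedBall z r)
    (hy : y ∈ closedBall z r) : |V n x - V n y| ≤ D / m * dist x y := by
  have := (convex_closedBall z r).norm_image_sub_le_of_norm_hasFDerivWithin_le
    (f := V n) (f' := fderiv ℝ (V n)) (C := D / m)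
    (fun w hw => (hasFDerivAt_of_smooth (G.smooth n) (hr hw).1).hasFDerivWithinAt)
    (fun w hw => by
      rw [le_div_iff₀ hm0]
      have h1 := G.grad n w (hr hw).1
      have h2 := mul_le_mul_of_nonneg_right (hm w hw) (norm_nonneg (fderiv ℝ (V n) w))
      linarith) hy hx
  rwa [Real.norm_eq_abs, ← dist_eq_norm] at this

theorem exists_tendsto (G : GreenSeq V D K A c d) : ∃ φ : ℕ → ℕ, StrictMono φ ∧
    ∃ (Vl : ℂ → ℝ) (W : ℂ → ℂ),
      TendstoLocallyUniformlyOn (fun n => V (φ n)) Vl atTop PD ∧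
      TendstoLocallyUniformlyOn (fun n => dz (V (φ n))) W atTop PD := by
  obtain ⟨φ, hφ, Q, hQ, hc⟩ := G.exists_dense_subseq
  have G' := G.comp hφ.tendsto_atTop
  have hloc : ∀ z ∈ PD, ∃ r > 0, UniformCauchySeqOn (fun n => V (φ n)) atTop (ball z r) ∧
      UniformCauchySeqOn (fun n => dz (V (φ n))) atTop (ball z r) := by
    intro z hz
    obtain ⟨r, hr, hsub, m, hm0, hm⟩ := exists_closedBall_PD hz
    have h1 : UniformCauchySeqOn (fun n => V (φ n)) atTop (closedBall z (2 * r)) := by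
      refine uniformCauchySeqOn_of_lipschitz (D := ball z (2 * r) ∩ Q) (L := D / m)
        (isCompact_closedBall _ _) (fun x hx => ball_subset_closedBall hx.1) ?_
        (fun n x hx y hy => G'.lipschitz hsub hm0 hm n hx hy)
        (fun x hx => hc x ⟨hx.2, hsub (ball_subset_closedBall hx.1)⟩)
      rw [← closure_ball z (by positivity : 2 * r ≠ 0)]
      exact closure_minimal (hQ.open_subset_closure_inter isOpen_ball) isClosed_closure
    refine ⟨r, hr, h1.mono (ball_subset_closedBall.trans
      (closedBall_subset_closedBall (by linarith))), ?_⟩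
    rw [Metric.uniformCauchySeqOn_iff] at h1 ⊢
    intro ε hε
    have hη : 0 < ε * r / (8 * exp 1) := by positivity
    obtain ⟨N₁, hN₁⟩ := h1 _ hη
    obtain ⟨N₂, hN₂⟩ := eventually_atTop.1 (G'.lapl m hm0 (ε / (8 * r)) (by positivity))
    refine ⟨max N₁ N₂, fun i hi j hj w hw => ?_⟩
    have hsub' : ball w r ⊆ closedBall z (2 * r) := fun x hx => by
      rw [mem_closedBall]
      have := dist_triangle x w z
      rw [mem_ball] at hx hw
      linarith
    have hb : ball w r ⊆ ball 0 1 := fun x hx => (hsub (hsub' hx)).1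
    have s1 := (G'.smooth i).mono hb
    have s2 := (G'.smooth j).mono hb
    rw [dist_eq_norm, ← dz_sub_of_smooth isOpen_ball s1 s2 (mem_ball_self hr)]
    refine (norm_dz_le_of_lap_le hr (s1.sub s2) (ε := 2 * (ε / (8 * r)))
      (η := ε * r / (8 * exp 1)) (fun x hx => ?_) (fun x hx => ?_)).trans_lt ?_
    · have e := sndDeriv_sub_of_smooth isOpen_ball s1 s2 hx
      have hx1 := mem_ball_zero_iff.1 (hb hx)
      have hx2 := hm x (hsub' hx)
      have a1 := hN₂ i ((le_max_right _ _).trans hi) x hx2 hx1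
      have a2 := hN₂ j ((le_max_right _ _).trans hj) x hx2 hx1
      change |fderiv ℝ (fderiv ℝ fun w => V (φ i) w - V (φ j) w) x 1 1
        + fderiv ℝ (fderiv ℝ fun w => V (φ i) w - V (φ j) w) x Complex.I Complex.I| ≤ _
      rw [e]
      simp only [sub_apply]
      rw [abs_le] at a1 a2 ⊢
      constructor <;> linarith [a1.1, a1.2, a2.1, a2.2]
    · have := hN₁ i ((le_max_left _ _).trans hi) j ((le_max_left _ _).trans hj) x (hsub' hx)
      rw [Real.dist_eq] at this
      exact this.le
    · have e1 : r * (2 * (ε / (8 * r))) = ε / 4 := by field_simp; ring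
      have e2 : 2 * exp 1 * (ε * r / (8 * exp 1)) / r = ε / 4 := by field_simp; ring
      rw [e1, e2]; linarith
  have hV : ∀ z, ∃ a, z ∈ PD → Tendsto (fun n => V (φ n) z) atTop (𝓝 a) := fun z => by
    by_cases hz : z ∈ PD
    · obtain ⟨r, hr, h1, -⟩ := hloc z hz
      obtain ⟨a, ha⟩ := cauchySeq_tendsto_of_complete (h1.cauchySeq (mem_ball_self hr))
      exact ⟨a, fun _ => ha⟩
    · exact ⟨0, fun h => absurd h hz⟩
  have hW : ∀ z, ∃ a, z ∈ PD → Tendsto (fun n => dz (V (φ n)) z) atTop (𝓝 a) := fun z => by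
    by_cases hz : z ∈ PD
    · obtain ⟨r, hr, -, h1⟩ := hloc z hz
      obtain ⟨a, ha⟩ := cauchySeq_tendsto_of_complete (h1.cauchySeq (mem_ball_self hr))
      exact ⟨a, fun _ => ha⟩
    · exact ⟨0, fun h => absurd h hz⟩
  choose Vl hVl using hV
  choose W hW using hW
  refine ⟨φ, hφ, Vl, W, ?_, ?_⟩
  · intro u hu z hz
    obtain ⟨r, hr, h1, -⟩ := hloc z hz
    exact ⟨ball z r ∩ PD, inter_mem (mem_nhdsWithin_of_mem_nhds (ball_mem_nhds z hr))
      self_mem_nhdsWithin, (h1.mono inter_subset_left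
      ).tendstoUniformlyOn_of_tendsto (fun x hx => (hVl x hx.2)) u hu⟩
  · intro u hu z hz
    obtain ⟨r, hr, -, h1⟩ := hloc z hz
    exact ⟨ball z r ∩ PD, inter_mem (mem_nhdsWithin_of_mem_nhds (ball_mem_nhds z hr))
      self_mem_nhdsWithin, (h1.mono inter_subset_left
      ).tendstoUniformlyOn_of_tendsto (fun x hx => (hW x hx.2)) u hu⟩

end GreenSeq

theorem tendsto_cavg_of_bounded {E : Type*} [NormedAddCommGroup E] [NormedSpace ℝ E]
    {F : ℕ → ℝ → E} {f : ℝ → E} {C : ℝ} (hF : ∀ n, Continuous (F n)) (hC : ∀ n θ, ‖F n θ‖ ≤ C)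
    (h : ∀ θ, Tendsto (fun n => F n θ) atTop (𝓝 (f θ))) :
    Tendsto (fun n => cavg (F n)) atTop (𝓝 (cavg f)) := by
  unfold cavg
  refine Tendsto.const_smul ?_ _
  refine intervalIntegral.tendsto_integral_filter_of_dominated_convergence (fun _ => C) ?_ ?_ ?_ ?_
  · exact Eventually.of_forall fun n => (hF n).aestronglyMeasurable
  · exact Eventually.of_forall fun n => Eventually.of_forall fun θ _ => hC n θ
  · exact intervalIntegrable_const
  · exact Eventually.of_forall fun θ _ => h θ

/-- The mean value property over circles around the origin. -/
theorem cavg_pol_of_differentiableOn {F : ℂ → ℂ} (hF : DifferentiableOn ℂ F (ball 0 1)) {s : ℝ}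
    (hs : s < 0) : cavg (fun θ => F (pol s θ)) = F 0 := by
  have hF' : ContinuousOn (deriv F) (ball 0 1) := (hF.deriv isOpen_ball).continuousOn
  have hd : ∀ z ∈ ball (0 : ℂ) 1, HasDerivAt F (deriv F z) z := fun z hz =>
    (hF.differentiableAt (isOpen_ball.mem_nhds hz)).hasDerivAt
  have c1 : ContinuousOn (Function.uncurry fun s θ => deriv F (pol s θ) * pol s θ)
      (Iio 0 ×ˢ univ) := (continuousOn_comp_pol hF').mul continuous_pol.continuousOn
  have h1 : ∀ s < 0, HasDerivAt (fun t => cavg fun θ => F (pol t θ)) 0 s := fun s hs => by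
    have h := hasDerivAt_cavg (F := fun s θ => F (pol s θ))
      (F' := fun s θ => deriv F (pol s θ) * pol s θ) (b := 0) (fun s hs θ =>
        (hd _ (pol_mem hs θ)).comp s (hasDerivAt_pol_left s θ))
      (continuousOn_comp_pol hF.continuousOn) c1 hs
    refine h.congr_deriv ?_
    have h0 : cavg (fun θ => Complex.I * (deriv F (pol s θ) * pol s θ)) = 0 := by
      refine cavg_deriv_eq_zero (g := fun θ => F (pol s θ)) (fun θ => ?_)
        ((continuous_slice (F := fun s θ => deriv F (pol s θ) * pol s θ) c1 hs).const_mul _) ?_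
      · refine ((hd _ (pol_mem hs θ)).comp θ (hasDerivAt_pol_right s θ)).congr_deriv ?_
        ring
      · simp only [pol_period]
    have h2 := cavg_smul Complex.I (fun θ => deriv F (pol s θ) * pol s θ)
    simp only [smul_eq_mul] at h2
    rw [h2] at h0
    exact (mul_eq_zero.1 h0).resolve_left Complex.I_ne_zero
  have h2 := norm_le_of_norm_deriv_le_atBot (a := s)
    (F := fun s => (cavg fun θ => F (pol s θ)) - F 0) (G := fun _ => 0) (G' := fun _ => 0)
    (fun x hx => (h1 x (hx.trans_lt hs)).sub_const _) (fun x => hasDerivAt_const _ _)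
    (fun x _ => by simp) (by simpa using (tendsto_cavg_pol hF.continuousOn).sub_const (F 0))
    tendsto_const_nhds
  exact sub_eq_zero.1 (norm_le_zero_iff.1 h2)

theorem rectangle_integral_dz_le {g : ℂ → ℝ} (hg : ContDiffOn ℝ (⊤ : ℕ∞) g (ball 0 1)) {z w : ℂ}
    (hR : Complex.Rectangle z w ⊆ ball 0 1) {ε : ℝ}
    (hε : ∀ x ∈ Complex.Rectangle z w, |fderiv ℝ (fderiv ℝ g) x 1 1
      + fderiv ℝ (fderiv ℝ g) x Complex.I Complex.I| ≤ ε) :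
    ‖Complex.wedgeIntegral z w (dz g) + Complex.wedgeIntegral w z (dz g)‖
      ≤ ε * |w.im - z.im| * |w.re - z.re| := by
  have e : ∀ x ∈ Complex.Rectangle z w, Complex.I • fderiv ℝ (dz g) x 1
      - fderiv ℝ (dz g) x Complex.I = Complex.I * ((fderiv ℝ (fderiv ℝ g) x 1 1
        + fderiv ℝ (fderiv ℝ g) x Complex.I Complex.I : ℝ) : ℂ) := fun x hx => by
    obtain ⟨L, hL, hL'⟩ := hasFDerivAt_dz hg (hR hx)
    rw [hL.fderiv, hL', hL']
    have h := dzz_add_I_mul hg (hR hx) 1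
    simp only [mul_one, map_one, one_mul] at h
    rw [← h, smul_eq_mul]
    have := Complex.I_mul_I
    linear_combination (-dzz g x Complex.I) * this
  have hd : ∀ x ∈ Ioo (min z.re w.re) (max z.re w.re) ×ℂ Ioo (min z.im w.im) (max z.im w.im) \ ∅,
      HasFDerivAt (dz g) (fderiv ℝ (dz g) x) x := fun x hx => by
    have hx' : x ∈ ball (0 : ℂ) 1 := hR (by
      rw [Complex.Rectangle, Complex.mem_reProdIm]
      rw [sdiff_empty, Complex.mem_reProdIm] at hx
      exact ⟨Ioo_subset_Icc_self hx.1, Ioo_subset_Icc_self hx.2⟩)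
    obtain ⟨L, hL, -⟩ := hasFDerivAt_dz hg hx'
    exact hL.differentiableAt.hasFDerivAt
  have hi : IntegrableOn (fun x => Complex.I • fderiv ℝ (dz g) x 1 - fderiv ℝ (dz g) x Complex.I)
      (Complex.Rectangle z w) := by
    refine ContinuousOn.integrableOn_compact (isCompact_uIcc.reProdIm isCompact_uIcc) ?_
    have hc := (continuousOn_fderiv_fderiv hg).mono hR
    have hc' : ContinuousOn (fun x => Complex.I * ((fderiv ℝ (fderiv ℝ g) x 1 1
        + fderiv ℝ (fderiv ℝ g) x Complex.I Complex.I : ℝ) : ℂ)) (Complex.Rectangle z w) :=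
      (Complex.continuous_ofReal.comp_continuousOn
        (((hc.clm_apply continuousOn_const).clm_apply continuousOn_const).add
        ((hc.clm_apply continuousOn_const).clm_apply continuousOn_const))).const_mul _
    exact hc'.congr e
  rw [Complex.wedgeIntegral_add_wedgeIntegral_eq,
    Complex.integral_boundary_rect_of_hasFDerivAt_real_off_countable (dz g) (fderiv ℝ (dz g)) z w ∅
      countable_empty ((continuousOn_dz hg).mono hR) hd hi]
  refine intervalIntegral.norm_integral_le_of_norm_le_const fun x hx => ?_
  refine intervalIntegral.norm_integral_le_of_norm_le_const fun y hy => ?_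
  have hm : (x + y * Complex.I : ℂ) ∈ Complex.Rectangle z w := by
    rw [Complex.Rectangle, Complex.mem_reProdIm]
    simpa using ⟨uIoc_subset_uIcc hx, uIoc_subset_uIcc hy⟩
  rw [e _ hm, norm_mul, Complex.norm_I, one_mul, Complex.norm_real]
  exact hε _ hm

theorem tendsto_wedgeIntegral {F : ℕ → ℂ → ℂ} {f : ℂ → ℂ} {z w : ℂ} {C : ℝ}
    (hF : ∀ n, ContinuousOn (F n) (Complex.Rectangle z w))
    (hC : ∀ n, ∀ x ∈ Complex.Rectangle z w, ‖F n x‖ ≤ C)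
    (h : ∀ x ∈ Complex.Rectangle z w, Tendsto (fun n => F n x) atTop (𝓝 (f x))) :
    Tendsto (fun n => Complex.wedgeIntegral z w (F n)) atTop (𝓝 (Complex.wedgeIntegral z w f)) := by
  have key : ∀ (a b : ℝ) (p : ℝ → ℂ), Continuous p →
      (∀ x ∈ uIcc a b, p x ∈ Complex.Rectangle z w) →
      Tendsto (fun n => ∫ x in a..b, F n (p x)) atTop (𝓝 (∫ x in a..b, f (p x))) := by
    intro a b p hp hpm
    refine intervalIntegral.tendsto_integral_filter_of_dominated_convergence (fun _ => C)
      ?_ ?_ ?_ ?_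
    · refine Eventually.of_forall fun n => ?_
      exact (((hF n).comp hp.continuousOn hpm).mono uIoc_subset_uIcc).aestronglyMeasurable
        measurableSet_uIoc
    · exact Eventually.of_forall fun n => Eventually.of_forall fun x hx =>
        hC n _ (hpm x (uIoc_subset_uIcc hx))
    · exact intervalIntegrable_const
    · exact Eventually.of_forall fun x hx => h _ (hpm x (uIoc_subset_uIcc hx))
  unfold Complex.wedgeIntegral
  refine (key _ _ (fun x => (x : ℂ) + z.im * Complex.I) (by fun_prop) fun x hx => ?_).add
    ((key _ _ (fun y => (w.re : ℂ) + y * Complex.I) (by fun_prop) fun y hy => ?_).const_smul _)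
  · rw [Complex.Rectangle, Complex.mem_reProdIm]; simpa using hx
  · rw [Complex.Rectangle, Complex.mem_reProdIm]; simpa using hy

namespace GreenSeq

variable {V : ℕ → ℂ → ℝ} {D K A c : ℝ} {d : ℂ} {Vl : ℂ → ℝ} {W : ℂ → ℂ}

theorem norm_mul_dz_le (G : GreenSeq V D K A c d) (n : ℕ) {z : ℂ} (hz : z ∈ ball (0 : ℂ) 1) :
    ‖z * dz (V n) z‖ ≤ 2 * D := by
  rw [norm_mul]
  have h1 := mul_le_mul_of_nonneg_left (norm_dz_le (V n) z) (norm_nonneg z)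
  have h2 := G.grad n z hz
  linarith

theorem tendsto_cavg_dz (G : GreenSeq V D K A c d)
    (hW : TendstoLocallyUniformlyOn (fun n => dz (V n)) W atTop PD) {s : ℝ} (hs : s < 0) :
    Tendsto (fun n => cavg fun θ => pol s θ * dz (V n) (pol s θ)) atTop
      (𝓝 (cavg fun θ => pol s θ * W (pol s θ))) ∧
    Tendsto (fun n => cavg fun θ => pol s θ * dz (V n) (pol s θ) ^ 2) atTop
      (𝓝 (cavg fun θ => pol s θ * W (pol s θ) ^ 2)) := by
  have hp : Continuous (pol s) := continuous_iff_continuousAt.2 fun θ =>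
    (hasDerivAt_pol_right s θ).continuousAt
  have hc : ∀ n, Continuous fun θ => dz (V n) (pol s θ) := fun n =>
    continuous_slice (F := fun s θ => dz (V n) (pol s θ))
      (continuousOn_comp_pol (continuousOn_dz (G.smooth n))) hs
  have hl : ∀ θ, Tendsto (fun n => dz (V n) (pol s θ)) atTop (𝓝 (W (pol s θ))) := fun θ =>
    hW.tendsto_at (pol_mem_PD hs θ)
  have hb : ∀ n θ, ‖pol s θ * dz (V n) (pol s θ)‖ ≤ 2 * D := fun n θ =>
    G.norm_mul_dz_le n (pol_mem hs θ)
  constructor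
  · exact tendsto_cavg_of_bounded (fun n => hp.mul (hc n)) hb fun θ => (hl θ).const_mul _
  · refine tendsto_cavg_of_bounded (C := exp (-s) * (2 * D) ^ 2)
      (fun n => hp.mul ((hc n).pow 2)) (fun n θ => ?_) fun θ => ((hl θ).pow 2).const_mul _
    have h1 := pow_le_pow_left₀ (norm_nonneg _) (hb n θ) 2
    rw [norm_mul, norm_pol] at h1
    rw [norm_mul, norm_pow, norm_pol]
    have h2 : exp s * ‖dz (V n) (pol s θ)‖ ^ 2
        = exp (-s) * (exp s * ‖dz (V n) (pol s θ)‖) ^ 2 := by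
      have : exp (-s) * exp s = 1 := by rw [← exp_add]; simp
      linear_combination (-(exp s * ‖dz (V n) (pol s θ)‖ ^ 2)) * this
    rw [h2]
    exact mul_le_mul_of_nonneg_left h1 (exp_pos _).le

theorem differentiableOn_limit (G : GreenSeq V D K A c d)
    (hW : TendstoLocallyUniformlyOn (fun n => dz (V n)) W atTop PD) :
    DifferentiableOn ℂ W PD := by
  refine (Complex.isConservativeOn_and_continuousOn_iff_isDifferentiableOn isOpen_PD).1
    ⟨fun z w hR => ?_, hW.continuousOn (Frequently.of_forall fun n =>
      (continuousOn_dz (G.smooth n)).mono sdiff_subset)⟩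
  have hRb : Complex.Rectangle z w ⊆ ball 0 1 := hR.trans sdiff_subset
  have hcp : IsCompact (Complex.Rectangle z w) := isCompact_uIcc.reProdIm isCompact_uIcc
  have hne : (Complex.Rectangle z w).Nonempty := ⟨z, by
    rw [Complex.Rectangle, Complex.mem_reProdIm]; exact ⟨left_mem_uIcc, left_mem_uIcc⟩⟩
  obtain ⟨x₀, hx₀, hmin⟩ := hcp.exists_isMinOn hne continuous_norm.continuousOn
  have hm0 : 0 < ‖x₀‖ := norm_pos_iff.2 (hR hx₀).2
  have hm : ∀ x ∈ Complex.Rectangle z w, ‖x₀‖ ≤ ‖x‖ := fun x hx => hmin hx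
  have hC : ∀ n, ∀ x ∈ Complex.Rectangle z w, ‖dz (V n) x‖ ≤ 2 * D / ‖x₀‖ := fun n x hx => by
    rw [le_div_iff₀ hm0]
    have h1 := G.norm_mul_dz_le n (hRb hx)
    rw [norm_mul] at h1
    have h2 := mul_le_mul_of_nonneg_right (hm x hx) (norm_nonneg (dz (V n) x))
    linarith
  have hsymm : Complex.Rectangle w z = Complex.Rectangle z w := by
    simp only [Complex.Rectangle, uIcc_comm]
  have hcont : ∀ n, ContinuousOn (dz (V n)) (Complex.Rectangle z w) := fun n =>
    (continuousOn_dz (G.smooth n)).mono hRb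
  have hl : ∀ x ∈ Complex.Rectangle z w, Tendsto (fun n => dz (V n) x) atTop (𝓝 (W x)) :=
    fun x hx => hW.tendsto_at (hR hx)
  have t := (tendsto_wedgeIntegral hcont hC hl).add
    (tendsto_wedgeIntegral (z := w) (w := z) (by rwa [hsymm]) (by rwa [hsymm]) (by rwa [hsymm]))
  have t0 : Tendsto (fun n => Complex.wedgeIntegral z w (dz (V n))
      + Complex.wedgeIntegral w z (dz (V n))) atTop (𝓝 0) := by
    rw [NormedAddGroup.tendsto_nhds_zero]
    intro ε hε
    have ha : 0 < |w.im - z.im| * |w.re - z.re| + 1 := by positivity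
    filter_upwards [G.lapl ‖x₀‖ hm0 (ε / (|w.im - z.im| * |w.re - z.re| + 1)) (by positivity)]
      with n hn
    refine (rectangle_integral_dz_le (G.smooth n) hRb fun x hx =>
      hn x (hm x hx) (mem_ball_zero_iff.1 (hRb hx))).trans_lt ?_
    rw [mul_assoc, div_mul_eq_mul_div, div_lt_iff₀ ha]
    linarith
  exact eq_neg_of_add_eq_zero_left (tendsto_nhds_unique t t0)

end GreenSeq

theorem pol_ne_zero (s θ : ℝ) : pol s θ ≠ 0 := by simp [pol, Complex.exp_ne_zero]

theorem continuous_pol_right (s : ℝ) : Continuous (pol s) :=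
  continuous_iff_continuousAt.2 fun θ => (hasDerivAt_pol_right s θ).continuousAt

theorem cavg_inv_pol (s : ℝ) : (cavg fun θ => (pol s θ)⁻¹) = 0 := by
  refine cavg_deriv_eq_zero (g := fun θ => Complex.I * (pol s θ)⁻¹) (fun θ => ?_)
    ((continuous_pol_right s).inv₀ (pol_ne_zero s)) ?_
  · refine (((hasDerivAt_pol_right s θ).inv (pol_ne_zero s θ)).const_mul Complex.I).congr_deriv ?_
    have := Complex.I_mul_I
    have h0 := pol_ne_zero s θ
    field_simp
    linear_combination (-1 : ℂ) * this
  · simp only [pol_period]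

theorem exists_holomorphic_part {W : ℂ → ℂ} {C : ℝ} {d : ℂ} (hW : DifferentiableOn ℂ W PD)
    (hC : ∀ z ∈ PD, ‖z * W z‖ ≤ C) {s : ℝ} (hs : s < 0)
    (hflux : (cavg fun θ => pol s θ * W (pol s θ)) = -2)
    (hmom : (cavg fun θ => pol s θ * W (pol s θ) ^ 2) = 2 * d) :
    ∃ h : ℂ → ℂ, DifferentiableOn ℂ h (ball 0 1) ∧ (∀ z ∈ PD, W z = -2 / z + h z) ∧
      h 0 = -d / 2 := by
  have hb : ball (0 : ℂ) 1 ∈ 𝓝 (0 : ℂ) := ball_mem_nhds _ one_pos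
  set k : ℂ → ℂ := Function.update (fun z => z * W z) 0 (limUnder (𝓝[≠] 0) fun z => z * W z)
    with hk
  have hkd : DifferentiableOn ℂ k (ball 0 1) := by
    refine Complex.differentiableOn_update_limUnder_of_bddAbove hb (differentiableOn_id.mul hW)
      ⟨C, ?_⟩
    rintro _ ⟨z, hz, rfl⟩
    exact hC z hz
  have hkz : ∀ z ∈ PD, k z = z * W z := fun z hz => by
    rw [hk, Function.update_of_ne hz.2]
  have hk0 : k 0 = -2 := by
    rw [← cavg_pol_of_differentiableOn hkd hs, ← hflux]
    exact congrArg cavg (funext fun θ => hkz _ (pol_mem_PD hs θ))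
  have hd : DifferentiableOn ℂ (dslope k 0) (ball 0 1) :=
    (Complex.differentiableOn_dslope hb).2 hkd
  have hWz : ∀ z ∈ PD, W z = -2 / z + dslope k 0 z := fun z hz => by
    have hz0 : z ≠ 0 := hz.2
    have h1 := sub_smul_dslope k 0 z
    rw [sub_zero, smul_eq_mul, hk0, hkz z hz] at h1
    field_simp
    linear_combination (-1 : ℂ) * h1
  refine ⟨dslope k 0, hd, hWz, ?_⟩
  set h := dslope k 0
  have hq : DifferentiableOn ℂ (fun z => -4 * h z + z * h z ^ 2) (ball 0 1) :=
    (hd.const_mul _).add (differentiableOn_id.mul (hd.pow 2))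
  have h1 := cavg_pol_of_differentiableOn hq hs
  have h2 : (fun θ => pol s θ * W (pol s θ) ^ 2) = fun θ => 4 * (pol s θ)⁻¹
      + (-4 * h (pol s θ) + pol s θ * h (pol s θ) ^ 2) := funext fun θ => by
    rw [hWz _ (pol_mem_PD hs θ)]
    have := pol_ne_zero s θ
    field_simp
    ring
  have hc : Continuous fun θ => -4 * h (pol s θ) + pol s θ * h (pol s θ) ^ 2 :=
    continuous_slice (F := fun s θ => -4 * h (pol s θ) + pol s θ * h (pol s θ) ^ 2)
      (continuousOn_comp_pol hq.continuousOn) hs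
  have hi : Continuous fun θ => 4 * (pol s θ)⁻¹ :=
    ((continuous_pol_right s).inv₀ (pol_ne_zero s)).const_mul 4
  have h3 := cavg_smul (4 : ℂ) fun θ => (pol s θ)⁻¹
  simp only [smul_eq_mul] at h3
  rw [h2, cavg_add hi hc, h3,
    cavg_inv_pol, h1] at hmom
  simp only [mul_zero, zero_mul, zero_add, add_zero] at hmom
  linear_combination (-1 / 4 : ℂ) * hmom

theorem isPreconnected_PD : IsPreconnected PD := by
  have h : PD = (fun p : ℝ × ℝ => pol p.1 p.2) '' (Iio 0 ×ˢ univ) := by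
    ext z
    constructor
    · intro hz
      obtain ⟨s, hs, θ, rfl⟩ := exists_pol hz
      exact ⟨(s, θ), ⟨hs, mem_univ _⟩, rfl⟩
    · rintro ⟨⟨s, θ⟩, ⟨hs, -⟩, rfl⟩
      exact pol_mem_PD hs θ
  rw [h]
  exact (isPreconnected_Iio.prod isPreconnected_univ).image _ continuous_pol.continuousOn

theorem hasFDerivAt_re_of_hasDerivAt {Φ : ℂ → ℂ} {ζ z : ℂ} (h : HasDerivAt Φ ζ z) :
    HasFDerivAt (fun w => (Φ w).re) (reMul ζ) z := by
  have h1 := (Complex.reCLM.hasFDerivAt (x := Φ z)).comp z (h.hasFDerivAt.restrictScalars ℝ)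
  refine h1.congr_fderiv ?_
  ext w
  simp [reMul_apply, mul_comm]

theorem hasFDerivAt_neg_two_log_norm {z : ℂ} (hz : z ≠ 0) :
    HasFDerivAt (fun w : ℂ => -2 * log ‖w‖) (reMul (-2 / z)) z := by
  have e : (fun w : ℂ => -2 * log ‖w‖) = fun w => -log (w.re * w.re + w.im * w.im) := by
    funext w
    have := Complex.normSq_eq_norm_sq w
    rw [Complex.normSq_apply] at this
    rw [this, Real.log_pow]
    push_cast
    ring
  have hn : z.re * z.re + z.im * z.im ≠ 0 := by
    have := Complex.normSq_pos.2 hz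
    rw [Complex.normSq_apply] at this
    exact this.ne'
  rw [e]
  have h1 : HasFDerivAt (fun w : ℂ => w.re) Complex.reCLM z := Complex.reCLM.hasFDerivAt
  have h2 : HasFDerivAt (fun w : ℂ => w.im) Complex.imCLM z := Complex.imCLM.hasFDerivAt
  refine (((h1.mul h1).add (h2.mul h2)).log hn).neg.congr_fderiv ?_
  ext w
  simp [reMul_apply, Complex.div_re, Complex.div_im, Complex.normSq_apply]
  field_simp
  ring

namespace GreenSeq

variable {V : ℕ → ℂ → ℝ} {D K A c : ℝ} {d : ℂ} {Vl : ℂ → ℝ} {W : ℂ → ℂ}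

theorem hasFDerivAt_limit (G : GreenSeq V D K A c d)
    (hV : TendstoLocallyUniformlyOn V Vl atTop PD)
    (hW : TendstoLocallyUniformlyOn (fun n => dz (V n)) W atTop PD) {z : ℂ} (hz : z ∈ PD) :
    HasFDerivAt Vl (reMul (W z)) z := by
  refine hasFDerivAt_of_tendstoLocallyUniformlyOn (f := V) (g' := fun z => reMul (W z))
    (f' := fun n z => reMul (dz (V n) z)) isOpen_PD
    (reMul.uniformContinuous.comp_tendstoLocallyUniformlyOn hW) (fun n x hx => ?_)
    (fun x hx => hV.tendsto_at hx) hz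
  rw [← fderiv_eq_reMul]
  exact hasFDerivAt_of_smooth (G.smooth n) hx.1

/-- The limit differs from `-2 log |z|` by a harmonic function vanishing at the origin. -/
theorem limit_eq (G : GreenSeq V D K A c d)
    (hV : TendstoLocallyUniformlyOn V Vl atTop PD)
    (hW : TendstoLocallyUniformlyOn (fun n => dz (V n)) W atTop PD) :
    ∃ Φ : ℂ → ℂ, ∃ h : ℂ → ℂ, Φ 0 = 0 ∧ (∀ z ∈ ball (0 : ℂ) 1, HasDerivAt Φ (h z) z) ∧
      h 0 = -d / 2 ∧ (∀ z ∈ PD, Vl z = -2 * log ‖z‖ + (Φ z).re) ∧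
      ∀ z ∈ PD, W z = -2 / z + h z := by
  have hWd := G.differentiableOn_limit hW
  have hs : (-1 : ℝ) < 0 := by norm_num
  obtain ⟨h, hd, hWz, h0⟩ := exists_holomorphic_part (d := d) hWd (C := 2 * D) (fun z hz =>
      le_of_tendsto ((hW.tendsto_at hz).const_mul z).norm
        (Eventually.of_forall fun n => G.norm_mul_dz_le n hz.1)) hs
    (tendsto_nhds_unique (G.tendsto_cavg_dz hW hs).1 (G.flux _ hs))
    (tendsto_nhds_unique (G.tendsto_cavg_dz hW hs).2 (G.mom _ hs))
  obtain ⟨Φ, hΦ0, hΦ⟩ := hd.isExactOn_ball.with_val_at 0 0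
  refine ⟨Φ, h, hΦ0, hΦ, h0, ?_, hWz⟩
  have hD1 : ∀ z ∈ PD, HasFDerivAt (fun w => -2 * log ‖w‖ + (Φ w).re) (reMul (W z)) z :=
    fun z hz => by
      rw [hWz z hz, map_add]
      exact (hasFDerivAt_neg_two_log_norm hz.2).add (hasFDerivAt_re_of_hasDerivAt (hΦ z hz.1))
  obtain ⟨a, ha⟩ := isOpen_PD.exists_eq_add_of_fderiv_eq isPreconnected_PD
    (fun z hz => (G.hasFDerivAt_limit hV hW hz).differentiableAt.differentiableWithinAt)
    (fun z hz => (hD1 z hz).differentiableAt.differentiableWithinAt)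
    (fun z hz => by rw [(G.hasFDerivAt_limit hV hW hz).fderiv, (hD1 z hz).fderiv])
  have hΦc : ContinuousOn Φ (ball 0 1) := fun z hz => (hΦ z hz).continuousAt.continuousWithinAt
  have hm : ∀ s : ℝ, s < 0 → |a| ≤ A * exp (s / c) := by
    intro s hs
    have hcV : ∀ n, Continuous fun θ => V n (pol s θ) := fun n =>
      continuous_slice (F := fun s θ => V n (pol s θ))
        (continuousOn_comp_pol (G.smooth n).continuousOn) hs
    have hcP : Continuous fun θ => Φ (pol s θ) :=
      continuous_slice (F := fun s θ => Φ (pol s θ)) (continuousOn_comp_pol hΦc) hs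
    have hmean : (cavg fun θ => Vl (pol s θ)) = -2 * s + a := by
      have e : (fun θ => Vl (pol s θ)) = fun θ => (-2 * s + a) + (Φ (pol s θ)).re :=
        funext fun θ => by
          have := ha (pol_mem_PD hs θ)
          simp only [norm_pol, log_exp] at this
          linarith
      have hcR : Continuous fun θ => (Φ (pol s θ)).re := Complex.continuous_re.comp hcP
      have e2 : (cavg fun θ => (Φ (pol s θ)).re) = (cavg fun θ => Φ (pol s θ)).re := by
        have := Complex.reCLM.intervalIntegral_comp_comm
          (hcP.intervalIntegrable (μ := volume) 0 (2 * π))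
        simp only [cavg, Complex.reCLM_apply] at this ⊢
        rw [this, Complex.smul_re]
      rw [e, cavg_add continuous_const hcR, cavg_const, e2,
        cavg_pol_of_differentiableOn (fun z hz => (hΦ z hz).differentiableAt.differentiableWithinAt)
          hs, hΦ0]
      simp
    have hlim : Tendsto (fun n => cavg fun θ => V n (pol s θ)) atTop (𝓝 (-2 * s + a)) := by
      rw [← hmean]
      obtain ⟨M, hM⟩ := G.exists_bound (pol_mem_PD hs 0)
      refine tendsto_cavg_of_bounded (C := M + K) hcV (fun n θ => ?_) fun θ =>
        hV.tendsto_at (pol_mem_PD hs θ)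
      have h1 := abs_add_le (V n (pol s 0)) (V n (pol s θ) - V n (pol s 0))
      rw [add_sub_cancel] at h1
      have h2 := G.osc n s hs θ 0
      rw [norm_eq_abs]
      linarith [hM n]
    refine le_of_forall_pos_le_add fun ε hε => ?_
    have h1 : Tendsto (fun n => |(cavg fun θ => V n (pol s θ)) + 2 * s|) atTop
        (𝓝 |(-2 * s + a) + 2 * s|) := (hlim.add_const _).abs
    have h2 := le_of_tendsto h1 (G.mean s hs ε hε)
    rw [show (-2 * s + a) + 2 * s = a by ring] at h2
    linarith
  have ha0 : a = 0 := by
    have t : Tendsto (fun s : ℝ => A * exp (s / c)) atBot (𝓝 (A * 0)) :=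
      (tendsto_exp_atBot.comp (tendsto_id.atBot_div_const G.hc)).const_mul A
    rw [mul_zero] at t
    exact abs_nonpos_iff.1 (ge_of_tendsto t ((eventually_lt_atBot 0).mono hm))
  intro z hz
  have := ha hz
  simpa [ha0] using this

end GreenSeq

theorem harmonic_re {Φ h : ℂ → ℂ} (hΦ : ∀ z ∈ ball (0 : ℂ) 1, HasDerivAt Φ (h z) z) {z : ℂ}
    (hz : z ∈ ball (0 : ℂ) 1) :
    fderiv ℝ (fderiv ℝ fun w => (Φ w).re) z 1 1
      + fderiv ℝ (fderiv ℝ fun w => (Φ w).re) z Complex.I Complex.I = 0 := by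
  have hΦd : DifferentiableOn ℂ Φ (ball 0 1) := fun z hz =>
    (hΦ z hz).differentiableAt.differentiableWithinAt
  have hd : DifferentiableOn ℂ h (ball 0 1) :=
    (hΦd.deriv isOpen_ball).congr fun z hz => (hΦ z hz).deriv.symm
  have h1 := (hd.differentiableAt (isOpen_ball.mem_nhds hz)).hasDerivAt
  have h2 : HasFDerivAt (fun w => reMul (h w))
      (reMul.comp ((ContinuousLinearMap.toSpanSingleton ℂ (deriv h z)).restrictScalars ℝ)) z :=
    reMul.hasFDerivAt.comp z (h1.hasFDerivAt.restrictScalars ℝ)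
  have h3 : (fderiv ℝ fun w => (Φ w).re) =ᶠ[𝓝 z] fun w => reMul (h w) := by
    filter_upwards [isOpen_ball.mem_nhds hz] with w hw
    exact (hasFDerivAt_re_of_hasDerivAt (hΦ w hw)).fderiv
  rw [h3.fderiv_eq, h2.fderiv]
  simp

namespace GreenSeq

variable {V : ℕ → ℂ → ℝ} {D K A c : ℝ} {d : ℂ}

theorem exists_harmonic_limit (G : GreenSeq V D K A c d) : ∃ φ : ℕ → ℕ, StrictMono φ ∧
    ∃ H : ℂ → ℝ, ContDiffOn ℝ (⊤ : ℕ∞) H (ball 0 1) ∧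
      (∀ z ∈ ball (0 : ℂ) 1, fderiv ℝ (fderiv ℝ H) z 1 1
        + fderiv ℝ (fderiv ℝ H) z Complex.I Complex.I = 0) ∧
      H 0 = 0 ∧ fderiv ℝ H 0 = reMul (-d / 2) ∧
      TendstoLocallyUniformlyOn (fun n => V (φ n)) (fun z => -2 * log ‖z‖ + H z) atTop PD ∧
      TendstoLocallyUniformlyOn (fun n => fderiv ℝ (V (φ n)))
        (fderiv ℝ fun z => -2 * log ‖z‖ + H z) atTop PD := by
  obtain ⟨φ, hφ, Vl, W, hV, hW⟩ := G.exists_tendsto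
  obtain ⟨Φ, h, hΦ0, hΦ, h0, hVl, hWz⟩ := (G.comp hφ.tendsto_atTop).limit_eq hV hW
  have hb0 : (0 : ℂ) ∈ ball (0 : ℂ) 1 := mem_ball_self one_pos
  have hΦd : DifferentiableOn ℂ Φ (ball 0 1) := fun z hz =>
    (hΦ z hz).differentiableAt.differentiableWithinAt
  refine ⟨φ, hφ, fun z => (Φ z).re, ?_, fun z hz => harmonic_re hΦ hz, by simp [hΦ0], ?_,
    hV.congr_right hVl, ?_⟩
  · exact Complex.reCLM.contDiff.comp_contDiffOn
      ((hΦd.contDiffOn isOpen_ball).restrict_scalars ℝ)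
  · rw [(hasFDerivAt_re_of_hasDerivAt (hΦ 0 hb0)).fderiv, h0]
  · have h1 := reMul.uniformContinuous.comp_tendstoLocallyUniformlyOn hW
    refine TendstoLocallyUniformlyOn.congr_right (g := _)
      (TendstoLocallyUniformlyOn.congr h1 (G := fun n => fderiv ℝ (V (φ n))) fun n z _ => ?_)
      fun z hz => ?_
    · exact (fderiv_eq_reMul _ _).symm
    · have := (hasFDerivAt_neg_two_log_norm hz.2).add (hasFDerivAt_re_of_hasDerivAt (hΦ z hz.1))
      rw [Function.comp_apply, hWz z hz, map_add]
      exact this.fderiv.symm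

end GreenSeq

theorem cavg_ofReal (g : ℝ → ℝ) : (cavg fun θ => (g θ : ℂ)) = (cavg g : ℝ) := by
  simp only [cavg, intervalIntegral.integral_ofReal, Complex.real_smul, smul_eq_mul]
  push_cast
  rfl

namespace Cyl

variable {b lam s : ℝ} (C : Cyl b lam)

theorem cavg_ut (hs : s < b) : cavg (C.ut s) = 0 :=
  cavg_deriv_eq_zero (C.hut s hs) (continuous_slice C.cut hs) (C.pu s hs)

theorem cavg_us_sub (hs : s < b) :
    (cavg fun θ => (C.us s θ : ℂ) - Complex.I * C.ut s θ) = (cavg (C.us s) : ℝ) := by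
  have h1 : Continuous fun θ => (C.us s θ : ℂ) :=
    Complex.continuous_ofReal.comp (continuous_slice C.cus hs)
  have h2 : Continuous fun θ => Complex.I * (C.ut s θ : ℂ) :=
    (Complex.continuous_ofReal.comp (continuous_slice C.cut hs)).const_mul _
  have h3 := cavg_smul Complex.I fun θ => (C.ut s θ : ℂ)
  simp only [smul_eq_mul] at h3
  rw [cavg_sub h1 h2, h3, cavg_ofReal, cavg_ofReal, C.cavg_ut hs]
  simp

end Cyl

theorem PlaneSol.pol_mul_dz {lam : ℝ} {f v : ℂ → ℝ} (S : PlaneSol lam f v) (s θ : ℝ) :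
    pol s θ * dz v (pol s θ) = (S.cyl.us s θ : ℂ) - Complex.I * S.cyl.ut s θ :=
  dz_mul _ _ _

section
variable {g : ℂ → ℝ} {z : ℂ}

theorem fderiv_mul_sub (hg : ContDiffOn ℝ (⊤ : ℕ∞) g (ball 0 1)) (hz : z ∈ ball (0 : ℂ) 1)
    (a b : ℝ) : fderiv ℝ (fun w => a * (g w - b)) z = a • fderiv ℝ g z :=
  (((hasFDerivAt_of_smooth hg hz).sub_const b).const_mul a).fderiv

theorem fderiv_fderiv_mul_sub (hg : ContDiffOn ℝ (⊤ : ℕ∞) g (ball 0 1))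
    (hz : z ∈ ball (0 : ℂ) 1) (a b : ℝ) :
    fderiv ℝ (fderiv ℝ fun w => a * (g w - b)) z = a • fderiv ℝ (fderiv ℝ g) z := by
  have h : (fderiv ℝ fun w => a * (g w - b)) =ᶠ[𝓝 z] fun w => a • fderiv ℝ g w := by
    filter_upwards [isOpen_ball.mem_nhds hz] with w hw using fderiv_mul_sub hg hw a b
  rw [h.fderiv_eq]
  exact ((hasFDerivAt_fderiv_of_smooth hg hz).const_smul a).fderiv

theorem dz_mul_sub (hg : ContDiffOn ℝ (⊤ : ℕ∞) g (ball 0 1)) (hz : z ∈ ball (0 : ℂ) 1)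
    (a b : ℝ) : dz (fun w => a * (g w - b)) z = a * dz g z := by
  simp only [dz, fderiv_mul_sub hg hz, smul_apply, smul_eq_mul]
  push_cast
  ring

end

namespace BlowUp

variable {γ μ lam : ℕ → ℝ} {C₀ Cf D : ℝ} {f v : ℕ → ℂ → ℝ} {B : ℕ → ℝ → ℝ}

theorem comp (S : BlowUp γ μ lam C₀ Cf D f v B) {φ : ℕ → ℕ} (hφ : Tendsto φ atTop atTop) :
    BlowUp (fun n => γ (φ n)) (fun n => μ (φ n)) (fun n => lam (φ n)) C₀ Cf D
      (fun n => f (φ n)) (fun n => v (φ n)) (fun n => B (φ n)) where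
  sys n := S.sys (φ n)
  hγ := S.hγ.comp hφ
  hμ := S.hμ.comp hφ
  close ℓ η hη := hφ.eventually (S.close ℓ η hη)

theorem greenSeq (S : BlowUp γ μ lam C₀ Cf D f v B) {d : ℂ}
    (hd : Tendsto (fun n => dz (f n) 0 / f n 0) atTop (𝓝 d)) :
    GreenSeq (fun n z => γ n * (v n z - B n 1)) D (2 * π * D) (A2 D) (2 * Av C₀ Cf D) d where
  smooth n := contDiffOn_const.mul ((S.sys n).sol.cv.sub contDiffOn_const)
  grad n z hz := by
    have hγ := (S.sys n).hγ
    have h0 : 0 < γ n := by linarith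
    rw [fderiv_mul_sub (S.sys n).sol.cv hz, norm_smul, norm_of_nonneg h0.le]
    have h1 := (le_div_iff₀ h0).1 ((S.sys n).hdv z hz)
    linarith
  osc n s hs θ θ' := by
    have hγ := (S.sys n).hγ
    have h0 : 0 < γ n := by linarith
    have h1 := (le_div_iff₀ h0).1 ((S.sys n).abs_u_sub hs θ θ')
    rw [show γ n * (v n (pol s θ) - B n 1) - γ n * (v n (pol s θ') - B n 1)
      = γ n * ((S.sys n).sol.cyl.u s θ - (S.sys n).sol.cyl.u s θ') by
        simp only [PlaneSol.cyl]; ring, abs_mul, abs_of_pos h0]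
    linarith
  lapl r hr ε hε := by
    filter_upwards [S.eventually_density (log r) (mul_pos hε (pow_pos hr 2))] with n hn z hz1 hz2
    have hzP : z ∈ PD := ⟨mem_ball_zero_iff.2 hz2, norm_pos_iff.1 (hr.trans_le hz1)⟩
    obtain ⟨s, hs, θ, rfl⟩ := exists_pol hzP
    rw [norm_pol] at hz1
    have hls : log r ≤ s := (log_le_iff_le_exp hr).2 hz1
    have h1 := (hn s ⟨hls, hs⟩ θ).1
    rw [fderiv_fderiv_mul_sub (S.sys n).sol.cv hzP.1]
    have h2 := (S.sys n).sol.pde _ hzP.1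
    have h3 : (γ n • fderiv ℝ (fderiv ℝ (v n)) (pol s θ)) 1 1
        + (γ n • fderiv ℝ (fderiv ℝ (v n)) (pol s θ)) Complex.I Complex.I
        = -(γ n * lam n * (S.sys n).sol.cyl.g s θ) := by
      simp only [smul_apply, smul_eq_mul, Cyl.g, PlaneSol.cyl]
      linear_combination γ n * h2
    rw [h3, abs_neg]
    have h4 : exp (2 * s) = exp s ^ 2 := by rw [← exp_nat_mul]; norm_num
    rw [show γ n * lam n * exp (2 * s) * (S.sys n).sol.cyl.g s θ
      = exp s ^ 2 * (γ n * lam n * (S.sys n).sol.cyl.g s θ) by rw [h4]; ring, abs_mul,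
      abs_of_nonneg (sq_nonneg _)] at h1
    have h5 := mul_le_mul_of_nonneg_right (pow_le_pow_left₀ hr.le hz1 2)
      (abs_nonneg (γ n * lam n * (S.sys n).sol.cyl.g s θ))
    refine le_of_mul_le_mul_left ?_ (pow_pos hr 2)
    linarith
  hc := by
    have hD := (S.sys 0).hD
    have := one_le_two_pi_sq.trans
      (one_le_Ac (D := 2 * π * D) (S.sys 0).hC₀.le (S.sys 0).hCf (by positivity) (le_refl 0))
    change 0 < 2 * Ac C₀ Cf (2 * π * D) 0
    linarith
  mean s hs ε hε := by
    filter_upwards [S.eventually_compare hs hε] with n hn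
    have h : (cavg fun θ => γ n * (v n (pol s θ) - B n 1))
        = γ n * ((S.sys n).sol.cyl.y s - B n 1) := by
      have h1 : (cavg fun θ => (S.sys n).sol.cyl.u s θ - B n 1)
          = (S.sys n).sol.cyl.y s - B n 1 := by
        rw [cavg_sub (continuous_slice (S.sys n).sol.cyl.cu hs) continuous_const, cavg_const]
        rfl
      rw [cavg_const_mul]
      exact congrArg _ h1
    rw [h]
    exact hn
  flux s hs := by
    have h : ∀ n, (cavg fun θ => pol s θ * dz (fun z => γ n * (v n z - B n 1)) (pol s θ))
        = ((-(S.sys n).sol.cyl.p (γ n) s : ℝ) : ℂ) := fun n => by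
      have e : (fun θ => pol s θ * dz (fun z => γ n * (v n z - B n 1)) (pol s θ))
          = fun θ => (γ n : ℂ) * (((S.sys n).sol.cyl.us s θ : ℂ)
            - Complex.I * (S.sys n).sol.cyl.ut s θ) := funext fun θ => by
        rw [dz_mul_sub (S.sys n).sol.cv (pol_mem hs θ), ← (S.sys n).sol.pol_mul_dz]
        ring
      have h3 := cavg_smul (γ n : ℂ) fun θ => ((S.sys n).sol.cyl.us s θ : ℂ)
            - Complex.I * (S.sys n).sol.cyl.ut s θ
      simp only [smul_eq_mul] at h3
      rw [e, h3, Cyl.cavg_us_sub _ hs, Cyl.p]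
      push_cast
      ring
    simp only [h]
    have hp : Tendsto (fun n => (S.sys n).sol.cyl.p (γ n) s) atTop (𝓝 2) := by
      rw [← tendsto_sub_nhds_zero_iff, NormedAddGroup.tendsto_nhds_zero]
      intro ε hε
      filter_upwards [S.eventually_abs_p_sub hs (half_pos hε)] with n hn
      rw [norm_eq_abs]
      linarith
    have := (Complex.continuous_ofReal.tendsto _).comp hp.neg
    simpa [Function.comp_def] using this
  mom s hs := by
    have h : ∀ n, (cavg fun θ => pol s θ * dz (fun z => γ n * (v n z - B n 1)) (pol s θ) ^ 2)
        = (γ n : ℂ) ^ 2 * (S.sys n).sol.cyl.M s := fun n => by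
      have e : (fun θ => pol s θ * dz (fun z => γ n * (v n z - B n 1)) (pol s θ) ^ 2)
          = fun θ : ℝ => (γ n : ℂ) ^ 2 * (Complex.exp (-(s + θ * Complex.I)) *
            (((S.sys n).sol.cyl.us s θ : ℂ)
            - Complex.I * (S.sys n).sol.cyl.ut s θ) ^ 2) := funext fun θ => by
        rw [dz_mul_sub (S.sys n).sol.cv (pol_mem hs θ), ← (S.sys n).sol.pol_mul_dz, Complex.exp_neg,
          ← pol]
        have := pol_ne_zero s θ
        field_simp
      have h3 := cavg_smul ((γ n : ℂ) ^ 2) fun θ : ℝ => Complex.exp (-(s + θ * Complex.I)) *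
            (((S.sys n).sol.cyl.us s θ : ℂ)
            - Complex.I * (S.sys n).sol.cyl.ut s θ) ^ 2
      simp only [smul_eq_mul] at h3
      rw [e, h3, Cyl.M]
    simp only [h]
    simpa using (S.tendsto_M hs).add (hd.const_mul 2)

theorem exists_limit (S : BlowUp γ μ lam C₀ Cf D f v B) : ∃ φ : ℕ → ℕ, StrictMono φ ∧
    ∃ (d : ℂ) (H : ℂ → ℝ), Tendsto (fun n => dz (f (φ n)) 0 / f (φ n) 0) atTop (𝓝 d) ∧
      ContDiffOn ℝ (⊤ : ℕ∞) H (ball 0 1) ∧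
      (∀ z ∈ ball (0 : ℂ) 1, fderiv ℝ (fderiv ℝ H) z 1 1
        + fderiv ℝ (fderiv ℝ H) z Complex.I Complex.I = 0) ∧
      H 0 = 0 ∧ fderiv ℝ H 0 = reMul (-d / 2) ∧
      TendstoLocallyUniformlyOn (fun n z => γ (φ n) * (v (φ n) z - B (φ n) 1))
        (fun z => -2 * log ‖z‖ + H z) atTop PD ∧
      TendstoLocallyUniformlyOn
        (fun n => fderiv ℝ fun z => γ (φ n) * (v (φ n) z - B (φ n) 1))
        (fderiv ℝ fun z => -2 * log ‖z‖ + H z) atTop PD := by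
  obtain ⟨d, -, ψ, hψ, hd⟩ := (isCompact_closedBall (0 : ℂ) (2 * Cf * C₀)).tendsto_subseq
    (x := fun n => dz (f n) 0 / f n 0) fun n => mem_closedBall_zero_iff.2 (S.sys n).norm_coef
  obtain ⟨φ, hφ, H, h⟩ := ((S.comp hψ.tendsto_atTop).greenSeq hd).exists_harmonic_limit
  exact ⟨ψ ∘ φ, hψ.comp hφ, d, H, hd.comp hφ.tendsto_atTop, h⟩

end BlowUp

/-- The isometric identification of `ℂ` with the plane. -/
abbrev toPt : ℂ ≃ₗᵢ[ℝ] Pt := Complex.orthonormalBasisOneI.repr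

/-- The identification of `ℂ` with the plane, scaled by `R`. -/
def plin (R : ℝ) : ℂ →L[ℝ] Pt := R • (toPt.toContinuousLinearEquiv : ℂ →L[ℝ] Pt)

theorem plin_apply (R : ℝ) (z : ℂ) : plin R z = R • toPt z := rfl

theorem norm_plin {R : ℝ} (hR : 0 < R) (z : ℂ) : ‖plin R z‖ = R * ‖z‖ := by
  rw [plin_apply, norm_smul, norm_of_nonneg hR.le, LinearIsometryEquiv.norm_map]

theorem plin_mem_ball {R : ℝ} (hR : 0 < R) {z : ℂ} (hz : z ∈ ball (0 : ℂ) 1) :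
    plin R z ∈ ball (0 : Pt) R := by
  rw [mem_ball_zero_iff] at hz ⊢
  rw [norm_plin hR]
  have := mul_lt_mul_of_pos_left hz hR
  linarith

theorem toPt_one : toPt 1 = EuclideanSpace.single 0 1 := by
  ext i; fin_cases i <;> simp [toPt]

theorem toPt_I : toPt Complex.I = EuclideanSpace.single 1 1 := by
  ext i; fin_cases i <;> simp [toPt]

theorem inner_toPt (z w : ℂ) : ⟪toPt z, toPt w⟫ = z.re * w.re + z.im * w.im := by
  rw [LinearIsometryEquiv.inner_map_map, Complex.inner]
  simp
  ring

section pullback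

variable {g : Pt → ℝ} {R : ℝ} {z : ℂ}

theorem contDiffOn_plin (hR : 0 < R) (hg : ContDiffOn ℝ (⊤ : ℕ∞) g (ball 0 R)) :
    ContDiffOn ℝ (⊤ : ℕ∞) (fun w => g (plin R w)) (ball 0 1) :=
  hg.comp (plin R).contDiff.contDiffOn fun _ h => plin_mem_ball hR h

theorem fderiv_plin (hR : 0 < R) (hg : ContDiffOn ℝ (⊤ : ℕ∞) g (ball 0 R))
    (hz : z ∈ ball (0 : ℂ) 1) :
    fderiv ℝ (fun w => g (plin R w)) z = (fderiv ℝ g (plin R z)).comp (plin R) := by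
  have := fderiv_comp_affine 0 (plin R) isOpen_ball hg (x := z)
    (by simpa only [zero_add] using plin_mem_ball hR hz)
  simpa only [zero_add] using this

theorem fderiv_fderiv_plin (hR : 0 < R) (hg : ContDiffOn ℝ (⊤ : ℕ∞) g (ball 0 R))
    (hz : z ∈ ball (0 : ℂ) 1) (a b : ℂ) :
    fderiv ℝ (fderiv ℝ fun w => g (plin R w)) z a b
      = fderiv ℝ (fderiv ℝ g) (plin R z) (plin R a) (plin R b) := by
  have := fderiv_fderiv_comp_affine 0 (plin R) isOpen_ball hg (x := z)
    (by simpa only [zero_add] using plin_mem_ball hR hz) a b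
  simpa only [zero_add] using this

theorem norm_fderiv_plin_le (hR : 0 < R) (hg : ContDiffOn ℝ (⊤ : ℕ∞) g (ball 0 R))
    (hz : z ∈ ball (0 : ℂ) 1) :
    ‖fderiv ℝ (fun w => g (plin R w)) z‖ ≤ R * ‖fderiv ℝ g (plin R z)‖ := by
  rw [fderiv_plin hR hg hz]
  refine ContinuousLinearMap.opNorm_le_bound _ (by positivity) fun e => ?_
  have := (fderiv ℝ g (plin R z)).le_opNorm (plin R e)
  rw [norm_plin hR] at this
  rw [ContinuousLinearMap.comp_apply]
  linarith

theorem norm_fderiv_fderiv_plin_le (hR : 0 < R) (hg : ContDiffOn ℝ (⊤ : ℕ∞) g (ball 0 R))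
    (hz : z ∈ ball (0 : ℂ) 1) :
    ‖fderiv ℝ (fderiv ℝ fun w => g (plin R w)) z‖ ≤ R ^ 2 * ‖iteratedFDeriv ℝ 2 g (plin R z)‖ := by
  refine ContinuousLinearMap.opNorm_le_bound₂ _ (by positivity) fun a b => ?_
  rw [fderiv_fderiv_plin hR hg hz]
  have h := (iteratedFDeriv ℝ 2 g (plin R z)).le_opNorm ![plin R a, plin R b]
  rw [iteratedFDeriv_two_apply, Fin.prod_univ_two] at h
  simp only [Matrix.cons_val_zero, Matrix.cons_val_one, norm_plin hR] at h
  linarith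

end pullback

theorem norm_gradient (g : Pt → ℝ) (x : Pt) : ‖gradient g x‖ = ‖fderiv ℝ g x‖ := by
  rw [gradient, LinearIsometryEquiv.norm_map]

theorem lap_eq {g : Pt → ℝ} {O : Set Pt} (hO : IsOpen O) (hg : ContDiffOn ℝ (⊤ : ℕ∞) g O) {x : Pt}
    (hx : x ∈ O) : lap g x = -(fderiv ℝ (fderiv ℝ g) x (toPt 1) (toPt 1)
      + fderiv ℝ (fderiv ℝ g) x (toPt Complex.I) (toPt Complex.I)) := by
  have hd : DifferentiableAt ℝ (fderiv ℝ g) x :=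
    ((hg.fderiv_of_isOpen (m := (⊤ : ℕ∞)) hO (by simp)).contDiffAt
      (hO.mem_nhds hx)).differentiableAt
      (by simp)
  have h : ∀ e, fderiv ℝ (fun y => fderiv ℝ g y e) x e = fderiv ℝ (fderiv ℝ g) x e e := fun e => by
    rw [fderiv_clm_apply hd (differentiableAt_const e)]
    simp
  rw [lap, Fin.sum_univ_two, h, h, toPt_one, toPt_I]

section convergence

variable {F : ℕ → Pt → ℝ} {g : Pt → ℝ} {s : Set Pt}

theorem iteratedFDeriv_one_eq (g : Pt → ℝ) (x : Pt) :
    iteratedFDeriv ℝ 1 g x = (continuousMultilinearCurryFin1 ℝ Pt ℝ).symm (fderiv ℝ g x) := by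
  ext m
  rw [iteratedFDeriv_one_apply, continuousMultilinearCurryFin1_symm_apply]

theorem TendstoCkLocOn.tendsto {k : ℕ} (h : TendstoCkLocOn F g s k) :
    TendstoLocallyUniformlyOn F g atTop s := by
  have hu := (continuousMultilinearCurryFin0 ℝ Pt ℝ).isometry.uniformContinuous
  have h0 := hu.comp_tendstoLocallyUniformlyOn (h 0 k.zero_le)
  refine (h0.congr fun n x _ => ?_).congr_right fun x _ => ?_ <;>
  simp

theorem TendstoCkLocOn.tendsto_fderiv {k : ℕ} (hk : 1 ≤ k) (h : TendstoCkLocOn F g s k) :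
    TendstoLocallyUniformlyOn (fun n => fderiv ℝ (F n)) (fderiv ℝ g) atTop s := by
  have hu := (continuousMultilinearCurryFin1 ℝ Pt ℝ).isometry.uniformContinuous
  have h0 := hu.comp_tendstoLocallyUniformlyOn (h 1 hk)
  refine (h0.congr fun n x _ => ?_).congr_right fun x _ => ?_ <;>
  simp only [Function.comp_apply, iteratedFDeriv_one_eq, LinearIsometryEquiv.apply_symm_apply]

theorem tendstoCkLocOn_one (h0 : TendstoLocallyUniformlyOn F g atTop s)
    (h1 : TendstoLocallyUniformlyOn (fun n => fderiv ℝ (F n)) (fderiv ℝ g) atTop s) :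
    TendstoCkLocOn F g s 1 := by
  intro j hj
  obtain rfl | rfl : j = 0 ∨ j = 1 := by omega
  · simp only [iteratedFDeriv_zero_eq_comp]
    have hu := (continuousMultilinearCurryFin0 ℝ Pt ℝ).symm.isometry.uniformContinuous
    exact hu.comp_tendstoLocallyUniformlyOn h0
  · simp only [iteratedFDeriv_one_eq]
    have hu := (continuousMultilinearCurryFin1 ℝ Pt ℝ).symm.isometry.uniformContinuous
    exact hu.comp_tendstoLocallyUniformlyOn h1

end convergence

theorem fderiv_Ustd (x w : Pt) : fderiv ℝ Ustd x w = -(⟪x, w⟫ / 2 / (1 + ‖x‖ ^ 2 / 4)) := by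
  have h1 : HasFDerivAt (fun x : Pt => ‖x‖ ^ 2) (2 • (innerSL ℝ x)) x :=
    (hasStrictFDerivAt_norm_sq x).hasFDerivAt
  have h2 : 1 + ‖x‖ ^ 2 / 4 ≠ 0 := by positivity
  have h2' : 1 + (1 / 4) * ‖x‖ ^ 2 ≠ 0 := by positivity
  have h3 := (((h1.const_mul (1 / 4)).const_add 1).log h2').neg
  have e : Ustd = -fun y => log (1 + (1 / 4) * ‖y‖ ^ 2) := by
    funext y
    rw [Ustd, Pi.neg_apply]
    ring_nf
  rw [e, h3.fderiv]
  simp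
  field_simp
  ring

theorem RadSol.comp_mul {lam f0 R : ℝ} {B : ℝ → ℝ} (hR : 0 < R) (S : RadSol lam f0 B) :
    RadSol (lam * R ^ 2) f0 fun r => B (R * r) where
  cB := S.cB.comp (contDiff_const.mul contDiff_id)
  ode r hr := by
    have e1 : deriv (fun r => B (R * r)) = fun r => R * deriv B (R * r) := by
      funext r
      exact deriv_comp_mul_left R B r
    have e2 : deriv (fun r => R * deriv B (R * r)) r = R * (R * deriv (deriv B) (R * r)) := by
      rw [deriv_const_mul_field, deriv_comp_mul_left R (deriv B) r, smul_eq_mul]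
    have h := S.ode (R * r) (mul_pos hR hr)
    rw [e1, e2]
    have h3 : deriv B (R * r) / (R * r) * R = deriv B (R * r) / r := by field_simp
    rw [mul_div_assoc, ← h3]
    linear_combination R ^ 2 * h

theorem bubClose_of_close {γ μ ρ ℓ η : ℝ} {v : Pt → ℝ} (hρ : 0 < ρ) (hμ : 0 < μ)
    (hv : ContDiffOn ℝ (⊤ : ℕ∞) v (ball 0 ρ)) (hℓ : exp ℓ < ρ / μ)
    (h0 : ∀ x ∈ closedBall (0 : Pt) (exp ℓ), dist (Ustd x) (γ * (v (μ • x) - γ)) < η)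
    (h1 : ∀ x ∈ closedBall (0 : Pt) (exp ℓ), dist (fderiv ℝ Ustd x)
      (fderiv ℝ (fun x => γ * (v (μ • x) - γ)) x) < η * exp (-ℓ)) :
    BubClose γ (μ / ρ) (fun z => v (plin ρ z)) ℓ η := by
  intro x hx
  have hxm : toPt x ∈ closedBall (0 : Pt) (exp ℓ) := by
    rw [mem_closedBall_zero_iff, LinearIsometryEquiv.norm_map]
    exact hx
  have hp : plin ρ ((μ / ρ) • x) = μ • toPt x := by
    rw [plin_apply, map_smul, smul_smul, mul_div_cancel₀ _ hρ.ne']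
  have hn : ‖toPt x‖ = ‖x‖ := LinearIsometryEquiv.norm_map _ _
  have hzb : (μ / ρ) • x ∈ ball (0 : ℂ) 1 := by
    rw [mem_ball_zero_iff, norm_smul, norm_of_nonneg (by positivity), div_mul_eq_mul_div,
      div_lt_one hρ]
    rw [lt_div_iff₀ hμ] at hℓ
    have := mul_le_mul_of_nonneg_left hx hμ.le
    linarith
  refine ⟨?_, fun e => ?_⟩
  · have := h0 _ hxm
    rw [dist_comm, Real.dist_eq, Ustd, hn] at this
    rw [sub_neg_eq_add, ← hp] at this
    exact this.le
  · have hb : μ • toPt x ∈ ball (0 : Pt) ρ := hp ▸ plin_mem_ball hρ hzb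
    have hvd : HasFDerivAt v (fderiv ℝ v (μ • toPt x)) (μ • toPt x) :=
      ((hv.contDiffAt (isOpen_ball.mem_nhds hb)).differentiableAt (by simp)).hasFDerivAt
    have hF : HasFDerivAt (fun x : Pt => γ * (v (μ • x) - γ))
        (γ • (fderiv ℝ v (μ • toPt x)).comp (μ • ContinuousLinearMap.id ℝ Pt)) (toPt x) :=
      ((hvd.comp (toPt x) ((hasFDerivAt_id (toPt x)).const_smul μ)).sub_const γ).const_mul γ
    have h := h1 _ hxm
    rw [dist_comm, dist_eq_norm, hF.fderiv] at h
    have h2 := ContinuousLinearMap.le_of_opNorm_le _ h.le (toPt e)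
    rw [LinearIsometryEquiv.norm_map, norm_eq_abs, sub_apply, fderiv_Ustd, hn, inner_toPt] at h2
    rw [fderiv_plin hρ hv hzb, hp]
    simp only [smul_apply, ContinuousLinearMap.comp_apply, ContinuousLinearMap.id_apply,
      plin_apply, map_smul, smul_eq_mul, sub_neg_eq_add] at h2 ⊢
    rwa [show μ / ρ * (ρ * (fderiv ℝ v (μ • toPt x)) (toPt e))
      = μ * (fderiv ℝ v (μ • toPt x)) (toPt e) by field_simp]

theorem planeSol_plin {lam ρ : ℝ} {f v : Pt → ℝ} (hρ : 0 < ρ)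
    (hf : ContDiffOn ℝ (⊤ : ℕ∞) f (ball 0 ρ)) (hv : ContDiffOn ℝ (⊤ : ℕ∞) v (ball 0 ρ))
    (h : ∀ x ∈ ball (0 : Pt) ρ, lap v x = lam * f x * v x * exp (v x ^ 2)) :
    PlaneSol (lam * ρ ^ 2) (fun z => f (plin ρ z)) (fun z => v (plin ρ z)) where
  cf := contDiffOn_plin hρ hf
  cv := contDiffOn_plin hρ hv
  pde z hz := by
    have h1 := h _ (plin_mem_ball hρ hz)
    rw [lap_eq isOpen_ball hv (plin_mem_ball hρ hz)] at h1
    rw [fderiv_fderiv_plin hρ hv hz, fderiv_fderiv_plin hρ hv hz]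
    rw [plin_apply ρ 1, plin_apply ρ Complex.I]
    simp only [map_smul, smul_apply, smul_eq_mul]
    linear_combination (-ρ ^ 2) * h1

theorem toPt_symm_gradient {f : Pt → ℝ} {ρ : ℝ} (hρ : 0 < ρ)
    (hf : ContDiffOn ℝ (⊤ : ℕ∞) f (ball 0 ρ)) :
    (ρ / f 0) • gradient f 0 = toPt (starRingEnd ℂ
      (dz (fun z => f (plin ρ z)) 0 / (f (plin ρ 0) : ℝ))) := by
  refine ext_inner_right ℝ fun y => ?_
  obtain ⟨e, rfl⟩ := toPt.surjective y
  rw [inner_smul_left, inner_gradient_left, inner_toPt, map_zero]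
  have h1 := dz_mul (fun z => f (plin ρ z)) 0 e
  generalize dz (fun z => f (plin ρ z)) 0 = d at h1 ⊢
  rw [fderiv_plin hρ hf (mem_ball_self one_pos)] at h1
  have h2 := congrArg Complex.re h1
  simp only [map_zero, ContinuousLinearMap.comp_apply, plin_apply, map_smul, smul_eq_mul,
    Complex.mul_re, Complex.sub_re, Complex.ofReal_re, Complex.ofReal_im, Complex.I_re,
    Complex.I_im] at h2
  simp only [Complex.conj_re, Complex.conj_im, Complex.div_ofReal_re, Complex.div_ofReal_im,
    conj_trivial]
  linear_combination (-(1 / f 0)) * h2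

/-- Transfer of the limit from `ℂ` to the plane. -/
theorem tendstoCkLocOn_of_complex {F : ℕ → Pt → ℝ} {G : ℕ → ℂ → ℝ} {H : ℂ → ℝ}
    (hFG : ∀ n x, F n x = G n (toPt.symm x))
    (h0 : TendstoLocallyUniformlyOn G (fun z => -2 * log ‖z‖ + H z) atTop PD)
    (h1 : TendstoLocallyUniformlyOn (fun n => fderiv ℝ (G n))
        (fderiv ℝ fun z => -2 * log ‖z‖ + H z) atTop PD) :
    TendstoCkLocOn F (fun x => 2 * log (1 / ‖x‖) + H (toPt.symm x)) (ball 0 1 \ {0}) 1 := by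
  have hmap : MapsTo toPt.symm (ball (0 : Pt) 1 \ {0}) PD := fun x hx => by
    refine ⟨?_, fun h => hx.2 ?_⟩
    · rw [mem_ball_zero_iff, LinearIsometryEquiv.norm_map]
      exact mem_ball_zero_iff.1 hx.1
    · exact (LinearIsometryEquiv.map_eq_zero_iff toPt.symm).1 h
  have hF : F = fun n x => G n (toPt.symm x) := by
    funext n x
    exact hFG n x
  have hl : (fun x : Pt => 2 * log (1 / ‖x‖) + H (toPt.symm x))
      = (fun z => -2 * log ‖z‖ + H z) ∘ toPt.symm := by
    funext x
    rw [Function.comp_apply, LinearIsometryEquiv.norm_map, one_div, log_inv]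
    ring
  have hc : ∀ (g : ℂ → ℝ) (x : Pt), fderiv ℝ (fun x => g (toPt.symm x)) x
      = ((ContinuousLinearMap.compL ℝ Pt ℂ ℝ).flip
        (toPt.symm.toContinuousLinearEquiv : Pt →L[ℝ] ℂ)) (fderiv ℝ g (toPt.symm x)) :=
    fun g x => toPt.symm.toContinuousLinearEquiv.comp_right_fderiv
  rw [hF, hl]
  refine tendstoCkLocOn_one (h0.comp _ hmap toPt.symm.continuous.continuousOn) ?_
  have hu := ((ContinuousLinearMap.compL ℝ Pt ℂ ℝ).flip
    (toPt.symm.toContinuousLinearEquiv : Pt →L[ℝ] ℂ)).uniformContinuous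
  have h2 := hu.comp_tendstoLocallyUniformlyOn (h1.comp _ hmap toPt.symm.continuous.continuousOn)
  exact (h2.congr fun n x _ => (hc _ x).symm).congr_right fun x _ => (hc _ x).symm

theorem harmonic_transfer {H : ℂ → ℝ} {d : ℂ} (hs : ContDiffOn ℝ (⊤ : ℕ∞) H (ball 0 1))
    (hh : ∀ z ∈ ball (0 : ℂ) 1, fderiv ℝ (fderiv ℝ H) z 1 1
        + fderiv ℝ (fderiv ℝ H) z Complex.I Complex.I = 0)
    (hd : fderiv ℝ H 0 = reMul (-d / 2)) :
    ContDiffOn ℝ (⊤ : ℕ∞) (fun x : Pt => H (toPt.symm x)) (ball 0 1) ∧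
    (∀ x ∈ ball (0 : Pt) 1, lap (fun x => H (toPt.symm x)) x = 0) ∧
    gradient (fun x => H (toPt.symm x)) 0 = (-(1 / 2) : ℝ) • toPt (starRingEnd ℂ d) := by
  set A : Pt →L[ℝ] ℂ := (toPt.symm.toContinuousLinearEquiv : Pt →L[ℝ] ℂ)
  have hmap : ∀ x ∈ ball (0 : Pt) 1, toPt.symm x ∈ ball (0 : ℂ) 1 := fun x hx => by
    rw [mem_ball_zero_iff, LinearIsometryEquiv.norm_map]
    exact mem_ball_zero_iff.1 hx
  have hsm : ContDiffOn ℝ (⊤ : ℕ∞) (fun x : Pt => H (toPt.symm x)) (ball 0 1) :=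
    hs.comp A.contDiff.contDiffOn hmap
  refine ⟨hsm, fun x hx => ?_, ?_⟩
  · rw [lap_eq isOpen_ball hsm hx]
    have h : ∀ a b : ℂ, fderiv ℝ (fderiv ℝ fun x : Pt => H (toPt.symm x)) x (toPt a) (toPt b)
        = fderiv ℝ (fderiv ℝ H) (toPt.symm x) a b := fun a b => by
      have := fderiv_fderiv_comp_affine 0 A isOpen_ball hs (x := x)
        (by rw [zero_add]; exact hmap x hx) (toPt a) (toPt b)
      simp only [zero_add] at this
      refine this.trans ?_
      change fderiv ℝ (fderiv ℝ H) (toPt.symm x) (toPt.symm (toPt a)) (toPt.symm (toPt b)) = _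
      rw [LinearIsometryEquiv.symm_apply_apply, LinearIsometryEquiv.symm_apply_apply]
    rw [h, h, hh _ (hmap x hx), neg_zero]
  · refine ext_inner_right ℝ fun y => ?_
    obtain ⟨e, rfl⟩ := toPt.surjective y
    have h : fderiv ℝ (fun x : Pt => H (toPt.symm x)) 0 = (fderiv ℝ H (toPt.symm 0)).comp A :=
      toPt.symm.toContinuousLinearEquiv.comp_right_fderiv
    rw [inner_gradient_left, h, map_zero, hd, inner_smul_left, inner_toPt]
    change reMul (-d / 2) (toPt.symm (toPt e)) = _
    rw [LinearIsometryEquiv.symm_apply_apply, reMul_apply]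
    simp [Complex.mul_re]
    ring

theorem stmt7
    (ρ lam γ μ : ℕ → ℝ) (C₀ C₁ C₂ : ℝ) (hC₀ : 0 < C₀)
    (hρpos : ∀ n, 0 < ρ n) (hρbd : ∃ A : ℝ, ∀ n, ρ n ≤ A)
    (hlampos : ∀ n, 0 < lam n) (hlambd : ∃ A : ℝ, ∀ n, lam n ≤ A)
    (f : ℕ → Pt → ℝ)
    (hfs : ∀ n, ContDiffOn ℝ (⊤ : ℕ∞) (f n) (ball 0 (ρ n)))
    (hfpos : ∀ n, ∀ x ∈ ball (0 : Pt) (ρ n), 0 < f n x)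
    (hf0 : ∀ n, C₀⁻¹ ≤ f n 0 ∧ f n 0 ≤ C₀)
    (hf1 : ∀ n, ∀ x ∈ ball (0 : Pt) (ρ n), ‖gradient (f n) x‖ ≤ C₀)
    (hf2 : ∀ n, ∀ x ∈ ball (0 : Pt) (ρ n), ‖iteratedFDeriv ℝ 2 (f n) x‖ ≤ C₀)
    (v : ℕ → Pt → ℝ)
    (hvs : ∀ n, ContDiffOn ℝ (⊤ : ℕ∞) (v n) (ball 0 (ρ n)))
    (hvpos : ∀ n, ∀ x ∈ ball (0 : Pt) (ρ n), 0 < v n x)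
    (hveq : ∀ n, ∀ x ∈ ball (0 : Pt) (ρ n),
      lap (v n) x = lam n * f n x * v n x * Real.exp ((v n x) ^ 2))
    (hγdef : ∀ n, v n 0 = γ n) (hγ : Tendsto γ atTop atTop)
    (hgrad0 : ∀ n, gradient (v n) 0 = 0)
    (hμpos : ∀ n, 0 < μ n)
    (hμdef : ∀ n, (μ n) ^ 2 * (lam n * f n 0 * (γ n) ^ 2 * Real.exp ((γ n) ^ 2)) = 1)
    (hμinf : Tendsto (fun n => ((μ n) ^ 2)⁻¹) atTop atTop)
    (hρμ : Tendsto (fun n => ρ n / μ n) atTop atTop)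
    (hconv : TendstoCkLocOn (fun n x => γ n * (v n (μ n • x) - γ n)) Ustd Set.univ 2)
    (hC₁bd : ∀ n, ∀ x ∈ ball (0 : Pt) (ρ n),
      lam n * ‖x‖ ^ 2 * (v n x) ^ 2 * Real.exp ((v n x) ^ 2) ≤ C₁)
    (hC₂bd : ∀ n, ∀ x ∈ ball (0 : Pt) (ρ n), ‖x‖ * ‖gradient (v n) x‖ ≤ C₂ / γ n)
    (B : ℕ → ℝ → ℝ)
    (hBs : ∀ n, ContDiff ℝ (⊤ : ℕ∞) (B n))
    (hB0 : ∀ n, B n 0 = γ n) (hB0' : ∀ n, deriv (B n) 0 = 0)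
    (hBode : ∀ n, ∀ r > (0 : ℝ), deriv (deriv (B n)) r + deriv (B n) r / r
      = -(lam n * f n 0 * B n r * Real.exp ((B n r) ^ 2)))
    :
    ∃ φ : ℕ → ℕ, StrictMono φ ∧ ∃ H : Pt → ℝ, ∃ L : Pt,
      Tendsto (fun n => (ρ (φ n) / f (φ n) 0) • gradient (f (φ n)) 0) atTop (𝓝 L) ∧
      ContDiffOn ℝ (⊤ : ℕ∞) H (ball 0 1) ∧
      (∀ x ∈ ball (0 : Pt) 1, lap H x = 0) ∧
      H 0 = 0 ∧ gradient H 0 = (-(1 / 2) : ℝ) • L ∧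
      TendstoCkLocOn
        (fun n x => γ (φ n) * (v (φ n) ((ρ (φ n)) • x) - B (φ n) (ρ (φ n))))
        (fun x => 2 * Real.log (1 / ‖x‖) + H x) (ball 0 1 \ {0}) 1 := by
  obtain ⟨A, hA⟩ := hρbd
  have hA0 : 0 < A := (hρpos 0).trans_le (hA 0)
  obtain ⟨N, hN⟩ := (hγ.eventually_ge_atTop 1).exists_forall_of_atTop
  have hsys : ∀ n, Sys (γ (n + N)) (μ (n + N) / ρ (n + N)) (lam (n + N) * ρ (n + N) ^ 2) C₀
      (C₀ * A + C₀ * A ^ 2) |C₂| (fun z => f (n + N) (plin (ρ (n + N)) z))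
      (fun z => v (n + N) (plin (ρ (n + N)) z)) (fun r => B (n + N) (ρ (n + N) * r)) := by
    intro n
    have hγ1 := hN (n + N) (Nat.le_add_left N n)
    generalize n + N = m at hγ1 ⊢
    have hR := hρpos m
    have hRA := hA m
    have hR2 : ρ m ^ 2 ≤ A ^ 2 := pow_le_pow_left₀ hR.le hRA 2
    have hf00 : f m (plin (ρ m) 0) = f m 0 := by rw [map_zero]
    have hball : ∀ z ∈ ball (0 : ℂ) 1, plin (ρ m) z ∈ ball (0 : Pt) (ρ m) :=
      fun z hz => plin_mem_ball hR hz
    refine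
      { sol := planeSol_plin hR (hfs m) (hvs m) (hveq m)
        rad := RadSol.comp_mul hR ⟨hBs m, by simpa only [hf00] using hBode m⟩
        hγ := hγ1
        hμ := div_pos (hμpos m) hR
        hC₀ := hC₀
        hCf := by positivity
        hD := abs_nonneg _
        hf0 := hf00 ▸ (hf0 m).1
        hf0' := hf00 ▸ (hf0 m).2
        hnorm := ?_
        hvpos := fun z hz => hvpos m _ (hball z hz)
        hdf := fun z hz => ?_
        hddf := fun z hz => ?_
        hdv := fun z hz => ?_
        hB0 := ?_ }
    · have h := hμdef m
      simp only [map_zero]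
      rw [div_pow]
      field_simp
      linear_combination h
    · have h1 := hf1 m _ (hball z hz)
      rw [norm_gradient] at h1
      have h2 := mul_le_mul hRA h1 (norm_nonneg _) hA0.le
      have h3 : 0 ≤ C₀ * A ^ 2 := by positivity
      linarith [norm_fderiv_plin_le hR (hfs m) hz]
    · have h2 := mul_le_mul hR2 (hf2 m _ (hball z hz)) (norm_nonneg _) (sq_nonneg A)
      have h3 : 0 ≤ C₀ * A := by positivity
      linarith [norm_fderiv_fderiv_plin_le hR (hfs m) hz]
    · have h1 := hC₂bd m _ (hball z hz)
      rw [norm_gradient, norm_plin hR] at h1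
      have h2 := mul_le_mul_of_nonneg_left (norm_fderiv_plin_le hR (hvs m) hz) (norm_nonneg z)
      have h3 : C₂ / γ m ≤ |C₂| / γ m := by gcongr; exact le_abs_self _
      linarith
    · simp only [mul_zero]
      exact hB0 m
  have hsh := tendsto_add_atTop_nat N
  have S : BlowUp (fun n => γ (n + N)) (fun n => μ (n + N) / ρ (n + N))
      (fun n => lam (n + N) * ρ (n + N) ^ 2) C₀ (C₀ * A + C₀ * A ^ 2) |C₂|
      (fun n z => f (n + N) (plin (ρ (n + N)) z)) (fun n z => v (n + N) (plin (ρ (n + N)) z))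
      (fun n r => B (n + N) (ρ (n + N) * r)) := by
    refine ⟨hsys, hγ.comp hsh, ?_, fun ℓ η hη => ?_⟩
    · have h := (tendsto_inv_atTop_zero.comp hρμ).comp hsh
      simpa only [Function.comp_def, inv_div] using h
    · have hK := isCompact_closedBall (0 : Pt) (exp ℓ)
      have h0 := (tendstoLocallyUniformlyOn_iff_forall_isCompact isOpen_univ).1 hconv.tendsto _
        (subset_univ _) hK
      have h1 := (tendstoLocallyUniformlyOn_iff_forall_isCompact isOpen_univ).1
        (hconv.tendsto_fderiv one_le_two) _ (subset_univ _) hK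
      rw [Metric.tendstoUniformlyOn_iff] at h0 h1
      have hev := ((h0 η hη).and (h1 _ (mul_pos hη (exp_pos (-ℓ))))).and
        (hρμ.eventually_gt_atTop (exp ℓ))
      filter_upwards [hsh.eventually hev] with n hn
      exact bubClose_of_close (hρpos _) (hμpos _) (hvs _) hn.2 hn.1.1 hn.1.2
  obtain ⟨φ, hφ, d, H, hd, hs, hh, hH0, hHd, hc0, hc1⟩ := BlowUp.exists_limit S
  obtain ⟨hsm, hlap, hgr⟩ := harmonic_transfer hs hh hHd
  refine ⟨fun n => φ n + N, hφ.add_const N, fun x => H (toPt.symm x), toPt (starRingEnd ℂ d),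
    ?_, hsm, hlap, ?_, hgr, tendstoCkLocOn_of_complex (fun n x => ?_) hc0 hc1⟩
  · refine ((toPt.continuous.comp Complex.continuous_conj).continuousAt.tendsto.comp hd).congr
      fun n => ?_
    exact (toPt_symm_gradient (hρpos _) (hfs _)).symm
  · simp only [map_zero, hH0]
  · simp only [plin_apply, LinearIsometryEquiv.apply_symm_apply, mul_one]

end
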